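/- Let M be the 1-skeleton (the collection of faces with at most 2 elements) of a finite triangulation of a closed polygon in ℝ², let θ ∈ (0, π/3] satisfy sin φ ≥ sin θ for every angle φ of every triangular face of that triangulation, and let 0 < α, ᾶ ≤ 1. Let h : ⋃M → ℝ² be a homeomorphism onto its image with |h|_α < ∞ on ⋃M and |h⁻¹|_ᾶ < ∞ on h(⋃M). Then there exist constants ε₀ > 0, B₁ > 0, B₂ > 0, depending only on the minimum edge length of M, |h|_α, |h⁻¹|_ᾶ, α, ᾶ, and θ, such that for each 0 < ε ≤ ε₀ there exist a homeomorphism f : ⋃M → f(⋃M) ⊂ ℝ² and a 1-dimensional complex K with ⋃K = ⋃M and with every vertex of M a vertex of K, such that f is piecewise affine over K, f coincides with h at every vertex of M, ‖f − h‖_∞ ≤ ε on ⋃M, and every edge e of K satisfies B₁ ε^{b₁} < |e| < B₂ ε^{b₂}, where b₁ := −2/α + 2/(α²ᾶ) + 1/(α³ᾶ²) and b₂ := 1/α. -/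

import Mathlib

open Set Geometry EuclideanGeometry Metric Real

noncomputable section

abbrev E2 : Type := EuclideanSpace ℝ (Fin 2)

/-- The set of Hölder ratios of exponent `α` of `u` on `S`. -/
def holderRatioSet (α : ℝ) (S : Set E2) (u : E2 → E2) : Set ℝ :=
  {c | ∃ x ∈ S, ∃ y ∈ S, x ≠ y ∧ c = ‖u x - u y‖ / ‖x - y‖ ^ α}

/-- The Hölder seminorm of exponent `α` of `u` on `S`. -/
def holderSeminorm (α : ℝ) (S : Set E2) (u : E2 → E2) : ℝ :=
  sSup (holderRatioSet α S u)

/-- The supremum norm of `u` on `S`. -/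
def supNorm (S : Set E2) (u : E2 → E2) : ℝ :=
  sSup ((fun x => ‖u x‖) '' S)

/-- `f` is a homeomorphism of `S` onto its image `f '' S`. -/
def IsHomeoOn (f : E2 → E2) (S : Set E2) : Prop :=
  ContinuousOn f S ∧ Set.InjOn f S ∧ ContinuousOn (Function.invFunOn f S) (f '' S)

/-- `K` is a triangulation of `Ω`. -/
def IsTriangulation (K : SimplicialComplex ℝ E2) (Ω : Set E2) : Prop :=
  K.faces.Finite ∧ (∀ s ∈ K.faces, s.card ≤ 3) ∧ K.space = Ω ∧
    ∀ s ∈ K.faces, ∃ t ∈ K.faces, s ⊆ t ∧ t.card = 3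

/-- A closed polygon: a compact set admitting a triangulation. -/
def IsClosedPolygon (Ω : Set E2) : Prop :=
  IsCompact Ω ∧ ∃ K : SimplicialComplex ℝ E2, IsTriangulation K Ω

/-- `f` is piecewise affine over the simplicial complex `K`. -/
def PiecewiseAffineOn (f : E2 → E2) (K : SimplicialComplex ℝ E2) : Prop :=
  ∀ s ∈ K.faces, ∃ A : E2 →ᵃ[ℝ] E2, ∀ x ∈ convexHull ℝ (s : Set E2), f x = A x

/-- Every angle of every triangular face of `K` has sine at least `c`. -/
def AngleLB (K : SimplicialComplex ℝ E2) (c : ℝ) : Prop :=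
  ∀ s ∈ K.faces, ∀ p ∈ s, ∀ q ∈ s, ∀ r ∈ s,
    p ≠ q → q ≠ r → p ≠ r → c ≤ Real.sin (∠ p q r)

/-- Length of an edge (a two-element face). -/
def edgeLen (e : Finset E2) : ℝ := Metric.diam (e : Set E2)

/-- `o` is the incenter of the triangle `p₁p₂p₃` with inradius `r`. -/
def IsIncenter (p₁ p₂ p₃ o : E2) (r : ℝ) : Prop :=
  o ∈ interior (convexHull ℝ {p₁, p₂, p₃}) ∧
  Metric.infDist o (affineSpan ℝ ({p₁, p₂} : Set E2) : Set E2) = r ∧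
  Metric.infDist o (affineSpan ℝ ({p₂, p₃} : Set E2) : Set E2) = r ∧
  Metric.infDist o (affineSpan ℝ ({p₃, p₁} : Set E2) : Set E2) = r

/-- `a < b` are consecutive elements of `S`. -/
def Consec (S : Finset ℝ) (a b : ℝ) : Prop :=
  a ∈ S ∧ b ∈ S ∧ a < b ∧ ∀ c ∈ S, c ≤ a ∨ b ≤ c

theorem exists_consec {S : Finset ℝ} {x y t : ℝ} (hx : x ∈ S) (hy : y ∈ S) (hxt : x ≤ t)
    (hty : t < y) : ∃ a b, Consec S a b ∧ x ≤ a ∧ b ≤ y ∧ a ≤ t ∧ t < b := by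
  classical
  have h1 : (S.filter (· ≤ t)).Nonempty := ⟨x, by simp [hx, hxt]⟩
  have h2 : (S.filter (t < ·)).Nonempty := ⟨y, by simp [hy, hty]⟩
  have m1 := Finset.max'_mem _ h1
  have m2 := Finset.min'_mem _ h2
  rw [Finset.mem_filter] at m1 m2
  refine ⟨_, _, ⟨m1.1, m2.1, m1.2.trans_lt m2.2, fun c hc => ?_⟩,
    Finset.le_max' _ _ (by simp [hx, hxt]), Finset.min'_le _ _ (by simp [hy, hty]), m1.2, m2.2⟩
  rcases le_or_gt c t with h | h
  · exact Or.inl (Finset.le_max' _ _ (by simp [hc, h]))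
  · exact Or.inr (Finset.min'_le _ _ (by simp [hc, h]))

theorem mem_or_exists_consec {S : Finset ℝ} {x y t : ℝ} (hx : x ∈ S) (hy : y ∈ S) (hxt : x ≤ t)
    (hty : t ≤ y) : t ∈ S ∨ ∃ a b, Consec S a b ∧ a < t ∧ t < b := by
  rcases hty.eq_or_lt with rfl | h
  · exact Or.inl hy
  obtain ⟨a, b, hc, -, -, h1, h2⟩ := exists_consec hx hy hxt h
  rcases h1.eq_or_lt with rfl | h1
  · exact Or.inl hc.1
  · exact Or.inr ⟨a, b, hc, h1, h2⟩

theorem Consec.eq_of_mem {S : Finset ℝ} {a b a' b' t : ℝ} (h : Consec S a b) (h' : Consec S a' b')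
    (h1 : a < t) (h2 : t < b) (h3 : a' < t) (h4 : t < b') : a = a' ∧ b = b' := by
  have := h.2.2.2 a' h'.1
  have := h.2.2.2 b' h'.2.1
  have := h'.2.2.2 a h.1
  have := h'.2.2.2 b h.2.1
  constructor
  · rcases h.2.2.2 a' h'.1 with g | g <;> rcases h'.2.2.2 a h.1 with g' | g' <;> linarith
  · rcases h.2.2.2 b' h'.2.1 with g | g <;> rcases h'.2.2.2 b h.2.1 with g' | g' <;> linarith

theorem Consec.not_mem {S : Finset ℝ} {a b t : ℝ} (h : Consec S a b) (h1 : a < t) (h2 : t < b) :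
    t ∉ S := fun ht => by rcases h.2.2.2 t ht with g | g <;> linarith

theorem exists_glue {Y : Type*} [TopologicalSpace Y] [Nonempty Y] (S : Finset ℝ) (q : ℝ → Y)
    (Γ : ℝ → ℝ → ℝ → Y) (hc : ∀ a b, Consec S a b → Continuous (Γ a b))
    (ha : ∀ a b, Consec S a b → Γ a b a = q a) (hb : ∀ a b, Consec S a b → Γ a b b = q b) :
    ∃ F : ℝ → Y, Continuous F ∧ (∀ a ∈ S, F a = q a) ∧
      ∀ a b, Consec S a b → ∀ t ∈ Icc a b, F t = Γ a b t := by
  classical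
  induction S using Finset.induction_on_max with
  | empty => exact ⟨fun _ => Classical.arbitrary Y, continuous_const, by simp, fun a b h => by
      simpa using h.1⟩
  | insert x S hx ih =>
    have key : ∀ a b, Consec S a b → Consec (insert x S) a b := fun a b h =>
      ⟨Finset.mem_insert_of_mem h.1, Finset.mem_insert_of_mem h.2.1, h.2.2.1, fun c hc => by
        rcases Finset.mem_insert.1 hc with rfl | hc
        · exact Or.inr (hx _ h.2.1).le
        · exact h.2.2.2 c hc⟩
    obtain ⟨F, hF, hF1, hF2⟩ := ih (fun a b h => hc a b (key a b h))
      (fun a b h => ha a b (key a b h)) (fun a b h => hb a b (key a b h))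
    rcases S.eq_empty_or_nonempty with rfl | hne
    · refine ⟨fun _ => q x, continuous_const, by simp, fun a b h => ?_⟩
      have h1 := h.1; have h2 := h.2.1; have h3 := h.2.2.1
      simp at h1 h2; subst h1; subst h2; exact absurd h3 (lt_irrefl _)
    · set m := S.max' hne
      have hm : m ∈ S := S.max'_mem hne
      have hmx : m < x := hx m hm
      have hcm : Consec (insert x S) m x := ⟨by simp [hm], by simp, hmx, fun c hc => by
        rcases Finset.mem_insert.1 hc with rfl | hc
        · exact Or.inr le_rfl
        · exact Or.inl (S.le_max' c hc)⟩
      refine ⟨fun t => if t ≤ m then F t else Γ m x t, ?_, ?_, ?_⟩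
      · refine Continuous.if_le hF (hc _ _ hcm) continuous_id continuous_const fun t ht => ?_
        have ht : t = m := ht
        rw [ht, ha _ _ hcm, hF1 m hm]
      · intro a haS
        rcases Finset.mem_insert.1 haS with rfl | haS
        · simp only [not_le.2 hmx, if_false]; exact hb _ _ hcm
        · simp only [S.le_max' a haS, m, if_true]; exact hF1 a haS
      · intro a b h t ht
        rcases Finset.mem_insert.1 h.2.1 with hbx | hbS
        · have : a = m := by
            have haS : a ∈ S := (Finset.mem_insert.1 h.1).resolve_left (by
              rintro rfl; exact absurd h.2.2.1 (by rw [hbx]; exact lt_irrefl _))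
            refine le_antisymm (S.le_max' a haS) ?_
            rcases h.2.2.2 m (by simp [hm]) with g | g
            · exact g
            · rw [hbx] at g; linarith
          subst this; subst hbx
          rcases ht.1.eq_or_lt with heq | hlt
          · rw [← heq]; simp only [le_refl, if_true]
            rw [ha _ _ hcm, hF1 _ hm]
          · simp only [not_le.2 hlt, if_false]
        · have hbm := S.le_max' b hbS
          have haS : a ∈ S := (Finset.mem_insert.1 h.1).resolve_left (by
              rintro rfl; exact absurd h.2.2.1 (not_lt.2 (hx _ hbS).le))
          have : t ≤ m := ht.2.trans hbm
          simp only [this, if_true]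
          exact hF2 a b ⟨haS, hbS, h.2.2.1, fun c hc => h.2.2.2 c (by simp [hc])⟩ t ht

theorem log_increment {ℓ g : ℝ → ℂ} (hℓ : Continuous ℓ) (hg : Continuous g) {c : ℂ} (hc : c ≠ 0)
    (hexp : ∀ t, Complex.exp (ℓ t) = g t) (hre : ∀ t, 0 < (c * g t).re) (a b : ℝ) :
    ℓ b - ℓ a = Complex.log (c * g b) - Complex.log (c * g a) := by
  have hne : ∀ t, c * g t ≠ 0 := fun t h => by have := hre t; rw [h] at this; simp at this
  have hcont : Continuous fun t => Complex.log (c * g t) + (ℓ a - Complex.log (c * g a)) := by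
    refine Continuous.add ?_ continuous_const
    exact (continuous_const.mul hg).clog fun t => Or.inl (hre t)
  have := Complex.isCoveringMap_exp.eq_of_comp_eq hℓ hcont (by
    funext t
    refine Subtype.ext ?_
    simp only [Function.comp]
    rw [Complex.exp_add, Complex.exp_sub, Complex.exp_log (hne t), Complex.exp_log (hne a), hexp,
      hexp]
    have h1 : g a ≠ 0 := by rw [← hexp]; exact Complex.exp_ne_zero _
    field_simp) a (by ring)
  have h := congrFun this b
  rw [h]; ring

theorem exists_continuous_log {g : ℝ × ℝ → ℂ} (hg : Continuous g) (h0 : ∀ x, g x ≠ 0) :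
    ∃ L : ℝ × ℝ → ℂ, Continuous L ∧ ∀ x, Complex.exp (L x) = g x := by
  have : ContractibleSpace (univ : Set (ℝ × ℝ)) := convex_univ.contractibleSpace univ_nonempty
  have hs : IsSimplyConnected (univ : Set (ℝ × ℝ)) :=
    (inferInstance : SimplyConnectedSpace (univ : Set (ℝ × ℝ)))
  obtain ⟨f, hf, hf'⟩ := Complex.exists_continuousOn_eqOn_exp_comp (U := (univ : Set (ℝ × ℝ)))
    hs isOpen_univ hg.continuousOn
    (by rintro ⟨x, -, hx⟩; exact h0 x hx)
  exact ⟨f, continuousOn_univ.1 hf, fun x => hf' (mem_univ x)⟩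

/-- For `z` on the unit circle, `conj z * u` has real part less than one away from `z`. -/
theorem re_conj_mul_lt_one {z u : ℂ} (hz : ‖z‖ = 1) (hu : ‖u‖ ≤ 1) (hne : u ≠ z) :
    ((starRingEnd ℂ) z * u).re < 1 := by
  have h1 : z.re ^ 2 + z.im ^ 2 = 1 := by
    have := Complex.sq_norm z; rw [hz, Complex.normSq_apply] at this; linarith
  have h2 : u.re ^ 2 + u.im ^ 2 ≤ 1 := by
    have := Complex.sq_norm u; rw [Complex.normSq_apply] at this
    nlinarith [norm_nonneg u]
  by_contra! h
  simp only [Complex.mul_re, Complex.conj_re, Complex.conj_im] at h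
  refine hne (Complex.ext ?_ ?_) <;> nlinarith [sq_nonneg (u.re - z.re), sq_nonneg (u.im - z.im)]

/-- Two arcs in the closed unit disc joining distinct pairs of antipodal points meet. -/
theorem antipodal_arcs_meet {u v : ℝ → ℂ} (hu : Continuous u) (hv : Continuous v)
    (hu1 : ∀ t, ‖u t‖ ≤ 1) (hv1 : ∀ t, ‖v t‖ ≤ 1) {z w : ℂ} (hz : ‖z‖ = 1) (hw : ‖w‖ = 1)
    (hu0 : u 0 = z) (hu1' : u 1 = -z) (hv0 : v 0 = w) (hv1' : v 1 = -w) (hne : w ≠ z)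
    (hne' : w ≠ -z) : ∃ s t, u s = v t := by
  by_contra! hcon
  obtain ⟨L, hL, hLe⟩ := exists_continuous_log (g := fun x => u x.1 - v x.2)
    ((hu.comp continuous_fst).sub (hv.comp continuous_snd)) (fun x => sub_ne_zero.2 (hcon _ _))
  set cz := (starRingEnd ℂ) z
  set cw := (starRingEnd ℂ) w
  have hzz : cz * z = 1 := by
    rw [mul_comm, Complex.mul_conj, Complex.normSq_eq_norm_sq, hz]; simp
  have hww : cw * w = 1 := by
    rw [mul_comm, Complex.mul_conj, Complex.normSq_eq_norm_sq, hw]; simp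
  have hcz : cz ≠ 0 := left_ne_zero_of_mul_eq_one hzz
  have hcw : cw ≠ 0 := left_ne_zero_of_mul_eq_one hww
  have hsz : ∀ t, v t ≠ z := fun t h => hcon 0 t (by rw [hu0, h])
  have hsz' : ∀ t, v t ≠ -z := fun t h => hcon 1 t (by rw [hu1', h])
  have hsw : ∀ t, u t ≠ w := fun t h => hcon t 0 (by rw [hv0, h])
  have hsw' : ∀ t, u t ≠ -w := fun t h => hcon t 1 (by rw [hv1', h])
  have e1 := log_increment (ℓ := fun t => L (0, t)) (g := fun t => z - v t) (c := cz)
    (hL.comp (by fun_prop)) (by fun_prop) hcz (fun t => by rw [hLe, hu0]) (fun t => by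
      rw [mul_sub, hzz, Complex.sub_re, Complex.one_re]
      linarith [re_conj_mul_lt_one hz (hv1 t) (hsz t)]) 0 1
  have e2 := log_increment (ℓ := fun t => L (1, t)) (g := fun t => -z - v t) (c := -cz)
    (hL.comp (by fun_prop)) (by fun_prop) (neg_ne_zero.2 hcz) (fun t => by rw [hLe, hu1'])
    (fun t => by
      have h := re_conj_mul_lt_one (z := -z) (by rw [norm_neg, hz]) (hv1 t) (hsz' t)
      rw [map_neg] at h
      rw [mul_sub, neg_mul_neg, hzz, Complex.sub_re, Complex.one_re]
      linarith) 0 1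
  have e3 := log_increment (ℓ := fun t => L (t, 0)) (g := fun t => u t - w) (c := -cw)
    (hL.comp (by fun_prop)) (by fun_prop) (neg_ne_zero.2 hcw) (fun t => by rw [hLe, hv0])
    (fun t => by
      have h := re_conj_mul_lt_one hw (hu1 t) (hsw t)
      have : -cw * (u t - w) = 1 - cw * u t := by rw [← hww]; ring
      rw [this, Complex.sub_re, Complex.one_re]
      linarith) 0 1
  have e4 := log_increment (ℓ := fun t => L (t, 1)) (g := fun t => u t + w) (c := cw)
    (hL.comp (by fun_prop)) (by fun_prop) hcw (fun t => by rw [hLe, hv1', sub_neg_eq_add])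
    (fun t => by
      have h := re_conj_mul_lt_one (z := -w) (by rw [norm_neg, hw]) (hu1 t) (hsw' t)
      rw [map_neg] at h
      have : cw * (u t + w) = 1 - (-cw) * u t := by rw [← hww]; ring
      rw [this, Complex.sub_re, Complex.one_re]
      linarith) 0 1
  simp only [hu0, hu1', hv0, hv1'] at e1 e2 e3 e4
  set q := cz * w with hq
  have hqc : cw * z = (starRingEnd ℂ) q := by simp [q, cz, cw, mul_comm]
  have f1 : cz * (z - -w) = 1 + q := by rw [← hzz]; ring
  have f2 : cz * (z - w) = 1 - q := by rw [← hzz]; ring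
  have f3 : -cz * (-z - -w) = 1 - q := by rw [← hzz]; ring
  have f4 : -cz * (-z - w) = 1 + q := by rw [← hzz]; ring
  have f5 : -cw * (-z - w) = (starRingEnd ℂ) (1 + q) := by
    rw [map_add, map_one, ← hqc, ← hww]; ring
  have f6 : -cw * (z - w) = (starRingEnd ℂ) (1 - q) := by
    rw [map_sub, map_one, ← hqc, ← hww]; ring
  have f7 : cw * (-z + w) = (starRingEnd ℂ) (1 - q) := by
    rw [map_sub, map_one, ← hqc, ← hww]; ring
  have f8 : cw * (z + w) = (starRingEnd ℂ) (1 + q) := by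
    rw [map_add, map_one, ← hqc, ← hww]; ring
  rw [f1, f2] at e1
  rw [f3, f4] at e2
  rw [f5, f6] at e3
  rw [f7, f8] at e4
  have hqn : ‖q‖ = 1 := by simp [q, cz, hz, hw]
  have hwq : w = z * q := by rw [hq, ← mul_assoc, mul_comm z cz, hzz, one_mul]
  have hq1 : q ≠ 1 := fun h => hne (by rw [hwq, h, mul_one])
  have hq2 : q ≠ -1 := fun h => hne' (by rw [hwq, h]; ring)
  have hsq : q.re ^ 2 + q.im ^ 2 = 1 := by
    have := Complex.sq_norm q; rw [hqn, Complex.normSq_apply] at this; linarith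
  have him : q.im ≠ 0 := by
    intro h
    rw [h] at hsq
    have : (q.re - 1) * (q.re + 1) = 0 := by linarith
    rcases mul_eq_zero.1 this with g | g
    · exact hq1 (Complex.ext (by simp; linarith) (by simp [h]))
    · exact hq2 (Complex.ext (by simp; linarith) (by simp [h]))
  have hp1 : 0 < (1 + q).re := by
    have : q.re ^ 2 < 1 := by have := sq_pos_of_ne_zero him; linarith
    simp; nlinarith [abs_lt.1 ((sq_lt_one_iff_abs_lt_one _).1 this)]
  have hp2 : 0 < (1 - q).re := by
    have : q.re ^ 2 < 1 := by have := sq_pos_of_ne_zero him; linarith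
    simp; nlinarith [abs_lt.1 ((sq_lt_one_iff_abs_lt_one _).1 this)]
  have ha1 : (1 + q).arg ≠ π := fun h => by
    have := (Complex.arg_eq_pi_iff.1 h).1; linarith
  have ha2 : (1 - q).arg ≠ π := fun h => by
    have := (Complex.arg_eq_pi_iff.1 h).1; linarith
  have key : Complex.log (1 + q) - Complex.log (1 - q) =
      Complex.log ((starRingEnd ℂ) (1 + q)) - Complex.log ((starRingEnd ℂ) (1 - q)) := by
    linear_combination (e3 - e1 - e4 + e2) / 2
  rw [Complex.log_conj _ ha1, Complex.log_conj _ ha2] at key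
  have := congrArg Complex.im key
  simp only [Complex.sub_im, Complex.conj_im, Complex.log_im] at this
  have harg : (1 + q).arg = (1 - q).arg := by linarith
  rcases lt_or_gt_of_ne him with h | h
  · have h1 : (1 + q).arg < 0 := Complex.arg_neg_iff.2 (by simpa using h)
    have h2 : 0 ≤ (1 - q).arg := Complex.arg_nonneg_iff.2 (by simp; exact h.le)
    linarith
  · have h1 : 0 ≤ (1 + q).arg := Complex.arg_nonneg_iff.2 (by simp; exact h.le)
    have h2 : (1 - q).arg < 0 := Complex.arg_neg_iff.2 (by simpa using h)
    linarith

theorem exists_convex_rescale {c : Set ℂ} (hc : IsCompact c) (hconv : Convex ℝ c) {x : ℂ}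
    (hx : x ∈ interior c) : ∃ Ψ : ℂ → ℂ, Continuous Ψ ∧ Function.Injective Ψ ∧
      (∀ y ∈ c, ‖Ψ y‖ ≤ 1) ∧
      ∀ p ∈ frontier c, p ≠ x ∧ Ψ p = (‖p - x‖⁻¹ : ℝ) • (p - x) := by
  set s : Set ℂ := (fun y => y + x) ⁻¹' c
  have hs : s = (Homeomorph.addRight x) ⁻¹' c := rfl
  have hsc : Convex ℝ s := by
    have := hconv.translate_preimage_left x
    exact this
  have hs0 : s ∈ nhds (0 : ℂ) := by
    rw [hs]
    refine (Homeomorph.addRight x).continuous.continuousAt.preimage_mem_nhds ?_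
    simpa using mem_interior_iff_mem_nhds.1 hx
  have hsb : Bornology.IsVonNBounded ℝ s := by
    refine NormedSpace.isVonNBounded_of_isBounded ℝ ?_
    rw [hs]
    exact ((Homeomorph.addRight x).isCompact_preimage.2 hc).isBounded
  have hb0 : ball (0 : ℂ) 1 ∈ nhds (0 : ℂ) := ball_mem_nhds _ one_pos
  have hbb : Bornology.IsVonNBounded ℝ (ball (0 : ℂ) 1) :=
    NormedSpace.isVonNBounded_ball ℝ ℂ 1
  let h := gaugeRescaleHomeomorph s (ball 0 1) hsc hs0 hsb (convex_ball _ _) hb0 hbb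
  have hdef : ∀ y, h y = (gauge s y / ‖y‖) • y := fun y => by
    change gaugeRescale s (ball 0 1) y = _
    rw [gaugeRescale, gauge_unit_ball]
  refine ⟨fun y => h (y - x), h.continuous.comp (by fun_prop),
    h.injective.comp (sub_left_injective), fun y hy => ?_, fun p hp => ?_⟩
  · have h1 : gauge s (y - x) ≤ 1 := gauge_le_one_of_mem (by simpa [s] using hy)
    simp only [hdef]
    rw [norm_smul, Real.norm_eq_abs, abs_div, abs_norm, abs_of_nonneg (gauge_nonneg _)]
    rcases eq_or_ne (‖y - x‖) 0 with h0 | h0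
    · rw [h0]; simp
    · rw [div_mul_cancel₀ _ h0]; exact h1
  · have hpx : p ≠ x := by
      rintro rfl
      exact hp.2 hx
    refine ⟨hpx, ?_⟩
    have h1 : gauge s (p - x) = 1 := by
      rw [gauge_eq_one_iff_mem_frontier hsc hs0, hs, ← (Homeomorph.addRight x).preimage_frontier]
      simpa using hp
    simp only [hdef, h1, one_div]

theorem rescale_opposite {p q x : ℂ} (hx : x ∈ openSegment ℝ p q) (hp : p ≠ x) :
    (‖q - x‖⁻¹ : ℝ) • (q - x) = -((‖p - x‖⁻¹ : ℝ) • (p - x)) := by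
  obtain ⟨a, b, ha, hb, hab, rfl⟩ := hx
  obtain rfl : a = 1 - b := by linarith
  have h1 : p - ((1 - b) • p + b • q) = b • (p - q) := by module
  have h2 : q - ((1 - b) • p + b • q) = -((1 - b) • (p - q)) := by module
  have hpq : ‖p - q‖ ≠ 0 := by
    intro h
    rw [norm_eq_zero] at h
    apply hp
    rw [← sub_eq_zero, h1, h, smul_zero]
  rw [h1, h2, norm_neg, norm_smul, norm_smul, smul_neg, smul_smul, smul_smul]
  congr 2
  rw [Real.norm_of_nonneg ha.le, Real.norm_of_nonneg hb.le]
  field_simp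

/-- Arcs in a compact convex set whose endpoint chords cross at an interior point meet. -/
theorem chord_arcs_meet {c : Set ℂ} (hc : IsCompact c) (hconv : Convex ℝ c) {u v : ℝ → ℂ}
    (hu : Continuous u) (hv : Continuous v) (hu1 : ∀ t, u t ∈ c) (hv1 : ∀ t, v t ∈ c) {x : ℂ}
    (hx : x ∈ interior c) (hfu0 : u 0 ∈ frontier c) (hfu1 : u 1 ∈ frontier c)
    (hfv0 : v 0 ∈ frontier c) (hfv1 : v 1 ∈ frontier c)
    (hxu : x ∈ openSegment ℝ (u 0) (u 1)) (hxv : x ∈ openSegment ℝ (v 0) (v 1)) :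
    ∃ s t, u s = v t := by
  obtain ⟨Ψ, hΨ, hinj, hle, hfr⟩ := exists_convex_rescale hc hconv hx
  by_cases h1 : v 0 = u 0
  · exact ⟨0, 0, h1.symm⟩
  by_cases h2 : v 0 = u 1
  · exact ⟨1, 0, h2.symm⟩
  obtain ⟨n1, e1⟩ := hfr _ hfu0
  obtain ⟨n2, e2⟩ := hfr _ hfu1
  obtain ⟨n3, e3⟩ := hfr _ hfv0
  obtain ⟨n4, e4⟩ := hfr _ hfv1
  have nrm : ∀ p : ℂ, p ≠ x → ‖(‖p - x‖⁻¹ : ℝ) • (p - x)‖ = 1 := fun p hp => by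
    have := norm_ne_zero_iff.2 (sub_ne_zero.2 hp)
    rw [norm_smul, norm_inv, norm_norm, inv_mul_cancel₀ this]
  have e2' : Ψ (u 1) = -Ψ (u 0) := by rw [e1, e2, rescale_opposite hxu n1]
  have e4' : Ψ (v 1) = -Ψ (v 0) := by rw [e3, e4, rescale_opposite hxv n3]
  obtain ⟨s, t, h⟩ := antipodal_arcs_meet (u := fun t => Ψ (u t)) (v := fun t => Ψ (v t))
    (z := Ψ (u 0)) (w := Ψ (v 0))
    (hΨ.comp hu) (hΨ.comp hv) (fun t => hle _ (hu1 t)) (fun t => hle _ (hv1 t))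
    (by rw [e1, nrm _ n1]) (by rw [e3, nrm _ n3]) rfl e2' rfl e4'
    (fun h => h1 (hinj h)) (fun h => h2 (hinj (by rw [h, e2'])))
  exact ⟨s, t, hinj h⟩

/-- Arcs in a compact convex set around the unit disc, such that the chords between the radial
projections of their endpoints cross inside the disc, meet. -/
theorem radial_chord_arcs_meet {c : Set ℂ} (hc : IsCompact c) (hconv : Convex ℝ c)
    (h0 : (0 : ℂ) ∈ interior c) {u v : ℝ → ℂ} {a b a' b' : ℝ} (hab : a ≤ b) (hab' : a' ≤ b')
    (hu : ContinuousOn u (Icc a b)) (hv : ContinuousOn v (Icc a' b'))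
    (hu1 : ∀ t ∈ Icc a b, u t ∈ c) (hv1 : ∀ t ∈ Icc a' b', v t ∈ c)
    (hfu0 : u a ∈ frontier c) (hfu1 : u b ∈ frontier c)
    (hfv0 : v a' ∈ frontier c) (hfv1 : v b' ∈ frontier c) {x : ℂ} (hx : ‖x‖ < 1)
    (hxu : x ∈ openSegment ℝ ((‖u a‖⁻¹ : ℝ) • u a) ((‖u b‖⁻¹ : ℝ) • u b))
    (hxv : x ∈ openSegment ℝ ((‖v a'‖⁻¹ : ℝ) • v a') ((‖v b'‖⁻¹ : ℝ) • v b')) :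
    ∃ s ∈ Icc a b, ∃ t ∈ Icc a' b', u s = v t := by
  obtain ⟨Ψ, hΨ, hinj, hle, hfr⟩ := exists_convex_rescale hc hconv h0
  simp only [sub_zero] at hfr
  set k : ℝ → ℝ := fun t => max 0 (min 1 t)
  have hk : Continuous k := by fun_prop
  have hk0 : ∀ t, 0 ≤ k t := fun t => le_max_left _ _
  have hk1 : ∀ t, k t ≤ 1 := fun t => max_le zero_le_one (min_le_left _ _)
  have m1 : ∀ t, a + (b - a) * k t ∈ Icc a b := fun t => by
    constructor <;> nlinarith [hk0 t, hk1 t]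
  have m2 : ∀ t, a' + (b' - a') * k t ∈ Icc a' b' := fun t => by
    constructor <;> nlinarith [hk0 t, hk1 t]
  have k0 : k 0 = 0 := by simp [k]
  have k1 : k 1 = 1 := by simp [k]
  have nrm : ∀ p : ℂ, p ≠ 0 → ‖(‖p‖⁻¹ : ℝ) • p‖ = 1 := fun p hp => by
    have := norm_ne_zero_iff.2 hp
    rw [norm_smul, norm_inv, norm_norm, inv_mul_cancel₀ this]
  have fr : ∀ p ∈ frontier c, Ψ p ∈ frontier (closedBall (0 : ℂ) 1) := fun p hp => by
    rw [frontier_closedBall _ one_ne_zero, mem_sphere_zero_iff_norm, (hfr p hp).2,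
      nrm _ (hfr p hp).1]
  obtain ⟨s, t, h⟩ := chord_arcs_meet (c := closedBall (0 : ℂ) 1) (isCompact_closedBall _ _)
    (convex_closedBall _ _) (u := fun t => Ψ (u (a + (b - a) * k t)))
    (v := fun t => Ψ (v (a' + (b' - a') * k t))) (x := x)
    (hΨ.comp (hu.comp_continuous (by fun_prop) m1)) (hΨ.comp (hv.comp_continuous (by fun_prop) m2))
    (fun t => by simpa using hle _ (hu1 _ (m1 t))) (fun t => by simpa using hle _ (hv1 _ (m2 t)))
    (by rw [interior_closedBall _ one_ne_zero]; simpa using hx)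
    (by simpa [k0] using fr _ hfu0) (by simpa [k1] using fr _ hfu1)
    (by simpa [k0] using fr _ hfv0) (by simpa [k1] using fr _ hfv1)
    (by simpa [k0, k1, (hfr _ hfu0).2, (hfr _ hfu1).2] using hxu)
    (by simpa [k0, k1, (hfr _ hfv0).2, (hfr _ hfv1).2] using hxv)
  exact ⟨_, m1 s, _, m2 t, hinj h⟩

theorem exists_glue_continuousOn {Y : Type*} [TopologicalSpace Y] [Nonempty Y] (S : Finset ℝ)
    (q : ℝ → Y) (Γ : ℝ → ℝ → ℝ → Y) (hc : ∀ a b, Consec S a b → ContinuousOn (Γ a b) (Icc a b))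
    (ha : ∀ a b, Consec S a b → Γ a b a = q a) (hb : ∀ a b, Consec S a b → Γ a b b = q b) :
    ∃ F : ℝ → Y, Continuous F ∧ (∀ a ∈ S, F a = q a) ∧
      ∀ a b, Consec S a b → ∀ t ∈ Icc a b, F t = Γ a b t := by
  have cl : ∀ {a b t : ℝ}, t ∈ Icc a b → max a (min b t) = t := fun {a b t} h => by
    rw [min_eq_right h.2, max_eq_right h.1]
  obtain ⟨F, h1, h2, h3⟩ := exists_glue S q (fun a b t => Γ a b (max a (min b t)))
    (fun a b h => (hc a b h).comp_continuous (by fun_prop) fun t =>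
      ⟨le_max_left _ _, max_le h.2.2.1.le (min_le_left _ _)⟩)
    (fun a b h => by rw [cl (left_mem_Icc.2 h.2.2.1.le)]; exact ha a b h)
    (fun a b h => by rw [cl (right_mem_Icc.2 h.2.2.1.le)]; exact hb a b h)
  exact ⟨F, h1, h2, fun a b h t ht => by rw [h3 a b h t ht, cl ht]⟩

theorem continuousOn_Icc_of_consec {Y : Type*} [TopologicalSpace Y] {S : Finset ℝ} {F : ℝ → Y}
    {x y : ℝ} (hx : x ∈ S) (hy : y ∈ S) (h : ∀ a b, Consec S a b → ContinuousOn F (Icc a b)) :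
    ContinuousOn F (Icc x y) := by
  have : Nonempty Y := ⟨F x⟩
  obtain ⟨F', h1, h2, h3⟩ := exists_glue_continuousOn S F (fun _ _ => F) h (fun _ _ _ => rfl)
    (fun _ _ _ => rfl)
  refine h1.continuousOn.congr fun t ht => ?_
  rcases mem_or_exists_consec hx hy ht.1 ht.2 with hS | ⟨a, b, hc, g1, g2⟩
  · exact (h2 t hS).symm
  · exact (h3 a b hc t ⟨g1.le, g2.le⟩).symm

/-- A drawing in the plane of the graph with edges `E`, vertices `V` and vertex positions `P`. -/
structure Drawing {E V : Type*} (src tgt : E → V) (P : V → ℂ) (G : E → ℝ → ℂ) : Prop where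
  cont : ∀ e, Continuous (G e)
  zero : ∀ e, G e 0 = P (src e)
  one : ∀ e, G e 1 = P (tgt e)
  emb : ∀ e e' s s', s ∈ Ioo (0 : ℝ) 1 → s' ∈ Icc (0 : ℝ) 1 → G e s = G e' s' → e = e' ∧ s = s'

section Surgery

variable {E V ι : Type*} [Fintype ι] (ed : ι → E) (A B : ι → ℝ)

open Classical in
/-- The number of passes of the edge `e` completed at time `t`. -/
def passCount (e : E) (t : ℝ) : ℕ := (Finset.univ.filter fun i => ed i = e ∧ B i ≤ t).card

open Classical in
/-- The curve of `e` inverted into the disc of radius one half after an odd number of passes. -/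
def invertedCurve (w : E → ℝ → ℂ) (e : E) (t : ℝ) : ℂ :=
  if Even (passCount ed B e t) then w e t else (2 * w e t)⁻¹

open Classical in
/-- The radial segment replacing the `i`-th pass through the disc. -/
def radialPass (w : E → ℝ → ℂ) (i : ι) (t : ℝ) : ℂ :=
  if Even (passCount ed B (ed i) (A i)) then
    ((1 - (t - A i) / (B i - A i) / 2 : ℝ) : ℂ) * w (ed i) (A i)
  else ((1 / 2 + (t - A i) / (B i - A i) / 2 : ℝ) : ℂ) * w (ed i) (B i)

open Classical in
/-- The curve after surgery. -/
def surgeredCurve (w : E → ℝ → ℂ) (e : E) (t : ℝ) : ℂ :=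
  if h : ∃ i, ed i = e ∧ t ∈ Icc (A i) (B i) then radialPass ed A B w h.choose t
  else invertedCurve ed B w e t

variable {ed A B}

theorem passCount_step (hAB : ∀ i, A i < B i)
    (hdis : ∀ i j, i ≠ j → ed i = ed j → B i < A j ∨ B j < A i) (i : ι) :
    passCount ed B (ed i) (B i) = passCount ed B (ed i) (A i) + 1 := by
  classical
  unfold passCount
  rw [← Finset.card_insert_of_notMem (a := i)]
  · congr 1
    ext j
    simp only [Finset.mem_filter, Finset.mem_univ, true_and, Finset.mem_insert]
    constructor
    · rintro ⟨h1, h2⟩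
      by_cases hji : j = i
      · exact Or.inl hji
      · refine Or.inr ⟨h1, ?_⟩
        rcases hdis j i hji h1 with h | h
        · exact h.le
        · linarith [hAB j]
    · rintro (rfl | ⟨h1, h2⟩)
      · exact ⟨rfl, le_rfl⟩
      · exact ⟨h1, h2.trans (hAB i).le⟩
  · simp [hAB i]

variable {w : E → ℝ → ℂ}

theorem radialPass_left (hn : ∀ i, ‖w (ed i) (A i)‖ = 1)
    (hconj : ∀ i, w (ed i) (B i) = (starRingEnd ℂ) (w (ed i) (A i))) (i : ι) :
    radialPass ed A B w i (A i) = invertedCurve ed B w (ed i) (A i) := by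
  unfold radialPass invertedCurve
  split_ifs with h
  · simp
  · rw [hconj, mul_inv, Complex.inv_def (w (ed i) (A i)), Complex.normSq_eq_norm_sq, hn]
    simp

theorem radialPass_right (hAB : ∀ i, A i < B i)
    (hdis : ∀ i j, i ≠ j → ed i = ed j → B i < A j ∨ B j < A i)
    (hn : ∀ i, ‖w (ed i) (A i)‖ = 1)
    (hconj : ∀ i, w (ed i) (B i) = (starRingEnd ℂ) (w (ed i) (A i))) (i : ι) :
    radialPass ed A B w i (B i) = invertedCurve ed B w (ed i) (B i) := by
  unfold radialPass invertedCurve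
  rw [passCount_step hAB hdis]
  have h0 : B i - A i ≠ 0 := (sub_pos.2 (hAB i)).ne'
  by_cases h : Even (passCount ed B (ed i) (A i))
  · have h' : ¬ Even (passCount ed B (ed i) (A i) + 1) := by
      rw [Nat.even_add_one]; exact not_not.2 h
    have hc : w (ed i) (A i) = (starRingEnd ℂ) (w (ed i) (B i)) := by rw [hconj]; simp
    have hn' : ‖w (ed i) (B i)‖ = 1 := by rw [hconj]; simpa using hn i
    rw [if_pos h, if_neg h', hc, mul_inv, Complex.inv_def (w (ed i) (B i)),
      Complex.normSq_eq_norm_sq, hn', div_self h0]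
    norm_num
  · have h' : Even (passCount ed B (ed i) (A i) + 1) := by
      rw [Nat.even_add_one]; exact h
    rw [if_neg h, if_pos h', div_self h0]
    norm_num

theorem surgeredCurve_of_mem (hdis : ∀ i j, i ≠ j → ed i = ed j → B i < A j ∨ B j < A i) {i : ι}
    {t : ℝ} (ht : t ∈ Icc (A i) (B i)) :
    surgeredCurve ed A B w (ed i) t = radialPass ed A B w i t := by
  have h : ∃ j, ed j = ed i ∧ t ∈ Icc (A j) (B j) := ⟨i, rfl, ht⟩
  have hi : h.choose = i := by
    by_contra hne
    have hs := h.choose_spec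
    rcases hdis _ _ hne hs.1 with g | g <;> linarith [hs.2.1, hs.2.2, ht.1, ht.2]
  rw [surgeredCurve, dif_pos h, hi]

theorem surgeredCurve_of_not_mem {e : E} {t : ℝ} (h : ¬ ∃ i, ed i = e ∧ t ∈ Icc (A i) (B i)) :
    surgeredCurve ed A B w e t = invertedCurve ed B w e t := by
  rw [surgeredCurve, dif_neg h]

theorem continuousOn_surgeredCurve (hAB : ∀ i, A i < B i)
    (hdis : ∀ i j, i ≠ j → ed i = ed j → B i < A j ∨ B j < A i)
    (hn : ∀ i, ‖w (ed i) (A i)‖ = 1)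
    (hconj : ∀ i, w (ed i) (B i) = (starRingEnd ℂ) (w (ed i) (A i)))
    (hw : ∀ e, Continuous (w e)) (hA0 : ∀ i, 0 < A i) (hB1 : ∀ i, B i < 1)
    (hout : ∀ e, ∀ t ∈ Icc (0 : ℝ) 1, ‖w e t‖ ≤ 1 → ∃ i, ed i = e ∧ t ∈ Icc (A i) (B i)) (e : E) :
    ContinuousOn (surgeredCurve ed A B w e) (Icc 0 1) := by
  classical
  set I := Finset.univ.filter fun i => ed i = e
  set S : Finset ℝ := I.image A ∪ I.image B ∪ {0, 1} with hS
  have memA : ∀ i, ed i = e → A i ∈ S := fun i h => by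
    simp only [hS, Finset.mem_union, Finset.mem_image]
    exact Or.inl (Or.inl ⟨i, by simp [I, h], rfl⟩)
  have memB : ∀ i, ed i = e → B i ∈ S := fun i h => by
    simp only [hS, Finset.mem_union, Finset.mem_image]
    exact Or.inl (Or.inr ⟨i, by simp [I, h], rfl⟩)
  have S01 : ∀ c ∈ S, c ∈ Icc (0 : ℝ) 1 := by
    intro c hc
    simp only [hS, Finset.mem_union, Finset.mem_image, Finset.mem_insert,
      Finset.mem_singleton] at hc
    rcases hc with (⟨i, -, rfl⟩ | ⟨i, -, rfl⟩) | rfl | rfl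
    · exact ⟨(hA0 i).le, ((hAB i).trans (hB1 i)).le⟩
    · exact ⟨((hA0 i).trans (hAB i)).le, (hB1 i).le⟩
    · simp
    · simp
  refine continuousOn_Icc_of_consec (S := S) (by simp [hS]) (by simp [hS]) fun a b hc => ?_
  by_cases hp : ∃ i, ed i = e ∧ A i ≤ a ∧ b ≤ B i
  · obtain ⟨i, rfl, h1, h2⟩ := hp
    have : ContinuousOn (radialPass ed A B w i) (Icc a b) := by
      unfold radialPass
      split_ifs <;> fun_prop
    exact this.congr fun t ht => surgeredCurve_of_mem hdis ⟨h1.trans ht.1, ht.2.trans h2⟩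
  · have hend : ∀ t ∈ Icc a b, ∀ i, ed i = e → t ∈ Icc (A i) (B i) → t = A i ∨ t = B i := by
      intro t ht i hi hti
      rcases hc.2.2.2 _ (memA i hi) with h1 | h1
      · rcases hc.2.2.2 _ (memB i hi) with h2 | h2
        · exact Or.inr (le_antisymm hti.2 (h2.trans ht.1))
        · exact absurd ⟨i, hi, h1, h2⟩ hp
      · exact Or.inl (le_antisymm (ht.2.trans h1) hti.1)
    have hcount : ∀ t ∈ Icc a b, passCount ed B e t = passCount ed B e a := by
      intro t ht
      unfold passCount
      congr 1
      ext i
      simp only [Finset.mem_filter, Finset.mem_univ, true_and]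
      constructor
      · rintro ⟨hi, hB⟩
        refine ⟨hi, ?_⟩
        rcases hc.2.2.2 _ (memB i hi) with h2 | h2
        · exact h2
        · rcases hc.2.2.2 _ (memA i hi) with h1 | h1
          · exact absurd ⟨i, hi, h1, h2⟩ hp
          · linarith [hAB i, ht.2]
      · rintro ⟨hi, hB⟩
        exact ⟨hi, hB.trans ht.1⟩
    have heq : ∀ t ∈ Icc a b, surgeredCurve ed A B w e t = invertedCurve ed B w e t := by
      intro t ht
      by_cases h : ∃ i, ed i = e ∧ t ∈ Icc (A i) (B i)
      · obtain ⟨i, rfl, hti⟩ := h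
        rw [surgeredCurve_of_mem hdis hti]
        rcases hend t ht i rfl hti with rfl | rfl
        · exact radialPass_left hn hconj i
        · exact radialPass_right hAB hdis hn hconj i
      · exact surgeredCurve_of_not_mem h
    have hne : ∀ t ∈ Icc a b, w e t ≠ 0 := by
      intro t ht h0
      have ht01 : t ∈ Icc (0 : ℝ) 1 := ⟨(S01 a hc.1).1.trans ht.1, ht.2.trans (S01 b hc.2.1).2⟩
      obtain ⟨i, rfl, hti⟩ := hout e t ht01 (by rw [h0]; simp)
      have := hn i
      rcases hend t ht i rfl hti with rfl | rfl
      · rw [h0] at this; simp at this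
      · rw [hconj, map_eq_zero] at h0; rw [h0] at this; simp at this
    have hcont : ContinuousOn (fun t => if Even (passCount ed B e a) then w e t
        else (2 * w e t)⁻¹) (Icc a b) := by
      split_ifs
      · exact (hw e).continuousOn
      · exact ((continuous_const.mul (hw e)).continuousOn).inv₀ fun t ht =>
          mul_ne_zero two_ne_zero (hne t ht)
    refine hcont.congr fun t ht => ?_
    rw [heq t ht, invertedCurve, hcount t ht]

end Surgery

section Surgery

variable {E V ι : Type*} [Fintype ι] {ed : ι → E} {A B : ι → ℝ} {w : E → ℝ → ℂ}

theorem exists_radialPass_eq (hn : ∀ i, ‖w (ed i) (A i)‖ = 1)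
    (hconj : ∀ i, w (ed i) (B i) = (starRingEnd ℂ) (w (ed i) (A i))) (hAB : ∀ i, A i < B i)
    (i : ι) : ∃ x ∈ Icc (A i) (B i), ∃ k : ℝ, k ≠ 0 ∧ ∃ m : ℝ, ‖w (ed i) x‖ = 1 ∧
      ∀ t ∈ Icc (A i) (B i), radialPass ed A B w i t = ((m + k * t : ℝ) : ℂ) * w (ed i) x ∧
        1 / 2 ≤ m + k * t ∧ m + k * t ≤ 1 := by
  have h0 : 0 < B i - A i := sub_pos.2 (hAB i)
  have hτ : ∀ t ∈ Icc (A i) (B i), 0 ≤ (t - A i) / (B i - A i) ∧ (t - A i) / (B i - A i) ≤ 1 :=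
    fun t ht => ⟨div_nonneg (sub_nonneg.2 ht.1) h0.le, (div_le_one h0).2 (by linarith [ht.2])⟩
  by_cases h : Even (passCount ed B (ed i) (A i))
  · refine ⟨A i, left_mem_Icc.2 (hAB i).le, -(1 / (B i - A i) / 2), ?_,
      1 + A i / (B i - A i) / 2, hn i, fun t ht => ?_⟩
    · have := one_div_pos.2 h0; linarith
    · have e : 1 + A i / (B i - A i) / 2 + -(1 / (B i - A i) / 2) * t =
          1 - (t - A i) / (B i - A i) / 2 := by ring
      have := hτ t ht
      rw [e, radialPass, if_pos h]
      exact ⟨rfl, by linarith, by linarith⟩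
  · refine ⟨B i, right_mem_Icc.2 (hAB i).le, 1 / (B i - A i) / 2, ?_,
      1 / 2 - A i / (B i - A i) / 2, by rw [hconj]; simpa using hn i, fun t ht => ?_⟩
    · have := one_div_pos.2 h0; linarith
    · have e : 1 / 2 - A i / (B i - A i) / 2 + (1 / (B i - A i) / 2) * t =
          1 / 2 + (t - A i) / (B i - A i) / 2 := by ring
      have := hτ t ht
      rw [e, radialPass, if_neg h]
      exact ⟨rfl, by linarith, by linarith⟩

open Classical in
theorem Drawing.surgery {src tgt : E → V} {P : V → ℂ} {G : E → ℝ → ℂ} (hG : Drawing src tgt P G)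
    (Φ : ℂ ≃ₜ ℂ) (hAB : ∀ i, A i < B i)
    (hdis : ∀ i j, i ≠ j → ed i = ed j → B i < A j ∨ B j < A i)
    (hA0 : ∀ i, 0 < A i) (hB1 : ∀ i, B i < 1)
    (hn : ∀ i, ‖Φ (G (ed i) (A i))‖ = 1)
    (hconj : ∀ i, Φ (G (ed i) (B i)) = (starRingEnd ℂ) (Φ (G (ed i) (A i))))
    (hout : ∀ e, ∀ t ∈ Icc (0 : ℝ) 1, ‖Φ (G e t)‖ ≤ 1 → ∃ i, ed i = e ∧ t ∈ Icc (A i) (B i))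
    (heven : ∀ e, Even (Finset.univ.filter fun i => ed i = e).card) :
    ∃ G', Drawing src tgt P G' ∧ ∀ e, ∀ t ∈ Icc (0 : ℝ) 1, ‖Φ (G' e t)‖ ≤ 1 ∨
      (Even (passCount ed B e t) ∧ G' e t = G e t) := by
  set w : E → ℝ → ℂ := fun e t => Φ (G e t) with hw
  set D := surgeredCurve ed A B w with hD
  have hcont := continuousOn_surgeredCurve (w := w) hAB hdis hn hconj
    (fun e => Φ.continuous.comp (hG.cont e)) hA0 hB1 hout
  have cl : ∀ {t : ℝ}, t ∈ Icc (0 : ℝ) 1 → max 0 (min 1 t) = t := fun {t} h => by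
    rw [min_eq_right h.2, max_eq_right h.1]
  have I01 : ∀ i, ∀ t ∈ Icc (A i) (B i), t ∈ Ioo (0 : ℝ) 1 := fun i t ht =>
    ⟨(hA0 i).trans_le ht.1, ht.2.trans_lt (hB1 i)⟩
  have c0 : ∀ e, passCount ed B e 0 = 0 := fun e => by
    unfold passCount
    rw [Finset.card_eq_zero, Finset.filter_eq_empty_iff]
    rintro i - ⟨-, h⟩
    linarith [hA0 i, hAB i]
  have c1 : ∀ e, Even (passCount ed B e 1) := fun e => by
    have := heven e
    unfold passCount
    convert this using 4 with i
    simp [(hB1 i).le]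
  have tri : ∀ e, ∀ t ∈ Icc (0 : ℝ) 1, (∃ i, ed i = e ∧ t ∈ Icc (A i) (B i)) ∨
      (1 < ‖w e t‖ ∧ D e t = w e t ∧ Even (passCount ed B e t)) ∨
      (1 < ‖w e t‖ ∧ D e t = (2 * w e t)⁻¹ ∧ ‖D e t‖ < 1 / 2 ∧ t ∈ Ioo (0 : ℝ) 1) := by
    intro e t ht
    by_cases hp : ∃ i, ed i = e ∧ t ∈ Icc (A i) (B i)
    · exact Or.inl hp
    · have h1 : 1 < ‖w e t‖ := by
        by_contra! h
        exact hp (hout e t ht h)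
      have h2 : D e t = invertedCurve ed B w e t := surgeredCurve_of_not_mem hp
      by_cases hev : Even (passCount ed B e t)
      · exact Or.inr (Or.inl ⟨h1, by rw [h2, invertedCurve, if_pos hev], hev⟩)
      · have h3 : D e t = (2 * w e t)⁻¹ := by rw [h2, invertedCurve, if_neg hev]
        refine Or.inr (Or.inr ⟨h1, h3, ?_, ?_, ?_⟩)
        · rw [h3, norm_inv, norm_mul, Complex.norm_ofNat, inv_lt_comm₀ (by positivity)
              (by norm_num)]
          linarith
        · refine ht.1.lt_of_ne ?_
          rintro rfl
          exact hev (by rw [c0]; exact Even.zero)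
        · refine ht.2.lt_of_ne ?_
          rintro rfl
          exact hev (c1 e)
  have pnorm : ∀ i, ∀ t ∈ Icc (A i) (B i), 1 / 2 ≤ ‖D (ed i) t‖ ∧ ‖D (ed i) t‖ ≤ 1 := by
    intro i t ht
    obtain ⟨x, hx, k, hk, m, hxn, h⟩ := exists_radialPass_eq (w := w) hn hconj hAB i
    obtain ⟨e, h1, h2⟩ := h t ht
    rw [hD, surgeredCurve_of_mem hdis ht, e, norm_mul, hxn, mul_one, Complex.norm_real,
      Real.norm_of_nonneg (by linarith)]
    exact ⟨h1, h2⟩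
  have emb : ∀ e e' s s', s ∈ Ioo (0 : ℝ) 1 → s' ∈ Icc (0 : ℝ) 1 → D e s = D e' s' →
      e = e' ∧ s = s' := by
    intro e e' s s' hs hs' heq
    have wemb : w e s = w e' s' → e = e' ∧ s = s' := fun h =>
      hG.emb e e' s s' hs hs' (Φ.injective h)
    rcases tri e s ⟨hs.1.le, hs.2.le⟩ with ⟨i, rfl, hi⟩ | ⟨h1, h2, -⟩ | ⟨h1, h2, h3, -⟩ <;>
    rcases tri e' s' hs' with ⟨j, rfl, hj⟩ | ⟨h1', h2', -⟩ | ⟨h1', h2', h3', -⟩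
    · obtain ⟨x, hx, k, hk, m, hxn, h⟩ := exists_radialPass_eq (w := w) hn hconj hAB i
      obtain ⟨x', hx', k', hk', m', hxn', h'⟩ := exists_radialPass_eq (w := w) hn hconj hAB j
      obtain ⟨g1, g2, g3⟩ := h s hi
      obtain ⟨g1', g2', g3'⟩ := h' s' hj
      have heq' := heq
      rw [hD, surgeredCurve_of_mem hdis hi, surgeredCurve_of_mem hdis hj, g1, g1'] at heq
      have hr : m + k * s = m' + k' * s' := by
        have := congrArg norm heq
        rwa [norm_mul, norm_mul, hxn, hxn', mul_one, mul_one, Complex.norm_real, Complex.norm_real,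
          Real.norm_of_nonneg (by linarith), Real.norm_of_nonneg (by linarith)] at this
      rw [← hr] at heq
      have h0 : ((m + k * s : ℝ) : ℂ) ≠ 0 := by
        rw [Complex.ofReal_ne_zero]; linarith
      have hx01 := I01 j x' hx'
      obtain ⟨hed, hxx⟩ := hG.emb _ _ x x' (I01 i x hx) ⟨hx01.1.le, hx01.2.le⟩
        (Φ.injective (mul_left_cancel₀ h0 heq))
      have hij : i = j := by
        by_contra hne
        rcases hdis i j hne hed with g | g <;> linarith [hx.1, hx.2, hx'.1, hx'.2]
      subst hij
      refine ⟨rfl, ?_⟩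
      obtain ⟨g4, -⟩ := h s' hj
      rw [hD, surgeredCurve_of_mem hdis hi, surgeredCurve_of_mem hdis hj, g1, g4] at heq'
      have hw0 : w (ed i) x ≠ 0 := by rw [← norm_ne_zero_iff, hxn]; exact one_ne_zero
      have := Complex.ofReal_injective (mul_right_cancel₀ hw0 heq')
      exact mul_left_cancel₀ hk (by linarith)
    · exfalso
      have := (pnorm i s hi).2
      rw [heq, h2'] at this; linarith
    · exfalso
      have := (pnorm i s hi).1
      rw [heq] at this; linarith
    · exfalso
      have := (pnorm j s' hj).2
      rw [← heq, h2] at this; linarith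
    · exact wemb (by rw [← h2, heq, h2'])
    · exfalso
      rw [← heq, h2] at h3'; linarith
    · exfalso
      have := (pnorm j s' hj).1
      rw [← heq] at this; linarith
    · exfalso
      rw [heq, h2'] at h3; linarith
    · refine wemb ?_
      have := heq
      rw [h2, h2', inv_inj] at this
      exact mul_left_cancel₀ two_ne_zero this
  have end0 : ∀ e, D e 0 = w e 0 := fun e => by
    rcases tri e 0 ⟨le_rfl, zero_le_one⟩ with ⟨i, -, hi⟩ | ⟨-, h, -⟩ | ⟨-, -, -, h⟩
    · exact absurd (I01 i 0 hi).1 (lt_irrefl _)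
    · exact h
    · exact absurd h.1 (lt_irrefl _)
  have end1 : ∀ e, D e 1 = w e 1 := fun e => by
    rcases tri e 1 ⟨zero_le_one, le_rfl⟩ with ⟨i, -, hi⟩ | ⟨-, h, -⟩ | ⟨-, -, -, h⟩
    · exact absurd (I01 i 1 hi).2 (lt_irrefl _)
    · exact h
    · exact absurd h.2 (lt_irrefl _)
  refine ⟨fun e t => Φ.symm (D e (max 0 (min 1 t))), ⟨fun e => ?_, fun e => ?_, fun e => ?_, ?_⟩,
      ?_⟩
  · refine Φ.symm.continuous.comp ((hcont e).comp_continuous (by fun_prop) fun t => ?_)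
    exact ⟨le_max_left _ _, max_le zero_le_one (min_le_left _ _)⟩
  · simp only [cl (show (0 : ℝ) ∈ Icc (0 : ℝ) 1 by simp), end0, hw, Φ.symm_apply_apply, hG.zero]
  · simp only [cl (show (1 : ℝ) ∈ Icc (0 : ℝ) 1 by simp), end1, hw, Φ.symm_apply_apply, hG.one]
  · intro e e' s s' hs hs' h
    simp only [cl hs', cl (Ioo_subset_Icc_self hs)] at h
    exact emb e e' s s' hs hs' (Φ.symm.injective h)
  · intro e t ht
    simp only [cl ht, Φ.apply_symm_apply]
    rcases tri e t ht with ⟨i, rfl, hi⟩ | ⟨-, h, hev⟩ | ⟨-, -, h, -⟩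
    · exact Or.inl (pnorm i t hi).2
    · exact Or.inr ⟨hev, by rw [h]; simp [hw]⟩
    · exact Or.inl (by linarith)

end Surgery

theorem exists_homeomorph_add_contraction {g : ℂ → ℂ} {K : ℝ} (hK0 : 0 ≤ K) (hK : K < 1)
    (hg : ∀ z w, ‖g z - g w‖ ≤ K * ‖z - w‖) : ∃ N : ℂ ≃ₜ ℂ, ∀ z, N z = z + g z := by
  have h : ApproximatesLinearOn (fun z => z + g z)
      ((ContinuousLinearEquiv.refl ℝ ℂ : ℂ ≃L[ℝ] ℂ) : ℂ →L[ℝ] ℂ) univ ⟨K, hK0⟩ := by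
    intro z _ w _
    have : z + g z - (w + g w) - ((ContinuousLinearEquiv.refl ℝ ℂ : ℂ ≃L[ℝ] ℂ) : ℂ →L[ℝ] ℂ) (z - w)
        = g z - g w := by simp; ring
    rw [this]
    exact hg z w
  refine ⟨h.toHomeomorph _ (Or.inr ?_), fun z => rfl⟩
  have : ‖((ContinuousLinearEquiv.refl ℝ ℂ : ℂ ≃L[ℝ] ℂ).symm : ℂ →L[ℝ] ℂ)‖₊ = 1 := by
    have : ((ContinuousLinearEquiv.refl ℝ ℂ : ℂ ≃L[ℝ] ℂ).symm : ℂ →L[ℝ] ℂ) =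
      ContinuousLinearMap.id ℝ ℂ := rfl
    rw [this]
    exact ContinuousLinearMap.nnnorm_id
  rw [this, inv_one]
  exact hK

theorem exists_bounded_lipschitz_interpolation {ι : Type*} [Fintype ι] {x : ι → ℝ}
    (hx : Function.Injective x) (m : ι → ℝ) : ∃ (M : ℝ → ℝ) (K : ℝ), 0 < K ∧
      (∀ a b, |M a - M b| ≤ K * |a - b|) ∧ (∀ a, |M a| ≤ K) ∧ ∀ i, M (x i) = m i := by
  classical
  set C : ℝ := ∑ i, ∑ j, |m i - m j| / |x i - x j| with hC
  have hC0 : 0 ≤ C := Finset.sum_nonneg fun i _ => Finset.sum_nonneg fun j _ => by positivity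
  set f : ℝ → ℝ := fun y => if h : ∃ i, x i = y then m h.choose else 0
  have hf : ∀ i, f (x i) = m i := fun i => by
    have h : ∃ j, x j = x i := ⟨i, rfl⟩
    simp only [f, dif_pos h, hx h.choose_spec]
  have hlip : LipschitzOnWith ⟨C, hC0⟩ f (range x) := by
    refine LipschitzOnWith.of_dist_le_mul ?_
    rintro _ ⟨i, rfl⟩ _ ⟨j, rfl⟩
    rw [hf, hf, Real.dist_eq, Real.dist_eq]
    change _ ≤ C * _
    rcases eq_or_ne i j with rfl | hij
    · simp
    · have h0 : 0 < |x i - x j| := abs_pos.2 (sub_ne_zero.2 (hx.ne hij))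
      rw [← div_le_iff₀ h0, hC]
      refine le_trans ?_ (Finset.single_le_sum (f := fun i => ∑ j, |m i - m j| / |x i - x j|)
        (fun i _ => Finset.sum_nonneg fun j _ => by positivity) (Finset.mem_univ i))
      exact Finset.single_le_sum (f := fun j => |m i - m j| / |x i - x j|)
        (fun j _ => by positivity) (Finset.mem_univ j)
  obtain ⟨g, hg, hgf⟩ := hlip.extend_real
  set D : ℝ := ∑ i, |m i|
  have hD : ∀ i, |m i| ≤ D := fun i =>
    Finset.single_le_sum (f := fun i => |m i|) (fun j _ => by positivity) (Finset.mem_univ i)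
  have hD0 : 0 ≤ D := Finset.sum_nonneg fun i _ => abs_nonneg _
  refine ⟨fun a => max (min (g a) D) (-D), C + D + 1, by positivity, fun a b => ?_, fun a => ?_,
    fun i => ?_⟩
  · have := ((hg.min_const D).max_const (-D)).dist_le_mul a b
    rw [Real.dist_eq, Real.dist_eq] at this
    refine this.trans ?_
    change C * _ ≤ _
    exact mul_le_mul_of_nonneg_right (by linarith) (abs_nonneg _)
  · have : |max (min (g a) D) (-D)| ≤ D :=
      abs_le.2 ⟨le_max_right _ _, max_le (min_le_right _ _) (by linarith)⟩
    linarith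
  · have h1 : g (x i) = m i := by rw [← hgf ⟨i, rfl⟩, hf]
    have := abs_le.1 (hD i)
    simp only [h1]
    rw [min_eq_left this.2, max_eq_left this.1]

/-- A homeomorphism making finitely many oblique strands vertical in a thin strip above the
real axis. -/
theorem exists_straightening {ι : Type*} [Fintype ι] {x : ι → ℝ} (hx : Function.Injective x)
    (m : ι → ℝ) {τ₀ : ℝ} (hτ₀ : 0 < τ₀) : ∃ τ, 0 < τ ∧ τ ≤ τ₀ ∧ ∃ Φ : ℂ ≃ₜ ℂ,
      (∀ i Y, 0 ≤ Y → Y ≤ 4 → Φ ⟨x i + τ * Y * m i, τ * Y⟩ = ⟨x i, Y - 2⟩) ∧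
      ∀ z, z.im = τ * ((Φ z).im + 2) ∧ |z.re - (Φ z).re| ≤ τ₀ := by
  obtain ⟨M, K, hK, hM1, hM2, hM3⟩ := exists_bounded_lipschitz_interpolation hx m
  set τ : ℝ := min τ₀ (min (τ₀ / (4 * K)) (1 / (10 * K))) with hτ
  have hτ0 : 0 < τ := by positivity
  have h1 : τ ≤ τ₀ := min_le_left _ _
  have h2 : τ * (4 * K) ≤ τ₀ := by
    rw [← le_div_iff₀ (by positivity)]
    exact (min_le_right _ _).trans (min_le_left _ _)
  have h3 : τ * (10 * K) ≤ 1 := by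
    rw [← le_div_iff₀ (by positivity)]
    exact (min_le_right _ _).trans (min_le_right _ _)
  set c : ℝ → ℝ := fun Y => max 0 (min 4 Y)
  have hc0 : ∀ Y, 0 ≤ c Y := fun Y => le_max_left _ _
  have hc4 : ∀ Y, c Y ≤ 4 := fun Y => max_le (by norm_num) (min_le_left _ _)
  have hcl : ∀ Y Y', |c Y - c Y'| ≤ |Y - Y'| := fun Y Y' => by
    have := ((LipschitzWith.id (α := ℝ)).const_min 4).const_max 0 |>.dist_le_mul Y Y'
    simpa [Real.dist_eq] using this
  obtain ⟨N, hN⟩ := exists_homeomorph_add_contraction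
    (g := fun z => ((τ * (c (z.im + 2) * M z.re) : ℝ) : ℂ)) (K := τ * (5 * K)) (by positivity)
    (by linarith) (fun z w => by
      rw [← Complex.ofReal_sub, Complex.norm_real, Real.norm_eq_abs, ← mul_sub, abs_mul,
        abs_of_pos hτ0, mul_assoc]
      refine mul_le_mul_of_nonneg_left ?_ hτ0.le
      have e : c (z.im + 2) * M z.re - c (w.im + 2) * M w.re =
        c (z.im + 2) * (M z.re - M w.re) + (c (z.im + 2) - c (w.im + 2)) * M w.re := by ring
      rw [e]
      refine (abs_add_le _ _).trans ?_
      rw [abs_mul, abs_mul, abs_of_nonneg (hc0 _)]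
      have a1 : |z.re - w.re| ≤ ‖z - w‖ := by simpa using Complex.abs_re_le_norm (z - w)
      have a2 : |z.im - w.im| ≤ ‖z - w‖ := by simpa using Complex.abs_im_le_norm (z - w)
      have a3 := hcl (z.im + 2) (w.im + 2)
      rw [add_sub_add_right_eq_sub] at a3
      have b1 : c (z.im + 2) * |M z.re - M w.re| ≤ 4 * (K * ‖z - w‖) :=
        mul_le_mul (hc4 _) ((hM1 _ _).trans (mul_le_mul_of_nonneg_left a1 hK.le)) (abs_nonneg _)
          (by norm_num)
      have b2 : |c (z.im + 2) - c (w.im + 2)| * |M w.re| ≤ ‖z - w‖ * K :=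
        mul_le_mul (a3.trans a2) (hM2 _) (abs_nonneg _) (norm_nonneg _)
      linarith)
  let A : ℂ ≃ₜ ℂ :=
    { toFun := fun z => ⟨z.re, τ * (z.im + 2)⟩
      invFun := fun z => ⟨z.re, z.im / τ - 2⟩
      left_inv := fun z => Complex.ext rfl (by simp; field_simp; ring)
      right_inv := fun z => Complex.ext rfl (by simp; field_simp)
      continuous_toFun := by
        have : (fun z : ℂ => (⟨z.re, τ * (z.im + 2)⟩ : ℂ)) =
            fun z => (z.re : ℂ) + ((τ * (z.im + 2) : ℝ) : ℂ) * Complex.I := by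
          funext z; exact Complex.mk_eq_add_mul_I _ _
        rw [this]; fun_prop
      continuous_invFun := by
        have : (fun z : ℂ => (⟨z.re, z.im / τ - 2⟩ : ℂ)) =
            fun z => (z.re : ℂ) + ((z.im / τ - 2 : ℝ) : ℂ) * Complex.I := by
          funext z; exact Complex.mk_eq_add_mul_I _ _
        rw [this]; fun_prop }
  have hre : ∀ u : ℂ, (N u).re = u.re + τ * (c (u.im + 2) * M u.re) := fun u => by
    rw [hN, Complex.add_re, Complex.ofReal_re]
  have him : ∀ u : ℂ, (N u).im = u.im := fun u => by
    rw [hN, Complex.add_im, Complex.ofReal_im, add_zero]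
  refine ⟨τ, hτ0, h1, (N.trans A).symm, fun i Y hY0 hY4 => ?_, fun z => ?_⟩
  · rw [Homeomorph.symm_apply_eq, Homeomorph.trans_apply]
    have hcY : c (Y - 2 + 2) = Y := by
      simp only [c, sub_add_cancel]; rw [min_eq_right hY4, max_eq_right hY0]
    refine Complex.ext ?_ ?_
    · change _ = (N _).re
      rw [hre, hcY, hM3]; simp only; ring
    · change _ = τ * ((N _).im + 2)
      rw [him]; simp
  · set u := (N.trans A).symm z with hu
    have hz : z = A (N u) := by
      rw [← Homeomorph.trans_apply, hu, Homeomorph.apply_symm_apply]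
    constructor
    · rw [hz]
      change τ * ((N u).im + 2) = _
      rw [him]
    · have : z.re = u.re + τ * (c (u.im + 2) * M u.re) := by
        rw [hz]
        exact hre u
      rw [this, add_sub_cancel_left, abs_mul, abs_mul, abs_of_pos hτ0, abs_of_nonneg (hc0 _)]
      refine le_trans (mul_le_mul_of_nonneg_left ?_ hτ0.le) h2
      exact mul_le_mul (hc4 _) (hM2 _) (abs_nonneg _) (by norm_num)

/-- The affine chart of `ℂ` sending `z` to `o + ω z`, inverted. -/
def chartHomeo (o : ℂ) {ω : ℂ} (hω : ω ≠ 0) : ℂ ≃ₜ ℂ :=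
  (Homeomorph.addRight (-o)).trans (Homeomorph.mulLeft₀ ω⁻¹ (inv_ne_zero hω))

theorem chartHomeo_apply (o : ℂ) {ω : ℂ} (hω : ω ≠ 0) (z : ℂ) :
    chartHomeo o hω z = ω⁻¹ * (z + -o) := rfl

theorem chartHomeo_chart (o : ℂ) {ω : ℂ} (hω : ω ≠ 0) (z : ℂ) :
    chartHomeo o hω (o + ω * z) = z := by
  rw [chartHomeo_apply]; field_simp; ring

theorem chart_chartHomeo (o : ℂ) {ω : ℂ} (hω : ω ≠ 0) (z : ℂ) :
    o + ω * chartHomeo o hω z = z := by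
  rw [chartHomeo_apply]; field_simp; ring

theorem exists_pos_lt_of_isCompact {S : Set ℝ} (hS : IsCompact S) {f : ℝ → ℝ}
    (hf : ContinuousOn f S) (h0 : ∀ t ∈ S, 0 < f t) : ∃ η > 0, ∀ t ∈ S, η ≤ f t := by
  rcases S.eq_empty_or_nonempty with rfl | hne
  · exact ⟨1, one_pos, by simp⟩
  · obtain ⟨t, ht, h⟩ := hS.exists_isMinOn hne hf
    exact ⟨f t, h0 t ht, fun s hs => h hs⟩

theorem exists_pos_lowerBound {ι : Type*} [Finite ι] {f : ι → ℝ} (h : ∀ i, 0 < f i) :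
    ∃ η > 0, ∀ i, η ≤ f i := by
  rcases isEmpty_or_nonempty ι with hι | hι
  · exact ⟨1, one_pos, fun i => isEmptyElim i⟩
  · obtain ⟨i, hi⟩ := Finite.exists_min f
    exact ⟨f i, h i, hi⟩

variable {E V ι : Type*} [Fintype ι] [Finite E]

open Classical in
theorem Drawing.window {src tgt : E → V} {P : V → ℂ} {G : E → ℝ → ℂ} (hG : Drawing src tgt P G)
    {W : Set ℂ} {o ω : ℂ} (hω : ω ≠ 0) {r τ₀ : ℝ} (hr : 1 < r) (hτ₀ : 0 < τ₀)
    (hclean : ∀ x y : ℝ, |x| ≤ r → 0 < y → y ≤ τ₀ → o + ω * ⟨x, y⟩ ∉ W)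
    {ed : ι → E} {T x μ ν : ι → ℝ} (hinj : ∀ i j, ed i = ed j → T i = T j → i = j)
    (hT : ∀ i, T i ∈ Ioo (0 : ℝ) 1) (hx : ∀ i, |x i| < 1) (hν : ∀ i, ν i ≠ 0)
    (hloc : ∀ i, ∀ᶠ t in nhds (T i),
      G (ed i) t = o + ω * ⟨x i + (t - T i) * μ i, (t - T i) * ν i⟩)
    (hcomp : ∀ e, ∀ t ∈ Icc (0 : ℝ) 1, ∀ y : ℝ, |y| ≤ r → G e t = o + ω * ⟨y, 0⟩ →
      ∃ i, ed i = e ∧ T i = t)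
    (heven : ∀ e, Even (Finset.univ.filter fun i => ed i = e).card)
    {i₀ : ι} (hi₀ : ν i₀ < 0) (hmin : ∀ j, ed j = ed i₀ → T i₀ ≤ T j) :
    ∃ G', Drawing src tgt P G' ∧
      (∀ e, ∀ t ∈ Ioo (0 : ℝ) 1, G' e t ∈ W → G e t ∈ W ∧ ∀ᶠ s in nhds t, G' e s = G e s) ∧
      G' (ed i₀) (T i₀) ∉ W := by
  have hself : ∀ i, G (ed i) (T i) = o + ω * ⟨x i, 0⟩ := fun i => by
    have := (hloc i).self_of_nhds
    simpa using this
  have hxinj : Function.Injective x := fun i j hij => by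
    have h := hG.emb (ed i) (ed j) (T i) (T j) (hT i) (Ioo_subset_Icc_self (hT j))
      (by rw [hself, hself, hij])
    exact hinj i j h.1 h.2
  -- a common radius of the affine neighbourhoods
  obtain ⟨δ, hδ0, hδ⟩ : ∃ δ > 0, (∀ i, ∀ t, |t - T i| ≤ δ → t ∈ Ioo (0 : ℝ) 1 ∧
      G (ed i) t = o + ω * ⟨x i + (t - T i) * μ i, (t - T i) * ν i⟩) ∧
      ∀ i j, i ≠ j → ed i = ed j → 2 * δ < |T i - T j| := by
    have h1 : ∀ i, ∃ δ > 0, ∀ t, |t - T i| < δ → t ∈ Ioo (0 : ℝ) 1 ∧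
      G (ed i) t = o + ω * ⟨x i + (t - T i) * μ i, (t - T i) * ν i⟩ := fun i => by
      have h2 : ∀ᶠ t in nhds (T i), t ∈ Ioo (0 : ℝ) 1 := isOpen_Ioo.mem_nhds (hT i)
      have := h2.and (hloc i)
      obtain ⟨δ, h0, h⟩ := Metric.eventually_nhds_iff.1 this
      exact ⟨δ, h0, fun t ht => h (by rwa [Real.dist_eq])⟩
    choose δ₁ hδ₁ h1 using h1
    obtain ⟨d1, hd1, h1'⟩ := exists_pos_lowerBound hδ₁
    obtain ⟨d2, hd2, h2'⟩ := exists_pos_lowerBound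
      (f := fun p : ι × ι => if T p.1 = T p.2 then 1 else |T p.1 - T p.2|) (fun p => by
        split_ifs with h
        · exact one_pos
        · exact abs_pos.2 (sub_ne_zero.2 h))
    refine ⟨min d1 d2 / 4, by positivity, fun i t ht => h1 i t ?_, fun i j hij he => ?_⟩
    · have := min_le_left d1 d2
      have := lt_min hd1 hd2
      linarith [h1' i]
    · have h := h2' (i, j)
      simp only [if_neg fun h => hij (hinj i j he h)] at h
      have := min_le_right d1 d2
      have := lt_min hd1 hd2
      linarith
  obtain ⟨hδ, hsep⟩ := hδ
  -- the strands away from the crossings keep a distance from the window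
  obtain ⟨η, hη0, hη⟩ : ∃ η > 0, ∀ e, ∀ t ∈ Icc (0 : ℝ) 1, |(chartHomeo o hω (G e t)).re| ≤ r →
      |(chartHomeo o hω (G e t)).im| < η → ∃ i, ed i = e ∧ |t - T i| < δ := by
    have key : ∀ e, ∃ η > 0, ∀ t ∈ Icc (0 : ℝ) 1, |(chartHomeo o hω (G e t)).re| ≤ r →
      |(chartHomeo o hω (G e t)).im| < η → ∃ i, ed i = e ∧ |t - T i| < δ := fun e => by
      have hc : Continuous fun t => chartHomeo o hω (G e t) :=
        (chartHomeo o hω).continuous.comp (hG.cont e)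
      obtain ⟨η, h0, h⟩ := exists_pos_lt_of_isCompact
        (S := Icc (0 : ℝ) 1 ∩ ({t | |(chartHomeo o hω (G e t)).re| ≤ r} ∩
          ⋂ i, {t | ed i = e → δ ≤ |t - T i|})) (f := fun t => |(chartHomeo o hω (G e t)).im|)
        (isCompact_Icc.inter_right ((isClosed_le (by fun_prop) continuous_const).inter
          (isClosed_iInter fun i => by
            by_cases he : ed i = e
            · simp only [he, forall_const]
              exact isClosed_le continuous_const (by fun_prop)
            · simp [he]))) ((Complex.continuous_im.comp hc).abs.continuousOn)
        (fun t ht => by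
          obtain ⟨h1, h2, h3⟩ := ht
          refine abs_pos.2 fun h => ?_
          obtain ⟨i, hi, hit⟩ := hcomp e t h1 (chartHomeo o hω (G e t)).re h2 (by
            rw [← h]
            exact (chart_chartHomeo o hω _).symm)
          have := (mem_iInter.1 h3 i) hi
          rw [hit, sub_self, abs_zero] at this
          linarith)
      refine ⟨η, h0, fun t ht h1 h2 => ?_⟩
      by_contra! hcon
      exact absurd (h t ⟨ht, h1, mem_iInter.2 fun i => fun hi => hcon i hi⟩) (not_le.2 h2)
    choose η h0 h using key
    obtain ⟨η', h0', h'⟩ := exists_pos_lowerBound h0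
    exact ⟨η', h0', fun e t ht h1 h2 => h e t ht h1 (h2.trans_le (h' e))⟩
  obtain ⟨ν₀, hν₀0, hν₀⟩ := exists_pos_lowerBound fun i => abs_pos.2 (hν i)
  obtain ⟨τ, hτ0, hτ1, Φ, hΦ, hΦ'⟩ := exists_straightening hxinj (fun i => μ i / ν i)
    (τ₀ := min (r - 1) (min (τ₀ / 3) (min (η / 4) (δ * ν₀ / 4))))
    (by have := sub_pos.2 hr; positivity)
  have hτr := min_le_left (r - 1) (min (τ₀ / 3) (min (η / 4) (δ * ν₀ / 4)))
  have hτ' := hτ1.trans (min_le_right _ _)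
  have hττ₀ := hτ'.trans (min_le_left _ _)
  have hτη := (hτ'.trans (min_le_right _ _)).trans (min_le_left _ _)
  have hτδ := (hτ'.trans (min_le_right _ _)).trans (min_le_right _ _)
  have hstrand : ∀ i t, |t - T i| ≤ δ → 0 ≤ (t - T i) * ν i → (t - T i) * ν i ≤ 4 * τ →
      Φ (chartHomeo o hω (G (ed i) t)) = ⟨x i, (t - T i) * ν i / τ - 2⟩ := fun i t h1 h2 h3 => by
    rw [(hδ i t h1).2, chartHomeo_chart, ← hΦ i _ (by positivity) (by rwa [div_le_iff₀ hτ0])]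
    have := hν i
    congr 1
    refine Complex.ext ?_ ?_ <;> simp <;> field_simp
  set s : ι → ℝ := fun i => √(1 - x i ^ 2) with hs
  have hx2 : ∀ i, x i ^ 2 < 1 := fun i => by
    rw [← sq_abs]
    have := hx i
    have := abs_nonneg (x i)
    nlinarith
  have hs0 : ∀ i, 0 < s i := fun i => Real.sqrt_pos.2 (by linarith [hx2 i])
  have hs2 : ∀ i, s i ^ 2 = 1 - x i ^ 2 := fun i => Real.sq_sqrt (by linarith [hx2 i])
  have hs1 : ∀ i, s i ≤ 1 := fun i => by nlinarith [hs2 i, hs0 i, sq_nonneg (x i)]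
  set A : ι → ℝ := fun i => T i + τ * (2 / ν i - s i / |ν i|) with hA
  set B : ι → ℝ := fun i => T i + τ * (2 / ν i + s i / |ν i|) with hB
  have habs : ∀ i, 0 < |ν i| := fun i => abs_pos.2 (hν i)
  have hAB : ∀ i, A i < B i := fun i => by
    have : 0 < τ * (s i / |ν i|) := mul_pos hτ0 (div_pos (hs0 i) (habs i))
    simp only [hA, hB]
    nlinarith
  have hnear : ∀ i, ∀ t ∈ Icc (A i) (B i), |t - T i| < δ := fun i t ht => by
    have h3 : τ * (3 / |ν i|) < δ := by
      rw [← mul_div_assoc, div_lt_iff₀ (habs i)]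
      nlinarith [hν₀ i]
    have h4 : |2 / ν i| = 2 / |ν i| := by rw [abs_div, abs_two]
    have h5 : s i / |ν i| ≤ 1 / |ν i| := div_le_div_of_nonneg_right (hs1 i) (habs i).le
    have h6 := abs_le.1 h4.le
    have h7 : 2 / |ν i| + 1 / |ν i| = 3 / |ν i| := by ring
    have h8 := ht.1
    have h9 := ht.2
    simp only [hA, hB] at h8 h9
    rw [abs_lt]
    constructor <;> nlinarith
  have hAi : ∀ i, |A i - T i| < δ := fun i => hnear i _ (left_mem_Icc.2 (hAB i).le)
  have hBi : ∀ i, |B i - T i| < δ := fun i => hnear i _ (right_mem_Icc.2 (hAB i).le)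
  have hsg : ∀ i, ν i / |ν i| = 1 ∨ ν i / |ν i| = -1 := fun i => by
    rcases lt_or_gt_of_ne (hν i) with h | h
    · right; rw [abs_of_neg h, div_neg, div_self h.ne]
    · left; rw [abs_of_pos h, div_self h.ne']
  have hAν : ∀ i, (A i - T i) * ν i = τ * (2 - s i * (ν i / |ν i|)) := fun i => by
    simp only [hA]; have := hν i; have := (habs i).ne'; field_simp; ring
  have hBν : ∀ i, (B i - T i) * ν i = τ * (2 + s i * (ν i / |ν i|)) := fun i => by
    simp only [hB]; have := hν i; have := (habs i).ne'; field_simp; ring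
  have hΦA : ∀ i, Φ (chartHomeo o hω (G (ed i) (A i))) = ⟨x i, - (s i * (ν i / |ν i|))⟩ := by
    intro i
    rw [hstrand i _ (hAi i).le, hAν]
    · congr 1; field_simp; ring
    all_goals rw [hAν]; rcases hsg i with h | h <;> rw [h] <;> nlinarith [hs0 i, hs1 i]
  have hΦB : ∀ i, Φ (chartHomeo o hω (G (ed i) (B i))) = ⟨x i, s i * (ν i / |ν i|)⟩ := by
    intro i
    rw [hstrand i _ (hBi i).le, hBν]
    · congr 1; field_simp; ring
    all_goals rw [hBν]; rcases hsg i with h | h <;> rw [h] <;> nlinarith [hs0 i, hs1 i]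
  -- points of the disc lie slightly above the window
  have hdisc : ∀ z, ‖Φ z‖ ≤ 1 → |z.re| ≤ r ∧ τ ≤ z.im ∧ z.im ≤ 3 * τ := fun z hz => by
    obtain ⟨h1, h2⟩ := hΦ' z
    have h3 := abs_le.1 ((Complex.abs_re_le_norm _).trans hz)
    have h4 := abs_le.1 ((Complex.abs_im_le_norm _).trans hz)
    have h5 := abs_le.1 (h2.trans hτr)
    refine ⟨abs_le.2 ⟨by linarith, by linarith⟩, by nlinarith, by nlinarith⟩
  obtain ⟨G', hG', hGG'⟩ := hG.surgery ((chartHomeo o hω).trans Φ) hAB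
    (fun i j hij he => by
      have h1 := hsep i j hij he
      have := abs_lt.1 (hAi i); have := abs_lt.1 (hAi j)
      have := abs_lt.1 (hBi i); have := abs_lt.1 (hBi j)
      rcases lt_abs.1 h1 with h | h
      · right; linarith
      · left; linarith)
    (fun i => (hδ i _ (hAi i).le).1.1) (fun i => (hδ i _ (hBi i).le).1.2)
    (fun i => by
      rw [Homeomorph.trans_apply, hΦA, Complex.norm_eq_sqrt_sq_add_sq, Real.sqrt_eq_one]
      have := hs2 i
      rcases hsg i with h | h <;> rw [h] <;> simp only <;> nlinarith)
    (fun i => by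
      rw [Homeomorph.trans_apply, Homeomorph.trans_apply, hΦA, hΦB]
      refine Complex.ext ?_ ?_ <;> simp)
    (fun e t ht hn => by
      rw [Homeomorph.trans_apply] at hn
      obtain ⟨h1, h2, h3⟩ := hdisc _ hn
      obtain ⟨i, rfl, hi⟩ := hη e t ht h1 (by rw [abs_of_pos (by linarith)]; linarith)
      refine ⟨i, rfl, ?_⟩
      have him : (chartHomeo o hω (G (ed i) t)).im = (t - T i) * ν i := by
        rw [(hδ i t hi.le).2, chartHomeo_chart]
      rw [him] at h2 h3
      rw [hstrand i t hi.le (by linarith) (by linarith), Complex.norm_eq_sqrt_sq_add_sq,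
        Real.sqrt_le_iff] at hn
      simp only at hn
      have h4 : |(t - T i) * ν i / τ - 2| ≤ s i := abs_le_of_sq_le_sq (by
        rw [hs2]; linarith [hn.2]) (hs0 i).le
      have h5 : |(t - T i) - τ * (2 / ν i)| ≤ τ * (s i / |ν i|) := by
        have : (t - T i) - τ * (2 / ν i) = τ * (((t - T i) * ν i / τ - 2) / ν i) := by
          have := hν i; field_simp
        rw [this, abs_mul, abs_of_pos hτ0, abs_div]
        exact mul_le_mul_of_nonneg_left (div_le_div_of_nonneg_right h4 (habs i).le) hτ0.le
      have h6 := abs_le.1 h5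
      simp only [hA, hB]
      constructor <;> linarith)
    heven
  have hWdisc : ∀ z, z ∈ W → 1 < ‖Φ (chartHomeo o hω z)‖ := fun z hz => by
    by_contra! hn
    obtain ⟨h1, h2, h3⟩ := hdisc _ hn
    refine hclean _ _ h1 (by linarith) (by linarith) ?_
    rw [Complex.eta, chart_chartHomeo]
    exact hz
  refine ⟨G', hG', fun e t ht hW => ?_, fun hW => ?_⟩
  · have h1 := hWdisc _ hW
    have h2 : ∀ s ∈ Icc (0 : ℝ) 1, 1 < ‖Φ (chartHomeo o hω (G' e s))‖ → G' e s = G e s :=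
      fun s hs h => ((hGG' e s hs).resolve_left (not_le.2 h)).2
    refine ⟨(h2 t (Ioo_subset_Icc_self ht) h1) ▸ hW, ?_⟩
    have hc : Continuous fun s => ‖Φ (chartHomeo o hω (G' e s))‖ :=
      (Φ.continuous.comp ((chartHomeo o hω).continuous.comp (hG'.cont e))).norm
    filter_upwards [isOpen_Ioo.mem_nhds ht, hc.continuousAt.eventually_const_lt h1] with s hs h
    exact h2 s (Ioo_subset_Icc_self hs) h
  · have h1 := hWdisc _ hW
    have h2 := ((hGG' (ed i₀) (T i₀) (Ioo_subset_Icc_self (hT i₀))).resolve_left (not_le.2 h1)).1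
    have h3 : passCount ed B (ed i₀) (T i₀) = 1 := by
      rw [passCount, Finset.card_eq_one]
      refine ⟨i₀, ?_⟩
      ext j
      simp only [Finset.mem_filter, Finset.mem_univ, true_and, Finset.mem_singleton]
      constructor
      · rintro ⟨hj, hBj⟩
        by_contra hne
        have h4 := hsep j i₀ hne hj
        have h5 := hmin j hj
        rw [abs_of_nonneg (by linarith)] at h4
        have := abs_lt.1 (hBi j)
        linarith
      · rintro rfl
        refine ⟨rfl, ?_⟩
        have h4 := hBν j
        rw [abs_of_neg hi₀] at h4
        have h5 : ν j / -ν j = -1 := by rw [div_neg, div_self hi₀.ne]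
        rw [h5] at h4
        by_contra! h6
        nlinarith [hs1 j, mul_pos_of_neg_of_neg hi₀ (sub_neg.2 h6)]
    rw [h3] at h2
    exact absurd h2 (by decide)

section Crossings

variable {E V : Type*}

/-- The interior crossings of a drawing with a set of walls. -/
def crossings (W : Set ℂ) (G : E → ℝ → ℂ) : Set (E × ℝ) :=
  {q | q.2 ∈ Ioo (0 : ℝ) 1 ∧ G q.1 q.2 ∈ W}

/-- Drawings all of whose crossings with the walls are crossings of a reference drawing. -/
def Admissible (src tgt : E → V) (P : V → ℂ) (W : Set ℂ) (G₀ G : E → ℝ → ℂ) : Prop :=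
  Drawing src tgt P G ∧ ∀ q ∈ crossings W G, ∀ᶠ s in nhds q.2, G q.1 s = G₀ q.1 s

variable {src tgt : E → V} {P : V → ℂ} {W : Set ℂ} {G₀ G : E → ℝ → ℂ}

theorem Admissible.eq (h : Admissible src tgt P W G₀ G) {q : E × ℝ} (hq : q ∈ crossings W G) :
    G q.1 q.2 = G₀ q.1 q.2 := (h.2 q hq).self_of_nhds

theorem Admissible.subset (h : Admissible src tgt P W G₀ G) : crossings W G ⊆ crossings W G₀ :=
  fun _ hq => ⟨hq.1, h.eq hq ▸ hq.2⟩

theorem exists_minimal_admissible (hG₀ : Drawing src tgt P G₀) : ∃ G,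
    Admissible src tgt P W G₀ G ∧ ∀ G', Admissible src tgt P W G₀ G' →
      (crossings W G).ncard ≤ (crossings W G').ncard := by
  have hne : {G | Admissible src tgt P W G₀ G}.Nonempty :=
    ⟨G₀, hG₀, fun _ _ => Filter.Eventually.of_forall fun s => rfl⟩
  refine ⟨Function.argminOn (fun G => (crossings W G).ncard) _ hne,
    Function.argminOn_mem _ _ hne, fun G' hG' => Function.argminOn_le
      (fun G => (crossings W G).ncard) _ (show G' ∈ {G | Admissible src tgt P W G₀ G} from hG')⟩

theorem exists_gap_above (Q : Finset ℝ) {y z : ℝ} (hyz : y < z) : ∃ ε > 0, y + 3 * ε < z ∧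
    ∀ x ∈ Q, y < x → y + 3 * ε < x := by
  have : ∀ᶠ ε in nhdsWithin (0 : ℝ) (Ioi 0), y + 3 * ε < z ∧ ∀ x ∈ Q, y < x → y + 3 * ε < x := by
    refine Filter.Eventually.filter_mono nhdsWithin_le_nhds ?_
    have h : ∀ x, y < x → ∀ᶠ ε in nhds (0 : ℝ), y + 3 * ε < x := fun x hx =>
      (show Continuous fun ε : ℝ => y + 3 * ε by fun_prop).continuousAt.eventually_lt_const
        (by simpa using hx)
    refine (h z hyz).and ((Finset.eventually_all _).2 fun x _ => ?_)
    by_cases hx : y < x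
    · filter_upwards [h x hx] with ε hε _ using hε
    · simp [hx]
  obtain ⟨ε, h1, h2⟩ := (this.and self_mem_nhdsWithin).exists
  exact ⟨ε, h2, h1⟩

open Classical in
/-- In a drawing with the minimal number of crossings, a wall segment met by few edges carries
few crossings. -/
theorem Admissible.ncard_crossings_segment_lt [Fintype E] (hG : Admissible src tgt P W G₀ G)
    (hfin : (crossings W G₀).Finite)
    (hmin : ∀ G', Admissible src tgt P W G₀ G' → (crossings W G).ncard ≤ (crossings W G').ncard)
    {o ω : ℂ} (hω : ω ≠ 0) {τ₀ : ℝ} (hτ₀ : 0 < τ₀)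
    (hW : ∀ x : ℝ, 0 < x → x < 1 → o + ω * ⟨x, 0⟩ ∈ W)
    (hclean : ∀ x y : ℝ, 0 < x → x < 1 → y ≠ 0 → |y| < τ₀ → o + ω * ⟨x, y⟩ ∉ W)
    (hP : ∀ v, ∀ x : ℝ, 0 < x → x < 1 → P v ≠ o + ω * ⟨x, 0⟩)
    (htrans : ∀ q ∈ crossings W G₀, ∀ x : ℝ, 0 < x → x < 1 → G₀ q.1 q.2 = o + ω * ⟨x, 0⟩ →
      ∃ μ ν : ℝ, ν ≠ 0 ∧ ∀ᶠ t in nhds q.2,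
        G₀ q.1 t = o + ω * ⟨x + (t - q.2) * μ, (t - q.2) * ν⟩)
    (Es : Finset E) (hEs : ∀ q ∈ crossings W G₀, ∀ x : ℝ, 0 < x → x < 1 →
      G₀ q.1 q.2 = o + ω * ⟨x, 0⟩ → q.1 ∈ Es) :
    {q ∈ crossings W G | ∃ x : ℝ, 0 < x ∧ x < 1 ∧ G q.1 q.2 = o + ω * ⟨x, 0⟩}.ncard
      < 2 ^ Es.card := by
  have hXfin : (crossings W G).Finite := hfin.subset hG.subset
  have hQfin : {q ∈ crossings W G | ∃ x : ℝ, 0 < x ∧ x < 1 ∧ G q.1 q.2 = o + ω * ⟨x, 0⟩}.Finite :=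
    hXfin.subset fun q hq => hq.1
  obtain ⟨Q, hQ⟩ := hQfin.exists_finset_coe
  rw [← hQ, Set.ncard_coe_finset]
  have hQ' : ∀ q, q ∈ Q ↔ q ∈ crossings W G ∧
      ∃ x : ℝ, 0 < x ∧ x < 1 ∧ G q.1 q.2 = o + ω * ⟨x, 0⟩ := fun q => by
    rw [← Finset.mem_coe, hQ]; rfl
  set pos : E × ℝ → ℝ := fun q => (chartHomeo o hω (G q.1 q.2)).re with hpos
  have hpos' : ∀ q ∈ Q, 0 < pos q ∧ pos q < 1 ∧ G q.1 q.2 = o + ω * ⟨pos q, 0⟩ := fun q hq => by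
    obtain ⟨-, x, h0, h1, h⟩ := (hQ' q).1 hq
    have : pos q = x := by rw [hpos]; simp only [h, chartHomeo_chart]
    rw [this]
    exact ⟨h0, h1, h⟩
  have hposinj : ∀ q ∈ Q, ∀ q' ∈ Q, pos q = pos q' → q = q' := fun q hq q' hq' h => by
    have := hG.1.emb q.1 q'.1 q.2 q'.2 ((hQ' q).1 hq).1.1
      (Ioo_subset_Icc_self ((hQ' q').1 hq').1.1) (by
        rw [(hpos' q hq).2.2, (hpos' q' hq').2.2, h])
    exact Prod.ext this.1 this.2
  by_contra! hcard
  -- two prefixes with the same parities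
  set pre : ℝ → Finset (E × ℝ) := fun y => Q.filter fun q => pos q ≤ y
  set par : ℝ → Finset E := fun y => Es.filter fun e => Odd ((pre y).filter fun q => q.1 = e).card
  have h0 : (0 : ℝ) ∉ Q.image pos := fun h => by
    obtain ⟨q, hq, h⟩ := Finset.mem_image.1 h
    exact (hpos' q hq).1.ne' h
  obtain ⟨y, hy, y', hy', hyy', hpar⟩ : ∃ y ∈ insert 0 (Q.image pos), ∃ y' ∈ Q.image pos,
      y < y' ∧ par y = par y' := by
    have h1 : Es.powerset.card < (insert 0 (Q.image pos)).card := by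
      rw [Finset.card_powerset, Finset.card_insert_of_notMem h0,
        Finset.card_image_of_injOn fun q hq q' hq' => hposinj q hq q' hq']
      omega
    obtain ⟨y, hy, y', hy', hne, h⟩ := Finset.exists_ne_map_eq_of_card_lt_of_maps_to h1
      (f := par) fun y _ => Finset.mem_coe.2 (Finset.mem_powerset.2 (Finset.filter_subset _ _))
    have hnn : ∀ y ∈ insert 0 (Q.image pos), 0 ≤ y := fun y hy => by
      rcases Finset.mem_insert.1 hy with rfl | hy
      · exact le_rfl
      · obtain ⟨q, hq, rfl⟩ := Finset.mem_image.1 hy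
        exact (hpos' q hq).1.le
    rcases lt_or_gt_of_ne hne with h' | h'
    · refine ⟨y, hy, y', ?_, h', h⟩
      exact (Finset.mem_insert.1 hy').resolve_left ((hnn y hy).trans_lt h').ne'
    · refine ⟨y', hy', y, ?_, h', h.symm⟩
      exact (Finset.mem_insert.1 hy).resolve_left ((hnn y' hy').trans_lt h').ne'
  obtain ⟨q₁, hq₁, hq₁y⟩ := Finset.mem_image.1 hy'
  have hy0 : 0 ≤ y := by
    rcases Finset.mem_insert.1 hy with rfl | hy
    · exact le_rfl
    · obtain ⟨q, hq, rfl⟩ := Finset.mem_image.1 hy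
      exact (hpos' q hq).1.le
  have hy'1 : y' < 1 := hq₁y ▸ (hpos' q₁ hq₁).2.1
  set R : Finset (E × ℝ) := Q.filter fun q => y < pos q ∧ pos q ≤ y' with hR
  have hRe : ∀ e, Even (R.filter fun q => q.1 = e).card := fun e => by
    have hu : (pre y').filter (fun q => q.1 = e) =
        (pre y).filter (fun q => q.1 = e) ∪ R.filter (fun q => q.1 = e) := by
      ext q
      simp only [pre, hR, Finset.mem_filter, Finset.mem_union]
      constructor
      · rintro ⟨⟨h1, h2⟩, h3⟩
        rcases le_or_gt (pos q) y with h | h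
        · exact Or.inl ⟨⟨h1, h⟩, h3⟩
        · exact Or.inr ⟨⟨h1, h, h2⟩, h3⟩
      · rintro (⟨⟨h1, h2⟩, h3⟩ | ⟨⟨h1, -, h2⟩, h3⟩)
        · exact ⟨⟨h1, h2.trans hyy'.le⟩, h3⟩
        · exact ⟨⟨h1, h2⟩, h3⟩
    have hd : Disjoint ((pre y).filter (fun q => q.1 = e)) (R.filter (fun q => q.1 = e)) := by
      rw [Finset.disjoint_left]
      intro q h1 h2
      simp only [pre, hR, Finset.mem_filter] at h1 h2
      linarith [h1.1.2, h2.1.2.1]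
    have hc := congrArg Finset.card hu
    rw [Finset.card_union_of_disjoint hd] at hc
    by_cases he : e ∈ Es
    · have h1 : e ∈ par y ↔ e ∈ par y' := by rw [hpar]
      simp only [par, Finset.mem_filter, he, true_and] at h1
      rw [hc, Nat.odd_add, ← Nat.not_even_iff_odd] at h1
      by_contra hodd
      tauto
    · rw [Finset.filter_eq_empty_iff.2]
      · simp
      · rintro q hq rfl
        have hqQ := (Finset.mem_filter.1 hq).1
        have hqX := ((hQ' q).1 hqQ).1
        have := hpos' q hqQ
        exact he (hEs q (hG.subset hqX) _ this.1 this.2.1 (by rw [← hG.eq hqX]; exact this.2.2))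
  obtain ⟨ε₁, hε₁, hy1, hQ1⟩ := exists_gap_above (Q.image pos) hyy'
  obtain ⟨ε₂, hε₂, hy2, hQ2⟩ := exists_gap_above (Q.image pos) hy'1
  set ε := min ε₁ ε₂
  have hε : 0 < ε := lt_min hε₁ hε₂
  have hεε₁ : ε ≤ ε₁ := min_le_left _ _
  have hεε₂ : ε ≤ ε₂ := min_le_right _ _
  set c := (y + y' + 3 * ε) / 2 with hc
  set w := (y' - y - ε) / 2 with hw
  have hw0 : 0 < w := by rw [hw]; linarith
  have hRQ : ∀ q : R, q.1 ∈ Q := fun q => (Finset.mem_filter.1 q.2).1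
  have hRX : ∀ q : R, q.1 ∈ crossings W G := fun q => ((hQ' _).1 (hRQ q)).1
  have hRy : ∀ q : R, y + 3 * ε < pos q.1 ∧ pos q.1 ≤ y' := fun q => by
    obtain ⟨h1, h2, h3⟩ := Finset.mem_filter.1 q.2
    have := hQ1 _ (Finset.mem_image_of_mem _ h1) h2
    exact ⟨by linarith, h3⟩
  have hreg : ∀ x : ℝ, |x| ≤ 1 + ε / w → y + ε ≤ c + w * x ∧ c + w * x ≤ y' + 2 * ε := by
    intro x hx
    have h1 : |w * x| ≤ w + ε := by
      rw [abs_mul, abs_of_pos hw0]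
      refine (mul_le_mul_of_nonneg_left hx hw0.le).trans_eq ?_
      field_simp
    obtain ⟨h2, h3⟩ := abs_le.1 h1
    simp only [hc, hw] at h2 h3 ⊢
    constructor <;> linarith
  have hlocR : ∀ q : R, ∃ μ ν : ℝ, ν ≠ 0 ∧ ∀ᶠ t in nhds q.1.2,
      G q.1.1 t = o + ω * ⟨pos q.1 + (t - q.1.2) * μ, (t - q.1.2) * ν⟩ := fun q => by
    have h1 := hpos' q.1 (hRQ q)
    obtain ⟨μ, ν, h2, h3⟩ := htrans q.1 (hG.subset (hRX q)) _ h1.1 h1.2.1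
      (by rw [← hG.eq (hRX q)]; exact h1.2.2)
    refine ⟨μ, ν, h2, ?_⟩
    filter_upwards [h3, hG.2 _ (hRX q)] with t ht ht'
    rw [ht', ht]
  choose μ ν hν hloc using hlocR
  have hq₁R : q₁ ∈ R := by
    rw [hR, Finset.mem_filter]
    exact ⟨hq₁, by rw [hq₁y]; exact hyy', hq₁y.le⟩
  obtain ⟨i₀, hi₀, hi₀min⟩ := Finset.exists_min_image
    ((Finset.univ : Finset R).filter fun q => q.1.1 = q₁.1) (fun q => q.1.2)
    ⟨⟨q₁, hq₁R⟩, by simp⟩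
  have hmin₀ : ∀ j : R, j.1.1 = i₀.1.1 → i₀.1.2 ≤ j.1.2 := fun j hj =>
    hi₀min j (by simp only [Finset.mem_filter, Finset.mem_univ, true_and] at hi₀ ⊢; rw [hj, hi₀])
  -- apply the window surgery from the side of arrival
  have main : ∀ σ : ℝ, σ ^ 2 = 1 → ν i₀ * σ < 0 → False := fun σ hσ hνσ => by
    have hσ1 : |σ| = 1 := by rw [← sq_eq_sq₀ (abs_nonneg _) zero_le_one, sq_abs, hσ, one_pow]
    have hσ0 : σ ≠ 0 := by rintro rfl; norm_num at hσ
    have hchart : ∀ x y : ℝ, o + ω * (c : ℂ) + ω * (w : ℂ) * (σ : ℂ) * ⟨x, y⟩ =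
        o + ω * ⟨c + w * (σ * x), w * (σ * y)⟩ := fun x y => by
      have : (⟨c + w * (σ * x), w * (σ * y)⟩ : ℂ) = c + w * σ * ⟨x, y⟩ := by
        refine Complex.ext ?_ ?_ <;> simp [mul_assoc]
      rw [this]; ring
    have hσx : ∀ x : ℝ, |σ * x| = |x| := fun x => by rw [abs_mul, hσ1, one_mul]
    have hwC : (w : ℂ) ≠ 0 := Complex.ofReal_ne_zero.2 hw0.ne'
    have hσC : (σ : ℂ) ≠ 0 := Complex.ofReal_ne_zero.2 hσ0
    obtain ⟨G', hG', h1, h2⟩ := hG.1.window (W := W) (o := o + ω * c) (ω := ω * w * σ)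
      (mul_ne_zero (mul_ne_zero hω hwC) hσC)
      (r := 1 + ε / w) (τ₀ := τ₀ / (2 * w)) (by have := div_pos hε hw0; linarith) (by positivity)
      (fun x y' hx hy hy' => by
        rw [hchart]
        have h := hreg (σ * x) (by rwa [hσx])
        refine hclean _ _ (by linarith [h.1]) (by linarith [h.2])
          (mul_ne_zero hw0.ne' (mul_ne_zero hσ0 hy.ne')) ?_
        rw [abs_mul, hσx, abs_of_pos hw0, abs_of_pos hy]
        rw [le_div_iff₀ (by positivity)] at hy'
        linarith)
      (ι := R) (ed := fun q => q.1.1) (T := fun q => q.1.2)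
      (x := fun q => σ * ((pos q.1 - c) / w)) (μ := fun q => σ * (μ q / w))
      (ν := fun q => σ * (ν q / w))
      (fun i j h1 h2 => Subtype.ext (Prod.ext h1 h2))
      (fun i => (hRX i).1)
      (fun i => by
        rw [hσx, abs_div, abs_of_pos hw0, div_lt_one hw0, abs_lt]
        obtain ⟨h1, h2⟩ := hRy i
        simp only [hc, hw]
        constructor <;> linarith)
      (fun i => mul_ne_zero hσ0 (div_ne_zero (hν i) hw0.ne'))
      (fun i => by
        filter_upwards [hloc i] with t ht
        rw [ht, hchart]
        congr 2
        have e : ∀ z, w * (σ * (σ * (z / w))) = z := fun z => by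
          have : w * (σ * (σ * (z / w))) = σ ^ 2 * z := by field_simp
          rw [this, hσ, one_mul]
        refine Complex.ext ?_ ?_
        · have : c + w * (σ * (σ * ((pos i.1 - c) / w) + (t - i.1.2) * (σ * (μ i / w)))) =
            c + w * (σ * (σ * ((pos i.1 - c) / w))) +
              (t - i.1.2) * (w * (σ * (σ * (μ i / w)))) := by ring
          simp only
          rw [this, e, e]; ring
        · have : w * (σ * ((t - i.1.2) * (σ * (ν i / w)))) =
            (t - i.1.2) * (w * (σ * (σ * (ν i / w)))) := by ring
          simp only
          rw [this, e])
      (fun e t ht z hz hGt => by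
        rw [hchart, mul_zero, mul_zero] at hGt
        have h := hreg (σ * z) (by rwa [hσx])
        have hx0 : 0 < c + w * (σ * z) := by linarith [h.1]
        have hx1 : c + w * (σ * z) < 1 := by linarith [h.2]
        have ht' : t ∈ Ioo (0 : ℝ) 1 := by
          refine ⟨ht.1.lt_of_ne ?_, ht.2.lt_of_ne ?_⟩
          · rintro rfl
            exact hP (src e) _ hx0 hx1 (by rw [← hG.1.zero]; exact hGt)
          · rintro rfl
            exact hP (tgt e) _ hx0 hx1 (by rw [← hG.1.one]; exact hGt)
        have hq : (e, t) ∈ Q := (hQ' _).2 ⟨⟨ht', by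
          simp only; rw [hGt]; exact hW _ hx0 hx1⟩, _, hx0, hx1, hGt⟩
        have hp : pos (e, t) = c + w * (σ * z) := by
          simp only [hpos]; rw [hGt, chartHomeo_chart]
        have him := Finset.mem_image_of_mem pos hq
        refine ⟨⟨(e, t), ?_⟩, rfl, rfl⟩
        rw [hR, Finset.mem_filter]
        refine ⟨hq, by rw [hp]; linarith [h.1], ?_⟩
        by_contra! hlt
        have := hQ2 _ him hlt
        rw [hp] at this
        linarith [h.2])
      (fun e => by
        have : ((Finset.univ : Finset R).filter fun q => q.1.1 = e).card =
            (R.filter fun q => q.1 = e).card := by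
          refine Finset.card_bij (fun q _ => q.1) (fun q hq => ?_) (fun _ _ _ _ h => Subtype.ext h)
            (fun q hq => ?_)
          · simp only [Finset.mem_filter, Finset.mem_univ, true_and] at hq
            exact Finset.mem_filter.2 ⟨q.2, hq⟩
          · obtain ⟨h1, h2⟩ := Finset.mem_filter.1 hq
            exact ⟨⟨q, h1⟩, by simpa using h2, rfl⟩
        rw [this]
        exact hRe e)
      (i₀ := i₀) (by
        have : σ * (ν i₀ / w) = ν i₀ * σ / w := by ring
        rw [this]
        exact div_neg_of_neg_of_pos hνσ hw0)
      hmin₀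
    have hadm : Admissible src tgt P W G₀ G' := by
      refine ⟨hG', fun q hq => ?_⟩
      obtain ⟨h3, h4⟩ := h1 q.1 q.2 hq.1 hq.2
      filter_upwards [h4, hG.2 q ⟨hq.1, h3⟩] with s hs hs'
      rw [hs, hs']
    have hss : crossings W G' ⊂ crossings W G := by
      refine ⟨fun q hq => ⟨hq.1, (h1 q.1 q.2 hq.1 hq.2).1⟩, fun hsub => ?_⟩
      exact h2 (hsub (hRX i₀)).2
    exact absurd (hmin G' hadm) (not_le.2 (Set.ncard_lt_ncard hss hXfin))
  rcases lt_or_gt_of_ne (hν i₀) with h | h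
  · exact main 1 (by norm_num) (by linarith)
  · exact main (-1) (by norm_num) (by linarith)

end Crossings

/-- `F` is affine between consecutive elements of `S`. -/
def PLOn (F : ℝ → ℂ) (S : Finset ℝ) : Prop :=
  ∀ a b, Consec S a b → ∃ p d : ℂ, ∀ t ∈ Icc a b, F t = p + t * d

section Walls

variable {E V : Type*}

/-- The abscissae of the vertical walls in the horizontal strip `k ≤ im ≤ k + 1`. -/
def cuts (P : V → ℂ) (k : ℤ) : Set ℝ :=
  {x | (∃ n : ℤ, x = n) ∨ ∃ v, ⌊(P v).im⌋ = k ∧ x = (P v).re}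

/-- The unit grid together with a vertical wall through every vertex. -/
def walls (P : V → ℂ) : Set ℂ :=
  {z | (∃ n : ℤ, z.im = n) ∨ z.re ∈ cuts P ⌊z.im⌋}

/-- A piecewise linear drawing in general position with respect to the walls. -/
structure GenericDrawing (src tgt : E → V) (P : V → ℂ) (G : E → ℝ → ℂ) (S : E → Finset ℝ) : Prop
    extends Drawing src tgt P G where
  incident : ∀ v, ∃ e, v = src e ∨ v = tgt e
  mem : ∀ e, 0 ∈ S e ∧ 1 ∈ S e ∧ ∀ s ∈ S e, s ∈ Icc (0 : ℝ) 1
  pl : ∀ e, PLOn (G e) (S e)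
  im_ne : ∀ e, ∀ s ∈ S e, ∀ n : ℤ, (G e s).im ≠ n
  re_ne : ∀ e, ∀ s ∈ S e, ∀ n : ℤ, (G e s).re ≠ n
  re_vertex : ∀ e, ∀ s ∈ S e, ∀ v, (G e s).re = (P v).re → G e s = P v
  lattice : ∀ e, ∀ t ∈ Icc (0 : ℝ) 1, ∀ n : ℤ, (G e t).im = n →
    (∀ m : ℤ, (G e t).re ≠ m) ∧ ∀ v, (G e t).re ≠ (P v).re

variable {src tgt : E → V} {P : V → ℂ} {G : E → ℝ → ℂ} {S : E → Finset ℝ}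

theorem Drawing.ne_vertex (hG : Drawing src tgt P G) (hinc : ∀ v, ∃ e, v = src e ∨ v = tgt e)
    {e : E} {t : ℝ} (ht : t ∈ Ioo (0 : ℝ) 1) (v : V) : G e t ≠ P v := fun h => by
  obtain ⟨e', rfl | rfl⟩ := hinc v
  · have := (hG.emb e e' t 0 ht ⟨le_rfl, zero_le_one⟩ (by rw [h, hG.zero])).2
    exact ht.1.ne' this
  · have := (hG.emb e e' t 1 ht ⟨zero_le_one, le_rfl⟩ (by rw [h, hG.one])).2
    exact ht.2.ne this

namespace GenericDrawing

theorem exists_eq_vertex (hG : GenericDrawing src tgt P G S) (v : V) :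
    ∃ e, ∃ s ∈ S e, G e s = P v := by
  obtain ⟨e, rfl | rfl⟩ := hG.incident v
  · exact ⟨e, 0, (hG.mem e).1, hG.zero e⟩
  · exact ⟨e, 1, (hG.mem e).2.1, hG.one e⟩

theorem vertex_im_ne (hG : GenericDrawing src tgt P G S) (v : V) (n : ℤ) : (P v).im ≠ n := by
  obtain ⟨e, s, hs, h⟩ := hG.exists_eq_vertex v
  exact h ▸ hG.im_ne e s hs n

theorem vertex_eq (hG : GenericDrawing src tgt P G S) {v v' : V} (h : (P v).re = (P v').re) :
    P v = P v' := by
  obtain ⟨e, s, hs, h'⟩ := hG.exists_eq_vertex v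
  rw [← h'] at h ⊢
  exact hG.re_vertex e s hs v' h

theorem not_mem_breakpoints (hG : GenericDrawing src tgt P G S) {q : E × ℝ}
    (hq : q ∈ crossings (walls P) G) : q.2 ∉ S q.1 := fun h => by
  rcases hq.2 with ⟨n, hn⟩ | ⟨n, hn⟩ | ⟨v, -, hv⟩
  · exact hG.im_ne _ _ h n hn
  · exact hG.re_ne _ _ h n hn
  · exact hG.toDrawing.ne_vertex hG.incident hq.1 v (hG.re_vertex _ _ h v hv)

/-- Every crossing is transversal. -/
theorem transversal (hG : GenericDrawing src tgt P G S) {q : E × ℝ}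
    (hq : q ∈ crossings (walls P) G) {a b : ℝ} (hab : Consec (S q.1) a b) (ha : a < q.2)
    (hb : q.2 < b) {p d : ℂ} (hpd : ∀ t ∈ Icc a b, G q.1 t = p + t * d) :
    ((∃ n : ℤ, (G q.1 q.2).im = n) → d.im ≠ 0) ∧
      ((G q.1 q.2).re ∈ cuts P ⌊(G q.1 q.2).im⌋ → d.re ≠ 0) := by
  have h1 := hpd a ⟨le_rfl, hab.2.2.1.le⟩
  have h2 := hpd b ⟨hab.2.2.1.le, le_rfl⟩
  have h3 := hpd q.2 ⟨ha.le, hb.le⟩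
  constructor
  · rintro ⟨n, hn⟩ hd
    refine hG.im_ne q.1 a hab.1 n ?_
    rw [← hn, h1, h3]; simp [hd]
  · intro hc hd
    have e1 : (G q.1 a).re = (G q.1 q.2).re := by rw [h1, h3]; simp [hd]
    have e2 : (G q.1 b).re = (G q.1 q.2).re := by rw [h2, h3]; simp [hd]
    rcases hc with ⟨n, hn⟩ | ⟨v, -, hv⟩
    · exact hG.re_ne q.1 a hab.1 n (e1.trans hn)
    · have e3 := hG.re_vertex q.1 a hab.1 v (e1.trans hv)
      have e4 := hG.re_vertex q.1 b hab.2.1 v (e2.trans hv)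
      have e5 : ((b : ℂ) - a) * d = 0 := by
        have := e4.trans e3.symm
        rw [h1, h2] at this
        linear_combination this
      have hab0 : ((b : ℂ) - a) ≠ 0 := by
        rw [← Complex.ofReal_sub]
        exact Complex.ofReal_ne_zero.2 (sub_pos.2 hab.2.2.1).ne'
      have hd0 := (mul_eq_zero.1 e5).resolve_left hab0
      refine hG.toDrawing.ne_vertex hG.incident (e := q.1) hq.1 v ?_
      rw [← e3, h1, h3, hd0]; simp

theorem exists_local_affine (hG : GenericDrawing src tgt P G S) {q : E × ℝ}
    (hq : q ∈ crossings (walls P) G) : ∃ d : ℂ,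
      (∀ᶠ t in nhds q.2, G q.1 t = G q.1 q.2 + (t - q.2) * d) ∧
      ((∃ n : ℤ, (G q.1 q.2).im = n) → d.im ≠ 0) ∧
      ((G q.1 q.2).re ∈ cuts P ⌊(G q.1 q.2).im⌋ → d.re ≠ 0) := by
  rcases mem_or_exists_consec (hG.mem q.1).1 (hG.mem q.1).2.1 hq.1.1.le hq.1.2.le with h |
    ⟨a, b, hab, ha, hb⟩
  · exact absurd h (hG.not_mem_breakpoints hq)
  · obtain ⟨p, d, hpd⟩ := hG.pl q.1 a b hab
    refine ⟨d, ?_, hG.transversal hq hab ha hb hpd⟩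
    filter_upwards [isOpen_Ioo.mem_nhds (show q.2 ∈ Ioo a b from ⟨ha, hb⟩)] with t ht
    rw [hpd t (Ioo_subset_Icc_self ht), hpd q.2 ⟨ha.le, hb.le⟩]
    ring

end GenericDrawing

theorem finite_affine_integer {a b α β : ℝ} (hβ : β ≠ 0) :
    {t ∈ Icc a b | ∃ n : ℤ, α + t * β = n}.Finite := by
  set C := |α| + (|a| + |b|) * |β|
  have hfin : ((fun n : ℤ => ((n : ℝ) - α) / β) '' Icc ⌊-C⌋ ⌈C⌉).Finite :=
    (Set.finite_Icc _ _).image _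
  refine hfin.subset ?_
  rintro t ⟨ht, n, hn⟩
  have h1 : |(n : ℝ)| ≤ C := by
    rw [← hn]
    refine (abs_add_le _ _).trans ?_
    rw [abs_mul]
    have : |t| ≤ |a| + |b| := by
      rw [abs_le]
      constructor <;> linarith [ht.1, ht.2, neg_abs_le a, le_abs_self b, abs_nonneg a, abs_nonneg b]
    exact add_le_add le_rfl (mul_le_mul_of_nonneg_right this (abs_nonneg _))
  refine ⟨n, ⟨?_, ?_⟩, ?_⟩
  · rw [Int.floor_le_iff]; linarith [(abs_le.1 h1).1]
  · rw [Int.le_ceil_iff]; linarith [(abs_le.1 h1).2]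
  · simp only; rw [← hn]; field_simp; ring

theorem GenericDrawing.finite_crossings [Finite E] [Finite V]
    (hG : GenericDrawing src tgt P G S) : (crossings (walls P) G).Finite := by
  have : crossings (walls P) G ⊆ ⋃ e, ⋃ a ∈ (S e : Set ℝ), ⋃ b ∈ (S e : Set ℝ),
      (fun t => (e, t)) '' {t | Consec (S e) a b ∧ t ∈ Ioo a b ∧ (e,
          t) ∈ crossings (walls P) G} := by
    rintro ⟨e, t⟩ hq
    rcases mem_or_exists_consec (hG.mem e).1 (hG.mem e).2.1 hq.1.1.le hq.1.2.le with h |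
      ⟨a, b, hab, ha, hb⟩
    · exact absurd h (hG.not_mem_breakpoints hq)
    · simp only [mem_iUnion]
      exact ⟨e, a, hab.1, b, hab.2.1, t, ⟨hab, ⟨ha, hb⟩, hq⟩, rfl⟩
  refine Set.Finite.subset ?_ this
  refine Set.finite_iUnion fun e => (S e).finite_toSet.biUnion fun a _ =>
    (S e).finite_toSet.biUnion fun b _ => Set.Finite.image _ ?_
  by_cases hab : Consec (S e) a b
  swap
  · simp [hab]
  obtain ⟨p, d, hpd⟩ := hG.pl e a b hab
  have hsub : {t | Consec (S e) a b ∧ t ∈ Ioo a b ∧ (e, t) ∈ crossings (walls P) G} ⊆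
      {t | d.im ≠ 0 ∧ t ∈ Icc a b ∧ ∃ n : ℤ, p.im + t * d.im = n} ∪
      ({t | d.re ≠ 0 ∧ t ∈ Icc a b ∧ ∃ n : ℤ, p.re + t * d.re = n} ∪
      ⋃ v, {t | d.re ≠ 0 ∧ p.re + t * d.re = (P v).re}) := by
    rintro t ⟨-, ht, hq⟩
    have h1 := hG.transversal hq hab ht.1 ht.2 hpd
    have ht' := Ioo_subset_Icc_self ht
    have hre : (G e t).re = p.re + t * d.re := by rw [hpd t ht']; simp
    have him : (G e t).im = p.im + t * d.im := by rw [hpd t ht']; simp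
    rcases hq.2 with h | h
    · exact Or.inl ⟨h1.1 h, ht', him ▸ h⟩
    · have h2 := h1.2 h
      rcases h with h | ⟨v, -, h⟩
      · exact Or.inr (Or.inl ⟨h2, ht', hre ▸ h⟩)
      · exact Or.inr (Or.inr (mem_iUnion.2 ⟨v, h2, hre ▸ h⟩))
  refine Set.Finite.subset (.union ?_ (.union ?_ (Set.finite_iUnion fun v => ?_))) hsub
  · by_cases h : d.im = 0
    · simp [h]
    · simpa [h] using finite_affine_integer h
  · by_cases h : d.re = 0
    · simp [h]
    · simpa [h] using finite_affine_integer h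
  · by_cases h : d.re = 0
    · simp [h]
    · refine (Set.finite_singleton (((P v).re - p.re) / d.re)).subset ?_
      rintro t ⟨-, ht⟩
      rw [mem_singleton_iff, ← ht]; field_simp; ring

end Walls

theorem ncard_le_of_consec {β : Type*} {Y : Set β} (hY : Y.Finite) (f : β → ℝ) (S : Finset ℝ)
    {N : ℕ} (hS : ∀ q ∈ Y, ∃ a b, Consec S a b ∧ a < f q ∧ f q < b)
    (hN : ∀ a b, Consec S a b → {q ∈ Y | a < f q ∧ f q < b}.ncard ≤ N) :
    Y.ncard ≤ S.card * N := by
  have hsub : Y ⊆ ⋃ a ∈ S, {q ∈ Y | ∃ b, Consec S a b ∧ a < f q ∧ f q < b} := fun q hq => by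
    obtain ⟨a, b, h, h1, h2⟩ := hS q hq
    exact mem_biUnion (show a ∈ (S : Set ℝ) from h.1) ⟨hq, b, h, h1, h2⟩
  refine (Set.ncard_le_ncard hsub (S.finite_toSet.biUnion fun a _ =>
    hY.subset fun q hq => hq.1)).trans ((Finset.set_ncard_biUnion_le _ _).trans ?_)
  refine (Finset.sum_le_card_nsmul _ _ N fun a _ => ?_).trans_eq (smul_eq_mul _ _)
  by_cases h : ∃ b, Consec S a b
  · obtain ⟨b, hb⟩ := h
    refine (Set.ncard_le_ncard ?_ (hY.subset fun q hq => hq.1)).trans (hN a b hb)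
    rintro q ⟨hq, b', hb', h1, h2⟩
    have : b' = b := by
      rcases hb.2.2.2 b' hb'.2.1 with h | h <;> rcases hb'.2.2.2 b hb.2.1 with h' | h'
      · linarith [hb.2.2.1, hb'.2.2.1]
      · linarith [hb.2.2.1, hb'.2.2.1]
      · linarith [hb.2.2.1, hb'.2.2.1]
      · exact le_antisymm h' h
    exact ⟨hq, h1, this ▸ h2⟩
  · have : {q ∈ Y | ∃ b, Consec S a b ∧ a < f q ∧ f q < b} = ∅ := by
      rw [Set.eq_empty_iff_forall_notMem]
      rintro q ⟨-, b, hb, -⟩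
      exact h ⟨b, hb⟩
    rw [this, Set.ncard_empty]
    exact Nat.zero_le _

section Counting

variable {E V : Type*} [Fintype E] [Finite V] {src tgt : E → V} {P : V → ℂ} {G₀ G : E → ℝ → ℂ}
  {S : E → Finset ℝ}

theorem finite_cuts_inter (P : V → ℂ) (k : ℤ) (x y : ℝ) : (cuts P k ∩ Icc x y).Finite := by
  refine (((Set.finite_Icc ⌊x⌋ ⌈y⌉).image (fun n : ℤ => (n : ℝ))).union
    (Set.finite_range fun v => (P v).re)).subset ?_
  rintro z ⟨⟨n, rfl⟩ | ⟨v, -, rfl⟩, hz⟩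
  · refine Or.inl ⟨n, ⟨?_, ?_⟩, rfl⟩
    · exact_mod_cast (Int.floor_le x).trans hz.1
    · exact_mod_cast hz.2.trans (Int.le_ceil y)
  · exact Or.inr ⟨v, rfl⟩

/-- The box around a unit square in which the walls meeting the square are determined. -/
def box (m k : ℤ) : Set ℂ :=
  {z | (m : ℝ) ≤ z.re ∧ z.re ≤ m + 1 ∧ (k : ℝ) - 1 ≤ z.im ∧ z.im ≤ k + 1}

theorem Admissible.ncard_horizontal_segment_le
    (hG₀ : GenericDrawing src tgt P G₀ S) (hG : Admissible src tgt P (walls P) G₀ G)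
    (hmin : ∀ G', Admissible src tgt P (walls P) G₀ G' →
      (crossings (walls P) G).ncard ≤ (crossings (walls P) G').ncard)
    {m k : ℤ} (Es : Finset E) (hEs : ∀ e, ∀ t ∈ Icc (0 : ℝ) 1, G₀ e t ∈ box m k → e ∈ Es)
    {a b : ℝ} (hab : a < b) (hma : m ≤ a)
    (hbm : b ≤ m + 1) (hcut : ∀ x ∈ Ioo a b, x ∉ cuts P (k - 1) ∧ x ∉ cuts P k) :
    {q ∈ crossings (walls P) G | (G q.1 q.2).im = k ∧ a < (G q.1 q.2).re ∧
      (G q.1 q.2).re < b}.ncard ≤ 2 ^ Es.card := by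
  have hw : 0 < b - a := sub_pos.2 hab
  have hchart : ∀ x y : ℝ, (⟨a, k⟩ : ℂ) + ((b - a : ℝ) : ℂ) * ⟨x, y⟩ =
      ⟨a + (b - a) * x, k + (b - a) * y⟩ := fun x y => by
    refine Complex.ext ?_ ?_ <;> simp
  have hin : ∀ x : ℝ, 0 < x → x < 1 → a + (b - a) * x ∈ Ioo a b := fun x h0 h1 =>
    ⟨by nlinarith, by nlinarith⟩
  have := hG.ncard_crossings_segment_lt hG₀.finite_crossings hmin (o := ⟨a, k⟩)
    (ω := ((b - a : ℝ) : ℂ)) (Complex.ofReal_ne_zero.2 hw.ne') (τ₀ := 1 / (b - a)) (by positivity)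
    (fun x _ _ => by rw [hchart]; exact Or.inl ⟨k, by simp⟩)
    (fun x y h0 h1 hy hyτ hW => by
      rw [hchart] at hW
      rw [lt_div_iff₀ hw] at hyτ
      obtain ⟨h2, h3⟩ : -1 < (b - a) * y ∧ (b - a) * y < 1 := by
        rw [← abs_lt, abs_mul, abs_of_pos hw]; linarith
      have h4 : (b - a) * y ≠ 0 := mul_ne_zero hw.ne' hy
      have hf : ⌊(k : ℝ) + (b - a) * y⌋ = k - 1 ∨ ⌊(k : ℝ) + (b - a) * y⌋ = k := by
        rcases lt_or_gt_of_ne h4 with h | h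
        · left; rw [Int.floor_eq_iff]; push_cast; constructor <;> linarith
        · right; rw [Int.floor_eq_iff]; constructor <;> linarith
      rcases hW with ⟨n, hn⟩ | hW
      · simp only at hn
        have h5 : ((n - k : ℤ) : ℝ) = (b - a) * y := by push_cast; linarith
        rw [← h5] at h2 h3 h4
        have h6 : (-1 : ℤ) < n - k := by exact_mod_cast h2
        have h7 : n - k < (1 : ℤ) := by exact_mod_cast h3
        exact h4 (by exact_mod_cast (by omega : n - k = 0))
      · have h8 := hcut _ (hin x h0 h1)
        rcases hf with h | h <;> simp only [h] at hW
        · exact h8.1 hW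
        · exact h8.2 hW)
    (fun v x _ _ h => by
      rw [hchart] at h
      exact hG₀.vertex_im_ne v k (by rw [h]; simp))
    (fun q hq x h0 h1 h => by
      obtain ⟨d, hd, hd1, -⟩ := hG₀.exists_local_affine hq
      rw [h, hchart] at hd1 hd
      refine ⟨d.re / (b - a), d.im / (b - a), div_ne_zero (hd1 ⟨k, by simp⟩) hw.ne', ?_⟩
      filter_upwards [hd] with t ht
      rw [ht, hchart]
      refine Complex.ext ?_ ?_
      · simp; field_simp; ring
      · simp; field_simp)
    Es (fun q hq x h0 h1 h => hEs q.1 q.2 (Ioo_subset_Icc_self hq.1) (by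
      rw [h, hchart]
      have := hin x h0 h1
      exact ⟨by linarith [this.1], by linarith [this.2], by simp, by simp⟩))
  refine (Set.ncard_le_ncard ?_ (((hG₀.finite_crossings).subset hG.subset).subset
    fun q hq => hq.1)).trans this.le
  rintro q ⟨hq, h1, h2, h3⟩
  refine ⟨hq, ((G q.1 q.2).re - a) / (b - a), div_pos (by linarith) hw, ?_, ?_⟩
  · rw [div_lt_one hw]; linarith
  · rw [hchart]
    refine Complex.ext ?_ ?_
    · simp; field_simp; ring
    · simp [h1]

theorem Admissible.ncard_vertical_segment_le
    (hG₀ : GenericDrawing src tgt P G₀ S) (hG : Admissible src tgt P (walls P) G₀ G)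
    (hmin : ∀ G', Admissible src tgt P (walls P) G₀ G' →
      (crossings (walls P) G).ncard ≤ (crossings (walls P) G').ncard)
    {m k : ℤ} (Es : Finset E) (hEs : ∀ e, ∀ t ∈ Icc (0 : ℝ) 1, G₀ e t ∈ box m k → e ∈ Es)
    {a b c : ℝ} (hab : a < b) (hka : k ≤ a)
    (hbk : b ≤ k + 1) (hmc : m ≤ c) (hcm : c ≤ m + 1) (hc : c ∈ cuts P k)
    (hvert : ∀ v, (P v).re = c → (P v).im ∉ Ioo a b) :
    {q ∈ crossings (walls P) G | (G q.1 q.2).re = c ∧ a < (G q.1 q.2).im ∧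
      (G q.1 q.2).im < b}.ncard ≤ 2 ^ Es.card := by
  have hw : 0 < b - a := sub_pos.2 hab
  have hchart : ∀ x y : ℝ, (⟨c, a⟩ : ℂ) + ((b - a : ℝ) : ℂ) * Complex.I * ⟨x, y⟩ =
      ⟨c - (b - a) * y, a + (b - a) * x⟩ := fun x y => by
    refine Complex.ext ?_ ?_ <;> simp; ring
  have hin : ∀ x : ℝ, 0 < x → x < 1 → a + (b - a) * x ∈ Ioo a b := fun x h0 h1 =>
    ⟨by nlinarith, by nlinarith⟩
  have hfl : ∀ y ∈ Ioo a b, ⌊y⌋ = k := fun y hy => by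
    rw [Int.floor_eq_iff]; constructor <;> linarith [hy.1, hy.2]
  obtain ⟨τ, hτ, hτc⟩ : ∃ τ > 0, ∀ x, |x - c| < τ → x ≠ c → x ∉ cuts P k := by
    have hf : ((cuts P k ∩ Icc (c - 1) (c + 1)) \ {c}).Finite :=
      (finite_cuts_inter P k _ _).subset sdiff_subset
    obtain ⟨τ, h0, h⟩ := Metric.isOpen_iff.1 hf.isClosed.isOpen_compl c (by simp)
    refine ⟨min τ 1, by positivity, fun x hx hxc hcut => ?_⟩
    have h1 := hx.trans_le (min_le_left _ _)
    have h2 := abs_lt.1 (hx.trans_le (min_le_right _ _))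
    exact h (by rwa [mem_ball, Real.dist_eq])
      ⟨⟨hcut, by linarith [h2.1], by linarith [h2.2]⟩, hxc⟩
  have := hG.ncard_crossings_segment_lt hG₀.finite_crossings hmin (o := ⟨c, a⟩)
    (ω := ((b - a : ℝ) : ℂ) * Complex.I)
    (mul_ne_zero (Complex.ofReal_ne_zero.2 hw.ne') Complex.I_ne_zero)
    (τ₀ := τ / (b - a)) (by positivity)
    (fun x h0 h1 => by
      rw [hchart]
      refine Or.inr ?_
      simp only [mul_zero, sub_zero]
      rwa [hfl _ (hin x h0 h1)])
    (fun x y h0 h1 hy hyτ hW => by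
      rw [hchart] at hW
      rw [lt_div_iff₀ hw] at hyτ
      have hI := hin x h0 h1
      rcases hW with ⟨n, hn⟩ | hW
      · simp only at hn
        rw [hn] at hI
        have h1 : (k : ℝ) < n := by linarith [hI.1]
        have h2 : (n : ℝ) < k + 1 := by linarith [hI.2]
        have h3 : k < n := by exact_mod_cast h1
        have h4 : n < k + 1 := by exact_mod_cast h2
        omega
      · simp only [hfl _ hI] at hW
        refine hτc _ ?_ ?_ hW
        · rw [sub_sub_cancel_left, abs_neg, abs_mul, abs_of_pos hw]; linarith
        · have := mul_ne_zero hw.ne' hy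
          intro h
          exact this (by linarith))
    (fun v x h0 h1 h => by
      rw [hchart] at h
      refine hvert v (by rw [h]; simp) ?_
      rw [h]
      exact hin x h0 h1)
    (fun q hq x h0 h1 h => by
      obtain ⟨d, hd, -, hd1⟩ := hG₀.exists_local_affine hq
      rw [h, hchart] at hd1 hd
      simp only [mul_zero, sub_zero] at hd1
      rw [hfl _ (hin x h0 h1)] at hd1
      refine ⟨d.im / (b - a), -d.re / (b - a), div_ne_zero (neg_ne_zero.2 (hd1 hc)) hw.ne', ?_⟩
      filter_upwards [hd] with t ht
      rw [ht, hchart]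
      refine Complex.ext ?_ ?_
      · simp; field_simp; ring
      · simp; field_simp; ring)
    Es (fun q hq x h0 h1 h => hEs q.1 q.2 (Ioo_subset_Icc_self hq.1) (by
      rw [h, hchart]
      have := hin x h0 h1
      exact ⟨by simpa using hmc, by simpa using hcm, by simp only; linarith [this.1],
        by simp only; linarith [this.2]⟩))
  refine (Set.ncard_le_ncard ?_ (((hG₀.finite_crossings).subset hG.subset).subset
    fun q hq => hq.1)).trans this.le
  rintro q ⟨hq, h1, h2, h3⟩
  refine ⟨hq, ((G q.1 q.2).im - a) / (b - a), div_pos (by linarith) hw, ?_, ?_⟩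
  · rw [div_lt_one hw]; linarith
  · rw [hchart]
    refine Complex.ext ?_ ?_
    · simp [h1]
    · simp; field_simp; ring

open Classical in
/-- The number of crossings in a unit square of a drawing with the minimal number of crossings. -/
theorem Admissible.ncard_square_le
    (hG₀ : GenericDrawing src tgt P G₀ S) (hG : Admissible src tgt P (walls P) G₀ G)
    (hmin : ∀ G', Admissible src tgt P (walls P) G₀ G' →
      (crossings (walls P) G).ncard ≤ (crossings (walls P) G').ncard)
    {m k : ℤ} (Es : Finset E) (hEs : ∀ e, ∀ t ∈ Icc (0 : ℝ) 1, G₀ e t ∈ box m k → e ∈ Es)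
    (Vs : Finset V) (hVs : ∀ v, P v ∈ box m k → v ∈ Vs) :
    {q ∈ crossings (walls P) G | (m : ℝ) ≤ (G q.1 q.2).re ∧ (G q.1 q.2).re < m + 1 ∧
      (k : ℝ) ≤ (G q.1 q.2).im ∧ (G q.1 q.2).im < k + 1}.ncard ≤
      (Vs.card + 2) ^ 2 * 2 ^ Es.card := by
  have hfin : (crossings (walls P) G).Finite := hG₀.finite_crossings.subset hG.subset
  -- crossings with the bottom side
  have hH : {q ∈ crossings (walls P) G | (m : ℝ) ≤ (G q.1 q.2).re ∧ (G q.1 q.2).re < m + 1 ∧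
      (G q.1 q.2).im = k}.ncard ≤ (Vs.card + 2) * 2 ^ Es.card := by
    set C : Finset ℝ := insert (m : ℝ) (insert ((m : ℝ) + 1) (Vs.image fun v => (P v).re)) with hC
    refine (ncard_le_of_consec (hfin.subset fun q hq => hq.1) (fun q => (G q.1 q.2).re)
      (C.filter fun x => (m : ℝ) ≤ x ∧ x ≤ m + 1) (N := 2 ^ Es.card) ?_ ?_).trans
      (Nat.mul_le_mul_right _ ?_)
    · rintro q ⟨hq, h1, h2, h3⟩
      have e := hG.eq hq
      have hl := hG₀.lattice q.1 q.2 (Ioo_subset_Icc_self hq.1) k (by rw [← e]; exact h3)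
      rw [← e] at hl
      obtain h | h := mem_or_exists_consec (S := C.filter fun x => (m : ℝ) ≤ x ∧ x ≤ m + 1)
        (x := m) (y := m + 1) (by simp [hC]) (by simp [hC]) h1 h2.le
      · simp only [hC, Finset.mem_filter, Finset.mem_insert, Finset.mem_image] at h
        rcases h.1 with h | h | ⟨v, -, h⟩
        · exact absurd h (hl.1 m)
        · exact absurd h (by have := hl.1 (m + 1); push_cast at this; exact this)
        · exact absurd h.symm (hl.2 v)
      · exact h
    · intro a b hab
      have ha := (Finset.mem_filter.1 hab.1).2
      have hb := (Finset.mem_filter.1 hab.2.1).2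
      refine le_trans (Set.ncard_le_ncard ?_ (hfin.subset fun q hq => hq.1))
        (hG.ncard_horizontal_segment_le hG₀ hmin Es hEs hab.2.2.1 ha.1 hb.2 ?_)
      · rintro q ⟨⟨hq, -, -, h3⟩, h4, h5⟩
        exact ⟨hq, h3, h4, h5⟩
      · intro x hx
        have key : ∀ j : ℤ, (k : ℝ) - 1 ≤ j → (j : ℝ) ≤ k → x ∉ cuts P j := by
          rintro j hj1 hj2 (⟨n, rfl⟩ | ⟨v, hv, rfl⟩)
          · have h1 : (m : ℝ) < n := ha.1.trans_lt hx.1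
            have h2 : (n : ℝ) < m + 1 := hx.2.trans_le hb.2
            have h3 : m < n := by exact_mod_cast h1
            have h4 : n < m + 1 := by exact_mod_cast h2
            omega
          · rw [Int.floor_eq_iff] at hv
            have hm : (m : ℝ) ≤ (P v).re ∧ (P v).re ≤ m + 1 :=
              ⟨ha.1.trans hx.1.le, hx.2.le.trans hb.2⟩
            have hvV := hVs v ⟨hm.1, hm.2, by linarith, by linarith⟩
            refine hab.not_mem hx.1 hx.2 (Finset.mem_filter.2 ⟨?_, hm⟩)
            simp only [hC, Finset.mem_insert, Finset.mem_image]
            exact Or.inr (Or.inr ⟨v, hvV, rfl⟩)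
        exact ⟨key (k - 1) (by push_cast; exact le_rfl) (by push_cast; linarith),
          key k (by linarith) le_rfl⟩
    · refine (Finset.card_filter_le _ _).trans ((Finset.card_insert_le _ _).trans ?_)
      have := Finset.card_insert_le ((m : ℝ) + 1) (Vs.image fun v => (P v).re)
      have := Finset.card_image_le (s := Vs) (f := fun v => (P v).re)
      omega
  -- crossings with one vertical wall
  have hVc : ∀ c : ℝ, (m : ℝ) ≤ c → c ≤ m + 1 → c ∈ cuts P k →
      {q ∈ crossings (walls P) G | (G q.1 q.2).re = c ∧ (k : ℝ) < (G q.1 q.2).im ∧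
      (G q.1 q.2).im < k + 1}.ncard ≤ (Vs.card + 2) * 2 ^ Es.card := by
    intro c hmc hcm hck
    set C : Finset ℝ := insert (k : ℝ) (insert ((k : ℝ) + 1)
      ((Vs.filter fun v => (P v).re = c).image fun v => (P v).im)) with hC
    refine (ncard_le_of_consec (hfin.subset fun q hq => hq.1) (fun q => (G q.1 q.2).im)
      (C.filter fun x => (k : ℝ) ≤ x ∧ x ≤ k + 1) (N := 2 ^ Es.card) ?_ ?_).trans
      (Nat.mul_le_mul_right _ ?_)
    · rintro q ⟨hq, h1, h2, h3⟩
      obtain h | h := mem_or_exists_consec (S := C.filter fun x => (k : ℝ) ≤ x ∧ x ≤ k + 1)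
        (x := k) (y := k + 1) (by simp [hC]) (by simp [hC]) h2.le h3.le
      · simp only [hC, Finset.mem_filter, Finset.mem_insert, Finset.mem_image] at h
        rcases h.1 with h | h | ⟨v, ⟨-, h'⟩, h⟩
        · exact absurd h h2.ne'
        · exact absurd h h3.ne
        · exact absurd (Complex.ext (h1.trans h'.symm) h.symm)
            (hG.1.ne_vertex hG₀.incident (e := q.1) hq.1 v)
      · exact h
    · intro a b hab
      have ha := (Finset.mem_filter.1 hab.1).2
      have hb := (Finset.mem_filter.1 hab.2.1).2
      refine le_trans (Set.ncard_le_ncard ?_ (hfin.subset fun q hq => hq.1))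
        (hG.ncard_vertical_segment_le hG₀ hmin Es hEs hab.2.2.1 ha.1 hb.2 hmc hcm hck ?_)
      · rintro q ⟨⟨hq, h3, -, -⟩, h4, h5⟩
        exact ⟨hq, h3, h4, h5⟩
      · rintro v rfl hv
        have hk : (k : ℝ) ≤ (P v).im ∧ (P v).im ≤ k + 1 :=
          ⟨ha.1.trans hv.1.le, hv.2.le.trans hb.2⟩
        have hvV := hVs v ⟨hmc, hcm, by linarith [hk.1], hk.2⟩
        refine hab.not_mem hv.1 hv.2 (Finset.mem_filter.2 ⟨?_, hk⟩)
        simp only [hC, Finset.mem_insert, Finset.mem_image, Finset.mem_filter]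
        exact Or.inr (Or.inr ⟨v, ⟨hvV, rfl⟩, rfl⟩)
    · refine (Finset.card_filter_le _ _).trans ((Finset.card_insert_le _ _).trans ?_)
      have := Finset.card_insert_le ((k : ℝ) + 1)
        ((Vs.filter fun v => (P v).re = c).image fun v => (P v).im)
      have := Finset.card_image_le (s := Vs.filter fun v => (P v).re = c) (f := fun v => (P v).im)
      have := Finset.card_filter_le Vs fun v => (P v).re = c
      omega
  set C : Finset ℝ := insert (m : ℝ) (Vs.image fun v => (P v).re) with hC
  set C' := C.filter fun c => (m : ℝ) ≤ c ∧ c ≤ m + 1 ∧ c ∈ cuts P k with hC'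
  have hC'card : C'.card ≤ Vs.card + 1 :=
    (Finset.card_filter_le _ _).trans ((Finset.card_insert_le _ _).trans
      (Nat.succ_le_succ Finset.card_image_le))
  have hsub : {q ∈ crossings (walls P) G | (m : ℝ) ≤ (G q.1 q.2).re ∧ (G q.1 q.2).re < m + 1 ∧
      (k : ℝ) ≤ (G q.1 q.2).im ∧ (G q.1 q.2).im < k + 1} ⊆
      {q ∈ crossings (walls P) G | (m : ℝ) ≤ (G q.1 q.2).re ∧ (G q.1 q.2).re < m + 1 ∧
      (G q.1 q.2).im = k} ∪ ⋃ c ∈ C', {q ∈ crossings (walls P) G | (G q.1 q.2).re = c ∧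
        (k : ℝ) < (G q.1 q.2).im ∧ (G q.1 q.2).im < k + 1} := by
    rintro q ⟨hq, h1, h2, h3, h4⟩
    rcases h3.eq_or_lt with h | h
    · exact Or.inl ⟨hq, h1, h2, h.symm⟩
    · right
      have hfl : ⌊(G q.1 q.2).im⌋ = k := by rw [Int.floor_eq_iff]; exact ⟨h3, h4⟩
      have hcut : (G q.1 q.2).re ∈ cuts P k := by
        rcases hq.2 with ⟨n, hn⟩ | h'
        · rw [hn] at h h4
          have h5 : k < n := by exact_mod_cast h
          have h6 : n < k + 1 := by exact_mod_cast h4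
          omega
        · rwa [hfl] at h'
      refine mem_biUnion (x := (G q.1 q.2).re) ?_ ⟨hq, rfl, h, h4⟩
      refine Finset.mem_filter.2 ⟨?_, h1, h2.le, hcut⟩
      rw [hC, Finset.mem_insert, Finset.mem_image]
      rcases hcut with ⟨n, hn⟩ | ⟨v, hv, hv'⟩
      · rw [hn] at h1 h2 ⊢
        have h5 : m ≤ n := by exact_mod_cast h1
        have h6 : n < m + 1 := by exact_mod_cast h2
        left
        have : n = m := by omega
        rw [this]
      · right
        rw [Int.floor_eq_iff] at hv
        refine ⟨v, hVs v ⟨by linarith, by linarith, by linarith, by linarith⟩, hv'.symm⟩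
  refine (Set.ncard_le_ncard hsub ((hfin.subset fun q hq => hq.1).union
    (C'.finite_toSet.biUnion fun c _ => hfin.subset fun q hq => hq.1))).trans
    ((Set.ncard_union_le _ _).trans ?_)
  have h1 := (Finset.set_ncard_biUnion_le C' fun c => {q ∈ crossings (walls P) G |
    (G q.1 q.2).re = c ∧ (k : ℝ) < (G q.1 q.2).im ∧ (G q.1 q.2).im < k + 1}).trans
    ((Finset.sum_le_card_nsmul _ _ ((Vs.card + 2) * 2 ^ Es.card) fun c hc => by
      obtain ⟨-, h1, h2, h3⟩ := Finset.mem_filter.1 hc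
      exact hVc c h1 h2 h3).trans_eq (smul_eq_mul _ _))
  calc _ ≤ (Vs.card + 2) * 2 ^ Es.card + (Vs.card + 1) * ((Vs.card + 2) * 2 ^ Es.card) :=
        add_le_add hH (h1.trans (Nat.mul_le_mul_right _ hC'card))
    _ = _ := by ring

end Counting

theorem card_Icc_floor_le (x : ℝ) {R : ℝ} (hR : 0 ≤ R) :
    ((Finset.Icc ⌊x - R⌋ ⌊x + R⌋).card : ℝ) ≤ 2 * R + 2 := by
  have h1 : ⌊x - R⌋ ≤ ⌊x + R⌋ := Int.floor_le_floor (by linarith)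
  have h2 : ((Finset.Icc ⌊x - R⌋ ⌊x + R⌋).card : ℝ) = (⌊x + R⌋ : ℝ) + 1 - ⌊x - R⌋ := by
    rw [Int.card_Icc]
    have : (((⌊x + R⌋ + 1 - ⌊x - R⌋).toNat : ℤ) : ℝ) = ((⌊x + R⌋ + 1 - ⌊x - R⌋ : ℤ) : ℝ) := by
      rw [Int.toNat_of_nonneg (by omega)]
    rw [← Int.cast_natCast, this]; push_cast; ring
  rw [h2]
  linarith [Int.floor_le (x + R), Int.lt_floor_add_one (x - R)]

section Ball

variable {E V : Type*} [Fintype E] [Finite V] {src tgt : E → V} {P : V → ℂ} {G₀ G : E → ℝ → ℂ}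
  {S : E → Finset ℝ}

theorem box_subset_closedBall (m k : ℤ) {z : ℂ} (hz : z ∈ box m k) :
    ‖z - ⟨m + 1 / 2, k⟩‖ ≤ 2 := by
  obtain ⟨h1, h2, h3, h4⟩ := hz
  refine (Complex.norm_le_abs_re_add_abs_im _).trans ?_
  have : |z.re - (m + 1 / 2)| ≤ 1 / 2 := abs_le.2 ⟨by linarith, by linarith⟩
  have : |z.im - k| ≤ 1 := abs_le.2 ⟨by linarith, by linarith⟩
  simp only [Complex.sub_re, Complex.sub_im]
  linarith

/-- The number of crossings in a disc of a drawing with the minimal number of crossings. -/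
theorem Admissible.ncard_ball_le (hG₀ : GenericDrawing src tgt P G₀ S)
    (hG : Admissible src tgt P (walls P) G₀ G)
    (hmin : ∀ G', Admissible src tgt P (walls P) G₀ G' →
      (crossings (walls P) G).ncard ≤ (crossings (walls P) G').ncard) {K N : ℕ}
    (hK : ∀ z : ℂ, {e | ∃ t ∈ Icc (0 : ℝ) 1, ‖G₀ e t - z‖ ≤ 2}.ncard ≤ K)
    (hN : ∀ z : ℂ, {v | ‖P v - z‖ ≤ 2}.ncard ≤ N) (z : ℂ) {R : ℝ} (hR : 0 ≤ R) :
    ({q ∈ crossings (walls P) G | ‖G q.1 q.2 - z‖ ≤ R}.ncard : ℝ) ≤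
      (2 * R + 2) ^ 2 * ((N + 2) ^ 2 * 2 ^ K) := by
  classical
  have hfin : (crossings (walls P) G).Finite := hG₀.finite_crossings.subset hG.subset
  set I := Finset.Icc ⌊z.re - R⌋ ⌊z.re + R⌋ ×ˢ Finset.Icc ⌊z.im - R⌋ ⌊z.im + R⌋
  have hsq : ∀ p : ℤ × ℤ, {q ∈ crossings (walls P) G | (p.1 : ℝ) ≤ (G q.1 q.2).re ∧
      (G q.1 q.2).re < p.1 + 1 ∧ (p.2 : ℝ) ≤ (G q.1 q.2).im ∧ (G q.1 q.2).im < p.2 + 1}.ncard ≤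
      (N + 2) ^ 2 * 2 ^ K := fun p => by
    have f1 : {e | ∃ t ∈ Icc (0 : ℝ) 1, ‖G₀ e t - ⟨p.1 + 1 / 2, p.2⟩‖ ≤ 2}.Finite := Set.toFinite _
    have f2 : {v | ‖P v - ⟨p.1 + 1 / 2, p.2⟩‖ ≤ 2}.Finite := Set.toFinite _
    refine (hG.ncard_square_le hG₀ hmin (m := p.1) (k := p.2) f1.toFinset
      (fun e t ht h => by simpa using ⟨t, ht, by simpa using box_subset_closedBall _ _ h⟩)
          f2.toFinset
      (fun v h => by simpa using box_subset_closedBall _ _ h)).trans ?_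
    rw [← Set.ncard_eq_toFinset_card _ f1, ← Set.ncard_eq_toFinset_card _ f2]
    exact Nat.mul_le_mul (Nat.pow_le_pow_left (Nat.add_le_add_right (hN _) 2) 2)
      (Nat.pow_le_pow_right (by norm_num) (hK _))
  have hsub : {q ∈ crossings (walls P) G | ‖G q.1 q.2 - z‖ ≤ R} ⊆ ⋃ p ∈ I,
      {q ∈ crossings (walls P) G | (p.1 : ℝ) ≤ (G q.1 q.2).re ∧ (G q.1 q.2).re < p.1 + 1 ∧
        (p.2 : ℝ) ≤ (G q.1 q.2).im ∧ (G q.1 q.2).im < p.2 + 1} := by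
    rintro q ⟨hq, h⟩
    have h1 := abs_le.1 ((Complex.abs_re_le_norm _).trans h)
    have h2 := abs_le.1 ((Complex.abs_im_le_norm _).trans h)
    simp only [Complex.sub_re, Complex.sub_im] at h1 h2
    refine mem_biUnion (x := (⌊(G q.1 q.2).re⌋, ⌊(G q.1 q.2).im⌋)) ?_ ⟨hq, Int.floor_le _,
      Int.lt_floor_add_one _, Int.floor_le _, Int.lt_floor_add_one _⟩
    simp only [I, Finset.mem_coe, Finset.mem_product, Finset.mem_Icc]
    exact ⟨⟨Int.floor_le_floor (by linarith), Int.floor_le_floor (by linarith)⟩,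
      Int.floor_le_floor (by linarith), Int.floor_le_floor (by linarith)⟩
  have := (Set.ncard_le_ncard hsub (I.finite_toSet.biUnion fun p _ =>
    hfin.subset fun q hq => hq.1)).trans ((Finset.set_ncard_biUnion_le _ _).trans
      (Finset.sum_le_card_nsmul _ _ _ fun p _ => hsq p))
  rw [smul_eq_mul] at this
  have h' : ((I.card : ℕ) : ℝ) ≤ (2 * R + 2) ^ 2 := by
    rw [Finset.card_product, sq]
    push_cast
    exact mul_le_mul (card_Icc_floor_le _ hR) (card_Icc_floor_le _ hR) (by positivity)
      (by positivity)
  calc (_ : ℝ) ≤ ((I.card * ((N + 2) ^ 2 * 2 ^ K) : ℕ) : ℝ) := by exact_mod_cast this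
    _ = I.card * ((N + 2) ^ 2 * 2 ^ K) := by push_cast; ring
    _ ≤ _ := mul_le_mul_of_nonneg_right h' (by positivity)

end Ball

/-- The direction of a nonzero complex number. -/
def dir (p : ℂ) : ℂ := (‖p‖⁻¹ : ℝ) • p

theorem norm_dir {p : ℂ} (hp : 1 ≤ ‖p‖) : ‖dir p‖ = 1 := by
  rw [dir, norm_smul, Real.norm_eq_abs, abs_of_nonneg (by positivity)]
  exact inv_mul_cancel₀ (by positivity)

theorem norm_smul_dir {p : ℂ} (hp : 1 ≤ ‖p‖) : ‖p‖ • dir p = p := by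
  rw [dir, smul_smul, mul_inv_cancel₀ (by positivity), one_smul]

/-- Two chords of the unit circle with a common endpoint have no other point in common. -/
theorem chord_unique {r x x' z : ℂ} (hr : ‖r‖ = 1) (hx : ‖x‖ = 1) (hx' : ‖x'‖ = 1) (hz : z ≠ r)
    {c c' : ℝ} (h : z = r + c • (x - r)) (h' : z = r + c' • (x' - r)) : x = x' := by
  have hc : c ≠ 0 := by rintro rfl; exact hz (by simpa using h)
  have hc' : c' ≠ 0 := by rintro rfl; exact hz (by simpa using h')
  have key : ∀ {y : ℂ} {k : ℝ}, k ≠ 0 → ‖y‖ = 1 → z = r + k • (y - r) →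
      y = r + (-2 * inner ℝ r (z - r) / ‖z - r‖ ^ 2) • (z - r) := by
    intro y k hk hy h
    have hy' : y = r + k⁻¹ • (z - r) := by
      rw [h, add_sub_cancel_left, smul_smul, inv_mul_cancel₀ hk, one_smul]; ring
    have h1 : ‖y‖ ^ 2 = ‖r‖ ^ 2 + 2 * (k⁻¹ * inner ℝ r (z - r)) + (k⁻¹ * ‖z - r‖) ^ 2 := by
      conv_lhs => rw [hy']
      rw [norm_add_sq_real, inner_smul_right, norm_smul, Real.norm_eq_abs, mul_pow, sq_abs, mul_pow]
    rw [hy, hr] at h1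
    have h2 : ‖z - r‖ ≠ 0 := norm_ne_zero_iff.2 (sub_ne_zero.2 hz)
    have h3 : k⁻¹ = -2 * inner ℝ r (z - r) / ‖z - r‖ ^ 2 := by
      rw [eq_div_iff (pow_ne_zero 2 h2)]
      have hk' := inv_ne_zero hk
      have : k⁻¹ * (2 * inner ℝ r (z - r) + k⁻¹ * ‖z - r‖ ^ 2) = 0 := by linear_combination -h1
      have := (mul_eq_zero.1 this).resolve_left hk'
      linear_combination this
    rw [← h3]
    exact hy'
  rw [key hc hx h, ← key hc' hx' h']

section Radial

variable {D : Set ℂ}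

theorem mem_interior_of_norm_lt_one (hB : closedBall (0 : ℂ) 1 ⊆ D)
    {z : ℂ} (hz : ‖z‖ < 1) : z ∈ interior D :=
  interior_mono hB (interior_maximal ball_subset_closedBall isOpen_ball (by simpa using hz))

theorem one_le_norm_of_mem_frontier (hB : closedBall (0 : ℂ) 1 ⊆ D)
    {p : ℂ} (hp : p ∈ frontier D) : 1 ≤ ‖p‖ := by
  by_contra h
  exact hp.2 (mem_interior_of_norm_lt_one hB (not_le.1 h))

theorem smul_dir_mem_interior (hD : Convex ℝ D) (hB : closedBall (0 : ℂ) 1 ⊆ D)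
    {p : ℂ} (hp : p ∈ frontier D) {ρ : ℝ} (h0 : 0 ≤ ρ) (h1 : ρ < ‖p‖) :
    ρ • dir p ∈ interior D := by
  have hn : 0 < ‖p‖ := h0.trans_lt h1
  have := hD.combo_interior_closure_mem_interior
    (mem_interior_of_norm_lt_one hB (z := 0) (by simp)) hp.1 (a := 1 - ρ / ‖p‖) (b := ρ / ‖p‖)
    (by rw [sub_pos, div_lt_one hn]; exact h1) (by positivity) (by ring)
  rwa [smul_zero, zero_add, div_eq_mul_inv, ← smul_smul] at this

theorem eq_of_smul_dir_eq (hD : Convex ℝ D) (hB : closedBall (0 : ℂ) 1 ⊆ D)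
    {p q : ℂ} (hp : p ∈ frontier D) (hq : q ∈ frontier D) {ρ ρ' : ℝ}
    (h0 : 0 < ρ) (h0' : 0 < ρ') (h : ρ • dir p = ρ' • dir q) : p = q := by
  have hp1 := one_le_norm_of_mem_frontier hB hp
  have hq1 := one_le_norm_of_mem_frontier hB hq
  have hρ : ρ = ρ' := by
    have := congrArg norm h
    rwa [norm_smul, norm_smul, norm_dir hp1, norm_dir hq1, mul_one, mul_one, Real.norm_eq_abs,
      Real.norm_eq_abs, abs_of_pos h0, abs_of_pos h0'] at this
  subst hρ
  have hd : dir p = dir q := smul_right_injective ℂ h0.ne' h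
  have key : ∀ {p q : ℂ}, p ∈ frontier D → q ∈ frontier D → dir p = dir q → ‖q‖ ≤ ‖p‖ := by
    intro p q hp hq hd
    by_contra hlt
    refine hp.2 ?_
    rw [← norm_smul_dir (one_le_norm_of_mem_frontier hB hp), hd]
    exact smul_dir_mem_interior hD hB hq (norm_nonneg _) (not_le.1 hlt)
  rw [← norm_smul_dir hp1, ← norm_smul_dir hq1, hd,
    le_antisymm (key hq hp hd.symm) (key hp hq hd)]

/-- The path from `p` radially to the unit circle, along a chord, and radially to `q`. -/
def radialChord (p q : ℂ) (s : ℝ) : ℂ :=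
  max 0 (‖p‖ - s) • dir p + max 0 (s - ‖p‖ + 1) • dir q

theorem radialChord_zero {p q : ℂ} (hp : 1 ≤ ‖p‖) : radialChord p q 0 = p := by
  rw [radialChord, max_eq_right (by linarith), max_eq_left (by linarith), sub_zero,
    norm_smul_dir hp, zero_smul, add_zero]

theorem radialChord_end {p q : ℂ} (hq : 1 ≤ ‖q‖) :
    radialChord p q (‖p‖ + ‖q‖ - 1) = q := by
  rw [radialChord, max_eq_left (by linarith), max_eq_right (by linarith),
    show ‖p‖ + ‖q‖ - 1 - ‖p‖ + 1 = ‖q‖ by ring, norm_smul_dir hq, zero_smul, zero_add]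

theorem continuous_radialChord (p q : ℂ) : Continuous (radialChord p q) := by
  unfold radialChord; fun_prop

theorem radialChord_cases {p q : ℂ} {s : ℝ} (h0 : 0 < s)
    (h1 : s < ‖p‖ + ‖q‖ - 1) :
    (∃ ρ, 1 ≤ ρ ∧ ρ < ‖p‖ ∧ s = ‖p‖ - ρ ∧ radialChord p q s = ρ • dir p) ∨
    (∃ ρ, 1 ≤ ρ ∧ ρ < ‖q‖ ∧ s = ‖p‖ - 1 + ρ ∧ radialChord p q s = ρ • dir q) ∨
    ∃ c, 0 < c ∧ c < 1 ∧ s = ‖p‖ - 1 + c ∧ radialChord p q s = (1 - c) • dir p + c • dir q := by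
  unfold radialChord
  rcases le_or_gt s (‖p‖ - 1) with h | h
  · refine Or.inl ⟨‖p‖ - s, by linarith, by linarith, by ring, ?_⟩
    rw [max_eq_right (by linarith), max_eq_left (by linarith), zero_smul, add_zero]
  rcases le_or_gt ‖p‖ s with h' | h'
  · refine Or.inr (Or.inl ⟨s - ‖p‖ + 1, by linarith, by linarith, by ring, ?_⟩)
    rw [max_eq_left (by linarith), max_eq_right (by linarith), zero_smul, zero_add]
  · refine Or.inr (Or.inr ⟨s - ‖p‖ + 1, by linarith, by linarith, by ring, ?_⟩)
    rw [max_eq_right (by linarith), max_eq_right (by linarith)]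
    congr 2; ring

theorem norm_chord_lt_one {p q : ℂ} (hp : ‖p‖ = 1) (hq : ‖q‖ = 1) (hpq : p ≠ q) {c : ℝ}
    (h0 : 0 < c) (h1 : c < 1) : ‖(1 - c) • p + c • q‖ < 1 :=
  norm_combo_lt_of_ne hp.le hq.le hpq (by linarith) h0 (by ring)

theorem dir_ne (hD : Convex ℝ D) (hB : closedBall (0 : ℂ) 1 ⊆ D)
    {p q : ℂ} (hp : p ∈ frontier D) (hq : q ∈ frontier D) (h : p ≠ q) :
    dir p ≠ dir q := fun h' =>
  h (eq_of_smul_dir_eq hD hB hp hq one_pos one_pos (by rw [h']))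

theorem radialChord_mem_interior (hD : Convex ℝ D) (hB : closedBall (0 : ℂ) 1 ⊆ D)
    {p q : ℂ} (hp : p ∈ frontier D) (hq : q ∈ frontier D)
    (hpq : p ≠ q) {s : ℝ} (h0 : 0 < s) (h1 : s < ‖p‖ + ‖q‖ - 1) :
    radialChord p q s ∈ interior D := by
  rcases radialChord_cases h0 h1 with ⟨ρ, h2, h3, -, h⟩ | ⟨ρ, h2, h3, -, h⟩ | ⟨c, h2, h3, -, h⟩
  · rw [h]; exact smul_dir_mem_interior hD hB hp (by linarith) h3
  · rw [h]; exact smul_dir_mem_interior hD hB hq (by linarith) h3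
  · rw [h]
    exact mem_interior_of_norm_lt_one hB (norm_chord_lt_one
      (norm_dir (one_le_norm_of_mem_frontier hB hp))
      (norm_dir (one_le_norm_of_mem_frontier hB hq)) (dir_ne hD hB hp hq hpq) h2 h3)

theorem radialChord_injOn (hD : Convex ℝ D) (hB : closedBall (0 : ℂ) 1 ⊆ D)
    {p q : ℂ} (hp : p ∈ frontier D) (hq : q ∈ frontier D)
    (hpq : p ≠ q) {s s' : ℝ} (h0 : 0 < s) (h1 : s < ‖p‖ + ‖q‖ - 1) (h0' : 0 < s')
    (h1' : s' < ‖p‖ + ‖q‖ - 1) (h : radialChord p q s = radialChord p q s') : s = s' := by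
  have hp1 := one_le_norm_of_mem_frontier hB hp
  have hq1 := one_le_norm_of_mem_frontier hB hq
  have n1 := norm_dir hp1
  have n2 := norm_dir hq1
  have hn : ∀ {ρ : ℝ} {z : ℂ}, 1 ≤ ρ → ‖dir z‖ = 1 → ‖ρ • dir z‖ = ρ := fun h hz => by
    rw [norm_smul, hz, mul_one, Real.norm_eq_abs, abs_of_nonneg (by linarith)]
  have hlt := fun {c : ℝ} => norm_chord_lt_one (c := c) n1 n2 (dir_ne hD hB hp hq hpq)
  rcases radialChord_cases h0 h1 with ⟨ρ, h2, h3, hs, e⟩ | ⟨ρ, h2, h3, hs, e⟩ | ⟨c, h2, h3, hs, e⟩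
      <;>
  rcases radialChord_cases h0' h1' with ⟨ρ', h2', h3', hs', e'⟩ | ⟨ρ', h2', h3', hs', e'⟩ |
    ⟨c', h2', h3', hs', e'⟩ <;>
  rw [e, e'] at h
  · have := congrArg norm h
    rw [hn h2 n1, hn h2' n1] at this
    rw [hs, hs', this]
  · exact absurd (eq_of_smul_dir_eq hD hB hp hq (by linarith) (by linarith) h) hpq
  · have := congrArg norm h
    rw [hn h2 n1] at this
    linarith [hlt h2' h3']
  · exact absurd (eq_of_smul_dir_eq hD hB hp hq (by linarith) (by linarith) h.symm) hpq
  · have := congrArg norm h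
    rw [hn h2 n2, hn h2' n2] at this
    rw [hs, hs', this]
  · have := congrArg norm h
    rw [hn h2 n2] at this
    linarith [hlt h2' h3']
  · have := congrArg norm h
    rw [hn h2' n1] at this
    linarith [hlt h2 h3]
  · have := congrArg norm h
    rw [hn h2' n2] at this
    linarith [hlt h2 h3]
  · have : (c - c') • (dir q - dir p) = 0 := by
      rw [← sub_eq_zero] at h; rw [← h]; module
    rcases smul_eq_zero.1 this with h4 | h4
    · rw [hs, hs']; linarith
    · exact absurd (sub_eq_zero.1 h4).symm (dir_ne hD hB hp hq hpq)

/-- The paths attached to two disjoint arcs do not meet, even if the arcs have an endpoint on the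
unit circle in common. -/
theorem radialChord_disjoint (hD : Convex ℝ D) (hB : closedBall (0 : ℂ) 1 ⊆ D)
    (hDb : IsCompact D) {u v : ℝ → ℂ} {a b a' b' : ℝ} (hab : a ≤ b)
    (hab' : a' ≤ b') (hu : ContinuousOn u (Icc a b)) (hv : ContinuousOn v (Icc a' b'))
    (hu1 : ∀ t ∈ Icc a b, u t ∈ D) (hv1 : ∀ t ∈ Icc a' b', v t ∈ D)
    (hua : u a ∈ frontier D) (hub : u b ∈ frontier D) (hva : v a' ∈ frontier D)
    (hvb : v b' ∈ frontier D) (hne : u a ≠ u b) (hne' : v a' ≠ v b')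
    (hmeet : ∀ s ∈ Icc a b, ∀ t ∈ Icc a' b', u s = v t → (s = a ∨ s = b) ∧ (t = a' ∨ t = b') ∧
      ‖u s‖ = 1)
    (hno : ¬ (u a = v a' ∧ u b = v b')) (hno' : ¬ (u a = v b' ∧ u b = v a')) {s s' : ℝ}
    (h0 : 0 < s) (h1 : s < ‖u a‖ + ‖u b‖ - 1) (h0' : 0 < s') (h1' : s' < ‖v a'‖ + ‖v b'‖ - 1) :
    radialChord (u a) (u b) s ≠ radialChord (v a') (v b') s' := by
  intro h
  have la := left_mem_Icc.2 hab
  have lb := right_mem_Icc.2 hab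
  have la' := left_mem_Icc.2 hab'
  have lb' := right_mem_Icc.2 hab'
  have nua := norm_dir (one_le_norm_of_mem_frontier hB hua)
  have nub := norm_dir (one_le_norm_of_mem_frontier hB hub)
  have nva := norm_dir (one_le_norm_of_mem_frontier hB hva)
  have nvb := norm_dir (one_le_norm_of_mem_frontier hB hvb)
  have dne := dir_ne hD hB hua hub hne
  have dne' := dir_ne hD hB hva hvb hne'
  have hn : ∀ {ρ : ℝ} {z : ℂ}, 1 ≤ ρ → ‖dir z‖ = 1 → ‖ρ • dir z‖ = ρ := fun h hz => by
    rw [norm_smul, hz, mul_one, Real.norm_eq_abs, abs_of_nonneg (by linarith)]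
  have ray : ∀ x ∈ Icc a b, ∀ y ∈ Icc a' b', u x ∈ frontier D → v y ∈ frontier D → ∀ ρ ρ' : ℝ,
      1 ≤ ρ → ρ < ‖u x‖ → 1 ≤ ρ' → ρ • dir (u x) = ρ' • dir (v y) → False := by
    intro x hx y hy hux hvy ρ ρ' g1 g2 g1' g
    have := (hmeet x hx y hy (eq_of_smul_dir_eq hD hB hux hvy (by linarith) (by linarith) g)).2.2
    linarith
  rcases radialChord_cases h0 h1 with ⟨ρ, h2, h3, hs, e⟩ | ⟨ρ, h2, h3, hs, e⟩ | ⟨c, h2, h3, hs, e⟩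
      <;>
  rcases radialChord_cases h0' h1' with ⟨ρ', h2', h3', hs', e'⟩ | ⟨ρ', h2', h3', hs', e'⟩ |
    ⟨c', h2', h3', hs', e'⟩ <;>
  rw [e, e'] at h
  · exact ray a la a' la' hua hva _ _ h2 h3 h2' h
  · exact ray a la b' lb' hua hvb _ _ h2 h3 h2' h
  · have := congrArg norm h
    rw [hn h2 nua] at this
    linarith [norm_chord_lt_one nva nvb dne' h2' h3']
  · exact ray b lb a' la' hub hva _ _ h2 h3 h2' h
  · exact ray b lb b' lb' hub hvb _ _ h2 h3 h2' h
  · have := congrArg norm h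
    rw [hn h2 nub] at this
    linarith [norm_chord_lt_one nva nvb dne' h2' h3']
  · have := congrArg norm h
    rw [hn h2' nva] at this
    linarith [norm_chord_lt_one nua nub dne h2 h3]
  · have := congrArg norm h
    rw [hn h2' nvb] at this
    linarith [norm_chord_lt_one nua nub dne h2 h3]
  · have hlt := norm_chord_lt_one nua nub dne h2 h3
    set z := (1 - c) • dir (u a) + c • dir (u b) with hz
    have z1 : z = dir (u a) + c • (dir (u b) - dir (u a)) := by rw [hz]; module
    have z2 : z = dir (u b) + (1 - c) • (dir (u a) - dir (u b)) := by rw [hz]; module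
    have z3 : z = dir (v a') + c' • (dir (v b') - dir (v a')) := by rw [h]; module
    have z4 : z = dir (v b') + (1 - c') • (dir (v a') - dir (v b')) := by rw [h]; module
    have hzne : ∀ {r : ℂ}, ‖r‖ = 1 → z ≠ r := fun hr h => by
      rw [h, hr] at hlt
      exact lt_irrefl _ hlt
    have same : ∀ {p q}, p ∈ frontier D → q ∈ frontier D → dir p = dir q → p = q := fun hp hq h =>
      by_contra fun hne => dir_ne hD hB hp hq hne h
    obtain ⟨x, hx, y, hy, hxy⟩ := radial_chord_arcs_meet hDb hD
      (mem_interior_of_norm_lt_one hB (by simp)) hab hab' hu hv hu1 hv1 hua hub hva hvb hlt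
      ⟨1 - c, c, by linarith, h2, by ring, rfl⟩ ⟨1 - c', c', by linarith, h2', by ring, h.symm⟩
    obtain ⟨rfl | rfl, rfl | rfl, -⟩ := hmeet x hx y hy hxy
    · exact hno ⟨hxy, same hub hvb (chord_unique nua nub nvb (hzne nua) z1 (by rw [hxy]; exact z3))⟩
    · exact hno' ⟨hxy,
          same hub hva (chord_unique nua nub nva (hzne nua) z1 (by rw [hxy]; exact z4))⟩
    · exact hno' ⟨same hua hvb (chord_unique nub nua nvb (hzne nub) z2 (by rw [hxy]; exact z3)),
          hxy⟩
    · exact hno ⟨same hua hva (chord_unique nub nua nva (hzne nub) z2 (by rw [hxy]; exact z4)), hxy⟩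

end Radial

open Classical in
theorem exists_refinement (X : Finset ℝ) (t₁ t₂ : ℝ → ℝ → ℝ)
    (h : ∀ a b, Consec X a b → a ≤ t₁ a b ∧ t₁ a b ≤ t₂ a b ∧ t₂ a b ≤ b) :
    ∃ S : Finset ℝ, X ⊆ S ∧ (∀ s ∈ S, ∃ x ∈ X, ∃ y ∈ X, x ≤ s ∧ s ≤ y) ∧
      ∀ a b, Consec X a b → t₁ a b ∈ S ∧ t₂ a b ∈ S ∧
        (S.filter fun s => a < s ∧ s < b).card ≤ 2 := by
  set S : Finset ℝ := X ∪ X.biUnion fun a => X.biUnion fun b =>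
    if Consec X a b then {t₁ a b, t₂ a b} else ∅ with hS
  have hmem : ∀ s, s ∈ S ↔ s ∈ X ∨ ∃ a b, Consec X a b ∧ (s = t₁ a b ∨ s = t₂ a b) := by
    intro s
    simp only [hS, Finset.mem_union, Finset.mem_biUnion]
    refine or_congr_right ⟨?_, ?_⟩
    · rintro ⟨a, -, b, -, hs⟩
      split_ifs at hs with hc
      · exact ⟨a, b, hc, by simpa using hs⟩
      · simp at hs
    · rintro ⟨a, b, hc, hs⟩
      exact ⟨a, hc.1, b, hc.2.1, by rw [if_pos hc]; simpa using hs⟩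
  refine ⟨S, Finset.subset_union_left, fun s hs => ?_, fun a b hab =>
    ⟨(hmem _).2 (Or.inr ⟨a, b, hab, Or.inl rfl⟩), (hmem _).2 (Or.inr ⟨a, b, hab, Or.inr rfl⟩), ?_⟩⟩
  · rcases (hmem s).1 hs with hs | ⟨a, b, hc, rfl | rfl⟩
    · exact ⟨s, hs, s, hs, le_rfl, le_rfl⟩
    · obtain ⟨h1, h2, h3⟩ := h a b hc
      exact ⟨a, hc.1, b, hc.2.1, h1, h2.trans h3⟩
    · obtain ⟨h1, h2, h3⟩ := h a b hc
      exact ⟨a, hc.1, b, hc.2.1, h1.trans h2, h3⟩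
  · refine (Finset.card_le_card (t := {t₁ a b, t₂ a b}) fun s hs => ?_).trans Finset.card_le_two
    simp only [Finset.mem_filter] at hs
    rcases (hmem s).1 hs.1 with hs' | ⟨a', b', hc, hs'⟩
    · exact absurd hs' (hab.not_mem hs.2.1 hs.2.2)
    · obtain ⟨h1, h2, h3⟩ := h a' b' hc
      have hle : a' ≤ s ∧ s ≤ b' := by
        rcases hs' with rfl | rfl
        · exact ⟨h1, h2.trans h3⟩
        · exact ⟨h1.trans h2, h3⟩
      have ha : a' = a := by
        have h1 := hab.2.2.2 a' hc.1
        have h2 := hc.2.2.2 a hab.1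
        have h3 := hc.2.2.2 b hab.2.1
        rcases h1 with h1 | h1 <;> rcases h2 with h2 | h2 <;> rcases h3 with h3 | h3 <;> linarith
      have hb : b' = b := by
        have h1 := hab.2.2.2 b' hc.2.1
        have h2 := hc.2.2.2 b hab.2.1
        have h3 := hc.2.2.1
        rcases h1 with h1 | h1 <;> rcases h2 with h2 | h2 <;> linarith
      subst ha; subst hb
      simpa using hs'

/-- A combination of truncated affine functions is affine away from the kinks. -/
theorem radialChord_affine {p q : ℂ} {α β a b : ℝ} (h1 : (∀ t ∈ Icc a b, α + t * β ≤ ‖p‖ - 1) ∨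
      ∀ t ∈ Icc a b, ‖p‖ - 1 ≤ α + t * β)
    (h2 : (∀ t ∈ Icc a b, α + t * β ≤ ‖p‖) ∨ ∀ t ∈ Icc a b, ‖p‖ ≤ α + t * β) :
    ∃ x d : ℂ, ∀ t ∈ Icc a b, radialChord p q (α + t * β) = x + t • d := by
  unfold radialChord
  obtain ⟨x1, d1, e1⟩ : ∃ x d : ℝ, ∀ t ∈ Icc a b, max 0 (‖p‖ - (α + t * β)) = x + t * d := by
    rcases h2 with h | h
    · exact ⟨‖p‖ - α, -β, fun t ht => by rw [max_eq_right (by linarith [h t ht])]; ring⟩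
    · exact ⟨0, 0, fun t ht => by rw [max_eq_left (by linarith [h t ht])]; ring⟩
  obtain ⟨x2, d2, e2⟩ : ∃ x d : ℝ, ∀ t ∈ Icc a b, max 0 (α + t * β - ‖p‖ + 1) = x + t * d := by
    rcases h1 with h | h
    · exact ⟨0, 0, fun t ht => by rw [max_eq_left (by linarith [h t ht])]; ring⟩
    · exact ⟨α - ‖p‖ + 1, β, fun t ht => by rw [max_eq_right (by linarith [h t ht])]; ring⟩
  refine ⟨x1 • dir p + x2 • dir q, d1 • dir p + d2 • dir q, fun t ht => ?_⟩
  rw [e1 t ht, e2 t ht]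
  module

section Straighten

variable {E V C : Type*} {src tgt : E → V} {P : V → ℂ} {G : E → ℝ → ℂ}

/-- Replacing all arcs of a drawing between consecutive marked times by short paths inside the
cells containing them. -/
theorem Drawing.straighten (hG : Drawing src tgt P G) {X : E → Finset ℝ}
    (hX : ∀ e, 0 ∈ X e ∧ 1 ∈ X e ∧ ∀ s ∈ X e, s ∈ Icc (0 : ℝ) 1)
    (o : C → ℂ) (L : C → ℂ ≃L[ℝ] ℂ) (D : C → Set ℂ) (hDc : ∀ c, IsCompact (D c))
    (hD : ∀ c, Convex ℝ (D c)) (hB : ∀ c, closedBall (0 : ℂ) 1 ⊆ D c) (cell : E → ℝ → C)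
    (hmem : ∀ e a b, Consec (X e) a b → ∀ t ∈ Icc a b,
      (L (cell e a)).symm (G e t - o (cell e a)) ∈ D (cell e a))
    (hfr : ∀ e a b, Consec (X e) a b →
      (L (cell e a)).symm (G e a - o (cell e a)) ∈ frontier (D (cell e a)) ∧
      (L (cell e a)).symm (G e b - o (cell e a)) ∈ frontier (D (cell e a)))
    (hdisj : ∀ e a b e' a' b', Consec (X e) a b → Consec (X e') a' b' → ∀ z,
      (L (cell e a)).symm (z - o (cell e a)) ∈ interior (D (cell e a)) →
      (L (cell e' a')).symm (z - o (cell e' a')) ∈ interior (D (cell e' a')) → cell e a =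
          cell e' a')
    (hav : ∀ e a b, Consec (X e) a b → ∀ e', ∀ t ∈ X e',
      (L (cell e a)).symm (G e' t - o (cell e a)) ∉ interior (D (cell e a)))
    (hne : ∀ e a b, Consec (X e) a b → G e a ≠ G e b)
    (hshare : ∀ e a b e' a' b', Consec (X e) a b → Consec (X e') a' b' → cell e a = cell e' a' →
      (e = e' → a ≠ a') → ∀ x x', (x = a ∨ x = b) → (x' = a' ∨ x' = b') → G e x = G e' x' →
      ‖(L (cell e a)).symm (G e x - o (cell e a))‖ = 1)
    (hno : ∀ e a b e' a' b', Consec (X e) a b → Consec (X e') a' b' → cell e a = cell e' a' →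
      (e = e' → a ≠ a') → ¬ (G e a = G e' a' ∧ G e b = G e' b') ∧
        ¬ (G e a = G e' b' ∧ G e b = G e' a')) :
    ∃ (F : E → ℝ → ℂ) (S : E → Finset ℝ), Drawing src tgt P F ∧ ∀ e, X e ⊆ S e ∧
      (∀ s ∈ S e, s ∈ Icc (0 : ℝ) 1) ∧ PLOn (F e) (S e) ∧ (∀ t ∈ X e, F e t = G e t) ∧
      ∀ a b, Consec (X e) a b → ((S e).filter fun s => a < s ∧ s < b).card ≤ 2 ∧
        ∀ t ∈ Icc a b, (L (cell e a)).symm (F e t - o (cell e a)) ∈ D (cell e a) := by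
  classical
  set u : E → ℝ → ℝ → ℂ := fun e a t => (L (cell e a)).symm (G e t - o (cell e a)) with hu
  have hLu : ∀ e a t, o (cell e a) + L (cell e a) (u e a t) = G e t := fun e a t => by simp [hu]
  have hu1 : ∀ {e a b}, Consec (X e) a b → 1 ≤ ‖u e a a‖ ∧ 1 ≤ ‖u e a b‖ := fun hab =>
    ⟨one_le_norm_of_mem_frontier (hB _) (hfr _ _ _ hab).1,
      one_le_norm_of_mem_frontier (hB _) (hfr _ _ _ hab).2⟩
  have hune : ∀ {e a b}, Consec (X e) a b → u e a a ≠ u e a b := fun {e a b} hab h =>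
    hne e a b hab (by rw [← hLu e a a, h, hLu])
  have hucont : ∀ e a, Continuous (u e a) := fun e a =>
    (L (cell e a)).symm.continuous.comp ((hG.cont e).sub continuous_const)
  -- the total length and the time change
  set T : E → ℝ → ℝ → ℝ := fun e a b => ‖u e a a‖ + ‖u e a b‖ - 1 with hT
  have hT1 : ∀ {e a b}, Consec (X e) a b → 1 ≤ T e a b := fun hab => by
    have := hu1 hab; simp only [hT]; linarith
  set Γ : E → ℝ → ℝ → ℝ → ℂ := fun e a b t => o (cell e a) + L (cell e a)
    (radialChord (u e a a) (u e a b) (-a * (T e a b / (b - a)) + t * (T e a b / (b - a)))) with hΓ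
  have hs0 : ∀ e a b, -a * (T e a b / (b - a)) + a * (T e a b / (b - a)) = 0 := fun e a b => by ring
  have hs1 : ∀ {e a b}, a < b → -a * (T e a b / (b - a)) + b * (T e a b / (b - a)) = T e a b :=
    fun {e a b} h => by have := (sub_pos.2 h).ne'; field_simp; ring
  have hΓa : ∀ e a b, Consec (X e) a b → Γ e a b a = G e a := fun e a b hab => by
    simp only [hΓ]; rw [hs0, radialChord_zero (hu1 hab).1, hLu]
  have hΓb : ∀ e a b, Consec (X e) a b → Γ e a b b = G e b := fun e a b hab => by
    simp only [hΓ]; rw [hs1 hab.2.2.1, radialChord_end (hu1 hab).2, hLu]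
  choose F hF hFX hFΓ using fun e => exists_glue_continuousOn (X e) (G e) (Γ e)
    (fun a b _ => (continuous_const.add ((L (cell e a)).continuous.comp
      ((continuous_radialChord _ _).comp (by fun_prop)))).continuousOn) (hΓa e) (hΓb e)
  choose S hXS hSle hS using fun e => exists_refinement (X e)
    (fun a b => a + (b - a) * ((‖u e a a‖ - 1) / T e a b))
    (fun a b => a + (b - a) * (‖u e a a‖ / T e a b)) (fun a b hab => by
      have h1 := hu1 hab
      have h2 := hT1 hab
      have h3 := sub_pos.2 hab.2.2.1
      refine ⟨?_, ?_, ?_⟩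
      · have : 0 ≤ (‖u e a a‖ - 1) / T e a b := div_nonneg (by linarith) (by linarith)
        nlinarith
      · have : (‖u e a a‖ - 1) / T e a b ≤ ‖u e a a‖ / T e a b := by gcongr; linarith
        nlinarith
      · have : ‖u e a a‖ / T e a b ≤ 1 := by
          rw [div_le_one (by linarith)]; simp only [hT]; linarith
        nlinarith)
  -- position of the new arcs
  have hpos : ∀ {e a b t}, Consec (X e) a b → t ∈ Ioo a b →
      0 < -a * (T e a b / (b - a)) + t * (T e a b / (b - a)) ∧
      -a * (T e a b / (b - a)) + t * (T e a b / (b - a)) < T e a b := fun {e a b t} hab ht => by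
    have h1 : 0 < T e a b / (b - a) := div_pos (by linarith [hT1 hab]) (sub_pos.2 hab.2.2.1)
    have h2 := hs1 (e := e) hab.2.2.1
    constructor <;> nlinarith [ht.1, ht.2]
  have hinter : ∀ {e a b t}, Consec (X e) a b → t ∈ Ioo a b →
      (L (cell e a)).symm (F e t - o (cell e a)) ∈ interior (D (cell e a)) :=
    fun {e a b t} hab ht => by
      rw [hFΓ e a b hab t (Ioo_subset_Icc_self ht)]
      simp only [hΓ, add_sub_cancel_left, ContinuousLinearEquiv.symm_apply_apply]
      exact radialChord_mem_interior (hD _) (hB _) (hfr _ _ _ hab).1 (hfr _ _ _ hab).2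
        (hune hab) (hpos hab ht).1 (hpos hab ht).2
  have hloc : ∀ e, ∀ t ∈ Icc (0 : ℝ) 1, t ∈ X e ∨ ∃ a b, Consec (X e) a b ∧ t ∈ Ioo a b :=
    fun e t ht => by
      rcases mem_or_exists_consec (hX e).1 (hX e).2.1 ht.1 ht.2 with h | ⟨a, b, h, h1, h2⟩
      · exact Or.inl h
      · exact Or.inr ⟨a, b, h, h1, h2⟩
  have hI : ∀ {e a b}, Consec (X e) a b → 0 ≤ a ∧ b ≤ 1 := fun {e a b} hab =>
    ⟨((hX e).2.2 a hab.1).1, ((hX e).2.2 b hab.2.1).2⟩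
  refine ⟨F, S, ⟨hF, fun e => ?_, fun e => ?_, ?_⟩, fun e => ⟨hXS e, ?_, ?_, hFX e, fun a b hab =>
    ⟨(hS e a b hab).2.2, fun t ht => ?_⟩⟩⟩
  · rw [hFX e 0 (hX e).1, hG.zero]
  · rw [hFX e 1 (hX e).2.1, hG.one]
  · intro e e' s s' hs hs' heq
    rcases hloc e s (Ioo_subset_Icc_self hs) with h | ⟨a, b, hab, h⟩ <;>
    rcases hloc e' s' hs' with h' | ⟨a', b', hab', h'⟩
    · rw [hFX e s h, hFX e' s' h'] at heq
      exact hG.emb e e' s s' hs hs' heq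
    · refine absurd (hinter hab' h') ?_
      rw [← heq, hFX e s h]
      exact hav _ _ _ hab' _ _ h
    · refine absurd (hinter hab h) ?_
      rw [heq, hFX e' s' h']
      exact hav _ _ _ hab _ _ h'
    · have hi := hinter hab h
      have hi' := hinter hab' h'
      rw [← heq] at hi'
      have hc := hdisj _ _ _ _ _ _ hab hab' _ hi hi'
      by_cases hsame : e = e' ∧ a = a'
      · obtain ⟨rfl, rfl⟩ := hsame
        have hb : b = b' := by
          have h1 := hab.2.2.2 b' hab'.2.1
          have h2 := hab'.2.2.2 b hab.2.1
          rcases h1 with h1 | h1 <;> rcases h2 with h2 | h2 <;>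
            linarith [hab.2.2.1, hab'.2.2.1]
        subst hb
        refine ⟨rfl, ?_⟩
        rw [hFΓ e a b hab s (Ioo_subset_Icc_self h),
            hFΓ e a b hab s' (Ioo_subset_Icc_self h')] at heq
        have := radialChord_injOn (hD _) (hB _) (hfr _ _ _ hab).1 (hfr _ _ _ hab).2
          (hune hab) (hpos hab h).1 (hpos hab h).2 (hpos hab h').1 (hpos hab h').2
          ((L (cell e a)).injective (add_left_cancel heq))
        have h1 : 0 < T e a b / (b - a) := div_pos (by linarith [hT1 hab]) (sub_pos.2 hab.2.2.1)
        exact mul_right_cancel₀ h1.ne' (add_left_cancel this)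
      · exfalso
        have hsame' : e = e' → a ≠ a' := fun h1 h2 => hsame ⟨h1, h2⟩
        rw [hFΓ e a b hab s (Ioo_subset_Icc_self h),
          hFΓ e' a' b' hab' s' (Ioo_subset_Icc_self h')] at heq
        simp only [hΓ] at heq
        have huu : ∀ t, u e' a' t = (L (cell e a)).symm (G e' t - o (cell e a)) := fun t => by
          simp only [hu, hc]
        rw [← hc] at heq
        have hGne : ∀ x ∈ Icc a b, ∀ y ∈ Icc a' b', G e x = G e' y →
            (x = a ∨ x = b) ∧ (y = a' ∨ y = b') := by
          intro x hx y hy hxy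
          have key : ∀ {e a b e' a' b' x y}, Consec (X e) a b → Consec (X e') a' b' →
              (e = e' → a ≠ a') → x ∈ Icc a b → y ∈ Icc a' b' → G e x = G e' y →
              x = a ∨ x = b := by
            intro e a b e' a' b' x y hab hab' hs hx hy hxy
            by_contra hcon
            push Not at hcon
            have hx' : x ∈ Ioo a b := ⟨lt_of_le_of_ne hx.1 hcon.1.symm, lt_of_le_of_ne hx.2 hcon.2⟩
            obtain ⟨rfl, rfl⟩ := hG.emb e e' x y
              ⟨(hI hab).1.trans_lt hx'.1, hx'.2.trans_le (hI hab).2⟩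
              ⟨(hI hab').1.trans hy.1, hy.2.trans (hI hab').2⟩ hxy
            have hy' : x ∈ Ioo a' b' := by
              refine ⟨lt_of_le_of_ne hy.1 ?_, lt_of_le_of_ne hy.2 ?_⟩
              · rintro rfl; exact hab.not_mem hx'.1 hx'.2 hab'.1
              · rintro rfl; exact hab.not_mem hx'.1 hx'.2 hab'.2.1
            exact hs rfl (hab.eq_of_mem hab' hx'.1 hx'.2 hy'.1 hy'.2).1
          exact ⟨key hab hab' hsame' hx hy hxy,
            key hab' hab (fun h1 h2 => hsame' h1.symm h2.symm) hy hx hxy.symm⟩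
        have hGu : ∀ x y, u e a x = u e' a' y → G e x = G e' y := fun x y h => by
          rw [← hLu e a x, ← hLu e' a' y, h, hc]
        refine radialChord_disjoint (hD (cell e a)) (hB _) (hDc _) hab.2.2.1.le hab'.2.2.1.le
          (hucont e a).continuousOn (hucont e' a').continuousOn (hmem e a b hab)
          (by rw [hc]; exact hmem e' a' b' hab') (hfr e a b hab).1 (hfr e a b hab).2
          (by rw [hc]; exact (hfr e' a' b' hab').1) (by rw [hc]; exact (hfr e' a' b' hab').2)
          (hune hab) (hune hab') (fun x hx y hy hxy => ?_)
          (fun hh => (hno e a b e' a' b' hab hab' hc hsame').1 ⟨hGu _ _ hh.1, hGu _ _ hh.2⟩)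
          (fun hh => (hno e a b e' a' b' hab hab' hc hsame').2 ⟨hGu _ _ hh.1, hGu _ _ hh.2⟩)
          (hpos hab h).1 (hpos hab h).2 (hpos hab' h').1 (hpos hab' h').2
          ((L (cell e a)).injective (add_left_cancel heq))
        have h1 := hGne x hx y hy (hGu x y hxy)
        exact ⟨h1.1, h1.2, hshare e a b e' a' b' hab hab' hc hsame' x y h1.1 h1.2 (hGu x y hxy)⟩
  · intro s hs
    obtain ⟨x, hx, y, hy, h1, h2⟩ := hSle e s hs
    exact ⟨((hX e).2.2 x hx).1.trans h1, h2.trans ((hX e).2.2 y hy).2⟩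
  · intro a₀ b₀ hab₀
    obtain ⟨x₀, hx₀, -, -, h1, -⟩ := hSle e a₀ hab₀.1
    obtain ⟨-, -, y₀, hy₀, -, h2⟩ := hSle e b₀ hab₀.2.1
    obtain ⟨a, b, hab, -, -, h3, h4⟩ := exists_consec hx₀ hy₀ h1 (hab₀.2.2.1.trans_le h2)
    have h5 : b₀ ≤ b := by
      rcases hab₀.2.2.2 b (hXS e hab.2.1) with h | h
      · linarith
      · exact h
    have hTp : 0 < T e a b / (b - a) := div_pos (by linarith [hT1 hab]) (sub_pos.2 hab.2.2.1)
    have hw := sub_pos.2 hab.2.2.1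
    have hside : ∀ r : ℝ, a + (b - a) * (r / T e a b) ∈ S e →
        (∀ t ∈ Icc a₀ b₀, -a * (T e a b / (b - a)) + t * (T e a b / (b - a)) ≤ r) ∨
        ∀ t ∈ Icc a₀ b₀, r ≤ -a * (T e a b / (b - a)) + t * (T e a b / (b - a)) := by
      intro r hr
      have e1 : r = -a * (T e a b / (b - a)) + (a + (b - a) * (r / T e a b)) *
          (T e a b / (b - a)) := by
        have := hT1 hab
        have h0 : T e a b ≠ 0 := by linarith
        field_simp; ring
      rcases hab₀.2.2.2 _ hr with h | h
      · right
        intro t ht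
        rw [e1]
        have : a + (b - a) * (r / T e a b) ≤ t := h.trans ht.1
        gcongr
      · left
        intro t ht
        conv_rhs => rw [e1]
        have : t ≤ a + (b - a) * (r / T e a b) := ht.2.trans h
        gcongr
    obtain ⟨x, d, hxd⟩ := radialChord_affine (p := u e a a) (q := u e a b)
      (hside _ (hS e a b hab).1) (hside _ (hS e a b hab).2.1)
    refine ⟨o (cell e a) + L (cell e a) x, L (cell e a) d, fun t ht => ?_⟩
    rw [hFΓ e a b hab t ⟨h3.trans ht.1, ht.2.trans h5⟩]
    simp only [hΓ]
    rw [hxd t ht, map_add, map_smul, Complex.real_smul, add_assoc]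
  · rcases eq_or_lt_of_le ht.1 with rfl | h1
    · rw [hFX e _ hab.1]; exact hmem e _ b hab _ ht
    rcases eq_or_lt_of_le ht.2 with rfl | h2
    · rw [hFX e _ hab.2.1]; exact hmem e a _ hab _ ht
    exact interior_subset (hinter hab ⟨h1, h2⟩)

end Straighten

/-- The real linear automorphism `x + i y ↦ l x + i (m x + b y)` of the plane. -/
def shear (l m b : ℝ) (hl : l ≠ 0) (hb : b ≠ 0) : ℂ ≃L[ℝ] ℂ :=
  LinearEquiv.toContinuousLinearEquiv
    { toFun := fun z => ⟨l * z.re, m * z.re + b * z.im⟩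
      invFun := fun w => ⟨w.re / l, (w.im - m * (w.re / l)) / b⟩
      map_add' := fun z w => by refine Complex.ext ?_ ?_ <;> simp <;> ring
      map_smul' := fun c z => by refine Complex.ext ?_ ?_ <;> simp <;> ring
      left_inv := fun z => by refine Complex.ext ?_ ?_ <;> simp <;> field_simp; ring
      right_inv := fun z => by refine Complex.ext ?_ ?_ <;> simp <;> field_simp; ring }

theorem shear_apply (l m b : ℝ) (hl : l ≠ 0) (hb : b ≠ 0) (z : ℂ) :
    shear l m b hl hb z = ⟨l * z.re, m * z.re + b * z.im⟩ := rfl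

/-- The chart of a rectangle taking `-1` and `1` to prescribed points of the vertical sides. -/
theorem exists_rectangle_chart {α β k yl yr : ℝ} (hαβ : α < β) (hl : yl ∈ Ioo k (k + 1))
    (hr : yr ∈ Ioo k (k + 1)) : ∃ (o : ℂ) (L : ℂ ≃L[ℝ] ℂ),
      closedBall (0 : ℂ) 1 ⊆ {w | o + L w ∈ Icc α β ×ℂ Icc k (k + 1)} ∧
      o + L (-1) = ⟨α, yl⟩ ∧ o + L 1 = ⟨β, yr⟩ := by
  set b := min (min (yl - k) (k + 1 - yl)) (min (yr - k) (k + 1 - yr)) with hb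
  have hb0 : 0 < b := by
    simp only [hb, lt_min_iff]
    exact ⟨⟨by linarith [hl.1], by linarith [hl.2]⟩, by linarith [hr.1], by linarith [hr.2]⟩
  have b1 : b ≤ yl - k := (min_le_left _ _).trans (min_le_left _ _)
  have b2 : b ≤ k + 1 - yl := (min_le_left _ _).trans (min_le_right _ _)
  have b3 : b ≤ yr - k := (min_le_right _ _).trans (min_le_left _ _)
  have b4 : b ≤ k + 1 - yr := (min_le_right _ _).trans (min_le_right _ _)
  refine ⟨⟨(α + β) / 2, (yl + yr) / 2⟩, shear ((β - α) / 2) ((yr - yl) / 2) b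
    (by linarith) hb0.ne', ?_, ?_, ?_⟩
  · intro w hw
    rw [mem_closedBall_zero_iff] at hw
    have h1 := abs_le.1 ((Complex.abs_re_le_norm w).trans hw)
    have h2 := abs_le.1 ((Complex.abs_im_le_norm w).trans hw)
    rw [mem_ofPred_eq, shear_apply, Complex.mem_reProdIm]
    simp only [Complex.add_re, Complex.add_im]
    refine ⟨⟨by nlinarith, by nlinarith⟩, ?_, ?_⟩
    · nlinarith [mul_nonneg (by linarith [h1.2] : 0 ≤ 1 - w.re) (sub_nonneg.2 b1),
        mul_nonneg (by linarith [h1.1] : 0 ≤ 1 + w.re) (sub_nonneg.2 b3),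
        mul_nonneg hb0.le (by linarith [h2.1] : 0 ≤ 1 + w.im)]
    · nlinarith [mul_nonneg (by linarith [h1.2] : 0 ≤ 1 - w.re) (sub_nonneg.2 b2),
        mul_nonneg (by linarith [h1.1] : 0 ≤ 1 + w.re) (sub_nonneg.2 b4),
        mul_nonneg hb0.le (by linarith [h2.2] : 0 ≤ 1 - w.im)]
  · rw [shear_apply]; refine Complex.ext ?_ ?_ <;> simp <;> ring
  · rw [shear_apply]; refine Complex.ext ?_ ?_ <;> simp <;> ring

section Cells

variable {E V : Type*} {src tgt : E → V} {P : V → ℂ} {G₀ G : E → ℝ → ℂ} {S : E → Finset ℝ}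

/-- `Ioo c.2.1 c.2.2 ×ℂ Ioo c.1 (c.1 + 1)` is a component of the complement of the walls. -/
def IsCell (P : V → ℂ) (c : ℤ × ℝ × ℝ) : Prop :=
  c.2.1 ∈ cuts P c.1 ∧ c.2.2 ∈ cuts P c.1 ∧ c.2.1 < c.2.2 ∧ c.2.2 ≤ c.2.1 + 1 ∧
    ∀ x ∈ cuts P c.1, x ≤ c.2.1 ∨ c.2.2 ≤ x

/-- The open rectangle of a cell. -/
def openCell (c : ℤ × ℝ × ℝ) : Set ℂ := Ioo c.2.1 c.2.2 ×ℂ Ioo (c.1 : ℝ) (c.1 + 1)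

/-- The closed rectangle of a cell. -/
def closedCell (c : ℤ × ℝ × ℝ) : Set ℂ := Icc c.2.1 c.2.2 ×ℂ Icc (c.1 : ℝ) (c.1 + 1)

theorem floor_eq_of_mem_Ioo {k : ℤ} {x : ℝ} (h : x ∈ Ioo (k : ℝ) (k + 1)) : ⌊x⌋ = k :=
  Int.floor_eq_iff.2 ⟨h.1.le, h.2⟩

theorem IsCell.notMem_walls {c : ℤ × ℝ × ℝ} (hc : IsCell P c) {z : ℂ} (hz : z ∈ openCell c) :
    z ∉ walls P := by
  rintro (⟨n, hn⟩ | h)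
  · have h1 := hz.2.1
    have h2 := hz.2.2
    rw [hn] at h1 h2
    have h3 : c.1 < n := by exact_mod_cast h1
    have h4 : n < c.1 + 1 := by exact_mod_cast h2
    omega
  · rw [floor_eq_of_mem_Ioo hz.2] at h
    rcases hc.2.2.2.2 _ h with h' | h'
    · exact absurd hz.1.1 (not_lt.2 h')
    · exact absurd hz.1.2 (not_lt.2 h')

theorem IsCell.mem_openCell {c : ℤ × ℝ × ℝ} (hc : IsCell P c) {z : ℂ} (hz : z ∈ closedCell c)
    (hw : z ∉ walls P) : z ∈ openCell c := by
  have him : z.im ∈ Ioo (c.1 : ℝ) (c.1 + 1) := by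
    refine ⟨lt_of_le_of_ne hz.2.1 fun h => hw (Or.inl ⟨c.1, h.symm⟩), lt_of_le_of_ne hz.2.2
      fun h => hw (Or.inl ⟨c.1 + 1, by push_cast; exact h⟩)⟩
  refine ⟨⟨lt_of_le_of_ne hz.1.1 fun h => hw (Or.inr ?_), lt_of_le_of_ne hz.1.2 fun h =>
    hw (Or.inr ?_)⟩, him⟩
  · rw [floor_eq_of_mem_Ioo him, ← h]; exact hc.1
  · rw [floor_eq_of_mem_Ioo him, h]; exact hc.2.1

theorem IsCell.eq {c c' : ℤ × ℝ × ℝ} (hc : IsCell P c) (hc' : IsCell P c') {z : ℂ}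
    (hz : z ∈ openCell c) (hz' : z ∈ openCell c') : c = c' := by
  obtain ⟨k, α, β⟩ := c
  obtain ⟨k', α', β'⟩ := c'
  have hk : k = k' := by
    exact (floor_eq_of_mem_Ioo hz.2).symm.trans (floor_eq_of_mem_Ioo hz'.2)
  subst hk
  have h1 := hz.1
  have h2 := hz'.1
  simp only [mem_preimage] at h1 h2
  obtain ⟨g1, g2, -, -, g3⟩ := hc
  obtain ⟨g1', g2', -, -, g3'⟩ := hc'
  simp only at g1 g2 g3 g1' g2' g3'
  have e1 := g3 _ g1'
  have e2 := g3 _ g2'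
  have e3 := g3' _ g1
  have e4 := g3' _ g2
  have hα : α = α' := by
    rcases e1 with e1 | e1 <;> rcases e3 with e3 | e3 <;> linarith [h1.1, h1.2, h2.1, h2.2]
  have hβ : β = β' := by
    rcases e2 with e2 | e2 <;> rcases e4 with e4 | e4 <;> linarith [h1.1, h1.2, h2.1, h2.2]
  rw [hα, hβ]

theorem exists_isCell [Finite V] (P : V → ℂ) {z : ℂ} (hz : z ∉ walls P) :
    ∃ c, IsCell P c ∧ z ∈ openCell c := by
  classical
  set k := ⌊z.im⌋ with hk
  set m := ⌊z.re⌋ with hm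
  have hre : z.re ∉ cuts P k := fun h => hz (Or.inr h)
  set A := (finite_cuts_inter P k m (m + 1)).toFinset with hA
  have memA : ∀ x, x ∈ A ↔ x ∈ cuts P k ∧ x ∈ Icc (m : ℝ) (m + 1) := fun x => by simp [hA]
  obtain ⟨α, β, hc, h1, h2, h3, h4⟩ := exists_consec (S := A) (x := m) (y := m + 1) (t := z.re)
    ((memA _).2 ⟨Or.inl ⟨m, rfl⟩, le_rfl, by linarith⟩)
    ((memA _).2 ⟨Or.inl ⟨m + 1, by push_cast; rfl⟩, by linarith, le_rfl⟩)
    (Int.floor_le _) (Int.lt_floor_add_one _)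
  have hα := ((memA _).1 hc.1).1
  refine ⟨(k, α, β), ⟨hα, ((memA _).1 hc.2.1).1, hc.2.2.1, by simp only; linarith, ?_⟩,
    ⟨lt_of_le_of_ne h3 fun h => hre (h ▸ hα), h4⟩, ?_, Int.lt_floor_add_one _⟩
  · intro x hx
    simp only
    by_cases hx1 : x < m
    · left; linarith
    by_cases hx2 : (m : ℝ) + 1 < x
    · right; linarith
    exact hc.2.2.2 x ((memA x).2 ⟨hx, not_lt.1 hx1, not_lt.1 hx2⟩)
  · exact lt_of_le_of_ne (Int.floor_le _) fun h => hz (Or.inl ⟨k, h.symm⟩)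

theorem isOpen_openCell (c : ℤ × ℝ × ℝ) : IsOpen (openCell c) := isOpen_Ioo.reProdIm isOpen_Ioo

theorem closure_openCell {c : ℤ × ℝ × ℝ} (hc : c.2.1 < c.2.2) :
    closure (openCell c) = closedCell c := by
  rw [openCell, Complex.closure_reProdIm, closure_Ioo hc.ne, closure_Ioo (by linarith), closedCell]

theorem interior_closedCell (c : ℤ × ℝ × ℝ) : interior (closedCell c) = openCell c := by
  rw [closedCell, Complex.interior_reProdIm, interior_Icc, interior_Icc, openCell]

theorem convex_openCell (c : ℤ × ℝ × ℝ) : Convex ℝ (openCell c) :=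
  ((convex_Ioo _ _).linear_preimage Complex.reLm).inter
    ((convex_Ioo _ _).linear_preimage Complex.imLm)

theorem convex_closedCell (c : ℤ × ℝ × ℝ) : Convex ℝ (closedCell c) :=
  ((convex_Icc _ _).linear_preimage Complex.reLm).inter
    ((convex_Icc _ _).linear_preimage Complex.imLm)

theorem isCompact_closedCell (c : ℤ × ℝ × ℝ) : IsCompact (closedCell c) :=
  isCompact_Icc.reProdIm isCompact_Icc

theorem norm_sub_le_of_mem_closedCell {c : ℤ × ℝ × ℝ} (hc : IsCell P c) {z w : ℂ}
    (hz : z ∈ closedCell c) (hw : w ∈ closedCell c) : ‖z - w‖ ≤ 2 := by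
  refine (Complex.norm_le_abs_re_add_abs_im _).trans ?_
  have h1 := hz.1; have h2 := hz.2; have h3 := hw.1; have h4 := hw.2
  simp only [mem_preimage, mem_Icc] at h1 h2 h3 h4
  have h5 := hc.2.2.2.1
  have : |z.re - w.re| ≤ 1 := abs_le.2 ⟨by linarith, by linarith⟩
  have : |z.im - w.im| ≤ 1 := abs_le.2 ⟨by linarith, by linarith⟩
  simp only [Complex.sub_re, Complex.sub_im]
  linarith

/-- An arc avoiding the walls is contained in a cell. -/
theorem exists_cell_of_gap [Finite V] {γ : ℝ → ℂ} (hγ : Continuous γ) {a b : ℝ} (hab : a < b)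
    (h : ∀ t ∈ Ioo a b, γ t ∉ walls P) : ∃ c, IsCell P c ∧ (∀ t ∈ Ioo a b, γ t ∈ openCell c) ∧
      ∀ t ∈ Icc a b, γ t ∈ closedCell c := by
  have hm : (a + b) / 2 ∈ Ioo a b := ⟨by linarith, by linarith⟩
  obtain ⟨c, hc, hz⟩ := exists_isCell P (h _ hm)
  have hO : γ '' Ioo a b ⊆ openCell c := by
    refine IsPreconnected.subset_of_closure_inter_subset
      (isPreconnected_Ioo.image _ hγ.continuousOn) (isOpen_openCell c) ⟨_, ⟨_, hm, rfl⟩, hz⟩ ?_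
    rintro _ ⟨h1, t, ht, rfl⟩
    rw [closure_openCell hc.2.2.1] at h1
    exact hc.mem_openCell h1 (h t ht)
  refine ⟨c, hc, fun t ht => hO ⟨t, ht, rfl⟩, fun t ht => ?_⟩
  rw [← closure_openCell hc.2.2.1]
  rw [← closure_Ioo hab.ne] at ht
  exact closure_mono hO (image_closure_subset_closure_image hγ ⟨t, ht, rfl⟩)

end Cells

section Straightened

variable {E V : Type*} [Fintype E] [Finite V] {src tgt : E → V} {P : V → ℂ}
  {G₀ : E → ℝ → ℂ} {S₀ : E → Finset ℝ}

open Classical in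
/-- A drawing in general position agrees at boundedly many points of any disc with a piecewise
linear drawing which is short between these points. -/
theorem GenericDrawing.exists_straightened (hG₀ : GenericDrawing src tgt P G₀ S₀)
    (hP : Function.Injective P) (hloop : ∀ e, src e ≠ tgt e)
    (hsimple : ∀ e e', e ≠ e' → ¬ (src e = src e' ∧ tgt e = tgt e') ∧
      ¬ (src e = tgt e' ∧ tgt e = src e')) {K N : ℕ}
    (hK : ∀ z : ℂ, {e | ∃ t ∈ Icc (0 : ℝ) 1, ‖G₀ e t - z‖ ≤ 2}.ncard ≤ K)
    (hN : ∀ z : ℂ, {v | ‖P v - z‖ ≤ 2}.ncard ≤ N) :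
    ∃ (F : E → ℝ → ℂ) (X S : E → Finset ℝ), Drawing src tgt P F ∧ ∀ e, 0 ∈ X e ∧ 1 ∈ X e ∧
      X e ⊆ S e ∧ (∀ s ∈ S e, s ∈ Icc (0 : ℝ) 1) ∧ PLOn (F e) (S e) ∧
      (∀ t ∈ X e, F e t = G₀ e t) ∧
      (∀ a b, Consec (X e) a b → ((S e).filter fun s => a < s ∧ s < b).card ≤ 2 ∧
        ∀ t ∈ Icc a b, ‖F e t - F e a‖ ≤ 2) ∧
      ∀ (z : ℂ) (R : ℝ), 0 ≤ R → (((X e).filter fun t => ‖G₀ e t - z‖ ≤ R).card : ℝ) ≤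
        (2 * R + 2) ^ 2 * ((N + 2) ^ 2 * 2 ^ K) + 2 := by
  obtain ⟨G, hGa, hmin⟩ := exists_minimal_admissible (W := walls P) hG₀.toDrawing
  have hG := hGa.1
  have hfin : (crossings (walls P) G).Finite := hG₀.finite_crossings.subset hGa.subset
  have hfin' : ∀ e, {t | (e, t) ∈ crossings (walls P) G}.Finite := fun e =>
    Set.Finite.preimage (fun x _ y _ h => (Prod.mk.inj h).2) hfin
  set X : E → Finset ℝ := fun e => insert 0 (insert 1 (hfin' e).toFinset) with hX
  have memX : ∀ e t, t ∈ X e ↔ t = 0 ∨ t = 1 ∨ (e, t) ∈ crossings (walls P) G := fun e t => by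
    simp [hX]
  have hX0 : ∀ e, 0 ∈ X e ∧ 1 ∈ X e ∧ ∀ s ∈ X e, s ∈ Icc (0 : ℝ) 1 := fun e =>
    ⟨by simp [hX], by simp [hX], fun s hs => by
      rcases (memX e s).1 hs with rfl | rfl | h
      · simp
      · simp
      · exact Ioo_subset_Icc_self h.1⟩
  have hPw : ∀ v, P v ∈ walls P := fun v => Or.inr (Or.inr ⟨v, rfl, rfl⟩)
  have hXw : ∀ e, ∀ t ∈ X e, G e t ∈ walls P := fun e t ht => by
    rcases (memX e t).1 ht with rfl | rfl | h
    · rw [hG.zero]; exact hPw _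
    · rw [hG.one]; exact hPw _
    · exact h.2
  have hI : ∀ {e a b}, Consec (X e) a b → 0 ≤ a ∧ b ≤ 1 := fun {e a b} hab =>
    ⟨((hX0 e).2.2 a hab.1).1, ((hX0 e).2.2 b hab.2.1).2⟩
  -- the cell of an arc
  have hgap : ∀ e a b, Consec (X e) a b → ∃ c, IsCell P c ∧ (∀ t ∈ Ioo a b, G e t ∈ openCell c) ∧
      ∀ t ∈ Icc a b, G e t ∈ closedCell c := fun e a b hab =>
    exists_cell_of_gap (hG.cont e) hab.2.2.1 fun t ht hw => hab.not_mem ht.1 ht.2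
      ((memX e t).2 (Or.inr (Or.inr ⟨⟨(hI hab).1.trans_lt ht.1, ht.2.trans_le (hI hab).2⟩, hw⟩)))
  obtain ⟨c₀, hc₀⟩ : ∃ c : ℤ × ℝ × ℝ, c.2.1 < c.2.2 := ⟨(0, 0, 1), by simp⟩
  have hcell : ∀ e a, ∃ c : {c : ℤ × ℝ × ℝ // c.2.1 < c.2.2}, ∀ b, Consec (X e) a b →
      IsCell P c.1 ∧ (∀ t ∈ Ioo a b, G e t ∈ openCell c.1) ∧
      ∀ t ∈ Icc a b, G e t ∈ closedCell c.1 := fun e a => by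
    by_cases h : ∃ b, Consec (X e) a b
    · obtain ⟨b, hab⟩ := h
      obtain ⟨c, hc, h1, h2⟩ := hgap e a b hab
      refine ⟨⟨c, hc.2.2.1⟩, fun b' hab' => ?_⟩
      have : b' = b := by
        have g1 := hab.2.2.2 b' hab'.2.1
        have g2 := hab'.2.2.2 b hab.2.1
        rcases g1 with g1 | g1 <;> rcases g2 with g2 | g2 <;> linarith [hab.2.2.1, hab'.2.2.1]
      subst this
      exact ⟨hc, h1, h2⟩
    · exact ⟨⟨c₀, hc₀⟩, fun b hab => absurd ⟨b, hab⟩ h⟩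
  choose cell hcell using hcell
  -- the charts of the cells
  have hheight : ∀ (k : ℤ) (x : ℝ), ∃ y ∈ Ioo (k : ℝ) (k + 1),
      ∀ v, ⌊(P v).im⌋ = k → (P v).re = x → P v = ⟨x, y⟩ := fun k x => by
    by_cases h : ∃ v, ⌊(P v).im⌋ = k ∧ (P v).re = x
    · obtain ⟨v, hk, hx⟩ := h
      refine ⟨(P v).im, ⟨?_, ?_⟩, fun v' _ hx' => ?_⟩
      · exact lt_of_le_of_ne (hk ▸ Int.floor_le _) (hG₀.vertex_im_ne v k).symm
      · exact hk ▸ Int.lt_floor_add_one _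
      · rw [hG₀.vertex_eq (hx'.trans hx.symm), ← hx]
    · exact ⟨k + 1 / 2, ⟨by linarith, by linarith⟩, fun v hk hx => absurd ⟨v, hk, hx⟩ h⟩
  choose ht hht hvt using hheight
  have hchart := fun c : {c : ℤ × ℝ × ℝ // c.2.1 < c.2.2} => exists_rectangle_chart
    (k := (c.1.1 : ℝ)) c.2 (hht c.1.1 c.1.2.1) (hht c.1.1 c.1.2.2)
  choose o L hB hl hr using hchart
  set H : ∀ c : {c : ℤ × ℝ × ℝ // c.2.1 < c.2.2}, ℂ ≃ₜ ℂ := fun c =>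
    (L c).toHomeomorph.trans (Homeomorph.addLeft (o c)) with hH
  have hHa : ∀ c w, H c w = o c + L c w := fun c w => rfl
  set D : {c : ℤ × ℝ × ℝ // c.2.1 < c.2.2} → Set ℂ := fun c => H c ⁻¹' closedCell c.1 with hDdef
  have hmemD : ∀ c z, (L c).symm (z - o c) ∈ D c ↔ z ∈ closedCell c.1 := fun c z => by
    simp only [hDdef, mem_preimage, hHa, ContinuousLinearEquiv.apply_symm_apply, add_sub_cancel]
  have hmemI : ∀ c z, (L c).symm (z - o c) ∈ interior (D c) ↔ z ∈ openCell c.1 := fun c z => by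
    simp only [hDdef]
    rw [← (H c).preimage_interior, interior_closedCell]
    simp only [mem_preimage, hHa, ContinuousLinearEquiv.apply_symm_apply, add_sub_cancel]
  have hXn : ∀ e a b, Consec (X e) a b → ∀ e', ∀ t ∈ X e', G e' t ∉ openCell (cell e a).1 :=
    fun e a b hab e' t ht h => (hcell e a b hab).1.notMem_walls h (hXw e' t ht)
  -- a point shared by two arcs of a cell is a vertex
  have hvertex : ∀ e a b e' a' b', Consec (X e) a b → Consec (X e') a' b' →
      cell e a = cell e' a' → (e = e' → a ≠ a') → ∀ x x', (x = a ∨ x = b) → (x' = a' ∨ x' = b') →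
      G e x = G e' x' → x = 0 ∨ x = 1 := by
    intro e a b e' a' b' hab hab' hc hs x x' hx hx' heq
    by_contra hcon
    push Not at hcon
    have hxI : x ∈ Icc (0 : ℝ) 1 := (hX0 e).2.2 x (by rcases hx with rfl | rfl; exacts [hab.1,
        hab.2.1])
    have hxI' : x' ∈ Icc (0 : ℝ) 1 :=
      (hX0 e').2.2 x' (by rcases hx' with rfl | rfl; exacts [hab'.1, hab'.2.1])
    have hx0 : x ∈ Ioo (0 : ℝ) 1 :=
      ⟨lt_of_le_of_ne hxI.1 hcon.1.symm, lt_of_le_of_ne hxI.2 hcon.2⟩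
    obtain ⟨rfl, rfl⟩ := hG.emb e e' x x' hx0 hxI' heq
    have hxX : x ∈ X e := by rcases hx with rfl | rfl; exacts [hab.1, hab.2.1]
    have hcr : (e, x) ∈ crossings (walls P) G := ⟨hx0, hXw e x hxX⟩
    obtain ⟨d, hd, -, -⟩ := hG₀.exists_local_affine (hGa.subset hcr)
    have hcell' := hcell e a' b' hab'
    rw [← hc] at hcell'
    have key : ∀ a b b', Consec (X e) a x → Consec (X e) x b →
        (∀ t ∈ Ioo a x, G e t ∈ openCell (cell e b').1) →
        (∀ t ∈ Ioo x b, G e t ∈ openCell (cell e b').1) → G e x ∈ openCell (cell e b').1 := by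
      intro a b b' h1 h2 g1 g2
      have hloc : ∀ᶠ t in nhds x, G e t = G₀ e x + (t - x) * d := by
        filter_upwards [hGa.2 _ hcr, hd] with t e1 e2
        rw [e1, e2]
      obtain ⟨τ, hτ, hball⟩ := Metric.eventually_nhds_iff.1 (hloc.and
        (isOpen_Ioo.mem_nhds (show x ∈ Ioo a b from ⟨h1.2.2.1, h2.2.2.1⟩)))
      have p1 := hball (y := x - τ / 2) (by rw [Real.dist_eq, abs_lt]; constructor <;> linarith)
      have p2 := hball (y := x + τ / 2) (by rw [Real.dist_eq, abs_lt]; constructor <;> linarith)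
      have q1 := g1 (x - τ / 2) ⟨p1.2.1, by linarith⟩
      have q2 := g2 (x + τ / 2) ⟨by linarith, p2.2.2⟩
      have := convex_openCell _ q1 q2 (a := 1 / 2) (b := 1 / 2) (by norm_num) (by norm_num)
        (by norm_num)
      rw [p1.1, p2.1] at this
      have hGx : G e x = G₀ e x := hGa.eq hcr
      rw [hGx]
      convert this using 1
      rw [Complex.real_smul, Complex.real_smul]
      push_cast
      ring
    rcases hx with rfl | rfl <;> rcases hx' with rfl | rfl
    · exact hs rfl rfl
    · exact hXn e x b hab e x hxX (key a' b x hab' hab hcell'.2.1 (hcell e x b hab).2.1)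
    · exact hXn e a x hab e x hxX (key a b' a hab hab' (hcell e a x hab).2.1 hcell'.2.1)
    · refine hs rfl ?_
      have g1 := hab.2.2.2 a' hab'.1
      have g2 := hab'.2.2.2 a hab.1
      rcases g1 with g1 | g1 <;> rcases g2 with g2 | g2 <;> linarith [hab.2.2.1, hab'.2.2.1]
  have hend : ∀ e x, x = 0 ∨ x = 1 → ∃ v, G e x = P v := by
    rintro e x (rfl | rfl)
    · exact ⟨_, hG.zero e⟩
    · exact ⟨_, hG.one e⟩
  obtain ⟨F, S, hF, hFS⟩ := hG.straighten hX0 o L D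
    (fun c => (H c).isCompact_preimage.2 (isCompact_closedCell _))
    (fun c => by
      have : D c = (L c : ℂ →ₗ[ℝ] ℂ) ⁻¹' ((fun z => o c + z) ⁻¹' closedCell c.1) := rfl
      rw [this]
      exact ((convex_closedCell c.1).translate_preimage_right _).linear_preimage _)
    hB cell
    (fun e a b hab t ht => (hmemD _ _).2 ((hcell e a b hab).2.2 t ht))
    (fun e a b hab => ⟨⟨subset_closure ((hmemD _ _).2 ((hcell e a b hab).2.2 a
        (left_mem_Icc.2 hab.2.2.1.le))), fun h => hXn e a b hab e a hab.1 ((hmemI _ _).1 h)⟩,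
      subset_closure ((hmemD _ _).2 ((hcell e a b hab).2.2 b (right_mem_Icc.2 hab.2.2.1.le))),
      fun h => hXn e a b hab e b hab.2.1 ((hmemI _ _).1 h)⟩)
    (fun e a b e' a' b' hab hab' z h1 h2 => Subtype.ext ((hcell e a b hab).1.eq
      (hcell e' a' b' hab').1 ((hmemI _ _).1 h1) ((hmemI _ _).1 h2)))
    (fun e a b hab e' t ht h => hXn e a b hab e' t ht ((hmemI _ _).1 h))
    (fun e a b hab h => by
      have hlt := hab.2.2.1
      by_cases ha : 0 < a
      · exact hlt.ne (hG.emb e e a b ⟨ha, hlt.trans_le (hI hab).2⟩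
          ⟨(ha.trans hlt).le, (hI hab).2⟩ h).2
      by_cases hb : b < 1
      · exact hlt.ne' (hG.emb e e b a ⟨(hI hab).1.trans_lt hlt, hb⟩
          ⟨(hI hab).1, (hlt.trans hb).le⟩ h.symm).2
      have ha : a = 0 := le_antisymm (not_lt.1 ha) (hI hab).1
      have hb : b = 1 := le_antisymm (hI hab).2 (not_lt.1 hb)
      rw [ha, hb, hG.zero, hG.one] at h
      exact hloop e (hP h))
    (fun e a b e' a' b' hab hab' hc hs x x' hx hx' heq => by
      obtain ⟨v, hv⟩ := hend e x (hvertex e a b e' a' b' hab hab' hc hs x x' hx hx' heq)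
      have hxX : x ∈ X e := by rcases hx with rfl | rfl; exacts [hab.1, hab.2.1]
      have hcl : G e x ∈ closedCell (cell e a).1 := (hcell e a b hab).2.2 x (by
        rcases hx with rfl | rfl
        · exact left_mem_Icc.2 hab.2.2.1.le
        · exact right_mem_Icc.2 hab.2.2.1.le)
      have hnotin := hXn e a b hab e x hxX
      rw [hv] at hcl hnotin ⊢
      have him : (P v).im ∈ Ioo ((cell e a).1.1 : ℝ) ((cell e a).1.1 + 1) :=
        ⟨lt_of_le_of_ne hcl.2.1 (hG₀.vertex_im_ne v _).symm, lt_of_le_of_ne hcl.2.2 (by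
          have := hG₀.vertex_im_ne v ((cell e a).1.1 + 1); push_cast at this; exact this)⟩
      have hk := floor_eq_of_mem_Ioo him
      by_cases h1 : (P v).re = (cell e a).1.2.1
      · rw [hvt _ _ v hk h1, ← hl]; simp
      by_cases h2 : (P v).re = (cell e a).1.2.2
      · rw [hvt _ _ v hk h2, ← hr]; simp
      exact absurd ⟨⟨lt_of_le_of_ne hcl.1.1 (Ne.symm h1), lt_of_le_of_ne hcl.1.2 h2⟩, him⟩ hnotin)
    (fun e a b e' a' b' hab hab' hc hs => by
      have hs' : e' = e → a' ≠ a := fun h1 h2 => hs h1.symm h2.symm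
      have A := hvertex e a b e' a' b' hab hab' hc hs
      have A' := hvertex e' a' b' e a b hab' hab hc.symm hs'
      have full : ∀ {a b : ℝ}, a < b → (a = 0 ∨ a = 1) → (b = 0 ∨ b = 1) → a = 0 ∧ b = 1 := by
        rintro a b hlt (rfl | rfl) (rfl | rfl) <;> first | exact ⟨rfl, rfl⟩ | (exfalso; linarith)
      constructor
      · rintro ⟨h1, h2⟩
        obtain ⟨rfl, rfl⟩ := full hab.2.2.1 (A _ _ (Or.inl rfl) (Or.inl rfl) h1)
          (A _ _ (Or.inr rfl) (Or.inr rfl) h2)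
        obtain ⟨rfl, rfl⟩ := full hab'.2.2.1 (A' _ _ (Or.inl rfl) (Or.inl rfl) h1.symm)
          (A' _ _ (Or.inr rfl) (Or.inr rfl) h2.symm)
        rw [hG.zero, hG.zero] at h1
        rw [hG.one, hG.one] at h2
        exact (hsimple e e' fun h => hs h rfl).1 ⟨hP h1, hP h2⟩
      · rintro ⟨h1, h2⟩
        obtain ⟨rfl, rfl⟩ := full hab.2.2.1 (A _ _ (Or.inl rfl) (Or.inr rfl) h1)
          (A _ _ (Or.inr rfl) (Or.inl rfl) h2)
        obtain ⟨rfl, rfl⟩ := full hab'.2.2.1 (A' _ _ (Or.inl rfl) (Or.inr rfl) h2.symm)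
          (A' _ _ (Or.inr rfl) (Or.inl rfl) h1.symm)
        rw [hG.zero, hG.one] at h1
        rw [hG.one, hG.zero] at h2
        exact (hsimple e e' fun h => hs h rfl).2 ⟨hP h1, hP h2⟩)
  have hFG : ∀ e, ∀ t ∈ X e, F e t = G₀ e t := fun e t ht => by
    rcases (memX e t).1 ht with rfl | rfl | h
    · rw [hF.zero, hG₀.zero]
    · rw [hF.one, hG₀.one]
    · rw [(hFS e).2.2.2.1 t ht]; exact hGa.eq h
  refine ⟨F, X, S, hF, fun e => ⟨(hX0 e).1, (hX0 e).2.1, (hFS e).1, (hFS e).2.1, (hFS e).2.2.1,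
    hFG e, fun a b hab => ⟨((hFS e).2.2.2.2 a b hab).1, fun t ht => ?_⟩, fun z R hR => ?_⟩⟩
  · have h := ((hFS e).2.2.2.2 a b hab).2
    exact norm_sub_le_of_mem_closedCell (hcell e a b hab).1 ((hmemD _ _).1 (h t ht))
      ((hmemD _ _).1 (h a (left_mem_Icc.2 hab.2.2.1.le)))
  · have h1 := hGa.ncard_ball_le hG₀ hmin hK hN z hR
    have h2 : ((X e).filter fun t => ‖G₀ e t - z‖ ≤ R).card ≤
        {q ∈ crossings (walls P) G | ‖G q.1 q.2 - z‖ ≤ R}.ncard + 2 := by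
      have hf : {q ∈ crossings (walls P) G | ‖G q.1 q.2 - z‖ ≤ R}.Finite :=
        hfin.subset fun q hq => hq.1
      have : (X e).filter (fun t => ‖G₀ e t - z‖ ≤ R) ⊆
          (hf.toFinset.image Prod.snd) ∪ {0, 1} := fun t ht => by
        rw [Finset.mem_filter] at ht
        rcases (memX e t).1 ht.1 with rfl | rfl | h
        · simp
        · simp
        · rw [Finset.mem_union]
          left
          rw [Finset.mem_image]
          refine ⟨(e, t), hf.mem_toFinset.2 ⟨h, ?_⟩, rfl⟩
          rw [hGa.eq h]; exact ht.2
      refine (Finset.card_le_card this).trans ((Finset.card_union_le _ _).trans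
        (Nat.add_le_add ?_ Finset.card_le_two))
      rw [Set.ncard_eq_toFinset_card _ hf]
      exact Finset.card_image_le
    have h3 : (((X e).filter fun t => ‖G₀ e t - z‖ ≤ R).card : ℝ) ≤
        ({q ∈ crossings (walls P) G | ‖G q.1 q.2 - z‖ ≤ R}.ncard : ℝ) + 2 := by exact_mod_cast h2
    linarith

end Straightened

section Normalisation

/-- A sheared and rescaled copy of the plane. -/
def skew (m u y ρ : ℝ) (z : ℂ) : ℂ := ⟨(z.re - m * z.im - u) / ρ, (z.im - y) / ρ⟩

/-- The inverse of `skew`. -/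
def unskew (m u y ρ : ℝ) (z : ℂ) : ℂ := ⟨ρ * z.re + u + m * (ρ * z.im + y), ρ * z.im + y⟩

variable {m u y ρ : ℝ}

theorem unskew_skew (hρ : ρ ≠ 0) (z : ℂ) : unskew m u y ρ (skew m u y ρ z) = z := by
  unfold skew unskew
  refine Complex.ext ?_ ?_ <;> simp only <;> field_simp <;> ring

theorem skew_unskew (hρ : ρ ≠ 0) (z : ℂ) : skew m u y ρ (unskew m u y ρ z) = z := by
  unfold skew unskew
  refine Complex.ext ?_ ?_ <;> simp only <;> field_simp <;> ring

theorem continuous_skew : Continuous (skew m u y ρ) := by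
  have : skew m u y ρ = fun z : ℂ => (((z.re - m * z.im - u) / ρ : ℝ) : ℂ) +
      (((z.im - y) / ρ : ℝ) : ℂ) * Complex.I := by
    funext z; refine Complex.ext ?_ ?_ <;> simp [skew]
  rw [this]; fun_prop

theorem continuous_unskew : Continuous (unskew m u y ρ) := by
  have : unskew m u y ρ = fun z : ℂ => ((ρ * z.re + u + m * (ρ * z.im + y) : ℝ) : ℂ) +
      ((ρ * z.im + y : ℝ) : ℂ) * Complex.I := by
    funext z; refine Complex.ext ?_ ?_ <;> simp [unskew]
  rw [this]; fun_prop

theorem norm_mk_le (a b m : ℝ) (hm : |m| ≤ 1 / 2) :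
    ‖(⟨a + m * b, b⟩ : ℂ)‖ ≤ 2 * ‖(⟨a, b⟩ : ℂ)‖ := by
  have h : (⟨a + m * b, b⟩ : ℂ) = ⟨a, b⟩ + ((m * b : ℝ) : ℂ) := by
    refine Complex.ext ?_ ?_ <;> simp
  have hb : |b| ≤ ‖(⟨a, b⟩ : ℂ)‖ := Complex.abs_im_le_norm ⟨a, b⟩
  rw [h]
  refine (norm_add_le _ _).trans ?_
  rw [Complex.norm_real, Real.norm_eq_abs, abs_mul]
  have := mul_le_mul hm hb (abs_nonneg _) (by norm_num)
  have h0 := norm_nonneg (⟨a, b⟩ : ℂ)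
  linarith

theorem norm_skew_sub_le (hρ : 0 < ρ) (hm : |m| ≤ 1 / 2) (z w : ℂ) :
    ‖skew m u y ρ z - skew m u y ρ w‖ ≤ 2 * ‖z - w‖ / ρ := by
  have h : skew m u y ρ z - skew m u y ρ w =
      ((ρ⁻¹ : ℝ) : ℂ) * ⟨(z - w).re + (-m) * (z - w).im, (z - w).im⟩ := by
    unfold skew
    refine Complex.ext ?_ ?_ <;> simp <;> field_simp <;> ring
  have h2 := norm_mk_le (z - w).re (z - w).im (-m) (by rwa [abs_neg])
  rw [h, norm_mul, Complex.norm_real, Real.norm_of_nonneg (inv_nonneg.2 hρ.le), div_eq_inv_mul]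
  exact mul_le_mul_of_nonneg_left h2 (inv_nonneg.2 hρ.le)

theorem norm_unskew_sub_le (hρ : 0 < ρ) (hm : |m| ≤ 1 / 2) (z w : ℂ) :
    ‖unskew m u y ρ z - unskew m u y ρ w‖ ≤ 2 * ρ * ‖z - w‖ := by
  have h : unskew m u y ρ z - unskew m u y ρ w =
      (ρ : ℂ) * ⟨(z - w).re + m * (z - w).im, (z - w).im⟩ := by
    unfold unskew
    refine Complex.ext ?_ ?_ <;> simp <;> ring
  have h2 := norm_mk_le (z - w).re (z - w).im m hm
  rw [h, norm_mul, Complex.norm_real, Real.norm_of_nonneg hρ.le]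
  have := mul_le_mul_of_nonneg_left h2 hρ.le
  simp only [Complex.eta] at this ⊢
  linarith

theorem PLOn.skew {F : ℝ → ℂ} {S : Finset ℝ} (h : PLOn F S) :
    PLOn (fun t => skew m u y ρ (F t)) S := fun a b hab => by
  obtain ⟨p, d, hpd⟩ := h a b hab
  refine ⟨_root_.skew m u y ρ p, ⟨(d.re - m * d.im) / ρ, d.im / ρ⟩, fun t ht => ?_⟩
  simp only [hpd t ht]
  unfold _root_.skew
  refine Complex.ext ?_ ?_ <;> simp <;> ring

theorem PLOn.unskew {F : ℝ → ℂ} {S : Finset ℝ} (h : PLOn F S) :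
    PLOn (fun t => unskew m u y ρ (F t)) S := fun a b hab => by
  obtain ⟨p, d, hpd⟩ := h a b hab
  refine ⟨_root_.unskew m u y ρ p, ⟨ρ * d.re + m * (ρ * d.im), ρ * d.im⟩, fun t ht => ?_⟩
  simp only [hpd t ht]
  unfold _root_.unskew
  refine Complex.ext ?_ ?_ <;> simp <;> ring

variable {E V : Type*} {src tgt : E → V} {P : V → ℂ} {G : E → ℝ → ℂ} {S : E → Finset ℝ}

theorem Drawing.comp_injective (hG : Drawing src tgt P G) {φ : ℂ → ℂ} (hφ : Continuous φ)
    (hi : Function.Injective φ) :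
    Drawing src tgt (fun v => φ (P v)) (fun e t => φ (G e t)) where
  cont e := hφ.comp (hG.cont e)
  zero e := by rw [hG.zero]
  one e := by rw [hG.one]
  emb e e' s s' hs hs' h := hG.emb e e' s s' hs hs' (hi h)

/-- Generic coordinates exist. -/
theorem Drawing.exists_generic [Finite E] [Finite V] (hG : Drawing src tgt P G)
    (hinc : ∀ v, ∃ e, v = src e ∨ v = tgt e)
    (hmem : ∀ e, 0 ∈ S e ∧ 1 ∈ S e ∧ ∀ s ∈ S e, s ∈ Icc (0 : ℝ) 1)
    (hpl : ∀ e, PLOn (G e) (S e)) (hρ : 0 < ρ) :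
    ∃ m u y : ℝ, |m| ≤ 1 / 2 ∧ GenericDrawing src tgt (fun v => skew m u y ρ (P v))
      (fun e t => skew m u y ρ (G e t)) S := by
  set B : Set ℂ := ⋃ e, G e '' (S e : Set ℝ) with hBdef
  have hB : B.Finite := Set.finite_iUnion fun e => (S e).finite_toSet.image _
  have hBmem : ∀ e, ∀ s ∈ S e, G e s ∈ B := fun e s hs => mem_iUnion.2 ⟨e, s, hs, rfl⟩
  have hPB : ∀ v, P v ∈ B := fun v => by
    obtain ⟨e, rfl | rfl⟩ := hinc v
    · exact hG.zero e ▸ hBmem e 0 (hmem e).1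
    · exact hG.one e ▸ hBmem e 1 (hmem e).2.1
  obtain ⟨y, hy⟩ : ∃ y : ℝ, ∀ b ∈ B, ∀ n : ℤ, (b.im - y) / ρ ≠ n := by
    have hc : (⋃ b ∈ B, range fun n : ℤ => b.im - ρ * n).Countable :=
      hB.countable.biUnion fun b _ => countable_range _
    obtain ⟨y, hy⟩ := (hc.dense_compl ℝ).nonempty
    refine ⟨y, fun b hb n h => hy (mem_biUnion hb ⟨n, ?_⟩)⟩
    simp only; rw [← h]; field_simp; ring
  set Q : Set ℂ := ⋃ e, G e '' {t ∈ Icc (0 : ℝ) 1 | ∃ n : ℤ, ((G e t).im - y) / ρ = n}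
  have hQ : Q.Finite := by
    refine Set.finite_iUnion fun e => Set.Finite.image _ ?_
    have hsub : {t ∈ Icc (0 : ℝ) 1 | ∃ n : ℤ, ((G e t).im - y) / ρ = n} ⊆
        ⋃ a ∈ (S e : Set ℝ), ⋃ b ∈ (S e : Set ℝ),
          {t | Consec (S e) a b ∧ t ∈ Icc a b ∧ ∃ n : ℤ, ((G e t).im - y) / ρ = n} := by
      rintro t ⟨ht, hn⟩
      rcases mem_or_exists_consec (hmem e).1 (hmem e).2.1 ht.1 ht.2 with h | ⟨a, b, hab, h1, h2⟩
      · exact absurd hn.choose_spec (hy _ (hBmem e t h) _)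
      · simp only [mem_iUnion]
        exact ⟨a, hab.1, b, hab.2.1, hab, ⟨h1.le, h2.le⟩, hn⟩
    refine Set.Finite.subset ((S e).finite_toSet.biUnion fun a _ =>
      (S e).finite_toSet.biUnion fun b _ => ?_) hsub
    by_cases hab : Consec (S e) a b
    swap
    · simp [hab]
    obtain ⟨p, d, hpd⟩ := hpl e a b hab
    have him : ∀ t ∈ Icc a b, ((G e t).im - y) / ρ = (p.im - y) / ρ + t * (d.im / ρ) :=
      fun t ht => by rw [hpd t ht]; simp; ring
    by_cases hd : d.im = 0
    · convert Set.finite_empty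
      refine eq_empty_of_forall_notMem ?_
      rintro t ⟨-, ht, n, hn⟩
      refine hy _ (hBmem e a hab.1) n ?_
      rw [him a (left_mem_Icc.2 hab.2.2.1.le)]
      rw [him t ht] at hn
      rw [← hn, hd]; simp
    · refine (finite_affine_integer (a := a) (b := b) (α := (p.im - y) / ρ)
        (div_ne_zero hd hρ.ne')).subset ?_
      rintro t ⟨-, ht, n, hn⟩
      exact ⟨ht, n, him t ht ▸ hn⟩
  have hQP : ∀ q ∈ Q, ∀ v, q ≠ P v := by
    rintro q hq v rfl
    obtain ⟨e, t, ⟨-, n, hn⟩, h⟩ := mem_iUnion.1 hq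
    rw [h] at hn
    exact hy _ (hPB v) n hn
  obtain ⟨m, hm, hmv⟩ : ∃ m ∈ Ioo (0 : ℝ) (1 / 2), ∀ q ∈ B ∪ Q, ∀ v, q ≠ P v →
      q.re - m * q.im ≠ (P v).re - m * (P v).im := by
    have hf : (⋃ q ∈ B ∪ Q, ⋃ v, {(q.re - (P v).re) / (q.im - (P v).im)}).Finite :=
      (hB.union hQ).biUnion fun q _ => Set.finite_iUnion fun v => Set.finite_singleton _
    obtain ⟨m, hm, hm'⟩ := (Ioo_infinite (show (0 : ℝ) < 1 / 2 by norm_num)).exists_notMem_finite hf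
    refine ⟨m, hm, fun q hq v hne h => ?_⟩
    by_cases him : q.im = (P v).im
    · refine hne (Complex.ext ?_ him)
      rw [him] at h; linarith
    · refine hm' (mem_biUnion hq (mem_iUnion.2 ⟨v, ?_⟩))
      rw [mem_singleton_iff, eq_div_iff (sub_ne_zero.2 him)]
      linarith
  obtain ⟨u, hu⟩ : ∃ u : ℝ, ∀ b ∈ B ∪ Q, ∀ n : ℤ, (b.re - m * b.im - u) / ρ ≠ n := by
    have hc : (⋃ b ∈ B ∪ Q, range fun n : ℤ => b.re - m * b.im - ρ * n).Countable :=
      (hB.union hQ).countable.biUnion fun b _ => countable_range _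
    obtain ⟨u, hu⟩ := (hc.dense_compl ℝ).nonempty
    refine ⟨u, fun b hb n h => hu (mem_biUnion hb ⟨n, ?_⟩)⟩
    simp only; rw [← h]; field_simp; ring
  have hinj : Function.Injective (skew m u y ρ) :=
    Function.LeftInverse.injective (g := unskew m u y ρ) (unskew_skew hρ.ne')
  have hre : ∀ q v, (skew m u y ρ q).re = (skew m u y ρ (P v)).re →
      q.re - m * q.im = (P v).re - m * (P v).im := fun q v h => by
    simp only [skew] at h
    rw [div_left_inj' hρ.ne'] at h
    linarith
  refine ⟨m, u, y, ?_, { hG.comp_injective continuous_skew hinj with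
    incident := hinc
    mem := hmem
    pl := fun e => (hpl e).skew
    im_ne := fun e s hs => hy _ (hBmem e s hs)
    re_ne := fun e s hs => hu _ (Or.inl (hBmem e s hs))
    re_vertex := fun e s hs v h => ?_
    lattice := fun e t ht n h => ?_ }⟩
  · rw [abs_le]; constructor <;> linarith [hm.1, hm.2]
  · by_contra hne
    exact hmv _ (Or.inl (hBmem e s hs)) v (fun h' => hne (by rw [h'])) (hre _ _ h)
  · have hq : G e t ∈ Q := mem_iUnion.2 ⟨e, t, ⟨ht, n, h⟩, rfl⟩
    exact ⟨fun k => hu _ (Or.inr hq) k, fun v h' =>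
      hmv _ (Or.inr hq) v (hQP _ hq v) (hre _ _ h')⟩

open Classical in
/-- Straightening a piecewise linear drawing at scale `ρ`. -/
theorem Drawing.exists_straightened [Finite E] [Finite V] (hG : Drawing src tgt P G)
    (hinc : ∀ v, ∃ e, v = src e ∨ v = tgt e)
    (hmem : ∀ e, 0 ∈ S e ∧ 1 ∈ S e ∧ ∀ s ∈ S e, s ∈ Icc (0 : ℝ) 1)
    (hpl : ∀ e, PLOn (G e) (S e)) (hP : Function.Injective P) (hloop : ∀ e, src e ≠ tgt e)
    (hsimple : ∀ e e', e ≠ e' → ¬ (src e = src e' ∧ tgt e = tgt e') ∧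
      ¬ (src e = tgt e' ∧ tgt e = src e')) (hρ : 0 < ρ) {K N : ℕ}
    (hK : ∀ z : ℂ, {e | ∃ t ∈ Icc (0 : ℝ) 1, ‖G e t - z‖ ≤ 4 * ρ}.ncard ≤ K)
    (hN : ∀ z : ℂ, {v | ‖P v - z‖ ≤ 4 * ρ}.ncard ≤ N) :
    ∃ (F : E → ℝ → ℂ) (X S : E → Finset ℝ), Drawing src tgt P F ∧ ∀ e,
      0 ∈ X e ∧ 1 ∈ X e ∧ X e ⊆ S e ∧ (∀ s ∈ S e, s ∈ Icc (0 : ℝ) 1) ∧ PLOn (F e) (S e) ∧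
      (∀ t ∈ X e, F e t = G e t) ∧
      (∀ a b, Consec (X e) a b → ((S e).filter fun s => a < s ∧ s < b).card ≤ 2 ∧
        ∀ t ∈ Icc a b, ‖F e t - F e a‖ ≤ 4 * ρ) ∧
      ∀ z R, 0 ≤ R → (((X e).filter fun t => ‖G e t - z‖ ≤ R).card : ℝ) ≤
        (4 * R / ρ + 2) ^ 2 * ((N + 2) ^ 2 * 2 ^ K) + 2 := by
  have := Fintype.ofFinite E
  obtain ⟨m, u, y, hm, hgen⟩ := hG.exists_generic hinc hmem hpl hρ
  have hinj : Function.Injective (skew m u y ρ) :=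
    Function.LeftInverse.injective (g := unskew m u y ρ) (unskew_skew hρ.ne')
  have hinj' : Function.Injective (unskew m u y ρ) :=
    Function.LeftInverse.injective (g := skew m u y ρ) (skew_unskew hρ.ne')
  have hback : ∀ z w : ℂ, ‖skew m u y ρ w - z‖ ≤ 2 → ‖w - unskew m u y ρ z‖ ≤ 4 * ρ :=
    fun z w h => by
      have h1 := norm_unskew_sub_le (u := u) (y := y) hρ hm (skew m u y ρ w) z
      rw [unskew_skew hρ.ne'] at h1
      nlinarith
  obtain ⟨F, X, S', hF, h⟩ := hgen.exists_straightened (hinj.comp hP) hloop hsimple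
    (K := K) (N := N)
    (fun z => (Set.ncard_le_ncard (by
      rintro e ⟨t, ht, h⟩
      exact ⟨t, ht, hback z _ h⟩) (Set.toFinite _)).trans (hK (unskew m u y ρ z)))
    (fun z => (Set.ncard_le_ncard (by
      intro v h
      exact hback z _ h) (Set.toFinite _)).trans (hN (unskew m u y ρ z)))
  refine ⟨fun e t => unskew m u y ρ (F e t), X, S', ?_, fun e => ?_⟩
  · have := hF.comp_injective continuous_unskew hinj'
    simpa only [unskew_skew hρ.ne'] using this
  obtain ⟨h0, h1, h2, h3, h4, h5, h6, h7⟩ := h e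
  refine ⟨h0, h1, h2, h3, h4.unskew, fun t ht => ?_, fun a b hab => ⟨(h6 a b hab).1,
      fun t ht => ?_⟩,
    fun z R hR => ?_⟩
  · change unskew m u y ρ (F e t) = _
    rw [h5 t ht, unskew_skew hρ.ne']
  · have g1 := norm_unskew_sub_le (u := u) (y := y) hρ hm (F e t) (F e a)
    have g2 := (h6 a b hab).2 t ht
    nlinarith
  · have g := h7 (skew m u y ρ z) (2 * R / ρ) (by positivity)
    have hsub : ((X e).filter fun t => ‖G e t - z‖ ≤ R) ⊆
        ((X e).filter fun t => ‖skew m u y ρ (G e t) - skew m u y ρ z‖ ≤ 2 * R / ρ) := by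
      intro t ht
      rw [Finset.mem_filter] at ht ⊢
      refine ⟨ht.1, (norm_skew_sub_le hρ hm _ _).trans ?_⟩
      gcongr
      exact ht.2
    have g' : (((X e).filter fun t => ‖G e t - z‖ ≤ R).card : ℝ) ≤ _ :=
      (Nat.cast_le.2 (Finset.card_le_card hsub)).trans g
    refine g'.trans (le_of_eq ?_)
    ring

end Normalisation

section Polyline

/-- Two segments whose lengths are dominated by cross distances are disjoint. -/
theorem not_segments_meet {a b c d z : ℂ} (hbc : b ≠ c) (had : a ≠ d)
    (h1 : dist a b ≤ dist a c) (h2 : dist c d ≤ dist b d) (hz : dist a z + dist z b = dist a b)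
    (hz' : dist c z + dist z d = dist c d) : False := by
  have t1 := dist_triangle a z c
  have t2 := dist_triangle b z d
  have c1 := dist_comm z b
  have c2 := dist_comm z c
  have e : dist z b = dist z c := by linarith
  have w1 : Wbtw ℝ a z b := dist_add_dist_eq_iff.1 hz
  have w2 : Wbtw ℝ a z c := dist_add_dist_eq_iff.1 (by linarith)
  have w3 : Wbtw ℝ b z d := dist_add_dist_eq_iff.1 (by linarith)
  have w4 : Wbtw ℝ c z d := dist_add_dist_eq_iff.1 (by linarith)
  have key : ∀ {p : ℂ}, z ≠ p → Wbtw ℝ p z b → Wbtw ℝ p z c → False := fun {p} hp g1 g2 => by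
    obtain ⟨r, hr, rfl⟩ := g1
    have s1 := (show Wbtw ℝ p (AffineMap.lineMap p b r) b from ⟨r, hr, rfl⟩).sameRay_vsub_left
    have s1' := (show Wbtw ℝ p (AffineMap.lineMap p b r) b from ⟨r, hr, rfl⟩).sameRay_vsub
    have s2 := g2.sameRay_vsub
    have h := s1'.symm.trans s2 fun h0 => absurd h0 (by simpa [sub_eq_zero] using hp)
    have := (sameRay_iff_of_norm_eq (by
      rw [vsub_eq_sub, vsub_eq_sub, ← dist_eq_norm, ← dist_eq_norm, dist_comm, e, dist_comm])).1 h
    exact hbc (by simpa using this)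
  by_cases hza : z = a
  · refine key (p := d) (fun h => had (hza ▸ h)) w3.symm w4.symm
  · exact key hza w1 w2

/-- Adjacent segments meet only at their common end. -/
theorem eq_of_adjacent_segments_meet {a b d z : ℂ} (hab : a ≠ b) (hbd : b ≠ d)
    (h1 : dist a b ≤ dist a d) (h2 : dist b d ≤ dist a d) (hz : dist a z + dist z b = dist a b)
    (hz' : dist b z + dist z d = dist b d) : z = b := by
  by_contra hne
  have w1 : Wbtw ℝ b z a := (dist_add_dist_eq_iff.1 hz : Wbtw ℝ a z b).symm
  have w2 : Wbtw ℝ b z d := dist_add_dist_eq_iff.1 hz'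
  have s : SameRay ℝ (a - b) (d - b) := by
    refine (w1.sameRay_vsub_left.symm.trans w2.sameRay_vsub_left) fun h => ?_
    exact absurd h (by simpa [sub_eq_zero] using hne)
  have h := s.norm_sub
  rw [sub_sub_sub_cancel_right, ← dist_eq_norm, ← dist_eq_norm, ← dist_eq_norm, dist_comm d b] at h
  have p1 := dist_pos.2 hab
  have p2 := dist_pos.2 hbd
  rcases abs_cases (dist a b - dist b d) with ⟨g, -⟩ | ⟨g, -⟩ <;> linarith

/-- The affine parametrisation of the chord of `γ` over `[a, b]`. -/
def chordPath (γ : ℝ → ℂ) (a b t : ℝ) : ℂ := γ a + (((t - a) / (b - a) : ℝ) : ℂ) * (γ b - γ a)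

variable {γ : ℝ → ℂ} {a b t : ℝ}

theorem chordPath_left : chordPath γ a b a = γ a := by simp [chordPath]

theorem chordPath_right (h : a < b) : chordPath γ a b b = γ b := by
  have : b - a ≠ 0 := (sub_pos.2 h).ne'
  simp [chordPath, div_self this]

theorem continuous_chordPath : Continuous (chordPath γ a b) := by unfold chordPath; fun_prop

theorem dist_left_chordPath (h : a < b) (ht : t ∈ Icc a b) :
    dist (γ a) (chordPath γ a b t) = (t - a) / (b - a) * dist (γ a) (γ b) := by
  have h0 : 0 ≤ (t - a) / (b - a) := div_nonneg (by linarith [ht.1]) (by linarith)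
  rw [dist_comm, dist_eq_norm, dist_comm, dist_eq_norm, chordPath, add_sub_cancel_left, norm_mul,
    Complex.norm_real, Real.norm_of_nonneg h0]

theorem dist_chordPath_right (h : a < b) (ht : t ∈ Icc a b) :
    dist (chordPath γ a b t) (γ b) = (b - t) / (b - a) * dist (γ a) (γ b) := by
  have h0 : 0 ≤ (b - t) / (b - a) := div_nonneg (by linarith [ht.2]) (by linarith)
  have hne : b - a ≠ 0 := (sub_pos.2 h).ne'
  have : chordPath γ a b t - γ b = (((b - t) / (b - a) : ℝ) : ℂ) * (γ a - γ b) := by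
    have e : (t - a) / (b - a) = 1 - (b - t) / (b - a) := by field_simp; ring
    rw [chordPath, e]; push_cast; ring
  rw [dist_eq_norm, this, dist_eq_norm, norm_mul, Complex.norm_real, Real.norm_of_nonneg h0]

theorem dist_add_dist_chordPath (h : a < b) (ht : t ∈ Icc a b) :
    dist (γ a) (chordPath γ a b t) + dist (chordPath γ a b t) (γ b) = dist (γ a) (γ b) := by
  rw [dist_left_chordPath h ht, dist_chordPath_right h ht]
  have hne : b - a ≠ 0 := (sub_pos.2 h).ne'
  field_simp; ring

theorem chordPath_injOn (h : a < b) (hne : γ a ≠ γ b) {s : ℝ}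
    (he : chordPath γ a b s = chordPath γ a b t) : s = t := by
  have h0 : γ b - γ a ≠ 0 := sub_ne_zero.2 hne.symm
  have h1 := mul_right_cancel₀ h0 (add_left_cancel he)
  have h2 := Complex.ofReal_injective h1
  rw [div_left_inj' (sub_pos.2 h).ne'] at h2
  linarith

/-- The polyline inscribed in `γ` with breakpoints `S`. -/
structure Inscribed (γ : ℝ → ℂ) (S : Finset ℝ) (F : ℝ → ℂ) : Prop where
  cont : Continuous F
  eq : ∀ a ∈ S, F a = γ a
  chord : ∀ a b, Consec S a b → ∀ t ∈ Icc a b, F t = chordPath γ a b t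

theorem exists_inscribed (γ : ℝ → ℂ) (S : Finset ℝ) : ∃ F, Inscribed γ S F := by
  obtain ⟨F, h1, h2, h3⟩ := exists_glue_continuousOn S γ (fun a b t => chordPath γ a b t)
    (fun a b _ => continuous_chordPath.continuousOn) (fun a b _ => chordPath_left)
    (fun a b h => chordPath_right h.2.2.1)
  exact ⟨F, h1, h2, h3⟩

theorem Inscribed.plOn {S : Finset ℝ} {F : ℝ → ℂ} (h : Inscribed γ S F) : PLOn F S :=
  fun a b hab => ⟨γ a - ((a / (b - a) : ℝ) : ℂ) * (γ b - γ a),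
    (((b - a)⁻¹ : ℝ) : ℂ) * (γ b - γ a), fun t ht => by
      rw [h.chord a b hab t ht, chordPath, div_eq_mul_inv, div_eq_mul_inv]; push_cast; ring⟩

/-- A greedy inscribed polyline is simple. -/
theorem Inscribed.injOn {S : Finset ℝ} {F : ℝ → ℂ} (h : Inscribed γ S F) {x y : ℝ} (hx : x ∈ S)
    (hy : y ∈ S) (hinj : InjOn γ S)
    (hfwd : ∀ a b, Consec S a b → ∀ c ∈ S, a < c → dist (γ a) (γ b) ≤ dist (γ a) (γ c))
    (hbwd : ∀ a b, Consec S a b → ∀ c ∈ S, c < b → dist (γ a) (γ b) ≤ dist (γ c) (γ b)) :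
    InjOn F (Icc x y) := by
  have key : ∀ s t, s ∈ Icc x y → t ∈ Icc x y → s < t → F s ≠ F t := by
    intro s t hs ht hst heq
    obtain ⟨a, b, hab, -, -, h1, h2⟩ := exists_consec hx hy hs.1 (hst.trans_le ht.2)
    obtain ⟨c, d, hcd, h3, h4⟩ : ∃ c d, Consec S c d ∧ c < t ∧ t ≤ d := by
      rcases mem_or_exists_consec hx hy ht.1 ht.2 with g | ⟨c, d, hcd, g1, g2⟩
      · have hne : (S.filter (· < t)).Nonempty :=
          ⟨a, Finset.mem_filter.2 ⟨hab.1, h1.trans_lt hst⟩⟩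
        have hm := Finset.mem_filter.1 (Finset.max'_mem _ hne)
        refine ⟨_, t, ⟨hm.1, g, hm.2, fun c hc => ?_⟩, hm.2, le_rfl⟩
        by_cases hct : c < t
        · exact Or.inl (Finset.le_max' _ _ (Finset.mem_filter.2 ⟨hc, hct⟩))
        · exact Or.inr (not_lt.1 hct)
      · exact ⟨c, d, hcd, g1, g2.le⟩
    have hsI : s ∈ Icc a b := ⟨h1, h2.le⟩
    have htI : t ∈ Icc c d := ⟨h3.le, h4⟩
    have e1 := h.chord a b hab s hsI
    have e2 := h.chord c d hcd t htI
    have d1 := dist_add_dist_chordPath (γ := γ) hab.2.2.1 hsI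
    have d2 := dist_add_dist_chordPath (γ := γ) hcd.2.2.1 htI
    rw [← e1] at d1
    rw [← e2, ← heq] at d2
    rcases hcd.2.2.2 b hab.2.1 with hbc | hbd
    · rcases hbc.eq_or_lt with rfl | hbc
      · have hz := eq_of_adjacent_segments_meet (hinj.ne hab.1 hab.2.1 hab.2.2.1.ne)
          (hinj.ne hcd.1 hcd.2.1 hcd.2.2.1.ne)
          (hfwd a b hab d hcd.2.1 (hab.2.2.1.trans hcd.2.2.1))
          (hbwd b d hcd a hab.1 (hab.2.2.1.trans hcd.2.2.1)) d1 d2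
        rw [e1, ← chordPath_right (γ := γ) hab.2.2.1] at hz
        exact h2.ne (chordPath_injOn hab.2.2.1 (hinj.ne hab.1 hab.2.1 hab.2.2.1.ne) hz)
      · exact not_segments_meet (hinj.ne hab.2.1 hcd.1 hbc.ne)
          (hinj.ne hab.1 hcd.2.1 (hab.2.2.1.trans (hbc.trans hcd.2.2.1)).ne)
          (hfwd a b hab c hcd.1 (hab.2.2.1.trans hbc))
          (hbwd c d hcd b hab.2.1 (hbc.trans hcd.2.2.1)) d1 d2
    · have : a = c ∧ b = d := by
        rcases hab.2.2.2 c hcd.1 with g1 | g1 <;> rcases hab.2.2.2 d hcd.2.1 with g2 | g2 <;>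
        rcases hcd.2.2.2 a hab.1 with g3 | g3 <;>
          constructor <;> linarith
      obtain ⟨rfl, rfl⟩ := this
      rw [e1, e2] at heq
      exact hst.ne (chordPath_injOn hab.2.2.1 (hinj.ne hab.1 hab.2.1 hab.2.2.1.ne) heq)
  intro s hs t ht heq
  rcases lt_trichotomy s t with g | g | g
  · exact absurd heq (key s t hs ht g)
  · exact g
  · exact absurd heq.symm (key t s ht hs g)

/-- Greedy breakpoints: every step leaves a ball for the last time. -/
theorem exists_greedy {γ : ℝ → ℂ} (hγ : Continuous γ) {x y ρ : ℝ} (hxy : x ≤ y) (hρ : 0 < ρ) :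
    ∃ S : Finset ℝ, x ∈ S ∧ y ∈ S ∧ (∀ s ∈ S, s ∈ Icc x y) ∧ ∀ a b, Consec S a b →
      dist (γ a) (γ b) ≤ ρ ∧ (b = y ∨ ∀ s ∈ Icc b y, ρ ≤ dist (γ a) (γ s)) := by
  classical
  obtain ⟨δ, hδ, hU⟩ := Metric.uniformContinuousOn_iff.1
    (isCompact_Icc.uniformContinuousOn_of_continuous (hγ.continuousOn (s := Icc x y))) ρ hρ
  have main : ∀ n : ℕ, ∀ z ∈ Icc x y, y - z ≤ n * (δ / 2) →
      ∃ S : Finset ℝ, z ∈ S ∧ y ∈ S ∧ (∀ s ∈ S, s ∈ Icc z y) ∧ ∀ a b, Consec S a b →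
      dist (γ a) (γ b) ≤ ρ ∧ (b = y ∨ ∀ s ∈ Icc b y, ρ ≤ dist (γ a) (γ s)) := by
    intro n
    induction n with
    | zero =>
      intro z hz h
      have : z = y := by simp at h; linarith [hz.2]
      subst this
      refine ⟨{z}, by simp, by simp, by simp, fun a b hab => ?_⟩
      have h1 := Finset.mem_singleton.1 hab.1
      have h2 := Finset.mem_singleton.1 hab.2.1
      exact absurd hab.2.2.1 (by rw [h1, h2]; exact lt_irrefl _)
    | succ n ih =>
      intro z hz h
      rcases hz.2.eq_or_lt with rfl | hzy
      · exact ih z hz (by rw [sub_self]; positivity)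
      have hcomp : IsCompact {t ∈ Icc z y | dist (γ z) (γ t) ≤ ρ} :=
        isCompact_Icc.inter_right (isClosed_le
          (show Continuous fun t => dist (γ z) (γ t) by fun_prop) continuous_const)
      obtain ⟨w, hw, hwmax⟩ := hcomp.exists_isGreatest
        ⟨z, ⟨le_rfl, hz.2⟩, by rw [dist_self]; exact hρ.le⟩
      have hmin : min (z + δ / 2) y ≤ w := by
        refine hwmax ⟨⟨le_min (by linarith) hz.2, min_le_right _ _⟩, ?_⟩
        refine (hU z hz _ ⟨le_min (by linarith [hz.1]) hxy, min_le_right _ _⟩ ?_).le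
        rw [Real.dist_eq, abs_lt]
        constructor
        · linarith [min_le_left (z + δ / 2) y]
        · linarith [le_min (show z ≤ z + δ / 2 by linarith) hz.2]
      have hzw : z < w := (lt_min (by linarith) hzy).trans_le hmin
      have hwy : y - w ≤ n * (δ / 2) := by
        push_cast at h
        rcases min_le_iff.1 hmin with g | g
        · linarith
        · have : 0 ≤ (n : ℝ) * (δ / 2) := by positivity
          linarith
      obtain ⟨S, h1, h2, h3, h4⟩ := ih w ⟨hz.1.trans hw.1.1, hw.1.2⟩ hwy
      refine ⟨insert z S, Finset.mem_insert_self _ _, Finset.mem_insert_of_mem h2, fun s hs => ?_,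
        fun a b hab => ?_⟩
      · rcases Finset.mem_insert.1 hs with rfl | hs
        · exact ⟨le_rfl, hz.2⟩
        · exact ⟨hzw.le.trans (h3 s hs).1, (h3 s hs).2⟩
      · have hbS : b ∈ S := by
          refine (Finset.mem_insert.1 hab.2.1).resolve_left fun hb => ?_
          rcases Finset.mem_insert.1 hab.1 with ha | ha
          · exact absurd hab.2.2.1 (by rw [ha, hb]; exact lt_irrefl _)
          · linarith [hab.2.2.1, (h3 a ha).1]
        rcases Finset.mem_insert.1 hab.1 with rfl | ha
        · have hbw : b = w := by
            refine le_antisymm ?_ (h3 b hbS).1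
            exact (hab.2.2.2 w (Finset.mem_insert_of_mem h1)).resolve_left (not_le.2 hzw)
          subst hbw
          refine ⟨hw.2, ?_⟩
          by_cases hby : b = y
          · exact Or.inl hby
          right
          have hlt : ∀ s ∈ Ioc b y, ρ < dist (γ a) (γ s) := fun s hs => by
            by_contra hcon
            exact absurd (hwmax ⟨⟨hzw.le.trans hs.1.le, hs.2⟩, not_lt.1 hcon⟩) (not_le.2 hs.1)
          have hcl : closure (Ioc b y) ⊆ {s | ρ ≤ dist (γ a) (γ s)} :=
            closure_minimal (fun s hs => (hlt s hs).le)
              (isClosed_le continuous_const (by fun_prop))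
          rw [closure_Ioc hby] at hcl
          exact fun s hs => hcl hs
        · exact h4 a b ⟨ha, hbS, hab.2.2.1, fun c hc => hab.2.2.2 c (Finset.mem_insert_of_mem hc)⟩
  obtain ⟨n, hn⟩ := exists_nat_ge ((y - x) / (δ / 2))
  exact main n x ⟨le_rfl, hxy⟩ ((div_le_iff₀ (by positivity)).1 hn)

/-- An injective curve that almost returns has hardly moved in between. -/
theorem exists_wander {γ : ℝ → ℂ} (hγ : Continuous γ) (hinj : InjOn γ (Icc 0 1)) {κ : ℝ}
    (hκ : 0 < κ) : ∃ ρ > 0, ∀ s ∈ Icc (0 : ℝ) 1, ∀ t ∈ Icc (0 : ℝ) 1, dist (γ s) (γ t) < ρ →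
      ∀ u ∈ Icc s t, dist (γ u) (γ s) ≤ κ := by
  obtain ⟨δ, hδ, hU⟩ := Metric.uniformContinuousOn_iff.1
    (isCompact_Icc.uniformContinuousOn_of_continuous (hγ.continuousOn (s := Icc 0 1))) κ hκ
  have hC : IsCompact {p : ℝ × ℝ | p ∈ Icc (0 : ℝ) 1 ×ˢ Icc (0 : ℝ) 1 ∧ δ ≤ p.2 - p.1} :=
    (isCompact_Icc.prod isCompact_Icc).inter_right
      (isClosed_le continuous_const (show Continuous fun p : ℝ × ℝ => p.2 - p.1 by fun_prop))
  obtain ⟨ρ, hρ, h⟩ : ∃ ρ > 0, ∀ p ∈ {p : ℝ × ℝ | p ∈ Icc (0 : ℝ) 1 ×ˢ Icc (0 : ℝ) 1 ∧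
      δ ≤ p.2 - p.1}, ρ ≤ dist (γ p.1) (γ p.2) := by
    rcases eq_empty_or_nonempty {p : ℝ × ℝ | p ∈ Icc (0 : ℝ) 1 ×ˢ Icc (0 : ℝ) 1 ∧ δ ≤ p.2 - p.1}
      with he | hne
    · exact ⟨1, one_pos, fun p hp => by rw [he] at hp; exact hp.elim⟩
    · obtain ⟨q, hq, hmin⟩ := hC.exists_isMinOn hne
        (f := fun p : ℝ × ℝ => dist (γ p.1) (γ p.2)) (by fun_prop)
      refine ⟨_, dist_pos.2 fun h => ?_, fun p hp => hmin hp⟩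
      have := hinj hq.1.1 hq.1.2 h
      linarith [hq.2]
  refine ⟨ρ, hρ, fun s hs t ht hst u hu => ?_⟩
  have hlt : t - s < δ := by
    by_contra hcon
    exact absurd (h (s, t) ⟨⟨hs, ht⟩, not_lt.1 hcon⟩) (not_le.2 hst)
  refine (hU u ⟨hs.1.trans hu.1, hu.2.trans ht.2⟩ s hs ?_).le
  rw [Real.dist_eq, abs_lt]
  constructor <;> linarith [hu.1, hu.2]

end Polyline

section Approximation

theorem exists_last_exit {f : ℝ → ℝ} (hf : Continuous f) {a b r : ℝ} (hab : a ≤ b) (ha : f a ≤ r)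
    (hb : r < f b) : ∃ t ∈ Ico a b, f t = r ∧ ∀ s ∈ Icc t b, r ≤ f s := by
  obtain ⟨t, ht, hmax⟩ := (isCompact_Icc.inter_right
    (isClosed_le hf (continuous_const (y := r)))
        : IsCompact (Icc a b ∩ {t | f t ≤ r})).exists_isGreatest
    ⟨a, ⟨le_rfl, hab⟩, ha⟩
  have htb : t < b := lt_of_le_of_ne ht.1.2 fun h => absurd ht.2 (by rw [h]; exact not_le.2 hb)
  have hlt : ∀ s ∈ Ioc t b, r ≤ f s := fun s hs => by
    by_contra hcon
    exact absurd (hmax ⟨⟨ht.1.1.trans hs.1.le, hs.2⟩, (not_le.1 hcon).le⟩) (not_le.2 hs.1)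
  have hcl : closure (Ioc t b) ⊆ {s | r ≤ f s} :=
    closure_minimal hlt (isClosed_le continuous_const hf)
  rw [closure_Ioc htb.ne] at hcl
  exact ⟨t, ⟨ht.1.1, htb⟩, le_antisymm ht.2 (hcl ⟨le_rfl, htb.le⟩), fun s hs => hcl hs⟩

theorem exists_first_entry {f : ℝ → ℝ} (hf : Continuous f) {a b r : ℝ} (hab : a ≤ b) (ha : r < f a)
    (hb : f b ≤ r) : ∃ t ∈ Ioc a b, f t = r ∧ ∀ s ∈ Icc a t, r ≤ f s := by
  obtain ⟨t, ht, h1, h2⟩ := exists_last_exit (f := fun t => f (-t)) (a := -b) (b := -a) (r := r)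
    (by fun_prop) (by linarith) (by simpa using hb) (by simpa using ha)
  refine ⟨-t, ⟨by linarith [ht.2], by linarith [ht.1]⟩, h1, fun s hs => ?_⟩
  have := h2 (-s) ⟨by linarith [hs.2], by linarith [hs.1]⟩
  simpa using this

theorem Consec.insert_ends {S : Finset ℝ} {x y a b u w : ℝ} (hx : x ∈ S) (hy : y ∈ S)
    (hS : ∀ s ∈ S, s ∈ Icc x y) (hu : u < x) (hw : y < w)
    (h : Consec (insert u (insert w S)) a b) :
    (a = u ∧ b = x) ∨ (a = y ∧ b = w) ∨ Consec S a b := by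
  have hxy := (hS x hx).2
  have hm : ∀ c, c ∈ insert u (insert w S) ↔ c = u ∨ c = w ∨ c ∈ S := fun c => by simp
  have h4 := h.2.2.2
  have h3 := h.2.2.1
  have gx := h4 x ((hm x).2 (Or.inr (Or.inr hx)))
  have gy := h4 y ((hm y).2 (Or.inr (Or.inr hy)))
  rcases (hm a).1 h.1 with ha | ha | ha <;> rcases (hm b).1 h.2.1 with hb | hb | hb
  · subst ha hb; exact absurd h3 (lt_irrefl _)
  · subst ha hb; rcases gx with g | g <;> linarith
  · subst ha
    refine Or.inl ⟨rfl, le_antisymm (gx.resolve_left (not_le.2 hu)) (hS b hb).1⟩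
  · subst ha hb; linarith
  · subst ha hb; exact absurd h3 (lt_irrefl _)
  · subst ha; linarith [(hS b hb).2]
  · subst hb; linarith [(hS a ha).1]
  · subst hb
    exact Or.inr (Or.inl ⟨le_antisymm (hS a ha).2 (gy.resolve_right (not_le.2 hw)), rfl⟩)
  · exact Or.inr (Or.inr ⟨ha, hb, h3, fun c hc => h4 c ((hm c).2 (Or.inr (Or.inr hc)))⟩)

variable {E V : Type*} {src tgt : E → V} {P : V → ℂ} {γ : E → ℝ → ℂ}

theorem Drawing.injOn (hγ : Drawing src tgt P γ) (hP : Function.Injective P)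
    (hloop : ∀ e, src e ≠ tgt e) (e : E) : InjOn (γ e) (Icc 0 1) := by
  have key : ∀ s t, s ∈ Icc (0 : ℝ) 1 → t ∈ Icc (0 : ℝ) 1 → s < t → γ e s ≠ γ e t := by
    intro s t hs ht hst h
    by_cases h0 : 0 < s
    · exact hst.ne (hγ.emb e e s t ⟨h0, hst.trans_le ht.2⟩ ht h).2
    by_cases h1 : t < 1
    · exact hst.ne' (hγ.emb e e t s ⟨hs.1.trans_lt hst, h1⟩ hs h.symm).2
    rw [le_antisymm (not_lt.1 h0) hs.1, le_antisymm ht.2 (not_lt.1 h1), hγ.zero, hγ.one] at h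
    exact hloop e (hP h)
  intro s hs t ht h
  rcases lt_trichotomy s t with g | g | g
  · exact absurd h (key s t hs ht g)
  · exact g
  · exact absurd h.symm (key t s ht hs g)

/-- Radii adapted to a drawing. -/
theorem Drawing.exists_radius [Finite E] [Finite V] (hγ : Drawing src tgt P γ)
    (hinc : ∀ v, ∃ e, v = src e ∨ v = tgt e) (hP : Function.Injective P)
    (hloop : ∀ e, src e ≠ tgt e) {κ : ℝ} (hκ : 0 < κ) :
    ∃ r > 0, r ≤ κ ∧ (∀ v v', v ≠ v' → 4 * r ≤ dist (P v) (P v')) ∧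
      (∀ e v, v ≠ src e → v ≠ tgt e → ∀ t ∈ Icc (0 : ℝ) 1, r ≤ dist (P v) (γ e t)) ∧
      ∀ e, ∀ s ∈ Icc (0 : ℝ) 1, ∀ t ∈ Icc (0 : ℝ) 1, dist (γ e s) (γ e t) ≤ r →
        ∀ u ∈ Icc s t, dist (γ e u) (γ e s) ≤ κ := by
  classical
  obtain ⟨r₁, h1, h1'⟩ := exists_pos_lowerBound
    (f := fun p : V × V => if p.1 = p.2 then 1 else dist (P p.1) (P p.2)) (fun p => by
      split_ifs with h
      · exact one_pos
      · exact dist_pos.2 (hP.ne h))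
  have hev : ∀ p : E × V, ∃ η > 0, p.2 ≠ src p.1 → p.2 ≠ tgt p.1 →
      ∀ t ∈ Icc (0 : ℝ) 1, η ≤ dist (P p.2) (γ p.1 t) := by
    rintro ⟨e, v⟩
    by_cases hv : v = src e
    · exact ⟨1, one_pos, fun h => absurd hv h⟩
    by_cases hv' : v = tgt e
    · exact ⟨1, one_pos, fun _ h => absurd hv' h⟩
    have := hγ.cont e
    obtain ⟨η, hη, h⟩ := exists_pos_lt_of_isCompact (isCompact_Icc (a := (0 : ℝ)) (b := 1))
      (f := fun t => dist (P v) (γ e t)) (by fun_prop) (fun t ht => dist_pos.2 fun heq => by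
        rcases ht.1.eq_or_lt with g | g
        · rw [← g, hγ.zero] at heq; exact hv (hP heq)
        rcases ht.2.eq_or_lt with g' | g'
        · rw [g', hγ.one] at heq; exact hv' (hP heq)
        exact hγ.ne_vertex hinc ⟨g, g'⟩ v heq.symm)
    exact ⟨η, hη, fun _ _ => h⟩
  choose η hη hη' using hev
  obtain ⟨r₂, h2, h2'⟩ := exists_pos_lowerBound hη
  choose w hw hw' using fun e => exists_wander (hγ.cont e) (hγ.injOn hP hloop e) hκ
  obtain ⟨r₃, h3, h3'⟩ := exists_pos_lowerBound hw
  have hr : 0 < min (min κ (r₁ / 4)) (min r₂ (r₃ / 2)) := by positivity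
  refine ⟨_, hr, (min_le_left _ _).trans (min_le_left _ _), fun v v' hv => ?_,
    fun e v g1 g2 t ht => ?_, fun e s hs t ht h u hu => ?_⟩
  · have := h1' (v, v')
    simp only [hv, if_false] at this
    linarith [(min_le_left (min κ (r₁ / 4)) (min r₂ (r₃ / 2))).trans (min_le_right _ _)]
  · exact ((min_le_right _ _).trans (min_le_left _ _)).trans ((h2' (e, v)).trans (hη' (e,
        v) g1 g2 t ht))
  · refine hw' e s hs t ht (h.trans_lt ?_) u hu
    linarith [(min_le_right (min κ (r₁ / 4)) (min r₂ (r₃ / 2))).trans (min_le_right _ _), h3' e]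

/-- Every drawing can be approximated by piecewise linear drawings. -/
theorem Drawing.exists_pl [Finite E] [Finite V] (hγ : Drawing src tgt P γ)
    (hinc : ∀ v, ∃ e, v = src e ∨ v = tgt e) (hP : Function.Injective P)
    (hloop : ∀ e, src e ≠ tgt e) {κ : ℝ} (hκ : 0 < κ) :
    ∃ (G : E → ℝ → ℂ) (S : E → Finset ℝ), Drawing src tgt P G ∧
      (∀ e, 0 ∈ S e ∧ 1 ∈ S e ∧ ∀ s ∈ S e, s ∈ Icc (0 : ℝ) 1) ∧ (∀ e, PLOn (G e) (S e)) ∧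
      ∀ e, ∀ t ∈ Icc (0 : ℝ) 1, dist (G e t) (γ e t) ≤ κ := by
  classical
  obtain ⟨r, hr, hrκ, hVV, hEV, hwan⟩ := hγ.exists_radius hinc hP hloop (half_pos hκ)
  have hst : ∀ e, 4 * r ≤ dist (γ e 0) (γ e 1) := fun e => by
    rw [hγ.zero, hγ.one]; exact hVV _ _ (hloop e)
  have hA : ∀ e, ∃ t ∈ Ico (0 : ℝ) 1, dist (γ e 0) (γ e t) = r ∧
      ∀ s ∈ Icc t 1, r ≤ dist (γ e 0) (γ e s) := fun e => by
    have := hγ.cont e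
    exact exists_last_exit (f := fun t => dist (γ e 0) (γ e t)) (by fun_prop) zero_le_one
      (by rw [dist_self]; exact hr.le) (by linarith [hst e])
  choose A hA0 hA1 hA2 using hA
  have hB : ∀ e, ∃ t ∈ Ioc (A e) 1, dist (γ e 1) (γ e t) = r ∧
      ∀ s ∈ Icc (A e) t, r ≤ dist (γ e 1) (γ e s) := fun e => by
    have := hγ.cont e
    refine exists_first_entry (f := fun t => dist (γ e 1) (γ e t)) (by fun_prop) (hA0 e).2.le
      ?_ (by rw [dist_self]; exact hr.le)
    have := dist_triangle_right (γ e 0) (γ e 1) (γ e (A e))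
    linarith [hst e, hA1 e]
  choose B hB0 hB1 hB2 using hB
  have hA_pos : ∀ e, 0 < A e := fun e => lt_of_le_of_ne (hA0 e).1 fun h => by
    have := hA1 e; rw [← h, dist_self] at this; exact hr.ne this
  have hB_lt : ∀ e, B e < 1 := fun e => lt_of_le_of_ne (hB0 e).2 fun h => by
    have := hB1 e; rw [h, dist_self] at this; exact hr.ne this
  have hAB : ∀ e, A e < B e := fun e => (hB0 e).1
  have hσ : ∀ p : E × E, ∃ σ > 0, p.1 ≠ p.2 → ∀ s ∈ Icc (A p.1) (B p.1),
      ∀ t ∈ Icc (A p.2) (B p.2), σ ≤ dist (γ p.1 s) (γ p.2 t) := by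
    rintro ⟨e, e'⟩
    by_cases h : e = e'
    · exact ⟨1, one_pos, fun h' => absurd h h'⟩
    have h1 := hγ.cont e
    have h2 := hγ.cont e'
    obtain ⟨q, hq, hmin⟩ := (isCompact_Icc.prod isCompact_Icc).exists_isMinOn
      (s := Icc (A e) (B e) ×ˢ Icc (A e') (B e')) ⟨(A e, A e'), ⟨le_rfl, (hAB e).le⟩,
        ⟨le_rfl, (hAB e').le⟩⟩ (f := fun p : ℝ × ℝ => dist (γ e p.1) (γ e' p.2)) (by fun_prop)
    refine ⟨_, dist_pos.2 fun heq => ?_, fun _ s hs t ht => hmin (mk_mem_prod hs ht)⟩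
    exact h (hγ.emb e e' q.1 q.2 ⟨(hA_pos e).trans_le hq.1.1, hq.1.2.trans_lt (hB_lt e)⟩
      ⟨(hA_pos e').le.trans hq.2.1, hq.2.2.trans (hB_lt e').le⟩ heq).1
  choose σ hσ0 hσ1 using hσ
  obtain ⟨δ, hδ, hδσ⟩ := exists_pos_lowerBound hσ0
  set ρ := min r (δ / 3) with hρdef
  have hρ : 0 < ρ := by positivity
  have hρr : ρ ≤ r := min_le_left _ _
  have hρδ : 2 * ρ < δ := by linarith [min_le_right r (δ / 3)]
  have hsep : ∀ e e', e ≠ e' → ∀ s ∈ Icc (A e) (B e), ∀ t ∈ Icc (A e') (B e'),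
      2 * ρ < dist (γ e s) (γ e' t) := fun e e' h s hs t ht =>
    hρδ.trans_le ((hδσ (e, e')).trans (hσ1 (e, e') h s hs t ht))
  choose T hTA hTB hT hgr using fun e => exists_greedy (hγ.cont e) (hAB e).le hρ
  set S : E → Finset ℝ := fun e => insert 0 (insert 1 (T e)) with hS
  have hS0 : ∀ e, 0 ∈ S e := fun e => Finset.mem_insert_self _ _
  have hS1 : ∀ e, 1 ∈ S e := fun e => Finset.mem_insert_of_mem (Finset.mem_insert_self _ _)
  have hSm : ∀ e c, c ∈ S e → c = 0 ∨ c = 1 ∨ c ∈ T e := fun e c hc => by simpa [hS] using hc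
  have hSI : ∀ e, ∀ s ∈ S e, s ∈ Icc (0 : ℝ) 1 := fun e s hs => by
    rcases hSm e s hs with rfl | rfl | h
    · exact ⟨le_rfl, zero_le_one⟩
    · exact ⟨zero_le_one, le_rfl⟩
    · exact ⟨(hA_pos e).le.trans (hT e s h).1, (hT e s h).2.trans (hB_lt e).le⟩
  have hcons : ∀ e a b, Consec (S e) a b → (a = 0 ∧ b = A e) ∨ (a = B e ∧ b = 1) ∨
      Consec (T e) a b := fun e a b h => h.insert_ends (hTA e) (hTB e) (hT e) (hA_pos e) (hB_lt e)
  choose G hG using fun e => exists_inscribed (γ e) (S e)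
  have hstep : ∀ e a b, Consec (S e) a b → dist (γ e a) (γ e b) ≤ r := fun e a b h => by
    rcases hcons e a b h with ⟨rfl, rfl⟩ | ⟨rfl, rfl⟩ | h
    · exact (hA1 e).le
    · rw [dist_comm]; exact (hB1 e).le
    · exact (hgr e a b h).1.trans hρr
  have hfwd : ∀ e a b, Consec (S e) a b → ∀ c ∈ S e, a < c →
      dist (γ e a) (γ e b) ≤ dist (γ e a) (γ e c) := fun e a b h c hc hac => by
    rcases hcons e a b h with ⟨rfl, rfl⟩ | ⟨rfl, rfl⟩ | h'
    · rw [hA1 e]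
      rcases hSm e c hc with rfl | rfl | hc'
      · exact absurd hac (lt_irrefl _)
      · linarith [hst e]
      · exact hA2 e c ⟨(hT e c hc').1, (hSI e c hc).2⟩
    · have : c = 1 := le_antisymm (hSI e c hc).2
        ((h.2.2.2 c hc).resolve_left (not_le.2 hac))
      rw [this]
    · have g := hgr e a b h'
      rcases hSm e c hc with rfl | rfl | hc'
      · exact absurd hac (not_lt.2 (hSI e a h.1).1)
      · refine g.1.trans (hρr.trans ?_)
        rw [dist_comm]
        exact hB2 e a (hT e a h'.1)
      · rcases g.2 with rfl | g2
        · have : c = B e := le_antisymm (hT e c hc').2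
            ((h.2.2.2 c hc).resolve_left (not_le.2 hac))
          rw [this]
        · exact g.1.trans (g2 c ⟨(h.2.2.2 c hc).resolve_left (not_le.2 hac), (hT e c hc').2⟩)
  have hbwd : ∀ e a b, Consec (S e) a b → ∀ c ∈ S e, c < b →
      dist (γ e a) (γ e b) ≤ dist (γ e c) (γ e b) := fun e a b h c hc hcb => by
    have hca : c ≤ a := (h.2.2.2 c hc).resolve_right (not_le.2 hcb)
    rcases hcons e a b h with ⟨rfl, rfl⟩ | ⟨rfl, rfl⟩ | h'
    · rw [le_antisymm hca (hSI e c hc).1]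
    · rw [dist_comm, hB1 e, dist_comm]
      rcases hSm e c hc with rfl | rfl | hc'
      · rw [dist_comm]; linarith [hst e]
      · exact absurd hcb (lt_irrefl _)
      · exact hB2 e c (hT e c hc')
    · have g := hgr e a b h'
      rcases hSm e c hc with rfl | rfl | hc'
      · exact (g.1.trans hρr).trans (hA2 e b ⟨(hT e b h'.2.1).1, (hSI e b h.2.1).2⟩)
      · exact absurd hcb (not_lt.2 (hSI e b h.2.1).2)
      · rcases hca.eq_or_lt with rfl | hca
        · exact le_rfl
        obtain ⟨x, y, hxy, -, hya, hxc, hcy⟩ := exists_consec hc' h'.1 le_rfl hca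
        have hxc : x = c := le_antisymm hxc ((hxy.2.2.2 c hc').resolve_right (not_le.2 hcy))
        subst hxc
        rcases (hgr e x y hxy).2 with rfl | g2
        · linarith [(hT e b h'.2.1).2, h.2.2.1]
        · exact g.1.trans (g2 b ⟨hya.trans h.2.2.1.le, (hT e b h'.2.1).2⟩)
  have hinj : ∀ e, InjOn (G e) (Icc 0 1) := fun e =>
    (hG e).injOn (hS0 e) (hS1 e) ((hγ.injOn hP hloop e).mono (hSI e)) (hfwd e) (hbwd e)
  have hfar : ∀ e v, ∀ x ∈ Icc (A e) (B e), r ≤ dist (P v) (γ e x) := fun e v x hx => by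
    by_cases h1 : v = src e
    · rw [h1, ← hγ.zero]; exact hA2 e x ⟨hx.1, hx.2.trans (hB_lt e).le⟩
    by_cases h2 : v = tgt e
    · rw [h2, ← hγ.one]; exact hB2 e x hx
    exact hEV e v h1 h2 x ⟨(hA_pos e).le.trans hx.1, hx.2.trans (hB_lt e).le⟩
  have hclass : ∀ e, ∀ t ∈ Icc (0 : ℝ) 1,
      (∃ x ∈ Icc (A e) (B e), dist (G e t) (γ e x) ≤ ρ) ∨
      ∃ v, ∃ τ ∈ Icc (A e) (B e), ∃ l ∈ Icc (0 : ℝ) 1, dist (P v) (γ e τ) = r ∧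
        G e t = P v + (l : ℂ) * (γ e τ - P v) ∧ (l = 0 → t ∉ Ioo (0 : ℝ) 1) := by
    intro e t ht
    rcases ht.2.eq_or_lt with rfl | ht1
    · refine Or.inr ⟨tgt e, B e, ⟨(hAB e).le, le_rfl⟩, 0, ⟨le_rfl, zero_le_one⟩, ?_, ?_, ?_⟩
      · rw [← hγ.one, hB1]
      · rw [(hG e).eq 1 (hS1 e), hγ.one]; simp
      · intro _ h; exact lt_irrefl _ h.2
    obtain ⟨a, b, hab, -, -, h1, h2⟩ := exists_consec (hS0 e) (hS1 e) ht.1 ht1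
    have hch := (hG e).chord a b hab t ⟨h1, h2.le⟩
    rcases hcons e a b hab with ⟨rfl, rfl⟩ | ⟨rfl, rfl⟩ | h
    · refine Or.inr ⟨src e, A e, ⟨le_rfl, (hAB e).le⟩, t / A e, ⟨by have := hA_pos e; positivity,
        (div_le_one (hA_pos e)).2 h2.le⟩, ?_, ?_, ?_⟩
      · rw [← hγ.zero, hA1]
      · rw [hch, chordPath, hγ.zero]; simp
      · intro h0 ht'
        rcases div_eq_zero_iff.1 h0 with g | g
        · exact ht'.1.ne' g
        · exact (hA_pos e).ne' g
    · have hne : 1 - B e ≠ 0 := (sub_pos.2 (hB_lt e)).ne'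
      refine Or.inr ⟨tgt e, B e, ⟨(hAB e).le, le_rfl⟩, (1 - t) / (1 - B e),
        ⟨div_nonneg (by linarith) (by linarith [hB_lt e]),
          (div_le_one (by linarith [hB_lt e])).2 (by linarith)⟩, ?_, ?_, ?_⟩
      · rw [← hγ.one, hB1]
      · have e1 : (t - B e) / (1 - B e) = 1 - (1 - t) / (1 - B e) := by field_simp; ring
        rw [hch, chordPath, hγ.one, e1]; push_cast; ring
      · intro h0 ht'
        rcases div_eq_zero_iff.1 h0 with g | g
        · linarith [ht'.2]
        · exact hne g
    · refine Or.inl ⟨a, hT e a h.1, ?_⟩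
      have d1 := dist_add_dist_chordPath (γ := γ e) hab.2.2.1 (t := t) ⟨h1, h2.le⟩
      rw [← hch] at d1
      rw [dist_comm]
      linarith [(hgr e a b h).1, dist_nonneg (x := G e t) (y := γ e b)]
  have hrad : ∀ (v : V) (q : ℂ) (l : ℝ), l ∈ Icc (0 : ℝ) 1 → dist (P v) q = r →
      dist (P v + (l : ℂ) * (q - P v)) (P v) = l * r ∧
      dist (P v + (l : ℂ) * (q - P v)) q = (1 - l) * r := by
    intro v q l hl hq
    rw [dist_comm, dist_eq_norm] at hq
    constructor
    · rw [dist_eq_norm, add_sub_cancel_left, norm_mul, Complex.norm_real,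
        Real.norm_of_nonneg hl.1, hq]
    · rw [dist_comm, dist_eq_norm]
      have : q - (P v + (l : ℂ) * (q - P v)) = ((1 - l : ℝ) : ℂ) * (q - P v) := by push_cast; ring
      rw [this, norm_mul, Complex.norm_real, Real.norm_of_nonneg (by linarith [hl.2]), hq]
  have hMR : ∀ e e', e ≠ e' → ∀ z : ℂ, (∃ x ∈ Icc (A e) (B e), dist z (γ e x) ≤ ρ) →
      (∃ v, ∃ τ ∈ Icc (A e') (B e'), ∃ l ∈ Icc (0 : ℝ) 1, dist (P v) (γ e' τ) = r ∧
        z = P v + (l : ℂ) * (γ e' τ - P v)) → False := by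
    rintro e e' hne z ⟨x, hx, hzx⟩ ⟨v, τ, hτ, l, hl, hd, rfl⟩
    obtain ⟨d1, d2⟩ := hrad v _ l hl hd
    have h1 := hfar e v x hx
    have h2 := dist_triangle_left (P v) (γ e x) (P v + (l : ℂ) * (γ e' τ - P v))
    have h3 := dist_triangle_left (γ e x) (γ e' τ) (P v + (l : ℂ) * (γ e' τ - P v))
    have h4 := hsep e e' hne x hx τ hτ
    nlinarith
  refine ⟨G, S, ⟨fun e => (hG e).cont, fun e => ?_, fun e => ?_, ?_⟩,
    fun e => ⟨hS0 e, hS1 e, hSI e⟩, fun e => (hG e).plOn, fun e t ht => ?_⟩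
  · rw [(hG e).eq 0 (hS0 e), hγ.zero]
  · rw [(hG e).eq 1 (hS1 e), hγ.one]
  · intro e e' s s' hs hs' heq
    by_cases he : e = e'
    · subst he
      exact ⟨rfl, hinj e (Ioo_subset_Icc_self hs) hs' heq⟩
    exfalso
    rcases hclass e s (Ioo_subset_Icc_self hs) with h | ⟨v, τ, hτ, l, hl, hd, hz, hl0⟩ <;>
      rcases hclass e' s' hs' with h' | ⟨v', τ', hτ', l', hl', hd', hz', -⟩
    · obtain ⟨x, hx, g1⟩ := h
      obtain ⟨x', hx', g2⟩ := h'
      rw [heq] at g1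
      linarith [hsep e e' he x hx x' hx', dist_triangle_left (γ e x) (γ e' x') (G e' s')]
    · exact hMR e e' he _ h ⟨v', τ', hτ', l', hl', hd', heq ▸ hz'⟩
    · exact hMR e' e (Ne.symm he) _ h' ⟨v, τ, hτ, l, hl, hd, heq ▸ hz⟩
    · obtain ⟨d1, -⟩ := hrad v _ l hl hd
      obtain ⟨d2, -⟩ := hrad v' _ l' hl' hd'
      rw [← hz] at d1
      rw [← hz', ← heq] at d2
      by_cases hv : v = v'
      · subst hv
        have hll : l = l' := by
          rw [d1] at d2
          exact mul_right_cancel₀ hr.ne' d2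
        subst hll
        have hl1 : (l : ℂ) ≠ 0 := Complex.ofReal_ne_zero.2 fun h0 => hl0 h0 hs
        rw [hz, hz'] at heq
        have h5 := mul_left_cancel₀ hl1 (add_left_cancel heq)
        have h6 : γ e τ = γ e' τ' := sub_left_injective h5
        have h7 := hsep e e' he τ hτ τ' hτ'
        rw [h6, dist_self] at h7
        linarith
      · have h3 := dist_triangle_left (P v) (P v') (G e s)
        have h4 := hVV v v' hv
        nlinarith [hl.2, hl'.2]
  · rcases ht.2.eq_or_lt with rfl | ht1
    · rw [(hG e).eq 1 (hS1 e), dist_self]; exact hκ.le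
    obtain ⟨a, b, hab, -, -, h1, h2⟩ := exists_consec (hS0 e) (hS1 e) ht.1 ht1
    have hch := (hG e).chord a b hab t ⟨h1, h2.le⟩
    have d1 := dist_add_dist_chordPath (γ := γ e) hab.2.2.1 (t := t) ⟨h1, h2.le⟩
    rw [← hch] at d1
    have d2 := hwan e a (hSI e a hab.1) b (hSI e b hab.2.1) (hstep e a b hab) t ⟨h1, h2.le⟩
    have d3 := dist_triangle (G e t) (γ e a) (γ e t)
    have d4 := hstep e a b hab
    have d5 := dist_nonneg (x := G e t) (y := γ e b)
    rw [dist_comm] at d2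
    rw [dist_comm (G e t) (γ e a)] at d3
    linarith

end Approximation

section Retiming

open Classical in
/-- The partition points together with the ends of `n` equal windows. -/
def withWindows (B : Finset ℝ) (n : ℕ) : Finset ℝ :=
  B ∪ (Finset.range (n + 1)).image fun k : ℕ => (k : ℝ) / n

open Classical in
/-- Number of partition points in the window of `y`. -/
def windowCount (B : Finset ℝ) (n : ℕ) (y : ℝ) : ℕ :=
  ((withWindows B n).filter fun x : ℝ => ⌈(n : ℝ) * x⌉₊ = ⌈(n : ℝ) * y⌉₊).card

/-- The new position of a partition point: points in each window become equidistributed. -/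
def equidistribute (B : Finset ℝ) (n : ℕ) (x : ℝ) : ℝ :=
  ∑ y ∈ (withWindows B n).filter (fun y => 0 < y ∧ y ≤ x), ((n : ℝ) * windowCount B n y)⁻¹

variable {B : Finset ℝ} {n : ℕ}

theorem div_mem_withWindows {k : ℕ} (hk : k ≤ n) : (k : ℝ) / n ∈ withWindows B n := by
  classical
  exact Finset.mem_union_right _ (Finset.mem_image.2 ⟨k, Finset.mem_range.2 (by omega), rfl⟩)

theorem windowCount_pos {y : ℝ} (hy : y ∈ withWindows B n) : 0 < windowCount B n y := by
  classical
  exact Finset.card_pos.2 ⟨y, Finset.mem_filter.2 ⟨hy, rfl⟩⟩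

theorem windowCount_le (hn : 0 < n) {N : ℕ}
    (hN : ∀ k : ℕ, (B.filter fun y => (k : ℝ) / n < y ∧ y < (k + 1) / n).card ≤ N) {y : ℝ}
    (hy : 0 < y) : windowCount B n y ≤ N + 1 := by
  classical
  have hn' : (0 : ℝ) < n := Nat.cast_pos.2 hn
  obtain ⟨j, hj⟩ : ∃ j, ⌈(n : ℝ) * y⌉₊ = j + 1 :=
    Nat.exists_eq_succ_of_ne_zero (Nat.ceil_pos.2 (by positivity)).ne'
  have hsub : ((withWindows B n).filter fun x : ℝ => ⌈(n : ℝ) * x⌉₊ = ⌈(n : ℝ) * y⌉₊) ⊆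
      insert (((j + 1 : ℕ) : ℝ) / n) (B.filter fun y => (j : ℝ) / n < y ∧ y < (j + 1) / n) := by
    intro x hx
    rw [Finset.mem_filter, hj] at hx
    obtain ⟨h1, h2⟩ := (Nat.ceil_eq_iff (by omega)).1 hx.2
    rw [Finset.mem_insert, Finset.mem_filter]
    by_cases hxe : x = ((j + 1 : ℕ) : ℝ) / n
    · exact Or.inl hxe
    right
    have h2' : x < (j + 1) / n := by
      refine lt_of_le_of_ne ?_ (by push_cast at hxe; exact hxe)
      rw [le_div_iff₀ hn', mul_comm]; push_cast at h2; exact h2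
    have h1' : (j : ℝ) / n < x := by
      rw [div_lt_iff₀ hn', mul_comm]; simpa using h1
    refine ⟨?_, h1', h2'⟩
    rcases Finset.mem_union.1 hx.1 with h | h
    · exact h
    · obtain ⟨k, -, rfl⟩ := Finset.mem_image.1 h
      rw [div_lt_div_iff_of_pos_right hn'] at h1' h2'
      have a1 : j < k := by exact_mod_cast h1'
      have a2 : k < j + 1 := by exact_mod_cast h2'
      omega
  calc windowCount B n y ≤ _ := Finset.card_le_card hsub
    _ ≤ _ := Finset.card_insert_le _ _
    _ ≤ N + 1 := Nat.add_le_add_right (hN j) 1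

theorem equidistribute_div (hn : 0 < n) {k : ℕ} (hk : k ≤ n) :
    equidistribute B n ((k : ℝ) / n) = (k : ℝ) / n := by
  classical
  have hn' : (0 : ℝ) < n := Nat.cast_pos.2 hn
  induction k with
  | zero =>
    unfold equidistribute
    rw [Finset.sum_eq_zero]
    · simp
    · intro y hy
      have := (Finset.mem_filter.1 hy).2
      simp at this
      linarith
  | succ k ih =>
    have ih := ih (by omega)
    set f : Finset ℝ := (withWindows B n).filter fun x : ℝ => ⌈(n : ℝ) * x⌉₊ = k + 1 with hf
    have hsplit : (withWindows B n).filter (fun y => 0 < y ∧ y ≤ ((k + 1 : ℕ) : ℝ) / n) =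
        (withWindows B n).filter (fun y => 0 < y ∧ y ≤ (k : ℝ) / n) ∪ f := by
      ext y
      simp only [hf, Finset.mem_union, Finset.mem_filter]
      rw [← and_or_left]
      refine and_congr_right fun _ => ?_
      rw [Nat.ceil_eq_iff (by omega), le_div_iff₀ hn', le_div_iff₀ hn']
      simp only [add_tsub_cancel_right]
      have hk0 : (0 : ℝ) ≤ k := Nat.cast_nonneg k
      rw [mul_comm y]
      push_cast
      constructor
      · rintro ⟨h1, h2⟩
        by_cases h : n * y ≤ k
        · exact Or.inl ⟨h1, h⟩
        · exact Or.inr ⟨not_le.1 h, h2⟩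
      · rintro (⟨h1, h2⟩ | ⟨h1, h2⟩)
        · exact ⟨h1, by linarith⟩
        · exact ⟨by by_contra hc; nlinarith, h2⟩
    have hdisj : Disjoint ((withWindows B n).filter (fun y => 0 < y ∧ y ≤ (k : ℝ) / n)) f := by
      rw [Finset.disjoint_left]
      intro y hy hy'
      have h1 := ((Finset.mem_filter.1 hy).2).2
      have h2 := ((Nat.ceil_eq_iff (by omega)).1 (Finset.mem_filter.1 hy').2).1
      rw [le_div_iff₀ hn'] at h1
      simp only [add_tsub_cancel_right] at h2
      linarith
    have hsum : ∑ y ∈ f, ((n : ℝ) * windowCount B n y)⁻¹ = (n : ℝ)⁻¹ := by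
      have hcard : ∀ y ∈ f, windowCount B n y = f.card := fun y hy => by
        unfold windowCount
        rw [(Finset.mem_filter.1 hy).2]
      rw [Finset.sum_congr rfl fun y hy => by rw [hcard y hy], Finset.sum_const, nsmul_eq_mul]
      have hne : (f.card : ℝ) ≠ 0 := Nat.cast_ne_zero.2 (Finset.card_pos.2
        ⟨((k + 1 : ℕ) : ℝ) / n, Finset.mem_filter.2 ⟨div_mem_withWindows hk, by
          rw [mul_div_cancel₀ _ hn'.ne', Nat.ceil_natCast]⟩⟩).ne'
      field_simp
    have : equidistribute B n (((k + 1 : ℕ) : ℝ) / n) = equidistribute B n ((k : ℝ) / n) +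
        ∑ y ∈ f, ((n : ℝ) * windowCount B n y)⁻¹ := by
      unfold equidistribute
      rw [hsplit, Finset.sum_union hdisj]
    rw [this, ih, hsum]
    push_cast
    field_simp

theorem equidistribute_mono : Monotone (equidistribute B n) := by
  classical
  intro x y hxy
  refine Finset.sum_le_sum_of_subset_of_nonneg (fun z hz => ?_) fun _ _ _ => by positivity
  rw [Finset.mem_filter] at hz ⊢
  exact ⟨hz.1, hz.2.1, hz.2.2.trans hxy⟩

theorem equidistribute_consec {a b : ℝ} (ha : 0 ≤ a) (h : Consec (withWindows B n) a b) :
    equidistribute B n b = equidistribute B n a + ((n : ℝ) * windowCount B n b)⁻¹ := by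
  classical
  unfold equidistribute
  have hlt := h.2.2.1
  have : (withWindows B n).filter (fun y => 0 < y ∧ y ≤ b) =
      insert b ((withWindows B n).filter (fun y => 0 < y ∧ y ≤ a)) := by
    ext y
    simp only [Finset.mem_insert, Finset.mem_filter]
    constructor
    · rintro ⟨h1, h2, h3⟩
      rcases h.2.2.2 y h1 with g | g
      · exact Or.inr ⟨h1, h2, g⟩
      · exact Or.inl (le_antisymm h3 g)
    · rintro (rfl | ⟨h1, h2, h3⟩)
      · exact ⟨h.2.1, ha.trans_lt hlt, le_rfl⟩
      · exact ⟨h1, h2, h3.trans hlt.le⟩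
  rw [this, Finset.sum_insert, add_comm]
  intro hb
  linarith [(Finset.mem_filter.1 hb).2.2]

/-- Reparametrisation of the unit interval making a partition quasi-uniform. -/
theorem exists_retiming (h0 : 0 ∈ B) (h1 : 1 ∈ B) (hB : ∀ s ∈ B, s ∈ Icc (0 : ℝ) 1) (hn : 0 < n)
    {N : ℕ} (hN : ∀ k : ℕ, (B.filter fun y => (k : ℝ) / n < y ∧ y < (k + 1) / n).card ≤ N) :
    ∃ (U : Finset ℝ) (φ : ℝ → ℝ), 0 ∈ U ∧ 1 ∈ U ∧ (∀ u ∈ U, u ∈ Icc (0 : ℝ) 1) ∧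
      Continuous φ ∧ StrictMonoOn φ (Icc 0 1) ∧ φ 0 = 0 ∧ φ 1 = 1 ∧
      (∀ t ∈ Icc (0 : ℝ) 1, |φ t - t| ≤ 1 / n) ∧
      ∀ a b, Consec U a b → 1 / (n * (N + 1)) ≤ b - a ∧ b - a ≤ 1 / n ∧
        (∃ p q : ℝ, ∀ t ∈ Icc a b, φ t = p + t * q) ∧ ∀ s ∈ B, s ≤ φ a ∨ φ b ≤ s := by
  classical
  have hn' : (0 : ℝ) < n := Nat.cast_pos.2 hn
  set B' := withWindows B n with hB'
  set σ := equidistribute B n with hσ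
  have hBB : B ⊆ B' := Finset.subset_union_left
  have hB'I : ∀ s ∈ B', s ∈ Icc (0 : ℝ) 1 := fun s hs => by
    rcases Finset.mem_union.1 hs with h | h
    · exact hB s h
    · obtain ⟨k, hk, rfl⟩ := Finset.mem_image.1 h
      have : (k : ℝ) ≤ n := by exact_mod_cast Nat.lt_succ_iff.1 (Finset.mem_range.1 hk)
      exact ⟨by positivity, (div_le_one hn').2 this⟩
  have hσ0 : σ 0 = 0 := by simpa using equidistribute_div (B := B) hn (Nat.zero_le n)
  have hσ1 : σ 1 = 1 := by simpa [hn'.ne'] using equidistribute_div (B := B) hn le_rfl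
  have hσlt : ∀ x ∈ B', ∀ y ∈ B', x < y → σ x < σ y := fun x hx y hy hxy => by
    obtain ⟨a, b, hab, hxa, hby, hax, -⟩ := exists_consec hx hy le_rfl hxy
    have e := equidistribute_consec (hB'I a hab.1).1 hab
    have p : 0 < ((n : ℝ) * windowCount B n b)⁻¹ := by
      have : (0 : ℝ) < windowCount B n b := Nat.cast_pos.2 (windowCount_pos hab.2.1)
      positivity
    have m1 := equidistribute_mono (B := B) (n := n) hxa
    have m2 := equidistribute_mono (B := B) (n := n) hby
    simp only [hσ]
    linarith
  have hσinj : InjOn σ (B' : Set ℝ) := fun x hx y hy h => by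
    rcases lt_trichotomy x y with g | g | g
    · exact absurd h (hσlt x hx y hy g).ne
    · exact g
    · exact absurd h (hσlt y hy x hx g).ne'
  set U := B'.image σ with hU
  set q : ℝ → ℝ := Function.invFunOn σ (B' : Set ℝ) with hq
  have hqσ : ∀ x ∈ B', q (σ x) = x := fun x hx => hσinj.leftInvOn_invFunOn hx
  have hUq : ∀ u ∈ U, ∃ x ∈ B', σ x = u ∧ q u = x := fun u hu => by
    obtain ⟨x, hx, rfl⟩ := Finset.mem_image.1 hu
    exact ⟨x, hx, rfl, hqσ x hx⟩
  have hcons : ∀ a b, Consec U a b → ∃ x y, Consec B' x y ∧ σ x = a ∧ σ y = b ∧ q a = x ∧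
      q b = y := by
    intro a b hab
    obtain ⟨x, hx, hxa, hqx⟩ := hUq a hab.1
    obtain ⟨y, hy, hyb, hqy⟩ := hUq b hab.2.1
    refine ⟨x, y, ⟨hx, hy, ?_, fun c hc => ?_⟩, hxa, hyb, hqx, hqy⟩
    · by_contra hcon
      have := equidistribute_mono (B := B) (n := n) (not_lt.1 hcon)
      simp only [← hσ, hxa, hyb] at this
      exact absurd hab.2.2.1 (not_lt.2 this)
    · rcases hab.2.2.2 (σ c) (Finset.mem_image_of_mem _ hc) with g | g
      · left; by_contra hcon
        have := hσlt x hx c hc (not_le.1 hcon); rw [hxa] at this; linarith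
      · right; by_contra hcon
        have := hσlt c hc y hy (not_le.1 hcon); rw [hyb] at this; linarith
  obtain ⟨φ, hφc, hφU, hφg⟩ := exists_glue_continuousOn U q
    (fun a b t => q a + (t - a) / (b - a) * (q b - q a)) (fun a b _ => by fun_prop)
    (fun a b _ => by simp) (fun a b h => by
      have : b - a ≠ 0 := (sub_pos.2 h.2.2.1).ne'
      rw [div_self this]; ring)
  have hU0 : 0 ∈ U := Finset.mem_image.2 ⟨0, hBB h0, hσ0⟩
  have hU1 : 1 ∈ U := Finset.mem_image.2 ⟨1, hBB h1, hσ1⟩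
  have hφ0 : φ 0 = 0 := by rw [hφU 0 hU0, ← hσ0, hqσ 0 (hBB h0), hσ0]
  have hφ1 : φ 1 = 1 := by rw [hφU 1 hU1, ← hσ1, hqσ 1 (hBB h1), hσ1]
  have hqmono : ∀ u ∈ U, ∀ v ∈ U, u ≤ v → q u ≤ q v := fun u hu v hv huv => by
    obtain ⟨x, hx, rfl, hqx⟩ := hUq u hu
    obtain ⟨y, hy, rfl, hqy⟩ := hUq v hv
    rw [hqx, hqy]
    by_contra hcon
    exact absurd (hσlt y hy x hx (not_le.1 hcon)) (not_lt.2 huv)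
  have hgap : ∀ a b, Consec U a b → ∀ s ∈ Icc a b, ∀ t ∈ Icc a b, s < t → φ s < φ t := by
    intro a b hab s hs t ht hst
    obtain ⟨x, y, hxy, -, -, hqx, hqy⟩ := hcons a b hab
    rw [hφg a b hab s hs, hφg a b hab t ht, hqx, hqy]
    have p1 := sub_pos.2 hab.2.2.1
    have p2 := sub_pos.2 hxy.2.2.1
    have : (s - a) / (b - a) < (t - a) / (b - a) := by gcongr
    nlinarith
  have hmono : ∀ s ∈ Icc (0 : ℝ) 1, ∀ t ∈ Icc (0 : ℝ) 1, s < t → φ s < φ t := by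
    intro s hs t ht hst
    obtain ⟨a, b, hab, -, -, g1, g2⟩ := exists_consec hU0 hU1 hs.1 (hst.trans_le ht.2)
    rcases le_total t b with htb | hbt
    · exact hgap a b hab s ⟨g1, g2.le⟩ t ⟨g1.trans hst.le, htb⟩ hst
    have k1 := hgap a b hab s ⟨g1, g2.le⟩ b ⟨hab.2.2.1.le, le_rfl⟩ g2
    refine k1.trans_le ?_
    rcases ht.2.eq_or_lt with rfl | ht1
    · rw [hφU b hab.2.1, hφU 1 hU1]; exact hqmono b hab.2.1 1 hU1 hbt
    obtain ⟨c, d, hcd, hbc, -, g3, g4⟩ := exists_consec hab.2.1 hU1 hbt ht1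
    have k2 : φ b ≤ φ c := by
      rw [hφU b hab.2.1, hφU c hcd.1]; exact hqmono b hab.2.1 c hcd.1 hbc
    rcases g3.eq_or_lt with rfl | g3'
    · exact k2
    · exact k2.trans (hgap c d hcd c ⟨le_rfl, hcd.2.2.1.le⟩ t ⟨g3, g4.le⟩ g3').le
  refine ⟨U, φ, hU0, hU1, fun u hu => ?_, hφc, fun s hs t ht hst => hmono s hs t ht hst, hφ0, hφ1,
    fun t ht => ?_, fun a b hab => ?_⟩
  · obtain ⟨x, hx, rfl, -⟩ := hUq u hu
    have := hB'I x hx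
    exact ⟨hσ0 ▸ equidistribute_mono this.1, hσ1 ▸ equidistribute_mono this.2⟩
  · rcases ht.2.eq_or_lt with rfl | ht1
    · rw [hφ1]; simp
    obtain ⟨a, b, hab, -, -, g1, g2⟩ := exists_consec hU0 hU1 ht.1 ht1
    obtain ⟨x, y, hxy, hxa, hyb, hqx, hqy⟩ := hcons a b hab
    have hx0 := (hB'I x hxy.1).1
    have hxn : x < 1 := hxy.2.2.1.trans_le (hB'I y hxy.2.1).2
    set k := ⌊n * x⌋₊ with hk
    have f1 : (k : ℝ) ≤ n * x := Nat.floor_le (by positivity)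
    have f2 : n * x < k + 1 := Nat.lt_floor_add_one _
    have hkn : k < n := by
      have : (k : ℝ) < n := f1.trans_lt (by nlinarith)
      exact_mod_cast this
    have hx1 : (k : ℝ) / n ≤ x := by rw [div_le_iff₀ hn']; linarith
    have hx2 : x < ((k + 1 : ℕ) : ℝ) / n := by rw [lt_div_iff₀ hn']; push_cast; linarith
    have hy2 : y ≤ ((k + 1 : ℕ) : ℝ) / n :=
      (hxy.2.2.2 _ (div_mem_withWindows hkn)).resolve_left (not_le.2 hx2)
    have m1 := equidistribute_mono (B := B) (n := n) hx1
    have m2 := equidistribute_mono (B := B) (n := n) hy2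
    rw [equidistribute_div hn hkn.le] at m1
    rw [equidistribute_div hn hkn] at m2
    simp only [← hσ, hxa, hyb] at m1 m2
    have b1 : φ a ≤ φ t := by
      rcases g1.eq_or_lt with rfl | g1'
      · exact le_rfl
      · exact (hgap a b hab a ⟨le_rfl, hab.2.2.1.le⟩ t ⟨g1, g2.le⟩ g1').le
    have b2 := hgap a b hab t ⟨g1, g2.le⟩ b ⟨hab.2.2.1.le, le_rfl⟩ g2
    rw [hφU a hab.1, hqx] at b1
    rw [hφU b hab.2.1, hqy] at b2
    have e : ((k + 1 : ℕ) : ℝ) / n = (k : ℝ) / n + 1 / n := by push_cast; ring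
    rw [e] at m2 hy2
    rw [abs_le]
    constructor <;> linarith
  · obtain ⟨x, y, hxy, hxa, hyb, hqx, hqy⟩ := hcons a b hab
    have e := equidistribute_consec (hB'I x hxy.1).1 hxy
    simp only [← hσ, hxa, hyb] at e
    have c1 : (1 : ℝ) ≤ windowCount B n y := by exact_mod_cast windowCount_pos hxy.2.1
    have c2 : (windowCount B n y : ℝ) ≤ N + 1 := by
      exact_mod_cast windowCount_le hn hN ((hB'I x hxy.1).1.trans_lt hxy.2.2.1)
    refine ⟨?_, ?_, ⟨q a - a / (b - a) * (q b - q a), (q b - q a) / (b - a), fun t ht => ?_⟩,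
      fun s hs => ?_⟩
    · rw [e, add_sub_cancel_left, one_div]
      gcongr
    · rw [e, add_sub_cancel_left, one_div]
      gcongr
      nlinarith
    · rw [hφg a b hab t ht]; ring
    · rw [hφU a hab.1, hφU b hab.2.1, hqx, hqy]
      exact hxy.2.2.2 s (hBB hs)

end Retiming

section Packing

/-- The planar determinant. -/
def planarDet (u v : E2) : ℝ := u 0 * v 1 - u 1 * v 0

theorem sin_angle_mul_dist_mul_dist (p q r : E2) :
    Real.sin (∠ p q r) * (dist p q * dist r q) = |planarDet (p - q) (r - q)| := by
  rw [EuclideanGeometry.angle, dist_eq_norm, dist_eq_norm]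
  simp only [vsub_eq_sub]
  rw [InnerProductGeometry.sin_angle_mul_norm_mul_norm, ← Real.sqrt_sq_eq_abs]
  congr 1
  simp only [PiLp.inner_apply, Fin.sum_univ_two, planarDet, RCLike.inner_apply, conj_trivial]
  ring

theorem abs_planarDet_le (u v : E2) : |planarDet u v| ≤ ‖u‖ * ‖v‖ := by
  have h := sin_angle_mul_dist_mul_dist u 0 v
  rw [sub_zero, sub_zero, dist_zero_right, dist_zero_right] at h
  rw [← h]
  exact mul_le_of_le_one_left (by positivity) (Real.sin_le_one _)

theorem closedBall_centroid_subset {p q r : E2} {L : ℝ} (hpq : dist p q ≤ L) (hpr : dist p r ≤ L)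
    (hqr : dist q r ≤ L) (hD : planarDet (q - p) (r - p) ≠ 0) (hL : 0 < L) :
    closedBall ((3 : ℝ)⁻¹ • (p + q + r)) (|planarDet (q - p) (r - p)| / (3 * L)) ⊆
      convexHull ℝ {p, q, r} := by
  intro x hx
  set D := planarDet (q - p) (r - p) with hDdef
  set v := x - (3 : ℝ)⁻¹ • (p + q + r) with hv
  have hvn : ‖v‖ ≤ |D| / (3 * L) := by
    rw [mem_closedBall, dist_eq_norm] at hx
    exact hx
  have key : ∀ w : E2, ‖w‖ ≤ L → |planarDet v w / D| ≤ 1 / 3 := by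
    intro w hw
    rw [abs_div, div_le_iff₀ (abs_pos.2 hD)]
    calc |planarDet v w| ≤ ‖v‖ * ‖w‖ := abs_planarDet_le _ _
      _ ≤ |D| / (3 * L) * L := by gcongr
      _ = 1 / 3 * |D| := by field_simp
  have k1 := abs_le.1 (key (r - p) (by rwa [← dist_eq_norm, dist_comm]))
  have k2 := abs_le.1 (key (p - q) (by rwa [← dist_eq_norm]))
  have k3 := abs_le.1 (key (q - r) (by rwa [← dist_eq_norm]))
  have hsum : planarDet v (r - p) / D + planarDet v (p - q) / D + planarDet v (q - r) / D = 0 := by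
    rw [← add_div, ← add_div]
    simp only [planarDet, PiLp.sub_apply]
    ring_nf
  rw [convexHull_insert (by simp), convexHull_pair]
  have hx : x = (1 / 3 + planarDet v (q - r) / D) • p + (1 / 3 + planarDet v (r - p) / D) • q +
      (1 / 3 + planarDet v (p - q) / D) • r := by
    have h1 : x = v + (3 : ℝ)⁻¹ • (p + q + r) := by rw [hv]; abel
    have h2 : D • v = planarDet v (q - r) • p + planarDet v (r - p) • q +
        planarDet v (p - q) • r := by
      ext i
      fin_cases i <;> simp [hDdef, planarDet] <;> ring
    have h3 : v = D⁻¹ • (planarDet v (q - r) • p + planarDet v (r - p) • q +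
        planarDet v (p - q) • r) := by
      rw [← h2, smul_smul, inv_mul_cancel₀ hD, one_smul]
    rw [h1]
    nth_rewrite 1 [h3]
    module
  rw [← convexHull_pair, ← convexHull_insert (by simp)]
  rw [hx]
  refine (convex_convexHull ℝ _).sum_mem (t := Finset.univ)
    (w := ![1 / 3 + planarDet v (q - r) / D, 1 / 3 + planarDet v (r - p) / D,
      1 / 3 + planarDet v (p - q) / D]) (z := ![p, q, r]) ?_ ?_ ?_ |> fun h => by
      simpa [Fin.sum_univ_three] using h
  · intro i _
    fin_cases i <;> simp <;> linarith
  · simp only [Fin.sum_univ_three]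
    simp
    linarith
  · intro i _
    apply subset_convexHull
    fin_cases i <;> simp

/-- A fat triangle with sides at least `l` contains a ball of fixed size close to each point. -/
theorem exists_closedBall_subset_triangle {p q r : E2} {l s : ℝ} (hl : 0 < l) (hs : 0 < s)
    (h1 : s ≤ Real.sin (∠ q p r)) (h2 : s ≤ Real.sin (∠ p q r)) (h3 : s ≤ Real.sin (∠ p r q))
    (hpq : l ≤ dist p q) (hpr : l ≤ dist p r) (hqr : l ≤ dist q r) {y : E2}
    (hy : y ∈ convexHull ℝ {p, q, r}) :
    ∃ g, dist g y ≤ l ∧ closedBall g (l * s / 6) ⊆ convexHull ℝ {p, q, r} := by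
  set D := planarDet (q - p) (r - p) with hD
  have d1 : Real.sin (∠ q p r) * (dist p q * dist p r) = |D| := by
    rw [dist_comm p q, dist_comm p r, sin_angle_mul_dist_mul_dist]
  have d2 : Real.sin (∠ p q r) * (dist p q * dist q r) = |D| := by
    rw [dist_comm q r, sin_angle_mul_dist_mul_dist, ← abs_neg, hD]
    congr 1
    simp [planarDet]; ring
  have d3 : Real.sin (∠ p r q) * (dist p r * dist q r) = |D| := by
    rw [sin_angle_mul_dist_mul_dist, hD]
    congr 1
    simp [planarDet]; ring
  obtain ⟨L, hlL, e1, e2, e3, hLD⟩ : ∃ L, l ≤ L ∧ dist p q ≤ L ∧ dist p r ≤ L ∧ dist q r ≤ L ∧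
      L * (L / 2) * s ≤ |D| := by
    have t1 := dist_triangle p r q
    have t2 := dist_triangle p q r
    have t3 := dist_triangle q p r
    rw [dist_comm r q] at t1
    rw [dist_comm q p] at t3
    have fin : ∀ x y t : ℝ, l ≤ x → x / 2 ≤ y → s ≤ t → t * (x * y) = |D| →
        x * (x / 2) * s ≤ |D| := by
      intro x y t hx hy ht h
      rw [← h, mul_comm t]
      have hx0 : 0 < x := hl.trans_le hx
      have hy0 : 0 < y := (half_pos hx0).trans_le hy
      gcongr
    have fin' : ∀ x y t : ℝ, l ≤ x → x / 2 ≤ y → s ≤ t → t * (y * x) = |D| →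
        x * (x / 2) * s ≤ |D| := by
      intro x y t hx hy ht h
      exact fin x y t hx hy ht (by rw [mul_comm x]; exact h)
    rcases le_total (dist p q) (dist p r) with a | a <;>
      rcases le_total (dist p r) (dist q r) with b | b <;>
      rcases le_total (dist p q) (dist q r) with c | c
    · refine ⟨dist q r, hqr, c, b, le_rfl, ?_⟩
      exact fin' _ _ _ hqr (by linarith) h3 d3
    · refine ⟨dist q r, hqr, a.trans b, b, le_rfl, ?_⟩
      exact fin' _ _ _ hqr (by linarith) h3 d3
    · refine ⟨dist p r, hpr, a, le_rfl, b, ?_⟩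
      exact fin _ _ _ hpr (by linarith) h3 d3
    · refine ⟨dist p r, hpr, a, le_rfl, b, ?_⟩
      exact fin' _ _ _ hpr (by linarith) h1 d1
    · refine ⟨dist q r, hqr, c, b, le_rfl, ?_⟩
      exact fin' _ _ _ hqr (by linarith) h2 d2
    · refine ⟨dist p q, hpq, le_rfl, a, c, ?_⟩
      exact fin _ _ _ hpq (by linarith) h2 d2
    · refine ⟨dist p q, hpq, le_rfl, a, b.trans a, ?_⟩
      exact fin _ _ _ hpq (by linarith) h2 d2
    · refine ⟨dist p q, hpq, le_rfl, a, c, ?_⟩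
      exact fin _ _ _ hpq (by linarith) h1 d1
  have hL : 0 < L := hl.trans_le hlL
  have hDpos : 0 < |D| := lt_of_lt_of_le (by positivity) hLD
  have hball := closedBall_centroid_subset e1 e2 e3 (abs_pos.1 hDpos) hL
  set c := (3 : ℝ)⁻¹ • (p + q + r) with hc
  have hcmem : c ∈ convexHull ℝ {p, q, r} := hball (mem_closedBall_self (by positivity))
  have hcy : dist c y ≤ L := by
    have hdiam : ∀ x ∈ convexHull ℝ {p, q, r}, ∀ x' ∈ convexHull ℝ {p, q, r}, dist x x' ≤ L := by
      intro x hx x' hx'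
      obtain ⟨u, hu, v, hv, h⟩ := convexHull_exists_dist_ge2 hx hx'
      refine h.trans ?_
      simp only [mem_insert_iff, mem_singleton_iff] at hu hv
      rcases hu with hu | hu | hu <;> rcases hv with hv | hv | hv <;> rw [hu, hv] <;>
        first | (rw [dist_self]; exact hL.le) | assumption | (rw [dist_comm]; assumption)
    exact hdiam _ hcmem _ hy
  refine ⟨y + (l / L) • (c - y), ?_, ?_⟩
  · rw [dist_eq_norm, add_sub_cancel_left, norm_smul, Real.norm_of_nonneg (by positivity),
      ← dist_eq_norm]
    calc l / L * dist c y ≤ l / L * L := by gcongr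
      _ = l := by field_simp
  · intro x hx
    rw [mem_closedBall, dist_eq_norm] at hx
    set x' := c + (L / l) • (x - (y + (l / L) • (c - y))) with hx'
    have hmem : x' ∈ convexHull ℝ {p, q, r} := by
      apply hball
      rw [mem_closedBall, dist_eq_norm, hx', add_sub_cancel_left, norm_smul,
        Real.norm_of_nonneg (by positivity)]
      calc L / l * ‖x - (y + (l / L) • (c - y))‖ ≤ L / l * (l * s / 6) := by gcongr
        _ = L * (L / 2) * s / (3 * L) := by field_simp; norm_num
        _ ≤ _ := by gcongr
    have hxx : x = (1 - l / L) • y + (l / L) • x' := by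
      have h1 : (l / L) • (L / l) • (x - (y + (l / L) • (c - y))) =
          (x - (y + (l / L) • (c - y))) := by
        rw [smul_smul, show l / L * (L / l) = 1 by field_simp, one_smul]
      rw [hx', smul_add, h1]
      module
    rw [hxx]
    refine convex_convexHull ℝ _ hy hmem ?_ (by positivity) (by ring)
    rw [sub_nonneg, div_le_one hL]
    exact hlL

theorem exists_ncard_le_of_separated (R : ℝ) {δ : ℝ} (hδ : 0 < δ) :
    ∃ K : ℕ, ∀ (z : E2) (A : Set E2), A ⊆ closedBall z R →
      (∀ x ∈ A, ∀ y ∈ A, x ≠ y → δ ≤ dist x y) → A.ncard ≤ K := by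
  obtain ⟨t, -, htf, ht⟩ := finite_cover_balls_of_compact (isCompact_closedBall (0 : E2) R)
    (half_pos hδ)
  refine ⟨t.ncard, fun z A hA hsep => ?_⟩
  have hex : ∀ x ∈ A, ∃ c ∈ t, dist (x - z) c < δ / 2 := by
    intro x hx
    have h1 : x - z ∈ closedBall (0 : E2) R := by
      rw [mem_closedBall, dist_zero_right, ← dist_eq_norm]
      exact hA hx
    simpa using ht h1
  choose! c hct hc using hex
  refine Set.ncard_le_ncard_of_injOn c hct ?_ htf
  intro x hx y hy hxy
  by_contra hne
  have h1 := hsep x hx y hy hne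
  have h2 := hc x hx
  have h3 := hc y hy
  rw [← hxy] at h3
  have h4 := dist_triangle_right (x - z) (y - z) (c x)
  rw [dist_sub_right] at h4
  linarith

/-- In a fat triangulation only boundedly many edges meet a ball of the size of the shortest
edge. -/
theorem exists_ncard_edges_le {l s : ℝ} (hl : 0 < l) (hs : 0 < s) :
    ∃ K : ℕ, ∀ T : SimplicialComplex ℝ E2, T.faces.Finite →
      (∀ e ∈ T.faces, ∃ t ∈ T.faces, e ⊆ t ∧ t.card = 3) → AngleLB T s →
      (∀ e ∈ T.faces, e.card = 2 → l ≤ edgeLen e) → ∀ z : E2,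
      {e ∈ T.faces | (convexHull ℝ (e : Set E2) ∩ closedBall z l).Nonempty}.ncard ≤ K := by
  classical
  obtain ⟨K, hK⟩ := exists_ncard_le_of_separated (2 * l) (δ := l * s / 6) (by positivity)
  refine ⟨K * 8, fun T hfin hpure hang hlen z => ?_⟩
  set A := {t ∈ T.faces | t.card = 3 ∧ (convexHull ℝ (t : Set E2) ∩ closedBall z l).Nonempty}
    with hA
  have hAfin : A.Finite := hfin.subset fun t ht => ht.1
  have hball : ∀ t ∈ A, ∃ g ∈ closedBall z (2 * l),
      closedBall g (l * s / 6) ⊆ convexHull ℝ (t : Set E2) := by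
    rintro t ⟨ht, hc, y, hyt, hyz⟩
    obtain ⟨p, q, r, hpq, hpr, hqr, rfl⟩ := Finset.card_eq_three.1 hc
    have hedge : ∀ a b : E2, a ∈ ({p, q, r} : Finset E2) → b ∈ ({p, q, r} : Finset E2) → a ≠ b →
        l ≤ dist a b := by
      intro a b ha hb hab
      have hf : ({a, b} : Finset E2) ∈ T.faces := T.down_closed ht
        (Finset.insert_subset ha (Finset.singleton_subset_iff.2 hb)) (Finset.insert_nonempty _ _)
      have := hlen _ hf (Finset.card_pair hab)
      simpa [edgeLen, Metric.diam_pair] using this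
    have hcoe : (({p, q, r} : Finset E2) : Set E2) = {p, q, r} := by simp
    rw [hcoe] at hyt ⊢
    obtain ⟨g, hg, hsub⟩ := exists_closedBall_subset_triangle hl hs
      (hang _ ht q (by simp) p (by simp) r (by simp) hpq.symm hpr hqr)
      (hang _ ht p (by simp) q (by simp) r (by simp) hpq hqr hpr)
      (hang _ ht p (by simp) r (by simp) q (by simp) hpr hqr.symm hpq)
      (hedge p q (by simp) (by simp) hpq) (hedge p r (by simp) (by simp) hpr)
      (hedge q r (by simp) (by simp) hqr) hyt
    refine ⟨g, ?_, hsub⟩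
    rw [mem_closedBall] at hyz ⊢
    linarith [dist_triangle g y z]
  choose! g hgz hg using hball
  have hδ : 0 < l * s / 6 := by positivity
  have hsep : ∀ t ∈ A, ∀ t' ∈ A, t ≠ t' → l * s / 6 ≤ dist (g t) (g t') := by
    intro t ht t' ht' hne
    by_contra hlt
    push Not at hlt
    have hc : (t ∩ t').card ≤ 2 := by
      by_contra hc
      push Not at hc
      have h1 : t ∩ t' = t := Finset.eq_of_subset_of_card_le Finset.inter_subset_left
        (by rw [ht.2.1]; omega)
      have h2 : t ∩ t' = t' := Finset.eq_of_subset_of_card_le Finset.inter_subset_right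
        (by rw [ht'.2.1]; omega)
      exact hne (h1.symm.trans h2)
    have hsub : closedBall (g t) (l * s / 6) ∩ closedBall (g t') (l * s / 6) ⊆
        convexHull ℝ ((t ∩ t' : Finset E2) : Set E2) := by
      rw [Finset.coe_inter]
      exact (inter_subset_inter (hg t ht) (hg t' ht')).trans (T.inter_subset_convexHull ht.1 ht'.1)
    have hinter : (interior (convexHull ℝ ((t ∩ t' : Finset E2) : Set E2))).Nonempty := by
      refine ⟨g t, interior_mono hsub ?_⟩
      rw [interior_inter]
      refine ⟨ball_subset_interior_closedBall (mem_ball_self hδ),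
        ball_subset_interior_closedBall hlt⟩
    rw [interior_convexHull_nonempty_iff_affineSpan_eq_top] at hinter
    have hv : vectorSpan ℝ ((t ∩ t' : Finset E2) : Set E2) = ⊤ := by
      rw [← direction_affineSpan, hinter, AffineSubspace.direction_top]
    have h2 : Module.finrank ℝ (vectorSpan ℝ ((t ∩ t' : Finset E2) : Set E2)) = 2 := by
      rw [hv, finrank_top]; simp
    have hne' : 1 ≤ (t ∩ t').card := by
      rw [Nat.one_le_iff_ne_zero, Ne, Finset.card_eq_zero]
      intro h0
      rw [h0] at hinter
      simp at hinter
    have h3 := finrank_vectorSpan_image_finset_le ℝ (id : E2 → E2) (t ∩ t')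
      (n := (t ∩ t').card - 1) (by omega)
    rw [Finset.image_id, h2] at h3
    omega
  have hAK : A.ncard ≤ K := by
    have hinj : InjOn g A := by
      intro t ht t' ht' h
      by_contra hne
      have := hsep t ht t' ht' hne
      rw [h, dist_self] at this
      linarith
    rw [← hinj.ncard_image]
    refine hK z _ (by rintro _ ⟨t, ht, rfl⟩; exact hgz t ht) ?_
    rintro _ ⟨t, ht, rfl⟩ _ ⟨t', ht', rfl⟩ hne
    exact hsep t ht t' ht' fun h => hne (by rw [h])
  have hcov : {e ∈ T.faces | (convexHull ℝ (e : Set E2) ∩ closedBall z l).Nonempty} ⊆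
      ((hAfin.toFinset.biUnion Finset.powerset : Finset (Finset E2)) : Set (Finset E2)) := by
    rintro e ⟨he, hne⟩
    obtain ⟨t, ht, het, htc⟩ := hpure e he
    rw [Finset.mem_coe, Finset.mem_biUnion]
    refine ⟨t, hAfin.mem_toFinset.2 ⟨ht, htc, ?_⟩, Finset.mem_powerset.2 het⟩
    exact hne.mono (inter_subset_inter_left _ (convexHull_mono (Finset.coe_subset.2 het)))
  refine (Set.ncard_le_ncard hcov (Finset.finite_toSet _)).trans ?_
  rw [Set.ncard_coe_finset]
  refine (Finset.card_biUnion_le_card_mul _ _ 8 fun t ht => ?_).trans ?_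
  · rw [Finset.card_powerset, (hAfin.mem_toFinset.1 ht).2.1]; norm_num
  · rw [← Set.ncard_eq_toFinset_card _ hAfin]
    exact Nat.mul_le_mul_right _ hAK

end Packing

section Retimed

theorem card_filter_le_of_gaps {X S : Finset ℝ} (h0 : 0 ∈ X) (h1 : 1 ∈ X)
    (hS : ∀ s ∈ S, s ∈ Icc (0 : ℝ) 1)
    (hgap : ∀ a b, Consec X a b → (S.filter fun s => a < s ∧ s < b).card ≤ 2) (u v : ℝ) :
    (S.filter fun s => u < s ∧ s < v).card ≤
      3 * (X.filter fun s => u < s ∧ s < v).card + 2 := by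
  classical
  set A := S.filter fun s => u < s ∧ s < v with hA
  set Y := X.filter fun s => u < s ∧ s < v with hY
  have hex : ∀ s ∈ A \ Y, ∃ c d, Consec X c d ∧ c < s ∧ s < d := by
    intro s hs
    obtain ⟨hsA, hsY⟩ := Finset.mem_sdiff.1 hs
    obtain ⟨hsS, hsu⟩ := Finset.mem_filter.1 hsA
    obtain ⟨g0, g1⟩ := hS s hsS
    rcases mem_or_exists_consec h0 h1 g0 g1 with h | h
    · exact absurd (Finset.mem_filter.2 ⟨h, hsu⟩) hsY
    · exact h
  choose! c d hcd hcs hsd using hex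
  have hfib : (A \ Y).card ≤ 2 * ((A \ Y).image c).card := by
    refine Finset.card_le_mul_card_image _ 2 fun x hx => ?_
    obtain ⟨s, hs, rfl⟩ := Finset.mem_image.1 hx
    refine (Finset.card_le_card fun s' hs' => ?_).trans (hgap _ _ (hcd s hs))
    obtain ⟨hs', he⟩ := Finset.mem_filter.1 hs'
    rw [Finset.mem_filter]
    refine ⟨(Finset.mem_filter.1 (Finset.mem_sdiff.1 hs').1).1, he ▸ hcs s' hs', ?_⟩
    refine (hsd s' hs').trans_le ?_
    have k := (hcd s' hs').2.2.2 (d s) (hcd s hs).2.1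
    have k' := (hcd s hs).2.2.1
    rcases k with k | k
    · linarith
    · exact k
  have himg : ((A \ Y).image c \ Y).card ≤ 1 := by
    have key : ∀ s ∈ A \ Y, ∀ s' ∈ A \ Y, c s ∉ Y → c s' ∉ Y → c s ≤ c s' := by
      intro s hs s' hs' h h'
      have b := (Finset.mem_filter.1 (Finset.mem_sdiff.1 hs).1).2
      have b' := (Finset.mem_filter.1 (Finset.mem_sdiff.1 hs').1).2
      have e : c s ≤ u := by
        by_contra hu
        push Not at hu
        exact h (Finset.mem_filter.2 ⟨(hcd s hs).1, hu, (hcs s hs).trans b.2⟩)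
      rcases (hcd s' hs').2.2.2 (c s) (hcd s hs).1 with k | k
      · exact k
      · linarith [hsd s' hs']
    rw [Finset.card_le_one]
    intro x hx y hy
    obtain ⟨hx, hxY⟩ := Finset.mem_sdiff.1 hx
    obtain ⟨hy, hyY⟩ := Finset.mem_sdiff.1 hy
    obtain ⟨s, hs, rfl⟩ := Finset.mem_image.1 hx
    obtain ⟨s', hs', rfl⟩ := Finset.mem_image.1 hy
    exact le_antisymm (key s hs s' hs' hxY hyY) (key s' hs' s hs hyY hxY)
  have e1 := Finset.card_le_card_sdiff_add_card (s := A) (t := Y)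
  have e2 := Finset.card_le_card_sdiff_add_card (s := (A \ Y).image c) (t := Y)
  omega

theorem PLOn.comp {F : ℝ → ℂ} {S U : Finset ℝ} {φ : ℝ → ℝ} (hF : PLOn F S) (h0 : 0 ∈ S)
    (h1 : 1 ∈ S) (hU : ∀ u ∈ U, u ∈ Icc (0 : ℝ) 1) (hφ : StrictMonoOn φ (Icc 0 1)) (hφ0 : φ 0 = 0)
    (hφ1 : φ 1 = 1)
    (haff : ∀ a b, Consec U a b → (∃ p q : ℝ, ∀ t ∈ Icc a b, φ t = p + t * q) ∧
      ∀ s ∈ S, s ≤ φ a ∨ φ b ≤ s) : PLOn (fun t => F (φ t)) U := by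
  intro a b hab
  obtain ⟨⟨p, q, hpq⟩, hs⟩ := haff a b hab
  have ha := hU a hab.1
  have hb := hU b hab.2.1
  have z0 : (0 : ℝ) ∈ Icc (0 : ℝ) 1 := ⟨le_rfl, zero_le_one⟩
  have z1 : (1 : ℝ) ∈ Icc (0 : ℝ) 1 := ⟨zero_le_one, le_rfl⟩
  have e0 : 0 ≤ φ a := hφ0 ▸ hφ.monotoneOn z0 ha ha.1
  have e1 : φ b ≤ 1 := hφ1 ▸ hφ.monotoneOn hb z1 hb.2
  have hlt := hφ ha hb hab.2.2.1
  obtain ⟨c, d, hcd, -, -, hca, had⟩ := exists_consec h0 h1 e0 (hlt.trans_le e1)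
  have hbd : φ b ≤ d := (hs d hcd.2.1).resolve_left (not_le.2 had)
  obtain ⟨P, D, hPD⟩ := hF c d hcd
  refine ⟨P + p * D, q * D, fun t ht => ?_⟩
  have htI : t ∈ Icc (0 : ℝ) 1 := ⟨ha.1.trans ht.1, ht.2.trans hb.2⟩
  have : φ t ∈ Icc c d := ⟨hca.trans (hφ.monotoneOn ha htI ht.1),
    (hφ.monotoneOn htI hb ht.2).trans hbd⟩
  simp only
  rw [hPD _ this, hpq t ht]
  push_cast
  ring

variable {E V : Type*} {src tgt : E → V} {P : V → ℂ} {γ : E → ℝ → ℂ}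

theorem Drawing.reparam {F : E → ℝ → ℂ} (hF : Drawing src tgt P F) {φ : E → ℝ → ℝ}
    (hc : ∀ e, Continuous (φ e)) (hm : ∀ e, StrictMonoOn (φ e) (Icc 0 1)) (h0 : ∀ e, φ e 0 = 0)
    (h1 : ∀ e, φ e 1 = 1) : Drawing src tgt P fun e t => F e (φ e t) := by
  have z0 : (0 : ℝ) ∈ Icc (0 : ℝ) 1 := ⟨le_rfl, zero_le_one⟩
  have z1 : (1 : ℝ) ∈ Icc (0 : ℝ) 1 := ⟨zero_le_one, le_rfl⟩
  refine ⟨fun e => (hF.cont e).comp (hc e), fun e => ?_, fun e => ?_, fun e e' s s' hs hs' h => ?_⟩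
  · simp only [h0, hF.zero]
  · simp only [h1, hF.one]
  · have hsI : s ∈ Icc (0 : ℝ) 1 := Ioo_subset_Icc_self hs
    have a1 : φ e s ∈ Ioo (0 : ℝ) 1 := by
      have := hm e z0 hsI hs.1
      have := hm e hsI z1 hs.2
      rw [h0] at *; rw [h1] at *
      constructor <;> assumption
    have a2 : φ e' s' ∈ Icc (0 : ℝ) 1 := by
      have := (hm e').monotoneOn z0 hs' hs'.1
      have := (hm e').monotoneOn hs' z1 hs'.2
      rw [h0] at *; rw [h1] at *
      constructor <;> assumption
    obtain ⟨rfl, h'⟩ := hF.emb e e' _ _ a1 a2 h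
    exact ⟨rfl, (hm e).injOn hsI hs' h'⟩

/-- Bi-Hölder drawings of graphs have piecewise affine approximations whose breakpoints are
quantitatively separated. -/
theorem Drawing.exists_separated_pl [Finite E] [Finite V] (hγ : Drawing src tgt P γ)
    (hinc : ∀ v, ∃ e, v = src e ∨ v = tgt e) (hP : Function.Injective P)
    (hloop : ∀ e, src e ≠ tgt e)
    (hsimple : ∀ e e', e ≠ e' → ¬ (src e = src e' ∧ tgt e = tgt e') ∧
      ¬ (src e = tgt e' ∧ tgt e = src e'))
    {ρ w H H' α α' : ℝ} (hρ : 0 < ρ) (hw : 0 < w) (hH : 0 ≤ H) (hH' : 0 ≤ H') (hα : 0 ≤ α)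
    (hα' : 0 ≤ α') {len : E → ℝ} (hlen : ∀ e, w ≤ len e) (hwρ : H' * (5 * ρ) ^ α' ≤ w)
    (hold : ∀ e, ∀ s ∈ Icc (0 : ℝ) 1, ∀ t ∈ Icc (0 : ℝ) 1,
      ‖γ e s - γ e t‖ ≤ H * (len e * |s - t|) ^ α)
    (hinv : ∀ e, ∀ s ∈ Icc (0 : ℝ) 1, ∀ t ∈ Icc (0 : ℝ) 1,
      len e * |s - t| ≤ H' * ‖γ e s - γ e t‖ ^ α') {K N : ℕ}
    (hK : ∀ z : ℂ, {e | ∃ t ∈ Icc (0 : ℝ) 1, ‖γ e t - z‖ ≤ 5 * ρ}.ncard ≤ K)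
    (hN : ∀ z : ℂ, {v | ‖P v - z‖ ≤ 4 * ρ}.ncard ≤ N) :
    ∃ (F : E → ℝ → ℂ) (U : E → Finset ℝ), Drawing src tgt P F ∧ ∀ e,
      0 ∈ U e ∧ 1 ∈ U e ∧ (∀ u ∈ U e, u ∈ Icc (0 : ℝ) 1) ∧ PLOn (F e) (U e) ∧
      (∀ t ∈ Icc (0 : ℝ) 1, ‖F e t - γ e t‖ ≤ 5 * ρ + H * (3 * w) ^ α) ∧
      ∀ a b, Consec (U e) a b →
        w / (3 * ((4 * (5 * ρ + H * (3 * w) ^ α) / ρ + 2) ^ 2 * ((N + 2) ^ 2 * 2 ^ K) + 2) + 3) ≤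
          len e * (b - a) ∧ len e * (b - a) ≤ 2 * w := by
  classical
  obtain ⟨G, S₀, hG, hS₀, hGpl, hGγ⟩ := hγ.exists_pl hinc hP hloop (half_pos hρ)
  simp only [dist_eq_norm] at hGγ
  obtain ⟨F, X, S, hF, h⟩ := hG.exists_straightened hinc hS₀ hGpl hP hloop hsimple hρ (K := K)
    (N := N) (fun z => (Set.ncard_le_ncard (by
      rintro e ⟨t, ht, h⟩
      refine ⟨t, ht, ?_⟩
      have h1 := norm_sub_le_norm_sub_add_norm_sub (γ e t) (G e t) z
      have h2 := hGγ e t ht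
      rw [norm_sub_rev] at h2
      linarith) (Set.toFinite _)).trans (hK z)) hN
  set R := 5 * ρ + H * (3 * w) ^ α with hR
  have hR0 : 0 ≤ R := by positivity
  set m := (4 * R / ρ + 2) ^ 2 * ((N + 2) ^ 2 * 2 ^ K) + 2 with hm
  have hm0 : 0 < m := by positivity
  set n : E → ℕ := fun e => ⌊len e / w⌋₊ with hn
  have hlen0 : ∀ e, 0 < len e := fun e => hw.trans_le (hlen e)
  have hn0 : ∀ e, 0 < n e := fun e => Nat.floor_pos.2 ((one_le_div hw).2 (hlen e))
  have hn1 : ∀ e, w ≤ len e / n e := by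
    intro e
    have h1 : (n e : ℝ) ≤ len e / w := Nat.floor_le (div_nonneg (hlen0 e).le hw.le)
    have h0 : (0 : ℝ) < n e := Nat.cast_pos.2 (hn0 e)
    rw [le_div_iff₀ h0]
    rw [le_div_iff₀ hw] at h1
    linarith
  have hn2 : ∀ e, len e / n e ≤ 2 * w := by
    intro e
    have h1 : len e / w < n e + 1 := Nat.lt_floor_add_one _
    have h0 : (1 : ℝ) ≤ n e := by exact_mod_cast hn0 e
    rw [div_le_iff₀ (by linarith)]
    rw [div_lt_iff₀ hw] at h1
    nlinarith
  have hXI : ∀ e, ∀ t ∈ X e, t ∈ Icc (0 : ℝ) 1 := fun e t ht => (h e).2.2.2.1 t ((h e).2.2.1 ht)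
  have hcount : ∀ e, ∀ k : ℕ, ((S e).filter fun y => (k : ℝ) / n e < y ∧ y < (k + 1) / n e).card ≤
      ⌊3 * m + 2⌋₊ := by
    intro e k
    obtain ⟨h0, h1, h2, h3, h4, h5, h6, h7⟩ := h e
    have hn' : (0 : ℝ) < n e := Nat.cast_pos.2 (hn0 e)
    refine Nat.le_floor ?_
    rcases le_or_gt ((k : ℝ) / n e) 1 with hk | hk
    swap
    · rw [Finset.filter_false_of_mem]
      · simp; positivity
      · intro y hy hy'
        linarith [(h3 y hy).2]
    have hkI : (k : ℝ) / n e ∈ Icc (0 : ℝ) 1 := ⟨by positivity, hk⟩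
    have e1 := card_filter_le_of_gaps h0 h1 h3 (fun a b hab => (h6 a b hab).1) ((k : ℝ) / n e)
      ((k + 1) / n e)
    have e2 : (((X e).filter fun s => (k : ℝ) / n e < s ∧ s < (k + 1) / n e).card : ℝ) ≤ m := by
      refine le_trans ?_ (h7 (γ e ((k : ℝ) / n e)) R hR0)
      rw [Nat.cast_le]
      refine Finset.card_le_card fun t ht => ?_
      obtain ⟨htX, ht1, ht2⟩ := Finset.mem_filter.1 ht
      refine Finset.mem_filter.2 ⟨htX, ?_⟩
      have htI := hXI e t htX
      have g1 := hGγ e t htI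
      have g2 := hold e t htI _ hkI
      have g3 : len e * |t - (k : ℝ) / n e| ≤ 3 * w := by
        rw [abs_of_pos (by linarith)]
        have : t - (k : ℝ) / n e ≤ 1 / n e := by
          rw [add_div] at ht2; linarith
        calc len e * (t - (k : ℝ) / n e) ≤ len e * (1 / n e) := by
              have := hlen0 e
              gcongr
          _ = len e / n e := by ring
          _ ≤ 3 * w := by linarith [hn2 e]
      have g4 : H * (len e * |t - (k : ℝ) / n e|) ^ α ≤ H * (3 * w) ^ α := by
        have := hlen0 e
        gcongr
      have g5 := norm_sub_le_norm_sub_add_norm_sub (G e t) (γ e t) (γ e ((k : ℝ) / n e))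
      linarith
    have e3 : (((S e).filter fun y => (k : ℝ) / n e < y ∧ y < (k + 1) / n e).card : ℝ) ≤
        3 * (((X e).filter fun s => (k : ℝ) / n e < s ∧ s < (k + 1) / n e).card : ℝ) + 2 := by
      exact_mod_cast e1
    linarith
  have hret := fun e => exists_retiming ((h e).2.2.1 (h e).1) ((h e).2.2.1 (h e).2.1)
    (h e).2.2.2.1 (hn0 e) (hcount e)
  choose U φ hU0 hU1 hUI hφc hφm hφ0 hφ1 hφt hUc using hret
  refine ⟨fun e t => F e (φ e t), U, hF.reparam hφc hφm hφ0 hφ1, fun e => ?_⟩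
  obtain ⟨h0, h1, h2, h3, h4, h5, h6, h7⟩ := h e
  have hn' : (0 : ℝ) < n e := Nat.cast_pos.2 (hn0 e)
  have hl := hlen0 e
  refine ⟨hU0 e, hU1 e, hUI e, h4.comp (h2 h0) (h2 h1) (hUI e) (hφm e) (hφ0 e) (hφ1 e)
    (fun a b hab => (hUc e a b hab).2.2), fun t ht => ?_, fun a b hab => ?_⟩
  · have z0 : (0 : ℝ) ∈ Icc (0 : ℝ) 1 := ⟨le_rfl, zero_le_one⟩
    have z1 : (1 : ℝ) ∈ Icc (0 : ℝ) 1 := ⟨zero_le_one, le_rfl⟩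
    set ψ := φ e t with hψ
    have hψ0 : 0 ≤ ψ := hφ0 e ▸ (hφm e).monotoneOn z0 ht ht.1
    have hψ1 : ψ ≤ 1 := hφ1 e ▸ (hφm e).monotoneOn ht z1 ht.2
    have hψt : len e * |ψ - t| ≤ 2 * w := by
      calc len e * |ψ - t| ≤ len e * (1 / n e) := by gcongr; exact hφt e t ht
        _ = len e / n e := by ring
        _ ≤ _ := hn2 e
    obtain ⟨c, hcX, hFc, hcψ⟩ : ∃ c ∈ X e, ‖F e ψ - F e c‖ ≤ 4 * ρ ∧ len e * |c - ψ| ≤ w := by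
      rcases mem_or_exists_consec h0 h1 hψ0 hψ1 with hx | ⟨c, d, hcd, hc, hd⟩
      · refine ⟨ψ, hx, ?_, ?_⟩
        · rw [sub_self, norm_zero]; positivity
        · rw [sub_self, abs_zero, mul_zero]; exact hw.le
      · have hcI := hXI e c hcd.1
        have hdI := hXI e d hcd.2.1
        refine ⟨c, hcd.1, (h6 c d hcd).2 ψ ⟨hc.le, hd.le⟩, ?_⟩
        calc len e * |c - ψ| ≤ len e * |c - d| := by
              rw [abs_of_neg (by linarith), abs_of_neg (by linarith)]
              gcongr
          _ ≤ H' * ‖γ e c - γ e d‖ ^ α' := hinv e c hcI d hdI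
          _ ≤ H' * (5 * ρ) ^ α' := by
              gcongr
              have g1 := (h6 c d hcd).2 d ⟨hcd.2.2.1.le, le_rfl⟩
              rw [h5 c hcd.1, h5 d hcd.2.1] at g1
              have g2 := hGγ e c hcI
              have g3 := hGγ e d hdI
              have g4 := norm_sub_le_norm_sub_add_norm_sub (γ e c) (G e c) (γ e d)
              have g5 := norm_sub_le_norm_sub_add_norm_sub (G e c) (G e d) (γ e d)
              rw [norm_sub_rev] at g1 g2
              linarith
          _ ≤ w := hwρ
    have hcI := hXI e c hcX
    have g1 := hold e c hcI t ht
    have g2 : len e * |c - t| ≤ 3 * w := by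
      have : |c - t| ≤ |c - ψ| + |ψ - t| := abs_sub_le _ _ _
      nlinarith
    have g3 : H * (len e * |c - t|) ^ α ≤ H * (3 * w) ^ α := by gcongr
    have g4 := hGγ e c hcI
    rw [← h5 c hcX] at g4
    have g5 := norm_sub_le_norm_sub_add_norm_sub (F e ψ) (F e c) (γ e t)
    have g6 := norm_sub_le_norm_sub_add_norm_sub (F e c) (γ e c) (γ e t)
    linarith
  · obtain ⟨c1, c2, -⟩ := hUc e a b hab
    constructor
    · have hfl : (⌊3 * m + 2⌋₊ : ℝ) ≤ 3 * m + 2 := Nat.floor_le (by positivity)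
      calc w / (3 * m + 3) ≤ (len e / n e) / (⌊3 * m + 2⌋₊ + 1) := by
            exact div_le_div₀ (by positivity) (hn1 e) (by positivity) (by linarith)
        _ = len e * (1 / (n e * (⌊3 * m + 2⌋₊ + 1))) := by field_simp
        _ ≤ _ := by gcongr
    · calc len e * (b - a) ≤ len e * (1 / n e) := by gcongr
        _ = len e / n e := by ring
        _ ≤ _ := hn2 e

end Retimed

section Scales

theorem exists_scale_constant {α α' H H' : ℝ} (hα : 0 < α) (hα' : 0 < α') (hH : 0 < H)
    (hH' : 0 < H') :
    ∃ c > 0, 5 * c ≤ 1 / 2 ∧ H * (3 * (H' * (5 * c) ^ α')) ^ α ≤ 1 / 2 := by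
  set q := ((2 * H)⁻¹) ^ (1 / α) with hq
  have hq0 : 0 < q := by positivity
  set s := (q / (3 * H')) ^ (1 / α') with hs
  have hs0 : 0 < s := by positivity
  have hsα : s ^ α' = q / (3 * H') := by
    rw [hs, ← Real.rpow_mul (by positivity), one_div_mul_cancel hα'.ne', Real.rpow_one]
  have hqα : q ^ α = (2 * H)⁻¹ := by
    rw [hq, ← Real.rpow_mul (by positivity), one_div_mul_cancel hα.ne', Real.rpow_one]
  refine ⟨min (1 / 2) s / 5, by positivity, ?_, ?_⟩
  · rw [mul_div_cancel₀ _ (by norm_num)]; exact min_le_left _ _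
  · rw [mul_div_cancel₀ _ (by norm_num)]
    calc H * (3 * (H' * min (1 / 2) s ^ α')) ^ α ≤ H * (3 * (H' * s ^ α')) ^ α := by
          gcongr; exact min_le_right _ _
      _ = H * q ^ α := by rw [hsα]; congr 2; field_simp
      _ = 1 / 2 := by rw [hqα]; field_simp

theorem exists_scales {α α' l H H' : ℝ} (hα0 : 0 < α) (hα1 : α ≤ 1) (hα'0 : 0 < α')
    (hα'1 : α' ≤ 1) (hl : 0 < l) (hH : 0 < H) (hH' : 0 < H') {C : ℝ} (hC : 0 ≤ C) :
    ∃ ε₀ > (0 : ℝ), ∃ B₁ > (0 : ℝ), ∃ B₂ > (0 : ℝ), ∀ ε : ℝ, 0 < ε → ε ≤ ε₀ →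
      ∃ ρ > (0 : ℝ), ∃ w > (0 : ℝ), w ≤ l ∧ H' * (5 * ρ) ^ α' ≤ w ∧ H' * (10 * ρ) ^ α' ≤ l ∧
        5 * ρ + H * (3 * w) ^ α ≤ ε ∧
        B₁ * ε ^ (-2 / α + 2 / (α ^ 2 * α') + 1 / (α ^ 3 * α' ^ 2)) <
          w / (3 * ((4 * (5 * ρ + H * (3 * w) ^ α) / ρ + 2) ^ 2 * C + 2) + 3) ∧
        2 * w < B₂ * ε ^ (1 / α) := by
  obtain ⟨c, hc, hc5, hcH⟩ := exists_scale_constant hα0 hα'0 hH hH'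
  set W := H' * (5 * c) ^ α' with hW
  have hW0 : 0 < W := by positivity
  set D := 3 * ((4 / c + 2) ^ 2 * C + 2) + 3 with hD
  have hD0 : 0 < D := by positivity
  refine ⟨min 1 (l / (H' * (10 * c) ^ α')), by positivity, W / (2 * D), by positivity, 3 * W,
    by positivity, fun ε hε hε₀ => ?_⟩
  have hε1 : ε ≤ 1 := hε₀.trans (min_le_left _ _)
  have hεl : H' * (10 * c) ^ α' * ε ≤ l := by
    have := hε₀.trans (min_le_right _ _)
    rw [le_div_iff₀ (by positivity)] at this
    linarith
  set p := 1 / (α * α') with hp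
  have hp1 : 1 ≤ p := by
    rw [hp, le_div_iff₀ (by positivity), one_mul]
    exact mul_le_one₀ hα1 hα'0.le hα'1
  have hα1' : 1 ≤ 1 / α := (one_le_div hα0).2 hα1
  have hpow : ∀ k : ℝ, 0 < k → (k * (c * ε ^ p)) ^ α' = (k * c) ^ α' * ε ^ (1 / α) := by
    intro k hk
    rw [← mul_assoc, Real.mul_rpow (by positivity) (by positivity), ← Real.rpow_mul hε.le]
    congr 2
    rw [hp]; field_simp
  have hεα : ε ^ (1 / α) ≤ ε := by
    simpa using Real.rpow_le_rpow_of_exponent_ge hε hε1 hα1'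
  have hεp : ε ^ p ≤ ε := by
    simpa using Real.rpow_le_rpow_of_exponent_ge hε hε1 hp1
  have h10 : H' * (10 * (c * ε ^ p)) ^ α' ≤ l := by
    rw [hpow 10 (by norm_num), ← mul_assoc]
    refine le_trans ?_ hεl
    gcongr
  have hw5 : H' * (5 * (c * ε ^ p)) ^ α' = W * ε ^ (1 / α) := by
    rw [hpow 5 (by norm_num), ← mul_assoc]
  have hR : 5 * (c * ε ^ p) + H * (3 * (W * ε ^ (1 / α))) ^ α ≤ ε := by
    have h1 : 5 * (c * ε ^ p) ≤ 1 / 2 * ε := by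
      rw [← mul_assoc]; gcongr
    have h2 : H * (3 * (W * ε ^ (1 / α))) ^ α ≤ 1 / 2 * ε := by
      rw [← mul_assoc 3, Real.mul_rpow (by positivity) (by positivity), ← Real.rpow_mul hε.le,
        one_div_mul_cancel hα0.ne', Real.rpow_one, ← mul_assoc]
      gcongr
    linarith
  refine ⟨c * ε ^ p, by positivity, W * ε ^ (1 / α), by positivity, ?_, hw5.le, h10, hR, ?_, ?_⟩
  · rw [← hw5]
    refine le_trans ?_ h10
    gcongr
    norm_num
  · set R := 5 * (c * ε ^ p) + H * (3 * (W * ε ^ (1 / α))) ^ α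
    have hR0 : 0 ≤ R := by positivity
    set x := ε ^ (1 - p) with hx
    have hx1 : 1 ≤ x := Real.one_le_rpow_of_pos_of_le_one_of_nonpos hε hε1 (by linarith)
    have hRx : R / (c * ε ^ p) ≤ x / c := by
      calc R / (c * ε ^ p) ≤ ε / (c * ε ^ p) := by gcongr
        _ = x / c := by
          rw [hx, Real.rpow_sub hε, Real.rpow_one]; field_simp
    have hden : 3 * ((4 * R / (c * ε ^ p) + 2) ^ 2 * C + 2) + 3 ≤ D * x ^ 2 := by
      have h1 : 4 * R / (c * ε ^ p) + 2 ≤ (4 / c + 2) * x := by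
        have : 4 * R / (c * ε ^ p) = 4 * (R / (c * ε ^ p)) := by ring
        have h2 : (4 / c + 2) * x = 4 * (x / c) + 2 * x := by ring
        rw [this, h2]
        linarith
      have h2 : (4 * R / (c * ε ^ p) + 2) ^ 2 * C ≤ ((4 / c + 2) * x) ^ 2 * C := by gcongr
      have h3 : (1 : ℝ) ≤ x ^ 2 := one_le_pow₀ hx1
      rw [hD]
      nlinarith
    have hexp : ε ^ (-2 / α + 2 / (α ^ 2 * α') + 1 / (α ^ 3 * α' ^ 2)) * x ^ 2 ≤ ε ^ (1 / α) := by
      have : x ^ 2 = ε ^ (2 * (1 - p)) := by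
        rw [mul_comm, Real.rpow_mul hε.le]; norm_cast
      rw [this, ← Real.rpow_add hε]
      refine Real.rpow_le_rpow_of_exponent_ge hε hε1 ?_
      have e1 : -2 / α + 2 / (α ^ 2 * α') + 1 / (α ^ 3 * α' ^ 2) =
          -2 * (1 / α) + 2 * (1 / α) * p + (1 / α) * p ^ 2 := by
        rw [hp]; field_simp
      rw [e1]
      nlinarith [mul_nonneg (sub_nonneg.2 hα1') (sub_nonneg.2 hp1),
        mul_nonneg (zero_le_one.trans hα1') (mul_nonneg (sub_nonneg.2 hp1)
          (by linarith : (0 : ℝ) ≤ p + 1))]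
    have hdpos : 0 < 3 * ((4 * R / (c * ε ^ p) + 2) ^ 2 * C + 2) + 3 := by positivity
    set b := ε ^ (-2 / α + 2 / (α ^ 2 * α') + 1 / (α ^ 3 * α' ^ 2))
    have hb : 0 < b := by positivity
    calc W / (2 * D) * b < W / D * b := by
          gcongr
          linarith
      _ = W * (b * x ^ 2) / (D * x ^ 2) := by field_simp
      _ ≤ W * ε ^ (1 / α) / (D * x ^ 2) := by gcongr
      _ ≤ _ := by gcongr
  · have : 0 < W * ε ^ (1 / α) := by positivity
    linarith

end Scales

section Assembly

theorem affineIndependent_coe_pair (a b : E2) :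
    AffineIndependent ℝ ((↑) : (({a, b} : Finset E2) : Set E2) → E2) := by
  rcases eq_or_ne a b with rfl | hab
  · have : Subsingleton (({a, a} : Finset E2) : Set E2) := by
      rw [Finset.pair_eq_singleton, Finset.coe_singleton]
      infer_instance
    exact affineIndependent_of_subsingleton ℝ _
  · have h := (affineIndependent_of_ne ℝ hab).range
    have e : ((({a, b} : Finset E2) : Set E2)) = range ![a, b] := by
      simp [Set.pair_comm]
    rw [e]
    exact h

theorem convexHull_lineMap_pair (p q : E2) {a b : ℝ} (hab : a ≤ b) :
    convexHull ℝ (({AffineMap.lineMap p q a, AffineMap.lineMap p q b} : Finset E2) : Set E2) =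
      AffineMap.lineMap p q '' Icc a b := by
  rw [Finset.coe_pair, convexHull_pair, ← image_segment, segment_eq_Icc hab]

theorem IsCompact.isHomeoOn {f : E2 → E2} {S : Set E2} (hS : IsCompact S) (hf : ContinuousOn f S)
    (hinj : InjOn f S) : IsHomeoOn f S := by
  refine ⟨hf, hinj, continuousOn_iff_isClosed.2 fun t ht => ?_⟩
  refine ⟨f '' (t ∩ S), ((hS.inter_left ht).image_of_continuousOn
    (hf.mono inter_subset_right)).isClosed, ?_⟩
  ext y
  constructor
  · rintro ⟨hy, x, hx, rfl⟩
    rw [mem_preimage, hinj.leftInvOn_invFunOn hx] at hy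
    exact ⟨⟨x, ⟨hy, hx⟩, rfl⟩, x, hx, rfl⟩
  · rintro ⟨⟨x, ⟨hxt, hx⟩, rfl⟩, -⟩
    refine ⟨?_, x, hx, rfl⟩
    rw [mem_preimage, hinj.leftInvOn_invFunOn hx]
    exact hxt

/-- The affine parameter of the projection to the line through `p` and `q`. -/
def lineParam (p q y : E2) : ℝ := inner ℝ (q - p) (y - p) / ‖q - p‖ ^ 2

theorem lineParam_lineMap {p q : E2} (h : p ≠ q) (t : ℝ) :
    lineParam p q (AffineMap.lineMap p q t) = t := by
  have : ‖q - p‖ ≠ 0 := norm_ne_zero_iff.2 (sub_ne_zero.2 h.symm)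
  rw [lineParam, AffineMap.lineMap_apply, vsub_eq_sub, vadd_eq_add, add_sub_cancel_right,
    inner_smul_right, real_inner_self_eq_norm_sq]
  field_simp

theorem continuous_lineParam (p q : E2) : Continuous (lineParam p q) := by
  unfold lineParam
  fun_prop

theorem exists_affineMap_lineMap {p q : E2} (h : p ≠ q) (c d : E2) :
    ∃ A : E2 →ᵃ[ℝ] E2, ∀ t : ℝ, A (AffineMap.lineMap p q t) = c + t • d := by
  have hn : ‖q - p‖ ≠ 0 := norm_ne_zero_iff.2 (sub_ne_zero.2 h.symm)
  refine ⟨(((innerSL ℝ (q - p)).toLinearMap.smulRight ((‖q - p‖ ^ 2)⁻¹ • d)).toAffineMap.comp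
    (AffineMap.id ℝ E2 - AffineMap.const ℝ E2 p)) + AffineMap.const ℝ E2 c, fun t => ?_⟩
  have := lineParam_lineMap h t
  rw [lineParam, div_eq_mul_inv] at this
  simp only [AffineMap.coe_add, Pi.add_apply, AffineMap.coe_comp, Function.comp_apply,
    AffineMap.const_apply, LinearMap.coe_toAffineMap, AffineMap.coe_sub, Pi.sub_apply,
    AffineMap.id_apply, LinearMap.smulRight_apply, ContinuousLinearMap.coe_coe, innerSL_apply_apply,
    smul_smul, this]
  rw [add_comm]

variable {E V : Type*} {src tgt : E → V} {P P' : V → ℂ} {F F' : E → ℝ → ℂ}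

theorem Drawing.vertex_of_not_mem_Ioo (hF : Drawing src tgt P F) (e : E) {t : ℝ}
    (ht : t ∈ Icc (0 : ℝ) 1) (h : t ∉ Ioo (0 : ℝ) 1) :
    ∃ v, (t = 0 ∧ v = src e ∨ t = 1 ∧ v = tgt e) ∧ F e t = P v := by
  rcases eq_or_lt_of_le ht.1 with h0 | h0
  · exact ⟨src e, Or.inl ⟨h0.symm, rfl⟩, by rw [← h0, hF.zero]⟩
  · rcases eq_or_lt_of_le ht.2 with h1 | h1
    · exact ⟨tgt e, Or.inr ⟨h1, rfl⟩, by rw [h1, hF.one]⟩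
    · exact absurd ⟨h0, h1⟩ h

/-- Two drawings of the same graph make the same identifications. -/
theorem Drawing.eq_of_eq (hF : Drawing src tgt P F) (hF' : Drawing src tgt P' F')
    (hP : Function.Injective P) {e e' : E} {t t' : ℝ} (ht : t ∈ Icc (0 : ℝ) 1)
    (ht' : t' ∈ Icc (0 : ℝ) 1) (h : F e t = F e' t') : F' e t = F' e' t' := by
  by_cases h1 : t ∈ Ioo (0 : ℝ) 1
  · obtain ⟨rfl, rfl⟩ := hF.emb e e' t t' h1 ht' h
    rfl
  by_cases h2 : t' ∈ Ioo (0 : ℝ) 1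
  · obtain ⟨rfl, rfl⟩ := hF.emb e' e t' t h2 ht h.symm
    rfl
  obtain ⟨v, hv, e1⟩ := hF.vertex_of_not_mem_Ioo e ht h1
  obtain ⟨v', hv', e2⟩ := hF.vertex_of_not_mem_Ioo e' ht' h2
  have hvv : v = v' := hP (by rw [← e1, ← e2, h])
  subst hvv
  have f1 : F' e t = P' v := by
    rcases hv with ⟨rfl, rfl⟩ | ⟨rfl, rfl⟩
    · exact hF'.zero e
    · exact hF'.one e
  have f2 : F' e' t' = P' v := by
    rcases hv' with ⟨rfl, rfl⟩ | ⟨rfl, rfl⟩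
    · exact hF'.zero e'
    · exact hF'.one e'
  rw [f1, f2]

/-- Identification of the complex numbers with the Euclidean plane. -/
def toPlane : ℂ ≃ₗᵢ[ℝ] E2 := Complex.orthonormalBasisOneI.repr

theorem exists_lineMap_complex {p : V → E2} [Finite E]
    (hX : Drawing src tgt (fun v => toPlane.symm (p v))
      fun e t => toPlane.symm (AffineMap.lineMap (p (src e)) (p (tgt e)) t))
    {U : E → Finset ℝ} (hU : ∀ e, 0 ∈ U e ∧ 1 ∈ U e ∧ ∀ u ∈ U e, u ∈ Icc (0 : ℝ) 1) :
    ∃ K : SimplicialComplex ℝ E2, ∀ s, s ∈ K.faces ↔ ∃ e a b, a ∈ U e ∧ b ∈ U e ∧ a ≤ b ∧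
      (∀ c ∈ U e, c ≤ a ∨ b ≤ c) ∧
      s = {AffineMap.lineMap (p (src e)) (p (tgt e)) a,
        AffineMap.lineMap (p (src e)) (p (tgt e)) b} := by
  set x : E → ℝ → E2 := fun e t => AffineMap.lineMap (p (src e)) (p (tgt e)) t with hx
  have emb : ∀ e e' s s', s ∈ Ioo (0 : ℝ) 1 → s' ∈ Icc (0 : ℝ) 1 → x e s = x e' s' →
      e = e' ∧ s = s' := fun e e' s s' hs hs' h =>
    hX.emb e e' s s' hs hs' (by simpa only using congrArg toPlane.symm h)
  have hmem : ∀ e e' t t', t ∈ Icc (0 : ℝ) 1 → t' ∈ Icc (0 : ℝ) 1 → x e t = x e' t' →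
      t ∈ U e → t' ∈ U e' := by
    intro e e' t t' ht ht' h htU
    by_cases h2 : t' ∈ Ioo (0 : ℝ) 1
    · obtain ⟨rfl, rfl⟩ := emb e' e t' t h2 ht h.symm
      exact htU
    · obtain ⟨v, hv, -⟩ := hX.vertex_of_not_mem_Ioo e' ht' h2
      rcases hv with ⟨rfl, -⟩ | ⟨rfl, -⟩
      · exact (hU e').1
      · exact (hU e').2.1
  refine ⟨
    { faces := {s | ∃ e a b, a ∈ U e ∧ b ∈ U e ∧ a ≤ b ∧
        (∀ c ∈ U e, c ≤ a ∨ b ≤ c) ∧ s = {x e a, x e b}}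
      isRelLowerSet_faces := ?_
      indep := ?_
      inter_subset_convexHull := ?_ }, fun s => Iff.rfl⟩
  · rintro s ⟨e, a, b, ha, hb, hab, hc, rfl⟩
    refine ⟨Finset.insert_nonempty _ _, fun t hts hne => ?_⟩
    have hs1 : ∀ c ∈ U e, ({x e c} : Finset E2) ∈ {s | ∃ e a b, a ∈ U e ∧ b ∈ U e ∧ a ≤ b ∧
      (∀ c ∈ U e, c ≤ a ∨ b ≤ c) ∧ s = {x e a, x e b}} := fun c hcU =>
      ⟨e, c, c, hcU, hcU, le_rfl, fun d _ => le_total d c, by rw [Finset.pair_eq_singleton]⟩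
    have hts' : t ⊆ {x e a, x e b} := hts
    rw [← Finset.coe_subset, Finset.coe_pair, Set.subset_pair_iff_eq, ← Finset.coe_pair,
      Finset.coe_inj, Finset.coe_eq_empty, Finset.coe_eq_singleton, Finset.coe_eq_singleton] at hts'
    rcases hts' with rfl | rfl | rfl | rfl
    · exact absurd hne Finset.not_nonempty_empty
    · exact hs1 a ha
    · exact hs1 b hb
    · exact ⟨e, a, b, ha, hb, hab, hc, rfl⟩
  · rintro s ⟨e, a, b, ha, hb, hab, hc, rfl⟩
    exact affineIndependent_coe_pair _ _
  · rintro s t ⟨e, a, b, ha, hb, hab, hc, rfl⟩ ⟨e', a', b', ha', hb', hab', hc', rfl⟩ y ⟨hy, hy'⟩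
    rw [convexHull_lineMap_pair _ _ hab] at hy
    rw [convexHull_lineMap_pair _ _ hab'] at hy'
    obtain ⟨τ, hτ, rfl⟩ := hy
    obtain ⟨τ', hτ', he⟩ := hy'
    have hτI : τ ∈ Icc (0 : ℝ) 1 := ⟨((hU e).2.2 a ha).1.trans hτ.1, hτ.2.trans ((hU e).2.2 b hb).2⟩
    have hτI' : τ' ∈ Icc (0 : ℝ) 1 :=
      ⟨((hU e').2.2 a' ha').1.trans hτ'.1, hτ'.2.trans ((hU e').2.2 b' hb').2⟩
    have hxx : x e τ = x e' τ' := he.symm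
    have hvert : ∀ {e a b τ}, (∀ c ∈ U e, c ≤ a ∨ b ≤ c) → τ ∈ Icc a b → τ ∈ U e →
        x e τ ∈ ({x e a, x e b} : Finset E2) := by
      intro e a b τ hc hτ hτU
      rw [Finset.mem_insert, Finset.mem_singleton]
      rcases hc τ hτU with k | k
      · left; rw [le_antisymm k hτ.1]
      · right; rw [le_antisymm hτ.2 k]
    by_cases hτU : τ ∈ U e
    · have hτU' := hmem e e' τ τ' hτI hτI' hxx hτU
      apply subset_convexHull
      refine ⟨hvert hc hτ hτU, ?_⟩
      have := hvert hc' hτ' hτU'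
      rw [← hxx] at this
      exact this
    · have hIoo : τ ∈ Ioo (0 : ℝ) 1 := by
        by_contra hn
        obtain ⟨v, hv, -⟩ := hX.vertex_of_not_mem_Ioo e hτI hn
        rcases hv with ⟨rfl, -⟩ | ⟨rfl, -⟩
        · exact hτU (hU e).1
        · exact hτU (hU e).2.1
      obtain ⟨rfl, rfl⟩ := emb e e' τ τ' hIoo hτI' hxx
      have n1 : ∀ {c}, c ∈ U e → c ≠ τ := fun hcU h => hτU (h ▸ hcU)
      have s1 := lt_of_le_of_ne hτ.1 (n1 ha)
      have s2 := lt_of_le_of_ne hτ.2 (n1 hb).symm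
      have s3 := lt_of_le_of_ne hτ'.1 (n1 ha')
      have s4 := lt_of_le_of_ne hτ'.2 (n1 hb').symm
      obtain ⟨rfl, rfl⟩ := Consec.eq_of_mem (S := U e) ⟨ha, hb, s1.trans s2, hc⟩
        ⟨ha', hb', s3.trans s4, hc'⟩ s1 s2 s3 s4
      rw [inter_self]
      change x e τ ∈ _
      rw [convexHull_lineMap_pair _ _ hab]
      exact ⟨τ, hτ, rfl⟩

/-- A piecewise affine drawing of a straight-line graph is induced by a piecewise affine
homeomorphism of its underlying set. -/
theorem exists_piecewiseAffine_of_drawing [Finite E] {p : V → E2} (hp : Function.Injective p)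
    (hloop : ∀ e, src e ≠ tgt e)
    (hX : Drawing src tgt (fun v => toPlane.symm (p v))
      fun e t => toPlane.symm (AffineMap.lineMap (p (src e)) (p (tgt e)) t))
    (hF : Drawing src tgt P F) (hP : Function.Injective P)
    {U : E → Finset ℝ} (hU : ∀ e, 0 ∈ U e ∧ 1 ∈ U e ∧ ∀ u ∈ U e, u ∈ Icc (0 : ℝ) 1)
    (hpl : ∀ e, PLOn (F e) (U e)) :
    ∃ (f : E2 → E2) (K : SimplicialComplex ℝ E2), K.faces.Finite ∧ (∀ s ∈ K.faces, s.card ≤ 2) ∧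
      K.space = (⋃ e, AffineMap.lineMap (p (src e)) (p (tgt e)) '' Icc (0 : ℝ) 1) ∧
      (∀ e, {p (src e)} ∈ K.faces ∧ {p (tgt e)} ∈ K.faces) ∧
      IsHomeoOn f K.space ∧ PiecewiseAffineOn f K ∧
      (∀ e, ∀ t ∈ Icc (0 : ℝ) 1,
        f (AffineMap.lineMap (p (src e)) (p (tgt e)) t) = toPlane (F e t)) ∧
      ∀ s ∈ K.faces, s.card = 2 → ∃ e a b, Consec (U e) a b ∧
        edgeLen s = dist (p (src e)) (p (tgt e)) * (b - a) := by
  classical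
  set x : E → ℝ → E2 := fun e t => AffineMap.lineMap (p (src e)) (p (tgt e)) t with hx
  have hne : ∀ e, p (src e) ≠ p (tgt e) := fun e h => hloop e (hp h)
  have hpi : Function.Injective fun v => toPlane.symm (p v) := toPlane.symm.injective.comp hp
  have hFX : ∀ {e e' t t'}, t ∈ Icc (0 : ℝ) 1 → t' ∈ Icc (0 : ℝ) 1 → x e t = x e' t' →
      F e t = F e' t' := fun ht ht' h =>
    hX.eq_of_eq hF hpi ht ht' (by simpa only using congrArg toPlane.symm h)
  have hXF : ∀ {e e' t t'}, t ∈ Icc (0 : ℝ) 1 → t' ∈ Icc (0 : ℝ) 1 → F e t = F e' t' →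
      x e t = x e' t' := fun ht ht' h => toPlane.symm.injective (hF.eq_of_eq hX hP ht ht' h)
  obtain ⟨K, hK⟩ := exists_lineMap_complex hX hU
  obtain ⟨f, hf⟩ : ∃ f : E2 → E2, ∀ e, ∀ t ∈ Icc (0 : ℝ) 1, f (x e t) = toPlane (F e t) := by
    refine ⟨fun y => if h : ∃ q : E × ℝ, q.2 ∈ Icc (0 : ℝ) 1 ∧ y = x q.1 q.2 then
      toPlane (F h.choose.1 h.choose.2) else 0, fun e t ht => ?_⟩
    have h : ∃ q : E × ℝ, q.2 ∈ Icc (0 : ℝ) 1 ∧ x e t = x q.1 q.2 := ⟨(e, t), ht, rfl⟩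
    simp only
    rw [dif_pos h, hFX h.choose_spec.1 ht h.choose_spec.2.symm]
  have hspace : K.space = ⋃ e, x e '' Icc (0 : ℝ) 1 := by
    ext y
    rw [SimplicialComplex.mem_space_iff, mem_iUnion]
    constructor
    · rintro ⟨s, hs, hy⟩
      obtain ⟨e, a, b, ha, hb, hab, hc, rfl⟩ := (hK s).1 hs
      rw [convexHull_lineMap_pair _ _ hab] at hy
      obtain ⟨t, ht, rfl⟩ := hy
      exact ⟨e, t, ⟨((hU e).2.2 a ha).1.trans ht.1, ht.2.trans ((hU e).2.2 b hb).2⟩, rfl⟩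
    · rintro ⟨e, t, ht, rfl⟩
      obtain ⟨a, b, ha, hb, hab, hc, hta⟩ : ∃ a b, a ∈ U e ∧ b ∈ U e ∧ a ≤ b ∧
          (∀ c ∈ U e, c ≤ a ∨ b ≤ c) ∧ t ∈ Icc a b := by
        rcases mem_or_exists_consec (hU e).1 (hU e).2.1 ht.1 ht.2 with h | ⟨a, b, h, h1, h2⟩
        · exact ⟨t, t, h, h, le_rfl, fun c _ => le_total c t, le_rfl, le_rfl⟩
        · exact ⟨a, b, h.1, h.2.1, h.2.2.1.le, h.2.2.2, h1.le, h2.le⟩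
      refine ⟨_, (hK _).2 ⟨e, a, b, ha, hb, hab, hc, rfl⟩, ?_⟩
      rw [convexHull_lineMap_pair _ _ hab]
      exact ⟨t, hta, rfl⟩
  have hxc : ∀ e, Continuous (x e) := fun e => AffineMap.lineMap_continuous
  have hcpt : ∀ e, IsCompact (x e '' Icc (0 : ℝ) 1) := fun e => isCompact_Icc.image (hxc e)
  refine ⟨f, K, ?_, fun s hs => ?_, hspace, fun e => ⟨?_, ?_⟩, ?_, fun s hs => ?_, hf,
    fun s hs hc => ?_⟩
  · refine (Set.finite_range (fun q : Σ e : E, U e × U e =>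
      ({x q.1 q.2.1, x q.1 q.2.2} : Finset E2))).subset fun s hs => ?_
    obtain ⟨e, a, b, ha, hb, hab, hc, rfl⟩ := (hK s).1 hs
    exact ⟨⟨e, ⟨a, ha⟩, ⟨b, hb⟩⟩, rfl⟩
  · obtain ⟨e, a, b, ha, hb, hab, hc, rfl⟩ := (hK s).1 hs
    exact Finset.card_le_two
  · exact (hK _).2 ⟨e, 0, 0, (hU e).1, (hU e).1, le_rfl, fun c _ => le_total c 0, by simp⟩
  · exact (hK _).2 ⟨e, 1, 1, (hU e).2.1, (hU e).2.1, le_rfl, fun c _ => le_total c 1, by simp⟩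
  · rw [hspace]
    refine (isCompact_iUnion hcpt).isHomeoOn ?_ ?_
    · refine (locallyFinite_of_finite _).continuousOn_iUnion (fun e => (hcpt e).isClosed)
        fun e => ?_
      have hc : Continuous fun y => toPlane (F e (lineParam (p (src e)) (p (tgt e)) y)) :=
        toPlane.continuous.comp ((hF.cont e).comp (continuous_lineParam _ _))
      refine hc.continuousOn.congr ?_
      rintro _ ⟨t, ht, rfl⟩
      simp only [hx, lineParam_lineMap (hne e)]
      exact hf e t ht
    · intro y hy y' hy' h
      obtain ⟨e, t, ht, rfl⟩ := mem_iUnion.1 hy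
      obtain ⟨e', t', ht', rfl⟩ := mem_iUnion.1 hy'
      rw [hf e t ht, hf e' t' ht'] at h
      exact hXF ht ht' (toPlane.injective h)
  · obtain ⟨e, a, b, ha, hb, hab, hc, rfl⟩ := (hK s).1 hs
    rw [convexHull_lineMap_pair _ _ hab]
    rcases eq_or_lt_of_le hab with rfl | hlt
    · refine ⟨AffineMap.const ℝ E2 (f (x e a)), ?_⟩
      rintro _ ⟨t, ht, rfl⟩
      rw [Icc_self] at ht
      rw [mem_singleton_iff.1 ht, AffineMap.const_apply]
    · obtain ⟨c, d, hcd⟩ := hpl e a b ⟨ha, hb, hlt, hc⟩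
      obtain ⟨A, hA⟩ := exists_affineMap_lineMap (hne e) (toPlane c) (toPlane d)
      refine ⟨A, ?_⟩
      rintro _ ⟨t, ht, rfl⟩
      have htI : t ∈ Icc (0 : ℝ) 1 :=
        ⟨((hU e).2.2 a ha).1.trans ht.1, ht.2.trans ((hU e).2.2 b hb).2⟩
      have h1 := hf e t htI
      rw [hA t]
      refine h1.trans ?_
      rw [hcd t ht, map_add, ← Complex.real_smul, map_smul]
  · obtain ⟨e, a, b, ha, hb, hab, hcc, rfl⟩ := (hK s).1 hs
    have hlt : a < b := by
      refine lt_of_le_of_ne hab ?_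
      rintro rfl
      simp at hc
    refine ⟨e, a, b, ⟨ha, hb, hlt, hcc⟩, ?_⟩
    rw [edgeLen, Finset.coe_pair, Metric.diam_pair, dist_lineMap_lineMap, Real.dist_eq,
      abs_of_neg (sub_neg.2 hlt)]
    ring

end Assembly

section Skeleton

/-- The edges of a simplicial complex in the plane. -/
abbrev EdgeOf (M : SimplicialComplex ℝ E2) : Type := {e : Finset E2 // e ∈ M.faces ∧ e.card = 2}

/-- The vertices of a simplicial complex in the plane. -/
abbrev VertexOf (M : SimplicialComplex ℝ E2) : Type := {v : E2 // ({v} : Finset E2) ∈ M.faces}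

theorem pair_eq_of_lineMap_eq {M : SimplicialComplex ℝ E2} {a b c d : E2} (hab : a ≠ b)
    (hcd : c ≠ d) (h1 : ({a, b} : Finset E2) ∈ M.faces) (h2 : ({c, d} : Finset E2) ∈ M.faces)
    {s s' : ℝ} (hs : s ∈ Ioo (0 : ℝ) 1) (hs' : s' ∈ Icc (0 : ℝ) 1)
    (h : AffineMap.lineMap a b s = AffineMap.lineMap c d s') :
    ({a, b} : Finset E2) = {c, d} := by
  have m1 : AffineMap.lineMap a b s ∈ convexHull ℝ (({a, b} : Finset E2) : Set E2) := by
    rw [Finset.coe_pair, convexHull_pair, segment_eq_image_lineMap]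
    exact ⟨s, ⟨hs.1.le, hs.2.le⟩, rfl⟩
  have m2 : AffineMap.lineMap a b s ∈ convexHull ℝ (({c, d} : Finset E2) : Set E2) := by
    rw [Finset.coe_pair, convexHull_pair, segment_eq_image_lineMap]
    exact ⟨s', hs', h.symm⟩
  have m := M.inter_subset_convexHull h1 h2 ⟨m1, m2⟩
  have hinj := AffineMap.lineMap_injective ℝ hab
  have ha : a ∈ ({c, d} : Finset E2) := by
    by_contra hn
    have hsub : (({a, b} : Finset E2) : Set E2) ∩ (({c, d} : Finset E2) : Set E2) ⊆ {b} := by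
      rintro y ⟨hy, hy'⟩
      rcases Finset.mem_insert.1 hy with rfl | hy
      · exact absurd hy' hn
      · exact Finset.mem_singleton.1 hy
    have k := convexHull_mono hsub m
    rw [convexHull_singleton, mem_singleton_iff] at k
    exact hs.2.ne (hinj (k.trans (AffineMap.lineMap_apply_one a b).symm))
  have hb : b ∈ ({c, d} : Finset E2) := by
    by_contra hn
    have hsub : (({a, b} : Finset E2) : Set E2) ∩ (({c, d} : Finset E2) : Set E2) ⊆ {a} := by
      rintro y ⟨hy, hy'⟩
      rcases Finset.mem_insert.1 hy with rfl | hy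
      · exact rfl
      · exact absurd (Finset.mem_singleton.1 hy ▸ hy') hn
    have k := convexHull_mono hsub m
    rw [convexHull_singleton, mem_singleton_iff] at k
    exact hs.1.ne' (hinj (k.trans (AffineMap.lineMap_apply_zero a b).symm))
  refine Finset.eq_of_subset_of_card_le ?_ ?_
  · intro y hy
    rcases Finset.mem_insert.1 hy with rfl | hy
    · exact ha
    · exact Finset.mem_singleton.1 hy ▸ hb
  · rw [Finset.card_pair hab, Finset.card_pair hcd]

theorem exists_endpoints (M : SimplicialComplex ℝ E2) :
    ∃ src tgt : EdgeOf M → VertexOf M,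
      ∀ e, src e ≠ tgt e ∧ e.1 = {(src e).1, (tgt e).1} := by
  have key : ∀ e : EdgeOf M, ∃ a b : VertexOf M, a ≠ b ∧ e.1 = {a.1, b.1} := by
    rintro ⟨e, he, hc⟩
    obtain ⟨a, b, hab, rfl⟩ := Finset.card_eq_two.1 hc
    refine ⟨⟨a, M.down_closed he (by simp) (by simp)⟩, ⟨b, M.down_closed he (by simp) (by simp)⟩,
      fun h => hab (congrArg Subtype.val h), rfl⟩
  choose src tgt h using key
  exact ⟨src, tgt, h⟩

variable {M : SimplicialComplex ℝ E2} {src tgt : EdgeOf M → VertexOf M}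

theorem edge_eq_of_lineMap_eq (hst : ∀ e, src e ≠ tgt e ∧ e.1 = {(src e).1, (tgt e).1})
    {e e' : EdgeOf M} {s s' : ℝ} (hs : s ∈ Ioo (0 : ℝ) 1) (hs' : s' ∈ Icc (0 : ℝ) 1)
    (h : AffineMap.lineMap (src e).1 (tgt e).1 s = AffineMap.lineMap (src e').1 (tgt e').1 s') :
    e = e' ∧ s = s' := by
  have hne : ∀ e, (src e).1 ≠ (tgt e).1 := fun e h => (hst e).1 (Subtype.ext h)
  have hee : e = e' := by
    refine Subtype.ext ?_
    rw [(hst e).2, (hst e').2]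
    exact pair_eq_of_lineMap_eq (hne e) (hne e') ((hst e).2 ▸ e.2.1) ((hst e').2 ▸ e'.2.1) hs hs' h
  subst hee
  exact ⟨rfl, AffineMap.lineMap_injective ℝ (hne e) h⟩

theorem drawing_lineMap (hst : ∀ e, src e ≠ tgt e ∧ e.1 = {(src e).1, (tgt e).1}) :
    Drawing src tgt (fun v => toPlane.symm v.1)
      fun e t => toPlane.symm (AffineMap.lineMap (src e).1 (tgt e).1 t) where
  cont e := toPlane.symm.continuous.comp AffineMap.lineMap_continuous
  zero e := by simp
  one e := by simp
  emb e e' s s' hs hs' h := edge_eq_of_lineMap_eq hst hs hs' (toPlane.symm.injective h)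

theorem lineMap_mem_convexHull (hst : ∀ e, src e ≠ tgt e ∧ e.1 = {(src e).1, (tgt e).1})
    (e : EdgeOf M) {t : ℝ} (ht : t ∈ Icc (0 : ℝ) 1) :
    AffineMap.lineMap (src e).1 (tgt e).1 t ∈ convexHull ℝ (e.1 : Set E2) := by
  rw [(hst e).2, Finset.coe_pair, convexHull_pair, segment_eq_image_lineMap]
  exact ⟨t, ht, rfl⟩

theorem drawing_comp_lineMap (hst : ∀ e, src e ≠ tgt e ∧ e.1 = {(src e).1, (tgt e).1})
    {h : E2 → E2} (hc : ContinuousOn h M.space) (hi : InjOn h M.space) :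
    Drawing src tgt (fun v => toPlane.symm (h v.1)) fun e t => toPlane.symm
      (h (AffineMap.lineMap (src e).1 (tgt e).1 (projIcc (0 : ℝ) 1 zero_le_one t : ℝ))) := by
  have hm : ∀ e t, AffineMap.lineMap (src e).1 (tgt e).1
      (projIcc (0 : ℝ) 1 zero_le_one t : ℝ) ∈ M.space := fun e t =>
    SimplicialComplex.convexHull_subset_space e.2.1
      (lineMap_mem_convexHull hst e (Subtype.coe_prop _))
  refine ⟨fun e => toPlane.symm.continuous.comp ?_, fun e => by simp, fun e => by simp,
    fun e e' s s' hs hs' heq => ?_⟩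
  · refine hc.comp_continuous ?_ (hm e)
    exact AffineMap.lineMap_continuous.comp (continuous_subtype_val.comp continuous_projIcc)
  · have k := hi (hm e s) (hm e' s') (toPlane.symm.injective heq)
    rw [projIcc_of_mem _ ⟨hs.1.le, hs.2.le⟩, projIcc_of_mem _ hs'] at k
    exact edge_eq_of_lineMap_eq hst hs hs' k

theorem space_eq_iUnion_lineMap (hst : ∀ e, src e ≠ tgt e ∧ e.1 = {(src e).1, (tgt e).1})
    (hdim : ∀ s ∈ M.faces, s.card ≤ 2) (hinc : ∀ v, ∃ e, v = src e ∨ v = tgt e) :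
    M.space = ⋃ e, AffineMap.lineMap (src e).1 (tgt e).1 '' Icc (0 : ℝ) 1 := by
  ext y
  rw [SimplicialComplex.mem_space_iff, mem_iUnion]
  constructor
  · rintro ⟨s, hs, hy⟩
    have hpos := (M.nonempty_of_mem_faces hs).card_pos
    rcases (hdim s hs).lt_or_eq with hc | hc
    · obtain ⟨v, rfl⟩ := Finset.card_eq_one.1 (show s.card = 1 by omega)
      rw [Finset.coe_singleton, convexHull_singleton, mem_singleton_iff] at hy
      obtain ⟨e, he | he⟩ := hinc ⟨v, hs⟩
      · exact ⟨e, 0, by simp, by simp [← he, hy]⟩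
      · exact ⟨e, 1, by simp, by simp [← he, hy]⟩
    · have hse : s = _ := (hst ⟨s, hs, hc⟩).2
      rw [hse, Finset.coe_pair, convexHull_pair, segment_eq_image_lineMap] at hy
      exact ⟨⟨s, hs, hc⟩, hy⟩
  · rintro ⟨e, t, ht, rfl⟩
    exact ⟨e.1, e.2.1, lineMap_mem_convexHull hst e ht⟩

theorem exists_edge_of_vertex (hst : ∀ e, src e ≠ tgt e ∧ e.1 = {(src e).1, (tgt e).1})
    {T : SimplicialComplex ℝ E2} (hT : ∀ s ∈ T.faces, ∃ t ∈ T.faces, s ⊆ t ∧ t.card = 3)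
    (hM : M.faces = {s ∈ T.faces | s.card ≤ 2}) (v : VertexOf M) :
    ∃ e, v = src e ∨ v = tgt e := by
  obtain ⟨v, hv⟩ := v
  have hvT : ({v} : Finset E2) ∈ T.faces := by rw [hM] at hv; exact hv.1
  obtain ⟨t, ht, hvt, hc⟩ := hT _ hvT
  obtain ⟨w, hw, hwv⟩ := Finset.exists_mem_ne (by omega : 1 < t.card) v
  have hcard : ({v, w} : Finset E2).card = 2 := Finset.card_pair hwv.symm
  have he : ({v, w} : Finset E2) ∈ M.faces := by
    rw [hM]
    refine ⟨T.down_closed ht ?_ (by simp), hcard.le⟩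
    intro y hy
    rcases Finset.mem_insert.1 hy with rfl | hy
    · exact hvt (Finset.mem_singleton_self _)
    · exact Finset.mem_singleton.1 hy ▸ hw
  refine ⟨⟨_, he, hcard⟩, ?_⟩
  have : v ∈ ({v, w} : Finset E2) := by simp
  have hvw : ({v, w} : Finset E2) = _ := (hst ⟨_, he, hcard⟩).2
  rw [hvw, Finset.mem_insert, Finset.mem_singleton] at this
  exact this.imp (fun h => Subtype.ext h) fun h => Subtype.ext h

theorem ncard_near_le {T : SimplicialComplex ℝ E2} (hfin : T.faces.Finite)
    (hMT : M.faces ⊆ T.faces) {ι : Type*} {g : ι → Finset E2} (hg : Function.Injective g)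
    (hgM : ∀ i, g i ∈ M.faces) {h : E2 → E2} {H' α' r l : ℝ} (hH' : 0 ≤ H') (hα' : 0 ≤ α')
    (hinv : ∀ x ∈ M.space, ∀ y ∈ M.space, ‖x - y‖ ≤ H' * ‖h x - h y‖ ^ α')
    (hr : H' * (2 * r) ^ α' ≤ l) {K : ℕ}
    (hK : ∀ z, {e ∈ T.faces | (convexHull ℝ (e : Set E2) ∩ closedBall z l).Nonempty}.ncard ≤ K)
    (z : ℂ) :
    {i | ∃ y ∈ convexHull ℝ (g i : Set E2), ‖toPlane.symm (h y) - z‖ ≤ r}.ncard ≤ K := by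
  rcases Set.eq_empty_or_nonempty
    {i | ∃ y ∈ convexHull ℝ (g i : Set E2), ‖toPlane.symm (h y) - z‖ ≤ r} with he | ⟨i₀, y₀, h1, h2⟩
  · rw [he, ncard_empty]
    exact Nat.zero_le _
  · refine (ncard_le_ncard_of_injOn g ?_ hg.injOn (hfin.subset fun e he => he.1)).trans (hK y₀)
    rintro i ⟨y, hy, hyz⟩
    refine ⟨hMT (hgM i), y, hy, ?_⟩
    have hd : ‖h y - h y₀‖ ≤ 2 * r := by
      rw [← toPlane.symm.norm_map, map_sub]
      calc ‖toPlane.symm (h y) - toPlane.symm (h y₀)‖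
          ≤ ‖toPlane.symm (h y) - z‖ + ‖z - toPlane.symm (h y₀)‖ :=
              norm_sub_le_norm_sub_add_norm_sub _ _ _
        _ ≤ 2 * r := by rw [norm_sub_rev z]; linarith
    rw [mem_closedBall, dist_eq_norm]
    refine (hinv y (SimplicialComplex.convexHull_subset_space (hgM i) hy) y₀
      (SimplicialComplex.convexHull_subset_space (hgM i₀) h1)).trans (le_trans ?_ hr)
    gcongr

end Skeleton

/-- approximation in the skeleton of a triangulation by a piecewise
affine homeomorphism, with explicit bounds on the edge lengths. -/
theorem statement5 (α α' θ : ℝ) (hα0 : 0 < α) (hα1 : α ≤ 1)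
    (hα'0 : 0 < α') (hα'1 : α' ≤ 1) (hθ0 : 0 < θ) (hθ1 : θ ≤ π / 3)
    (l H H' : ℝ) (hl : 0 < l) (hH : 0 < H) (hH' : 0 < H') :
    ∃ ε₀ > (0 : ℝ), ∃ B₁ > (0 : ℝ), ∃ B₂ > (0 : ℝ),
      ∀ (Ω : Set E2) (T : SimplicialComplex ℝ E2),
        IsClosedPolygon Ω → IsTriangulation T Ω →
      ∀ M : SimplicialComplex ℝ E2, M.faces = {s ∈ T.faces | s.card ≤ 2} →
      AngleLB T (Real.sin θ) →
      (∀ e ∈ M.faces, e.card = 2 → l ≤ edgeLen e) →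
      ∀ h : E2 → E2, IsHomeoOn h M.space →
      (∀ x ∈ M.space, ∀ y ∈ M.space, ‖h x - h y‖ ≤ H * ‖x - y‖ ^ α) →
      (∀ x ∈ h '' M.space, ∀ y ∈ h '' M.space,
        ‖Function.invFunOn h M.space x - Function.invFunOn h M.space y‖ ≤
          H' * ‖x - y‖ ^ α') →
      ∀ ε : ℝ, 0 < ε → ε ≤ ε₀ →
        ∃ (f : E2 → E2) (K : SimplicialComplex ℝ E2),
          K.faces.Finite ∧ (∀ s ∈ K.faces, s.card ≤ 2) ∧
          K.space = M.space ∧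
          (∀ v : E2, ({v} : Finset E2) ∈ M.faces → ({v} : Finset E2) ∈ K.faces) ∧
          IsHomeoOn f M.space ∧ PiecewiseAffineOn f K ∧
          (∀ v : E2, ({v} : Finset E2) ∈ M.faces → f v = h v) ∧
          (∀ x ∈ M.space, ‖f x - h x‖ ≤ ε) ∧
          (∀ e ∈ K.faces, e.card = 2 →
            B₁ * ε ^ (-2 / α + 2 / (α ^ 2 * α') + 1 / (α ^ 3 * α' ^ 2)) < edgeLen e ∧
            edgeLen e < B₂ * ε ^ (1 / α)) := by
  have hsin : 0 < Real.sin θ := Real.sin_pos_of_pos_of_lt_pi hθ0 (by linarith [Real.pi_pos])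
  obtain ⟨N, hN⟩ := exists_ncard_edges_le hl hsin
  obtain ⟨ε₀, hε₀, B₁, hB₁, B₂, hB₂, hscale⟩ := exists_scales hα0 hα1 hα'0 hα'1 hl hH hH'
    (C := ((N : ℝ) + 2) ^ 2 * 2 ^ N) (by positivity)
  refine ⟨ε₀, hε₀, B₁, hB₁, B₂, hB₂, ?_⟩
  rintro Ω T - ⟨hfin, -, -, hpure⟩ M hM hangle hedge h ⟨hcont, hinj, -⟩ hold hinv ε hε hεε
  obtain ⟨ρ, hρ, w, hw, hwl, hwρ, hρl, hερ, hlow, hup⟩ := hscale ε hε hεε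
  have hMT : M.faces ⊆ T.faces := by rw [hM]; exact fun s hs => hs.1
  have hcount := hN T hfin hpure hangle fun e he hc =>
    hedge e (by rw [hM]; exact ⟨he, hc.le⟩) hc
  have : Finite M.faces := (hfin.subset hMT).to_subtype
  have : Finite (EdgeOf M) := Finite.of_injective (fun e => (⟨e.1, e.2.1⟩ : M.faces))
    fun e e' he => Subtype.ext (Subtype.mk.inj he)
  have : Finite (VertexOf M) := Finite.of_injective (fun v => (⟨{v.1}, v.2⟩ : M.faces))
    fun v v' hv => Subtype.ext (Finset.singleton_injective (Subtype.mk.inj hv))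
  have hinv' : ∀ x ∈ M.space, ∀ y ∈ M.space, ‖x - y‖ ≤ H' * ‖h x - h y‖ ^ α' := by
    intro x hx y hy
    have := hinv _ (mem_image_of_mem h hx) _ (mem_image_of_mem h hy)
    rwa [hinj.leftInvOn_invFunOn hx, hinj.leftInvOn_invFunOn hy] at this
  obtain ⟨src, tgt, hst⟩ := exists_endpoints M
  have hinc := exists_edge_of_vertex hst hpure hM
  have hvs : ∀ v : VertexOf M, v.1 ∈ M.space := fun v =>
    SimplicialComplex.convexHull_subset_space v.2 (subset_convexHull ℝ _ (by simp))
  have hP : Function.Injective fun v : VertexOf M => toPlane.symm (h v.1) := fun v v' hv =>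
    Subtype.ext (hinj (hvs v) (hvs v') (toPlane.symm.injective hv))
  have hsimple : ∀ e e', e ≠ e' → ¬(src e = src e' ∧ tgt e = tgt e') ∧
      ¬(src e = tgt e' ∧ tgt e = src e') := by
    refine fun e e' hne => ⟨fun hee => hne (Subtype.ext ?_), fun hee => hne (Subtype.ext ?_)⟩
    · rw [(hst e).2, (hst e').2, hee.1, hee.2]
    · rw [(hst e).2, (hst e').2, hee.1, hee.2, Finset.pair_comm]
  have hmem : ∀ e, ∀ t ∈ Icc (0 : ℝ) 1,
      AffineMap.lineMap (src e).1 (tgt e).1 t ∈ M.space := fun e t ht =>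
    SimplicialComplex.convexHull_subset_space e.2.1 (lineMap_mem_convexHull hst e ht)
  have hlen : ∀ e, w ≤ dist (src e).1 (tgt e).1 := by
    intro e
    have := hedge e.1 e.2.1 e.2.2
    rw [(hst e).2, edgeLen, Finset.coe_pair, Metric.diam_pair] at this
    exact hwl.trans this
  have hdist : ∀ e, ∀ s t : ℝ, ‖AffineMap.lineMap (src e).1 (tgt e).1 s -
      AffineMap.lineMap (src e).1 (tgt e).1 t‖ = dist (src e).1 (tgt e).1 * |s - t| := by
    intro e s t
    rw [← dist_eq_norm, dist_lineMap_lineMap, Real.dist_eq, mul_comm]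
  have h8 : H' * (2 * (4 * ρ)) ^ α' ≤ l := by
    refine (mul_le_mul_of_nonneg_left ?_ hH'.le).trans hρl
    exact Real.rpow_le_rpow (by positivity) (by linarith) hα'0.le
  obtain ⟨F, U, hF, hU⟩ := (drawing_comp_lineMap hst hcont hinj).exists_separated_pl hinc hP
    (fun e => (hst e).1) hsimple hρ hw hH.le hH'.le hα0.le hα'0.le hlen hwρ
    (fun e s hs t ht => by
      rw [projIcc_of_mem _ hs, projIcc_of_mem _ ht, ← map_sub, toPlane.symm.norm_map, ← hdist]
      exact hold _ (hmem e s hs) _ (hmem e t ht))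
    (fun e s hs t ht => by
      rw [projIcc_of_mem _ hs, projIcc_of_mem _ ht, ← map_sub, toPlane.symm.norm_map, ← hdist]
      exact hinv' _ (hmem e s hs) _ (hmem e t ht))
    (K := N) (N := N)
    (fun z => (ncard_le_ncard (fun e he => by
        obtain ⟨t, ht, htz⟩ := he
        rw [projIcc_of_mem _ ht] at htz
        exact ⟨_, lineMap_mem_convexHull hst e ht, htz⟩) (toFinite _)).trans
      (ncard_near_le hfin hMT Subtype.val_injective (fun e : EdgeOf M => e.2.1) hH'.le hα'0.le
        hinv' (by rwa [← mul_assoc, show (2 : ℝ) * 5 = 10 by norm_num]) hcount z))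
    (fun z => (ncard_le_ncard (fun v hv => by
        exact ⟨v.1, subset_convexHull ℝ _ (by simp), hv⟩) (toFinite _)).trans
      (ncard_near_le hfin hMT (g := fun v : VertexOf M => {v.1})
        (Finset.singleton_injective.comp Subtype.val_injective) (fun v => v.2) hH'.le hα'0.le
        hinv' h8 hcount z))
  obtain ⟨f, K, hKfin, hKc, hKs, hKv, hf, hpa, hfF, hKe⟩ :=
    exists_piecewiseAffine_of_drawing Subtype.val_injective (fun e => (hst e).1)
      (drawing_lineMap hst) hF hP (U := U) (fun e => ⟨(hU e).1, (hU e).2.1, (hU e).2.2.1⟩)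
      fun e => (hU e).2.2.2.1
  have hspace : K.space = M.space := by
    rw [hKs, space_eq_iUnion_lineMap hst (fun s hs => by rw [hM] at hs; exact hs.2) hinc]
  refine ⟨f, K, hKfin, hKc, hspace, fun v hv => ?_, hspace ▸ hf, hpa, fun v hv => ?_,
    fun y hy => ?_, fun s hs hc => ?_⟩
  · obtain ⟨e, he | he⟩ := hinc ⟨v, hv⟩
    · have := (hKv e).1
      rwa [← he] at this
    · have := (hKv e).2
      rwa [← he] at this
  · obtain ⟨e, he | he⟩ := hinc ⟨v, hv⟩
    · have := hfF e 0 (by simp)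
      rw [AffineMap.lineMap_apply_zero, hF.zero, ← he, LinearIsometryEquiv.apply_symm_apply] at this
      exact this
    · have := hfF e 1 (by simp)
      rw [AffineMap.lineMap_apply_one, hF.one, ← he, LinearIsometryEquiv.apply_symm_apply] at this
      exact this
  · rw [← hspace, hKs, mem_iUnion] at hy
    obtain ⟨e, t, ht, rfl⟩ := hy
    have := (hU e).2.2.2.2.1 t ht
    rw [projIcc_of_mem _ ht, ← toPlane.norm_map, map_sub, LinearIsometryEquiv.apply_symm_apply,
      ← hfF e t ht] at this
    exact this.trans hερ
  · obtain ⟨e, a, b, hab, hlen'⟩ := hKe s hs hc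
    obtain ⟨h1, h2⟩ := (hU e).2.2.2.2.2 a b hab
    rw [hlen']
    exact ⟨hlow.trans_le h1, h2.trans_lt hup⟩

end
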